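/- There exists an absolute constant c > 0 such that for every ε ∈ (0,1) there exist arbitrarily large finite sets A ⊆ ℝ with |A+A| ≤ |A|^{1+ε} and |AA| ≤ |A|^{2−cε}; that is, for every N there is a finite A ⊆ ℝ with |A| ≥ N satisfying both bounds. -/

import Mathlib

open Pointwise

namespace GolodShafarevich

variable {k G V : Type*} [Field k] [Group G] [AddCommGroup V] [Module k V]

/-- Vectors whose displacement under every group element lies in `U`. -/
def fixedMod (ρ : Representation k G V) (U : Submodule k V) : Submodule k V where
  carrier := {v | ∀ g, ρ g v - v ∈ U}
  add_mem' {a b} ha hb g := by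
    have := U.add_mem (ha g) (hb g)
    rw [map_add]; convert this using 1; abel
  zero_mem' g := by simp
  smul_mem' c v hv g := by
    have := U.smul_mem c (hv g)
    rw [map_smul, ← smul_sub]; exact this

theorem exists_fixedMod_of_lt [Finite k] [Finite V] {p : ℕ} [Fact p.Prime] [CharP k p]
    (hG : IsPGroup p G) (ρ : Representation k G V) (U K : Submodule k V)
    (hU : ∀ g, ∀ v ∈ U, ρ g v ∈ U) (hK : ∀ g, ∀ v ∈ K, ρ g v ∈ K)
    (h : ∃ v ∈ K, v ∉ U) : ∃ v ∈ K, v ∉ U ∧ v ∈ fixedMod ρ U := by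
  let act : G → (K.map U.mkQ) → (K.map U.mkQ) := fun g x =>
    ⟨U.mapQ U (ρ g) (hU g) x.1, by
      obtain ⟨y, hy, hyx⟩ := x.2
      exact ⟨ρ g y, hK g y hy, by rw [← hyx]; simp⟩⟩
  let _ : MulAction G (K.map U.mkQ) :=
    { smul := act
      one_smul := by
        rintro ⟨x, y, hy, rfl⟩
        apply Subtype.ext
        change U.mapQ U (ρ 1) _ (U.mkQ y) = _
        simp
      mul_smul := by
        rintro g g' ⟨x, y, hy, rfl⟩
        apply Subtype.ext
        change U.mapQ U (ρ (g * g')) _ (U.mkQ y)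
          = U.mapQ U (ρ g) _ (U.mapQ U (ρ g') _ (U.mkQ y))
        simp }
  have h0 : (0 : K.map U.mkQ) ∈ MulAction.fixedPoints G (K.map U.mkQ) := by
    intro g
    apply Subtype.ext
    change U.mapQ U (ρ g) _ 0 = 0
    simp
  obtain ⟨v, hvK, hvU⟩ := h
  have hfin : Finite (V ⧸ U) := Finite.of_surjective _ (Submodule.mkQ_surjective U)
  have hne : Nontrivial (K.map U.mkQ) := by
    refine ⟨⟨⟨U.mkQ v, v, hvK, rfl⟩, 0, ?_⟩⟩
    intro e
    have := congrArg Subtype.val e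
    simp at this
    exact hvU this
  have hdvd : p ∣ Nat.card (K.map U.mkQ) := by
    have : Fintype k := Fintype.ofFinite k
    have hc := Module.natCard_eq_pow_finrank (K := k) (V := K.map U.mkQ)
    have hpos : 0 < Module.finrank k (K.map U.mkQ) := Module.finrank_pos
    obtain ⟨n, hp, hn⟩ := FiniteField.card k p
    rw [Nat.card_eq_fintype_card (α := k), hn, ← pow_mul] at hc
    rw [hc]
    exact dvd_pow_self p (by positivity)
  obtain ⟨x, hx, hx0⟩ :=
    hG.exists_fixed_point_of_prime_dvd_card_of_fixed_point (K.map U.mkQ) hdvd h0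
  obtain ⟨⟨_, y, hy, rfl⟩, rfl⟩ : ∃ z : K.map U.mkQ, z = x := ⟨x, rfl⟩
  refine ⟨y, hy, ?_, ?_⟩
  · intro hyU
    refine hx0 (Subtype.ext ?_)
    symm
    simpa using hyU
  · intro g
    have h1 := congrArg Subtype.val (hx g)
    change U.mapQ U (ρ g) _ (U.mkQ y) = U.mkQ y at h1
    simpa [Submodule.Quotient.eq] using h1

/-- The right regular representation on families of functions. -/
def transl (k G : Type*) [Field k] [Group G] (m : ℕ) :
    Representation k G (Fin m → G → k) where
  toFun h :=
    { toFun := fun F i g => F i (g * h)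
      map_add' := fun _ _ => rfl
      map_smul' := fun _ _ => rfl }
  map_one' := by ext; simp
  map_mul' a b := by ext; simp [mul_assoc]

/-- The right regular representation on functions. -/
def transl₁ (k G : Type*) [Field k] [Group G] : Representation k G (G → k) where
  toFun h :=
    { toFun := fun F g => F (g * h)
      map_add' := fun _ _ => rfl
      map_smul' := fun _ _ => rfl }
  map_one' := by ext; simp
  map_mul' a b := by ext; simp [mul_assoc]

theorem transl_apply {m : ℕ} (h : G) (F : Fin m → G → k) (i : Fin m) (g : G) :
    transl k G m h F i g = F i (g * h) := rfl

theorem transl₁_apply (h : G) (F : G → k) (g : G) : transl₁ k G h F g = F (g * h) := rfl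

/-- An invariant subspace of a representation of a `p`-group is the kernel of an equivariant map
to a power of the regular representation, which is minimal. -/
theorem exists_coinduced_map [Finite k] [Finite V] {p : ℕ} [Fact p.Prime] [CharP k p]
    (hG : IsPGroup p G) (ρ : Representation k G V) (U : Submodule k V)
    (hU : ∀ g, ∀ v ∈ U, ρ g v ∈ U) :
    ∃ m : ℕ, ∃ φ : V →ₗ[k] (Fin m → G → k),
      Module.finrank k (fixedMod ρ U) = m + Module.finrank k U ∧
      (∀ g v, φ (ρ g v) = transl k G m g (φ v)) ∧ LinearMap.ker φ = U ∧
      ∀ c : Fin m → k, ∃ v ∈ fixedMod ρ U, φ v = fun i _ => c i := by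
  classical
  have hle : U ≤ fixedMod ρ U := fun v hv g => U.sub_mem (hU g v hv) hv
  set W := (fixedMod ρ U).map U.mkQ with hW
  have : Module.Finite k V := Module.Finite.of_finite
  obtain ⟨m, hm⟩ : ∃ m, Module.finrank k W = m := ⟨_, rfl⟩
  let e : W ≃ₗ[k] (Fin m → k) := (Module.finBasisOfFinrankEq k W hm).equivFun
  obtain ⟨l, hl⟩ := LinearMap.exists_extend (p := W) e.toLinearMap
  let lam : V →ₗ[k] (Fin m → k) := l ∘ₗ U.mkQ
  have hlamU : ∀ v ∈ U, lam v = 0 := by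
    intro v hv
    have : U.mkQ v = 0 := by simpa using hv
    simp only [lam, LinearMap.comp_apply, this, map_zero]
  have hlamW : ∀ v (hv : v ∈ fixedMod ρ U), lam v = e ⟨U.mkQ v, v, hv, rfl⟩ := by
    intro v hv
    have := LinearMap.congr_fun hl ⟨U.mkQ v, v, hv, rfl⟩
    exact this
  let φ : V →ₗ[k] (Fin m → G → k) :=
    { toFun := fun v i g => lam (ρ g v) i
      map_add' := by intro a b; ext; simp
      map_smul' := by intro a b; ext; simp }
  have hφ : ∀ v i g, φ v i g = lam (ρ g v) i := fun _ _ _ => rfl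
  have heq : ∀ g v, φ (ρ g v) = transl k G m g (φ v) := by
    intro g v; ext i h
    rw [transl_apply, hφ, hφ, map_mul]; rfl
  refine ⟨m, φ, ?_, heq, ?_, ?_⟩
  · have h1 := LinearMap.finrank_range_add_finrank_ker (U.mkQ.domRestrict (fixedMod ρ U))
    rw [LinearMap.range_domRestrict] at h1
    rw [← h1, ← hm]
    congr 1
    rw [LinearMap.ker_domRestrict, Submodule.ker_mkQ]
    exact (Submodule.submoduleOfEquivOfLe hle).finrank_eq
  · apply le_antisymm
    · by_contra hcon
      obtain ⟨v, hvK, hvU⟩ := Set.not_subset.mp hcon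
      obtain ⟨y, hyK, hyU, hyf⟩ := exists_fixedMod_of_lt hG ρ U (LinearMap.ker φ) hU (by
        intro g v hv
        rw [LinearMap.mem_ker] at hv ⊢
        rw [heq, hv, map_zero]) ⟨v, hvK, hvU⟩
      apply hyU
      have h1 : lam y = 0 := by
        ext i
        have := congrFun (congrFun (LinearMap.mem_ker.mp hyK) i) 1
        rw [hφ] at this
        simpa using this
      rw [hlamW y hyf, e.map_eq_zero_iff] at h1
      have h2 := congrArg Subtype.val h1
      simpa using h2
    · intro v hv
      rw [LinearMap.mem_ker]
      ext i g
      rw [hφ, hlamU _ (hU g v hv)]; rfl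
  · intro c
    obtain ⟨v, hv, hvc⟩ := (e.symm c).2
    refine ⟨v, hv, ?_⟩
    have hvc' : e ⟨U.mkQ v, v, hv, rfl⟩ = c := by
      rw [← e.apply_symm_apply c]; congr 1; exact Subtype.ext hvc
    ext i g
    have h0 := hlamU _ (hv g)
    rw [map_sub, sub_eq_zero] at h0
    rw [hφ, h0, hlamW v hv, hvc']

end GolodShafarevich

namespace GolodShafarevich

variable (k G : Type*) [Field k] [Group G]

/-- The socle filtration of the regular representation. -/
def socleFil : ℕ → Submodule k (G → k)
  | 0 => ⊥
  | j + 1 => fixedMod (transl₁ k G) (socleFil j)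

/-- The constant functions. -/
def constFun : Submodule k (G → k) := Submodule.span k {1}

variable {k G}

omit [Group G] in
theorem mem_constFun {a : G → k} : a ∈ constFun k G ↔ ∃ c : k, ∀ g, a g = c := by
  rw [constFun, Submodule.mem_span_singleton]
  constructor
  · rintro ⟨c, rfl⟩; exact ⟨c, fun g => by simp⟩
  · rintro ⟨c, hc⟩; exact ⟨c, by ext g; simp [hc]⟩

theorem socleFil_one : socleFil k G 1 = constFun k G := by
  ext a
  rw [mem_constFun]
  change (∀ g, transl₁ k G g a - a ∈ (⊥ : Submodule k (G → k))) ↔ _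
  simp only [Submodule.mem_bot]
  constructor
  · intro h
    refine ⟨a 1, fun g => ?_⟩
    have := congrFun (h g) 1
    simpa [transl₁_apply, sub_eq_zero] using this
  · rintro ⟨c, hc⟩ g
    ext x
    simp [transl₁_apply, hc]

theorem finrank_constFun : Module.finrank k (constFun k G) = 1 := by
  rw [constFun, finrank_span_singleton]
  intro h
  simpa using congrFun h 1

theorem socleFil_mono_succ (j : ℕ) : socleFil k G j ≤ socleFil k G (j + 1) := by
  induction j with
  | zero => exact bot_le
  | succ j ih => exact fun v hv g => ih (hv g)

theorem transl₁_mem_constFun (g : G) (v : G → k) (hv : v ∈ constFun k G) :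
    transl₁ k G g v ∈ constFun k G := by
  rw [mem_constFun] at hv ⊢
  obtain ⟨c, hc⟩ := hv
  exact ⟨c, fun x => by simp [transl₁_apply, hc]⟩

omit [Group G] in
theorem finrank_pi_const [Finite k] [Finite G] (d : ℕ) (U : Submodule k (G → k)) :
    Module.finrank k (Submodule.pi Set.univ (fun _ : Fin d => U)) = d * Module.finrank k U := by
  have e : Submodule.pi Set.univ (fun _ : Fin d => U) ≃ₗ[k] (Fin d → U) :=
    { toFun := fun x i => ⟨x.1 i, x.2 i trivial⟩
      invFun := fun y => ⟨fun i => (y i).1, fun i _ => (y i).2⟩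
      map_add' := fun _ _ => rfl
      map_smul' := fun _ _ => rfl
      left_inv := fun _ => rfl
      right_inv := fun _ => rfl }
  rw [e.finrank_eq, Module.finrank_pi_fintype]
  simp

/-- The dimension count behind the Golod–Shafarevich inequality. -/
theorem socleFil_finrank_ineq [Finite k] [Finite G] {d r : ℕ}
    (ι : (G → k) →ₗ[k] (Fin d → G → k)) (φ : (Fin d → G → k) →ₗ[k] (Fin r → G → k))
    (hι : ∀ g v, ι (transl₁ k G g v) = transl k G d g (ι v))
    (hφ : ∀ g v, φ (transl k G d g v) = transl k G r g (φ v))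
    (hιk : LinearMap.ker ι = constFun k G) (hφk : LinearMap.ker φ = LinearMap.range ι)
    (hconst : ∀ c : Fin d → k, (fun i _ => c i) ∈ LinearMap.range ι) (j : ℕ) :
    d * Module.finrank k (socleFil k G (j + 1)) + 1 ≤
      Module.finrank k (socleFil k G (j + 2)) + r * Module.finrank k (socleFil k G j) := by
  have h1 : ∀ j (F : Fin d → G → k), (∀ i, F i ∈ socleFil k G (j + 1)) →
      ∀ i, φ F i ∈ socleFil k G j := by
    intro j
    induction j with
    | zero =>
      intro F hF i
      rw [zero_add, socleFil_one] at hF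
      simp only [mem_constFun] at hF
      choose c hc using hF
      have : F = fun i _ => c i := by ext i g; exact hc i g
      have h2 : F ∈ LinearMap.ker φ := by rw [hφk, this]; exact hconst c
      rw [LinearMap.mem_ker.mp h2]
      exact Submodule.zero_mem _
    | succ j ih =>
      intro F hF i g
      have := ih (transl k G d g F - F) (fun i => hF i g) i
      rwa [map_sub, hφ] at this
  have h2 : ∀ j a, (∀ i, ι a i ∈ socleFil k G j) ↔ a ∈ socleFil k G (j + 1) := by
    intro j
    induction j with
    | zero =>
      intro a
      rw [zero_add, socleFil_one, ← hιk, LinearMap.mem_ker, funext_iff]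
      rfl
    | succ j ih =>
      intro a
      change (∀ i, ∀ g, _) ↔ ∀ g, _ ∈ socleFil k G (j + 1)
      rw [forall_comm]
      refine forall_congr' fun g => ?_
      rw [← ih, map_sub, hι]
      rfl
  set P := Submodule.pi Set.univ (fun _ : Fin d => socleFil k G (j + 1)) with hP
  have hr := LinearMap.finrank_range_add_finrank_ker (φ.domRestrict P)
  rw [finrank_pi_const] at hr
  have hrange : Module.finrank k (LinearMap.range (φ.domRestrict P)) ≤
      r * Module.finrank k (socleFil k G j) := by
    rw [← finrank_pi_const]
    refine Submodule.finrank_mono ?_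
    rintro _ ⟨F, rfl⟩ i -
    exact h1 j F.1 (fun i => F.2 i trivial) i
  have hker : Module.finrank k (LinearMap.ker (φ.domRestrict P)) ≤
      Module.finrank k ((socleFil k G (j + 2)).map ι) := by
    have : (LinearMap.ker (φ.domRestrict P)).map P.subtype ≤ (socleFil k G (j + 2)).map ι := by
      rintro _ ⟨⟨F, hF⟩, hF2, rfl⟩
      have : F ∈ LinearMap.ker φ := hF2
      rw [hφk] at this
      obtain ⟨a, rfl⟩ := this
      exact ⟨a, (h2 _ a).mp (fun i => hF i trivial), rfl⟩
    have h3 := Submodule.finrank_mono this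
    rwa [← (Submodule.equivMapOfInjective P.subtype Subtype.val_injective _).finrank_eq] at h3
  have hmap := LinearMap.finrank_range_add_finrank_ker (ι.domRestrict (socleFil k G (j + 2)))
  rw [LinearMap.range_domRestrict] at hmap
  have hle : constFun k G ≤ socleFil k G (j + 2) := by
    rw [← socleFil_one]
    clear * -
    induction j with
    | zero => exact socleFil_mono_succ 1
    | succ j ih => exact ih.trans (socleFil_mono_succ _)
  have hk1 : Module.finrank k (LinearMap.ker (ι.domRestrict (socleFil k G (j + 2)))) = 1 := by
    rw [LinearMap.ker_domRestrict, hιk, ← finrank_constFun (k := k) (G := G)]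
    exact (Submodule.submoduleOfEquivOfLe hle).finrank_eq
  omega

theorem lt_of_bounded_recursion (c : ℕ → ℕ) (B d r a : ℕ) (hc0 : c 0 = 0) (hc1 : c 1 = 1)
    (hB : ∀ j, c j ≤ B) (h : ∀ j, d * c (j + 1) + 1 ≤ c (j + 2) + r * c j)
    (ha : 1 ≤ a) (hd : 2 * a ≤ d) : a ^ 2 < r := by
  by_contra hr
  push Not at hr
  have key : ∀ j, a * c j + (j + 1) ≤ c (j + 1) := by
    intro j
    induction j with
    | zero => simp [hc0, hc1]
    | succ j ih =>
      have h1 := h j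
      have h2 : 2 * a * c (j + 1) ≤ d * c (j + 1) := Nat.mul_le_mul_right _ hd
      have h3 : r * c j ≤ a ^ 2 * c j := Nat.mul_le_mul_right _ hr
      have h4 : a * (a * c j + (j + 1)) ≤ a * c (j + 1) := Nat.mul_le_mul_left _ ih
      have h5 : j + 1 ≤ a * (j + 1) := Nat.le_mul_of_pos_left _ ha
      have : a * (a * c j + (j + 1)) = a ^ 2 * c j + a * (j + 1) := by ring
      nlinarith
  have := key B
  have := hB (B + 1)
  omega

/-- A `p`-group with many characters has many independent classes of `2`-cocycles. -/
theorem exists_cocycles [Finite k] [Finite G] {p : ℕ} [Fact p.Prime] [CharP k p]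
    (hG : IsPGroup p G) {n a : ℕ} (χ : Fin n → G → k) (hχ : ∀ i g h, χ i (g * h) = χ i g + χ i h)
    (hli : LinearIndependent k χ) (ha : 1 ≤ a) (hn : 2 * a ≤ n) :
    ∃ r : ℕ, a ^ 2 < r ∧ ∃ c : (Fin r → k) →ₗ[k] (G → G → k),
      (∀ f g h l, c f g h + c f (g * h) l = c f h l + c f g (h * l)) ∧
      (∀ f g, c f 1 g = 0 ∧ c f g 1 = 0) ∧
      ∀ f, (∃ b : G → k, ∀ g h, c f g h = b g + b h - b (g * h)) → f = 0 := by
  classical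
  have : Fintype G := Fintype.ofFinite G
  obtain ⟨d, ι, hd, hι, hιk, hιc⟩ :=
    exists_coinduced_map hG (transl₁ k G) (constFun k G) transl₁_mem_constFun
  obtain ⟨r, φ, hr, hφ, hφk, hφc⟩ :=
    exists_coinduced_map hG (transl k G d) (LinearMap.range ι) (by
      rintro g _ ⟨v, rfl⟩
      exact ⟨transl₁ k G g v, hι g v⟩)
  have hnd : n ≤ d := by
    have h1 : LinearIndependent k (Fin.cons (1 : G → k) χ : Fin (n + 1) → G → k) := by
      rw [linearIndependent_finCons]
      refine ⟨hli, fun hmem => ?_⟩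
      have h0 : ∀ x ∈ Submodule.span k (Set.range χ), x 1 = 0 := by
        intro x hx
        induction hx using Submodule.span_induction with
        | mem x hx =>
          obtain ⟨i, rfl⟩ := hx
          have := hχ i 1 1
          simpa using this
        | zero => rfl
        | add x y _ _ hx hy => simp [hx, hy]
        | smul c x _ hx => simp [hx]
      simpa using h0 _ hmem
    have h2 : Submodule.span k (Set.range (Fin.cons (1 : G → k) χ : Fin (n + 1) → G → k)) ≤
        fixedMod (transl₁ k G) (constFun k G) := by
      rw [Submodule.span_le]
      rintro _ ⟨i, rfl⟩ g
      rw [mem_constFun]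
      refine Fin.cases ?_ (fun i => ?_) i
      · exact ⟨0, fun x => by simp [transl₁_apply]⟩
      · exact ⟨χ i g, fun x => by simp [transl₁_apply, hχ]⟩
    have h3 := Submodule.finrank_mono h2
    rw [finrank_span_eq_card h1, hd, finrank_constFun] at h3
    simpa using h3
  refine ⟨r, ?_, ?_⟩
  · refine lt_of_bounded_recursion (fun j => Module.finrank k (socleFil k G j))
      (Module.finrank k (G → k)) d r a ?_ ?_ ?_ ?_ ha (hn.trans hnd)
    · exact finrank_bot k _
    · rw [socleFil_one, finrank_constFun]
    · exact fun j => Submodule.finrank_le _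
    · refine socleFil_finrank_ineq ι φ hι hφ hιk hφk ?_
      intro c
      obtain ⟨v, -, hv⟩ := hιc c
      exact ⟨v, hv⟩
  · obtain ⟨s, hs⟩ := ι.rangeRestrict.exists_rightInverse_of_surjective ι.range_rangeRestrict
    obtain ⟨s', hs'⟩ := LinearMap.exists_extend s
    have hs1 : ∀ x ∈ LinearMap.range ι, ι (s' x) = x := by
      intro x hx
      have h1 : s' x = s ⟨x, hx⟩ := LinearMap.congr_fun hs' ⟨x, hx⟩
      have h2 := LinearMap.congr_fun hs ⟨x, hx⟩
      rw [h1]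
      exact congrArg Subtype.val h2
    have : ∃ σ : (Fin r → k) →ₗ[k] (Fin d → G → k),
        ∀ c, σ c ∈ fixedMod (transl k G d) (LinearMap.range ι) ∧ φ (σ c) = fun i _ => c i := by
      choose w hw hw2 using hφc
      refine ⟨(Pi.basisFun k (Fin r)).constr k fun i => w (Pi.single i 1), fun c => ?_⟩
      rw [Module.Basis.constr_apply_fintype]
      constructor
      · exact Submodule.sum_mem _ fun i _ => Submodule.smul_mem _ _ (hw _)
      · rw [map_sum]
        ext i g
        simp [hw2, Finset.sum_apply, Pi.single_apply]
    obtain ⟨σ, hσ⟩ := this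
    let u : (Fin r → k) → G → G → k := fun f g => s' (transl k G d g (σ f) - σ f)
    have hu : ∀ f g, ι (u f g) = transl k G d g (σ f) - σ f := fun f g => hs1 _ ((hσ f).1 g)
    let C : (Fin r → k) → G → G → G → k :=
      fun f g h => u f g + transl₁ k G g (u f h) - u f (g * h)
    have hC : ∀ f g h, ∃ e : k, ∀ x, C f g h x = e := by
      intro f g h
      rw [← mem_constFun, ← hιk, LinearMap.mem_ker]
      simp only [C, map_sub, map_add, hι, hu, map_mul]
      simp
    have hC1 : ∀ f g h x, C f g h x = C f g h 1 := by
      intro f g h x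
      obtain ⟨e, he⟩ := hC f g h
      rw [he, he]
    have hCd : ∀ f g h x, C f g h 1 = u f g x + u f h (x * g) - u f (g * h) x := by
      intro f g h x
      rw [← hC1 f g h x]; rfl
    have hu1 : ∀ f x, u f 1 x = 0 := by
      intro f x
      simp [u]
    refine ⟨{ toFun := fun f g h => C f g h 1
              map_add' := ?_
              map_smul' := ?_ }, ?_, ?_, ?_⟩
    · intro f f'
      ext g h
      simp [C, u, transl₁_apply]
      ring
    · intro e f
      ext g h
      simp [C, u, transl₁_apply, ← smul_sub]
      ring
    · intro f g h l
      change C f g h 1 + C f (g * h) l 1 = C f h l 1 + C f g (h * l) 1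
      rw [hCd f g h 1, hCd f (g * h) l 1, hCd f h l (1 * g), hCd f g (h * l) 1,
        mul_assoc, mul_assoc]
      ring
    · intro f g
      change C f 1 g 1 = 0 ∧ C f g 1 1 = 0
      rw [hCd f 1 g 1, hCd f g 1 1]
      simp [hu1]
    · rintro f ⟨b, hb⟩
      replace hb : ∀ g h, C f g h 1 = b g + b h - b (g * h) := hb
      let y : G → k := fun x => u f x 1 - b x
      have hy : ∀ g x, u f g x = y (x * g) - y x + b g := by
        intro g x
        have h1 := hCd f x g 1
        rw [hb] at h1
        simp only [one_mul] at h1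
        simp only [y]
        linear_combination -h1
      have h0 : ∀ g x, u f g x - (transl₁ k G g y - y) x = b g := by
        intro g x
        simp [hy, transl₁_apply]
      have hinv : ∀ g, transl k G d g (σ f - ι y) = σ f - ι y := by
        intro g
        have h1 : u f g - (transl₁ k G g y - y) ∈ LinearMap.ker ι := by
          rw [hιk, mem_constFun]; exact ⟨b g, h0 g⟩
        rw [LinearMap.mem_ker, map_sub, map_sub, hu, hι] at h1
        rw [map_sub]
        rw [sub_eq_zero] at h1
        exact sub_eq_sub_iff_sub_eq_sub.mp h1
      have hr0 : σ f - ι y ∈ LinearMap.range ι := by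
        obtain ⟨v, -, hv⟩ := hιc fun i => (σ f - ι y) i 1
        refine ⟨v, ?_⟩
        rw [hv]
        ext i g
        have := congrFun (congrFun (hinv g) i) 1
        rw [transl_apply, one_mul] at this
        exact this.symm
      have h2 : σ f ∈ LinearMap.ker φ := by
        rw [hφk]
        have := Submodule.add_mem _ hr0 (LinearMap.mem_range_self ι y)
        rwa [sub_add_cancel] at this
      have h3 := (hσ f).2
      rw [LinearMap.mem_ker.mp h2] at h3
      ext i
      exact (congrFun (congrFun h3 i) 1).symm

end GolodShafarevich

namespace HerbrandQuotient

theorem finrank_eq_range_add_ker {A B : Type*} [AddCommGroup A] [AddCommGroup B]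
    [Module.Finite ℤ A] (f : A →ₗ[ℤ] B) :
    Module.finrank ℤ A = Module.finrank ℤ (LinearMap.range f) +
      Module.finrank ℤ (LinearMap.ker f) := by
  rw [← Submodule.finrank_quotient_add_finrank (LinearMap.ker f),
    f.quotKerEquivRange.finrank_eq]

theorem index_range_two_congr {A B : Type*} [AddCommGroup A] [AddCommGroup B] (e : A ≃+ B) :
    (nsmulAddMonoidHom (α := A) 2).range.index = (nsmulAddMonoidHom (α := B) 2).range.index := by
  rw [← AddSubgroup.index_map_equiv _ e]
  congr 1
  ext x
  simp only [AddSubgroup.mem_map, AddMonoidHom.mem_range]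
  constructor
  · rintro ⟨_, ⟨y, rfl⟩, rfl⟩
    exact ⟨e y, by simp⟩
  · rintro ⟨y, rfl⟩
    exact ⟨_, ⟨e.symm y, rfl⟩, by simp⟩

theorem card_ker_two_congr {A B : Type*} [AddCommGroup A] [AddCommGroup B] (e : A ≃+ B) :
    Nat.card (nsmulAddMonoidHom (α := A) 2).ker = Nat.card (nsmulAddMonoidHom (α := B) 2).ker := by
  refine Nat.card_congr (e.toEquiv.subtypeEquiv fun a => ?_)
  simp only [AddMonoidHom.mem_ker, nsmulAddMonoidHom_apply]
  rw [← e.map_eq_zero_iff]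
  simp

theorem index_range_two_of_finite (A : Type*) [AddCommGroup A] [Finite A] :
    (nsmulAddMonoidHom (α := A) 2).range.index = Nat.card (nsmulAddMonoidHom (α := A) 2).ker := by
  have h1 := (nsmulAddMonoidHom (α := A) 2).ker.card_mul_index
  rw [AddSubgroup.index_ker] at h1
  have h2 := (nsmulAddMonoidHom (α := A) 2).range.card_mul_index
  have h3 : 0 < Nat.card (nsmulAddMonoidHom (α := A) 2).range := Nat.card_pos
  rw [← h1, mul_comm] at h2
  exact Nat.eq_of_mul_eq_mul_right h3 h2

theorem index_range_two_int : (nsmulAddMonoidHom (α := ℤ) 2).range.index = 2 := by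
  have : (nsmulAddMonoidHom (α := ℤ) 2).range = AddSubgroup.zmultiples 2 := by
    ext x
    simp [AddSubgroup.mem_zmultiples_iff, mul_comm]
  rw [this, Int.index_zmultiples]
  rfl

theorem index_range_two_pi (n : ℕ) :
    (nsmulAddMonoidHom (α := Fin n → ℤ) 2).range.index = 2 ^ n := by
  have : (nsmulAddMonoidHom (α := Fin n → ℤ) 2).range =
      AddSubgroup.pi Set.univ fun _ => (nsmulAddMonoidHom (α := ℤ) 2).range := by
    ext x
    simp only [AddMonoidHom.mem_range, AddSubgroup.mem_pi, Set.mem_univ, forall_const]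
    constructor
    · rintro ⟨y, rfl⟩ i
      exact ⟨y i, rfl⟩
    · intro h
      choose y hy using h
      exact ⟨y, funext hy⟩
  rw [this, AddSubgroup.index_pi]
  simp only [index_range_two_int]
  simp

theorem index_range_two_prod (A B : Type*) [AddCommGroup A] [AddCommGroup B] :
    (nsmulAddMonoidHom (α := A × B) 2).range.index =
    (nsmulAddMonoidHom (α := A) 2).range.index * (nsmulAddMonoidHom (α := B) 2).range.index := by
  rw [← AddSubgroup.index_prod]
  congr 1
  ext ⟨x, y⟩
  simp [AddSubgroup.mem_prod]

theorem index_range_two (A : Type*) [AddCommGroup A] [Module.Finite ℤ A] :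
    (nsmulAddMonoidHom (α := A) 2).range.index =
      2 ^ Module.finrank ℤ A * Nat.card (nsmulAddMonoidHom (α := A) 2).ker := by
  have : AddGroup.FG A := Module.Finite.iff_addGroup_fg.mp inferInstance
  obtain ⟨n, ι, _, p, hp, q, ⟨f⟩⟩ := AddCommGroup.equiv_free_prod_directSum_zmod A
  have h0 : ∀ i, NeZero (p i ^ q i) := fun i => ⟨pow_ne_zero _ (hp i).ne_zero⟩
  have hF : Finite (DirectSum ι fun i => ZMod (p i ^ q i)) := by
    classical
    exact Finite.of_equiv _ (DirectSum.addEquivProd (fun i => ZMod (p i ^ q i))).symm.toEquiv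
  obtain ⟨T, _, _, ⟨g⟩⟩ : ∃ (T : Type) (_ : AddCommGroup T) (_ : Finite T),
      Nonempty (A ≃+ (Fin n → ℤ) × DirectSum ι fun i => ZMod (p i ^ q i)) :=
    ⟨Unit, inferInstance, inferInstance,
      ⟨f.trans (Finsupp.addEquivFunOnFinite.prodCongr (AddEquiv.refl _))⟩⟩
  set D := DirectSum ι fun i => ZMod (p i ^ q i)
  have hr : Module.finrank ℤ A = n := by
    rw [g.toIntLinearEquiv.finrank_eq]
    have h1 := finrank_eq_range_add_ker (LinearMap.fst ℤ (Fin n → ℤ) D)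
    rw [LinearMap.range_eq_top.mpr LinearMap.fst_surjective, finrank_top, LinearMap.ker_fst,
      LinearMap.finrank_range_of_inj LinearMap.inr_injective] at h1
    have h2 : Module.finrank ℤ D = 0 := by
      rw [Module.finrank_eq_zero_iff_isTorsion]
      intro x
      exact ⟨⟨Nat.card D, mem_nonZeroDivisors_of_ne_zero (by exact_mod_cast Nat.card_pos.ne')⟩, by
        change ((Nat.card D : ℕ) : ℤ) • x = 0
        rw [natCast_zsmul, card_nsmul_eq_zero']⟩
    rw [h2, Module.finrank_fin_fun] at h1
    omega
  rw [index_range_two_congr g, card_ker_two_congr g, index_range_two_prod, index_range_two_pi,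
    index_range_two_of_finite, hr]
  congr 1
  refine Nat.card_congr ⟨fun x => ⟨(0, x.1), ?_⟩, fun y => ⟨y.1.2, ?_⟩, ?_, ?_⟩
  · have := x.2
    rw [AddMonoidHom.mem_ker] at this ⊢
    exact Prod.ext (by simp) (by simpa using this)
  · have := y.2
    rw [AddMonoidHom.mem_ker] at this ⊢
    exact congrArg Prod.snd this
  · intro x; rfl
  · rintro ⟨⟨y, z⟩, h⟩
    have h1 := congrArg Prod.fst (AddMonoidHom.mem_ker.mp h)
    have h2 : y = 0 := by
      funext i
      have := congrFun h1 i
      simpa using this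
    simp [h2]

theorem card_ker_two_of_unique {A : Type*} [AddCommGroup A] (t : A) (ht : t ≠ 0)
    (h2 : t + t = 0) (h : ∀ x : A, x + x = 0 → x = 0 ∨ x = t) :
    Nat.card (nsmulAddMonoidHom (α := A) 2).ker = 2 := by
  rw [Nat.card_eq_two_iff' (⟨0, by simp⟩ : (nsmulAddMonoidHom (α := A) 2).ker)]
  refine ⟨⟨t, by rw [AddMonoidHom.mem_ker]; simpa [two_nsmul] using h2⟩, by simpa using ht, ?_⟩
  rintro ⟨x, hx⟩ hx0
  rw [AddMonoidHom.mem_ker] at hx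
  rcases h x (by simpa [two_nsmul] using hx) with h | h
  · exact absurd (Subtype.ext h) hx0
  · exact Subtype.ext h

/-- The Herbrand quotient of an involution, when the first cohomology vanishes. -/
theorem index_norm_mul {A B : Type*} [AddCommGroup A] [AddCommGroup B] [Module.Finite ℤ A]
    [Module.Finite ℤ B] (j : B →+ A) (hj : Function.Injective j) (σ : A →+ A)
    (hσ : ∀ x, σ (σ x) = x) (n : A →+ B) (hn : ∀ x, j (n x) = x + σ x)
    (hfix : ∀ x, σ x = x → ∃ b, j b = x) (hfix' : ∀ b, σ (j b) = j b)
    (hH : ∀ x, x + σ x = 0 → ∃ y, x = y - σ y) (t : B) (ht : t ≠ 0) (ht2 : t + t = 0)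
    (hA : ∀ x : A, x + x = 0 → x = 0 ∨ x = j t) :
    n.range.index * 2 ^ Module.finrank ℤ A = 2 ^ (2 * Module.finrank ℤ B) := by
  have hnj : ∀ b, n (j b) = b + b := fun b => hj (by rw [hn, hfix', map_add])
  have hnσ : ∀ x, n (σ x) = n x := fun x => hj (by rw [hn, hn, hσ, add_comm])
  let D : A →+ n.ker :=
    { toFun := fun x => ⟨x - σ x, by rw [AddMonoidHom.mem_ker, map_sub, hnσ, sub_self]⟩
      map_zero' := by simp
      map_add' := fun x y => Subtype.ext (by simp only [map_add, AddSubgroup.coe_add]; abel) }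
  have hkerσ : ∀ m : n.ker, σ m = -m := by
    intro m
    have := hn m
    rw [AddMonoidHom.mem_ker.mp m.2, map_zero] at this
    exact (neg_eq_of_add_eq_zero_right this.symm).symm
  have hD : Function.Surjective D := by
    intro m
    obtain ⟨y, hy⟩ := hH m (by rw [hkerσ m, add_neg_cancel])
    exact ⟨y, Subtype.ext hy.symm⟩
  have hfinker : Module.Finite ℤ n.ker :=
    Module.Finite.of_surjective D.toIntLinearMap hD
  have hB2 : Nat.card (nsmulAddMonoidHom (α := B) 2).ker = 2 := by
    refine card_ker_two_of_unique t ht ht2 fun x hx => ?_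
    rcases hA (j x) (by rw [← map_add, hx, map_zero]) with h | h
    · exact Or.inl (hj (h.trans (map_zero j).symm))
    · exact Or.inr (hj h)
  have hM2 : Nat.card (nsmulAddMonoidHom (α := n.ker) 2).ker = 2 := by
    refine card_ker_two_of_unique ⟨j t, ?_⟩ ?_ ?_ fun x hx => ?_
    · rw [AddMonoidHom.mem_ker, hnj, ht2]
    · intro h
      exact ht (hj ((congrArg Subtype.val h).trans (map_zero j).symm))
    · exact Subtype.ext (by simp [← map_add, ht2])
    · rcases hA x (congrArg Subtype.val hx) with h | h
      · exact Or.inl (Subtype.ext h)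
      · exact Or.inr (Subtype.ext h)
  have hBi := index_range_two B
  have hMi := index_range_two n.ker
  rw [hB2] at hBi
  rw [hM2] at hMi
  have hle : (nsmulAddMonoidHom (α := B) 2).range ≤ n.range := by
    rintro _ ⟨b, rfl⟩
    exact ⟨j b, by rw [hnj]; simp [two_nsmul]⟩
  have h1 := AddSubgroup.relIndex_mul_index hle
  rw [← AddSubgroup.index_comap] at h1
  have h2 : (nsmulAddMonoidHom (α := B) 2).range.comap n =
      (nsmulAddMonoidHom (α := n.ker) 2).range.comap D := by
    ext x
    simp only [AddSubgroup.mem_comap, AddMonoidHom.mem_range, nsmulAddMonoidHom_apply, two_nsmul]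
    constructor
    · rintro ⟨b, hb⟩
      have hm : x - j b ∈ n.ker := by
        rw [AddMonoidHom.mem_ker, map_sub, hnj, hb, sub_self]
      refine ⟨⟨x - j b, hm⟩, Subtype.ext ?_⟩
      have h3 : σ (x - j b) = -(x - j b) := hkerσ ⟨_, hm⟩
      rw [map_sub, hfix'] at h3
      change x - j b + (x - j b) = x - σ x
      rw [sub_eq_iff_eq_add.mp h3]
      abel
    · rintro ⟨m, hm⟩
      have h3 : (m : A) + m = x - σ x := congrArg Subtype.val hm
      obtain ⟨b, hb⟩ := hfix (x - m) (by
        rw [map_sub, hkerσ]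
        have : σ x = x - (m + m) := by rw [h3]; abel
        rw [this]; abel)
      refine ⟨b, ?_⟩
      rw [← hnj, hb, map_sub, AddMonoidHom.mem_ker.mp m.2, sub_zero]
  rw [h2, AddSubgroup.index_comap_of_surjective _ hD, hBi, hMi] at h1
  have hker : LinearMap.ker D.toIntLinearMap = LinearMap.range j.toIntLinearMap := by
    ext x
    simp only [LinearMap.mem_ker, LinearMap.mem_range, AddMonoidHom.coe_toIntLinearMap]
    constructor
    · intro h
      exact hfix x (sub_eq_zero.mp (congrArg Subtype.val h)).symm
    · rintro ⟨b, rfl⟩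
      exact Subtype.ext (by simp [D, hfix'])
  have hrank : Module.finrank ℤ A = Module.finrank ℤ n.ker + Module.finrank ℤ B := by
    rw [finrank_eq_range_add_ker D.toIntLinearMap, LinearMap.range_eq_top.mpr hD, finrank_top,
      hker, LinearMap.finrank_range_of_inj (f := j.toIntLinearMap) hj]
  rw [hrank, pow_add, two_mul, pow_add]
  have : n.range.index * 2 ^ Module.finrank ℤ n.ker * 2 = 2 ^ Module.finrank ℤ B * 2 := by
    rw [← h1]; ring
  nlinarith [Nat.eq_of_mul_eq_mul_right (by norm_num) this]

end HerbrandQuotient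

namespace PlaceTheory

open NumberField IsDedekindDomain

variable {k : Type*} [Field k] [NumberField k]

/-- The normalized additive order at a finite place, with value `0` at `0`. -/
noncomputable def ord (v : HeightOneSpectrum (𝓞 k)) (x : k) : ℤ :=
  -(WithZero.log (v.valuation k x))

variable (v : HeightOneSpectrum (𝓞 k))

theorem valuation_ne_zero {x : k} (hx : x ≠ 0) : v.valuation k x ≠ 0 :=
  (Valuation.ne_zero_iff _).mpr hx

@[simp] theorem ord_zero : ord v (0 : k) = 0 := by simp [ord]

@[simp] theorem ord_one : ord v (1 : k) = 0 := by simp [ord]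

theorem ord_mul {x y : k} (hx : x ≠ 0) (hy : y ≠ 0) : ord v (x * y) = ord v x + ord v y := by
  rw [ord, map_mul, WithZero.log_mul (valuation_ne_zero v hx) (valuation_ne_zero v hy), ord, ord]
  ring

@[simp] theorem ord_neg (x : k) : ord v (-x) = ord v x := by
  rw [ord, Valuation.map_neg, ord]

@[simp] theorem ord_inv (x : k) : ord v x⁻¹ = -ord v x := by
  rw [ord, map_inv₀, WithZero.log_inv, ord]

theorem ord_div {x y : k} (hx : x ≠ 0) (hy : y ≠ 0) : ord v (x / y) = ord v x - ord v y := by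
  rw [div_eq_mul_inv, ord_mul v hx (inv_ne_zero hy), ord_inv]; ring

@[simp] theorem ord_pow (x : k) (n : ℕ) : ord v (x ^ n) = n * ord v x := by
  rw [ord, map_pow, WithZero.log_pow, ord]; simp

@[simp] theorem ord_zpow (x : k) (n : ℤ) : ord v (x ^ n) = n * ord v x := by
  rw [ord, map_zpow₀, WithZero.log_zpow, ord]; simp

theorem valuation_le_iff {x y : k} (hx : x ≠ 0) (hy : y ≠ 0) :
    v.valuation k x ≤ v.valuation k y ↔ ord v y ≤ ord v x := by
  rw [ord, ord, neg_le_neg_iff,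
    WithZero.log_le_log (valuation_ne_zero v hx) (valuation_ne_zero v hy)]

theorem valuation_lt_iff {x y : k} (hx : x ≠ 0) (hy : y ≠ 0) :
    v.valuation k x < v.valuation k y ↔ ord v y < ord v x := by
  rw [ord, ord, neg_lt_neg_iff,
    WithZero.log_lt_log (valuation_ne_zero v hx) (valuation_ne_zero v hy)]

theorem valuation_eq_iff {x y : k} (hx : x ≠ 0) (hy : y ≠ 0) :
    v.valuation k x = v.valuation k y ↔ ord v x = ord v y := by
  rw [le_antisymm_iff, valuation_le_iff v hx hy, valuation_le_iff v hy hx, le_antisymm_iff, and_comm]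

theorem valuation_le_one_iff {x : k} (hx : x ≠ 0) : v.valuation k x ≤ 1 ↔ 0 ≤ ord v x := by
  have := valuation_le_iff v hx one_ne_zero
  rwa [map_one, ord_one] at this

theorem valuation_lt_one_iff {x : k} (hx : x ≠ 0) : v.valuation k x < 1 ↔ 0 < ord v x := by
  have := valuation_lt_iff v hx one_ne_zero
  rwa [map_one, ord_one] at this

theorem valuation_eq_one_iff {x : k} (hx : x ≠ 0) : v.valuation k x = 1 ↔ ord v x = 0 := by
  have := valuation_eq_iff v hx one_ne_zero
  rwa [map_one, ord_one] at this

theorem valuation_lt_one_iff_le {x y : k} (hy : ord v y = 1) :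
    v.valuation k x < 1 ↔ v.valuation k x ≤ v.valuation k y := by
  have hy0 : y ≠ 0 := by rintro rfl; simp at hy
  rcases eq_or_ne x 0 with rfl | hx
  · simp
  · rw [valuation_lt_one_iff v hx, valuation_le_iff v hx hy0, hy]
    omega

theorem exists_ord_eq (n : ℤ) : ∃ x : k, x ≠ 0 ∧ ord v x = n := by
  obtain ⟨π, hπ⟩ := v.valuation_exists_uniformizer k
  have h0 : π ≠ 0 := by
    rintro rfl
    rw [map_zero] at hπ
    exact WithZero.exp_ne_zero hπ.symm
  refine ⟨π ^ n, zpow_ne_zero _ h0, ?_⟩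
  rw [ord_zpow, ord, hπ]
  simp

theorem finite_ord_ne_zero {x : k} (hx : x ≠ 0) :
    {v : HeightOneSpectrum (𝓞 k) | ord v x ≠ 0}.Finite := by
  obtain ⟨a, b, hb, rfl⟩ := IsFractionRing.div_surjective (A := 𝓞 k) x
  have hb0 : b ≠ 0 := nonZeroDivisors.ne_zero hb
  have ha0 : a ≠ 0 := by rintro rfl; simp at hx
  have h1 := Ideal.finite_factors (R := 𝓞 k) (I := Ideal.span {a}) (by simpa using ha0)
  have h2 := Ideal.finite_factors (R := 𝓞 k) (I := Ideal.span {b}) (by simpa using hb0)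
  refine (h1.union h2).subset fun v hv => ?_
  by_contra h
  simp only [Set.mem_union, Set.mem_ofPred_eq, not_or] at h
  have e1 : v.valuation k (algebraMap (𝓞 k) k a) = 1 := by
    refine le_antisymm (v.valuation_le_one a) (not_lt.mp fun h3 => h.1 ?_)
    exact (v.valuation_lt_one_iff_dvd a).mp h3
  have e2 : v.valuation k (algebraMap (𝓞 k) k b) = 1 := by
    refine le_antisymm (v.valuation_le_one b) (not_lt.mp fun h3 => h.2 ?_)
    exact (v.valuation_lt_one_iff_dvd b).mp h3
  refine hv ?_
  rw [ord, map_div₀, e1, e2]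
  simp

theorem ord_algebraMap_nonneg (a : 𝓞 k) : 0 ≤ ord v (algebraMap (𝓞 k) k a) := by
  rcases eq_or_ne a 0 with rfl | h
  · simp
  · exact (valuation_le_one_iff v (by simpa using h)).mp (v.valuation_le_one a)

theorem exists_integer_of_ord_nonneg {x : k} (h : ∀ v : HeightOneSpectrum (𝓞 k), 0 ≤ ord v x) :
    ∃ a : 𝓞 k, algebraMap (𝓞 k) k a = x := by
  rcases eq_or_ne x 0 with rfl | hx
  · exact ⟨0, map_zero _⟩
  · exact HeightOneSpectrum.mem_integers_of_valuation_le_one k x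
      fun v => (valuation_le_one_iff v hx).mpr (h v)

theorem exists_unit_of_ord_eq_zero {x : k} (hx : x ≠ 0)
    (h : ∀ v : HeightOneSpectrum (𝓞 k), ord v x = 0) :
    ∃ u : (𝓞 k)ˣ, algebraMap (𝓞 k) k u = x := by
  obtain ⟨a, ha⟩ := exists_integer_of_ord_nonneg fun v => (h v).ge
  obtain ⟨b, hb⟩ := exists_integer_of_ord_nonneg (x := x⁻¹) fun v => by simp [h v]
  have hab : a * b = 1 := by
    apply IsFractionRing.injective (𝓞 k) k
    rw [map_mul, ha, hb, map_one, mul_inv_cancel₀ hx]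
  exact ⟨⟨a, b, hab, by rw [mul_comm, hab]⟩, ha⟩

theorem ord_unit (u : (𝓞 k)ˣ) : ord v (algebraMap (𝓞 k) k u) = 0 := by
  have h1 := ord_algebraMap_nonneg v (u : 𝓞 k)
  have h2 := ord_algebraMap_nonneg v ((u⁻¹ : (𝓞 k)ˣ) : 𝓞 k)
  have h3 : algebraMap (𝓞 k) k u * algebraMap (𝓞 k) k (u⁻¹ : (𝓞 k)ˣ) = 1 := by
    rw [← map_mul, Units.mul_inv, map_one]
  have h4 := ord_mul v (left_ne_zero_of_mul_eq_one h3) (right_ne_zero_of_mul_eq_one h3)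
  rw [h3, ord_one] at h4
  omega

section Conj

variable {K : Type*} [Field K] [NumberField K]

/-- Transport of a finite place along an isomorphism. -/
noncomputable def conj (σ : k ≃+* K) (v : HeightOneSpectrum (𝓞 k)) : HeightOneSpectrum (𝓞 K) :=
  HeightOneSpectrum.equivOfRingEquiv (RingOfIntegers.mapRingEquiv σ) v

theorem valuation_conj (σ : k ≃+* K) (x : k) :
    (conj σ v).valuation K (σ x) = v.valuation k x := by
  have key : ∀ a : 𝓞 k, (conj σ v).intValuation (RingOfIntegers.mapRingEquiv σ a) =
      v.intValuation a := by
    intro a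
    have hmap : (conj σ v).asIdeal = v.asIdeal.map (RingOfIntegers.mapRingEquiv σ) := by
      exact Ideal.comap_symm _
    have h2 : ∀ n : ℕ, (conj σ v).intValuation (RingOfIntegers.mapRingEquiv σ a) ≤
        WithZero.exp (-(n : ℤ)) ↔ v.intValuation a ≤ WithZero.exp (-(n : ℤ)) := by
      intro n
      rw [HeightOneSpectrum.intValuation_le_pow_iff_mem,
        HeightOneSpectrum.intValuation_le_pow_iff_mem, hmap, ← Ideal.map_pow]
      rw [← Ideal.comap_symm, Ideal.mem_comap]
      simp
    rcases eq_or_ne a 0 with rfl | ha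
    · simp
    have e1 := HeightOneSpectrum.intValuation_if_neg v ha
    have ha' : RingOfIntegers.mapRingEquiv σ a ≠ 0 := by simpa using ha
    have e2 := HeightOneSpectrum.intValuation_if_neg (conj σ v) ha'
    apply le_antisymm
    · rw [e1]; exact (h2 _).mpr e1.le
    · rw [e2]; exact (h2 _).mp e2.le
  obtain ⟨a, b, hb, rfl⟩ := IsFractionRing.div_surjective (A := 𝓞 k) x
  have : ∀ a : 𝓞 k, σ (algebraMap (𝓞 k) k a) =
      algebraMap (𝓞 K) K (RingOfIntegers.mapRingEquiv σ a) := fun a => rfl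
  rw [map_div₀, map_div₀, map_div₀, this, this, HeightOneSpectrum.valuation_of_algebraMap,
    HeightOneSpectrum.valuation_of_algebraMap, key, key, HeightOneSpectrum.valuation_of_algebraMap,
    HeightOneSpectrum.valuation_of_algebraMap]

theorem ord_conj (σ : k ≃+* K) (x : k) : ord (conj σ v) (σ x) = ord v x := by
  rw [ord, valuation_conj, ord]

/-- A finite place is determined by its maximal ideal. -/
theorem eq_of_valuation_lt_one {v w : HeightOneSpectrum (𝓞 k)}
    (h : ∀ x : k, v.valuation k x < 1 → w.valuation k x < 1) : v = w := by
  have hle : v.asIdeal ≤ w.asIdeal := fun a ha =>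
    (w.valuation_lt_one_iff_mem a).mp (h _ ((v.valuation_lt_one_iff_mem (K := k) a).mpr ha))
  exact HeightOneSpectrum.ext ((v.isMaximal).eq_of_le w.isPrime.ne_top hle)

theorem eq_of_valuation_eq {v w : HeightOneSpectrum (𝓞 k)}
    (h : ∀ x : k, v.valuation k x = w.valuation k x) : v = w :=
  eq_of_valuation_lt_one fun x hx => by rwa [← h x]

end Conj

section Under

variable {K : Type*} [Field K] [NumberField K] [Algebra k K]

/-- The place below a place of an extension. -/
noncomputable def under (k : Type*) [Field k] [NumberField k] {K : Type*} [Field K]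
    [NumberField K] [Algebra k K] (w : HeightOneSpectrum (𝓞 K)) : HeightOneSpectrum (𝓞 k) :=
  w.under (𝓞 k)

instance (w : HeightOneSpectrum (𝓞 K)) : w.asIdeal.LiesOver (under k w).asIdeal := ⟨rfl⟩

/-- The ramification index of a place over the place below. -/
noncomputable def ram (k : Type*) [Field k] [NumberField k] {K : Type*} [Field K]
    [NumberField K] [Algebra k K] (w : HeightOneSpectrum (𝓞 K)) : ℕ :=
  (under k w).asIdeal.ramificationIdx' w.asIdeal

theorem ram_pos (w : HeightOneSpectrum (𝓞 K)) : 0 < ram k w :=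
  Nat.pos_of_ne_zero (Ideal.IsDedekindDomain.ramificationIdx'_ne_zero_of_liesOver w.asIdeal (under k w).ne_bot)

theorem valuation_pow_ram (w : HeightOneSpectrum (𝓞 K)) (x : k) :
    (under k w).valuation k x ^ ram k w = w.valuation K (algebraMap k K x) :=
  HeightOneSpectrum.valuation_liesOver K (under k w) w x

theorem ord_algebraMap (w : HeightOneSpectrum (𝓞 K)) (x : k) :
    ord w (algebraMap k K x) = ram k w * ord (under k w) x := by
  rw [ord, ← valuation_pow_ram, WithZero.log_pow, ord]
  simp

theorem valuation_algebraMap_le (w : HeightOneSpectrum (𝓞 K)) (x y : k) :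
    w.valuation K (algebraMap k K x) ≤ w.valuation K (algebraMap k K y) ↔
      (under k w).valuation k x ≤ (under k w).valuation k y := by
  rw [← valuation_pow_ram, ← valuation_pow_ram, pow_le_pow_iff_left₀ zero_le zero_le (ram_pos w).ne']

theorem valuation_algebraMap_lt (w : HeightOneSpectrum (𝓞 K)) (x y : k) :
    w.valuation K (algebraMap k K x) < w.valuation K (algebraMap k K y) ↔
      (under k w).valuation k x < (under k w).valuation k y := by
  rw [← not_le, valuation_algebraMap_le, not_le]

theorem exists_under_eq (v : HeightOneSpectrum (𝓞 k)) :
    ∃ w : HeightOneSpectrum (𝓞 K), under k w = v := by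
  obtain ⟨P, hP, hPv⟩ := Ideal.exists_ideal_over_prime_of_isIntegral_of_isDomain (S := 𝓞 K)
    v.asIdeal (by rw [(RingHom.injective_iff_ker_eq_bot _).mp
      (FaithfulSMul.algebraMap_injective (𝓞 k) (𝓞 K))]; exact bot_le)
  refine ⟨⟨P, hP, ?_⟩, HeightOneSpectrum.ext hPv⟩
  rintro rfl
  rw [Ideal.comap_bot_of_injective _ (FaithfulSMul.algebraMap_injective (𝓞 k) (𝓞 K))] at hPv
  exact v.ne_bot hPv.symm

theorem finite_under_eq (v : HeightOneSpectrum (𝓞 k)) :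
    {w : HeightOneSpectrum (𝓞 K) | under k w = v}.Finite := by
  obtain ⟨x, hx0, hx⟩ := exists_ord_eq v 1
  refine (finite_ord_ne_zero (k := K) (x := algebraMap k K x) (by simpa using hx0)).subset ?_
  rintro w rfl
  rw [Set.mem_ofPred_eq, ord_algebraMap, hx]
  simpa using (ram_pos w).ne'

theorem under_conj (σ : K ≃ₐ[k] K) (w : HeightOneSpectrum (𝓞 K)) :
    under k (conj (σ : K ≃+* K) w) = under k w := by
  refine eq_of_valuation_lt_one fun x hx => ?_
  have h1 := valuation_algebraMap_lt (k := k) w x 1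
  have h2 := valuation_algebraMap_lt (k := k) (conj (σ : K ≃+* K) w) x 1
  have h3 := valuation_conj w (σ : K ≃+* K) (algebraMap k K x)
  simp only [map_one, AlgEquiv.coe_ringEquiv, AlgEquiv.commutes] at h1 h2 h3
  rw [← h1, ← h3, h2]
  exact hx

end Under

end PlaceTheory

namespace PlaceTheory

open NumberField IsDedekindDomain

variable {k : Type*} [Field k] [NumberField k] {K : Type*} [Field K] [NumberField K] [Algebra k K]

/-- The residue degree of a place over the place below. -/
noncomputable def res (k : Type*) [Field k] [NumberField k] {K : Type*} [Field K]
    [NumberField K] [Algebra k K] (w : HeightOneSpectrum (𝓞 K)) : ℕ :=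
  w.asIdeal.inertiaDeg (𝓞 k)

theorem res_pos (w : HeightOneSpectrum (𝓞 K)) : 0 < res k w := Ideal.inertiaDeg_pos _ _

theorem finrank_ringOfIntegers : Module.finrank (𝓞 k) (𝓞 K) = Module.finrank k K :=
  (IsFractionRing.finrank_eq (𝓞 k) k (𝓞 K) K).symm

theorem sum_ram_mul_res (v : HeightOneSpectrum (𝓞 k)) (s : Finset (HeightOneSpectrum (𝓞 K)))
    (hs : ∀ w ∈ s, under k w = v) : ∑ w ∈ s, ram k w * res k w ≤ Module.finrank k K := by
  have h1 := Ideal.sum_ramification_inertia_eq_finrank v.asIdeal (𝓞 K)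
  rw [finrank_ringOfIntegers] at h1
  rw [← h1]
  classical
  let f : s → v.asIdeal.primesOver (𝓞 K) := fun w =>
    ⟨w.1.asIdeal, w.1.isPrime, ⟨by rw [← hs w.1 w.2]; rfl⟩⟩
  have hf : Function.Injective f := fun w w' h =>
    Subtype.ext (HeightOneSpectrum.ext (congrArg Subtype.val h))
  rw [← Finset.sum_coe_sort]
  have h2 : ∀ w : s, ram k w.1 * res k w.1 =
      (f w).1.ramificationIdx (𝓞 k) * (f w).1.inertiaDeg (𝓞 k) := by
    intro w
    rw [ram, res, Ideal.ramificationIdx'_eq_ramificationIdx _ _ (under k w.1).ne_bot]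
  rw [Finset.sum_congr rfl fun w _ => h2 w]
  rw [← Finset.sum_image (f := fun q : v.asIdeal.primesOver (𝓞 K) =>
    q.1.ramificationIdx (𝓞 k) * q.1.inertiaDeg (𝓞 k)) hf.injOn]
  exact Finset.sum_le_sum_of_subset (Finset.subset_univ _)

/-- Every integral element is congruent to an element of the base field. -/
theorem exists_sub_lt_of_res_eq_one {w : HeightOneSpectrum (𝓞 K)} (h : res k w = 1) {y : K}
    (hy : w.valuation K y ≤ 1) : ∃ c : 𝓞 k, w.valuation K (y - algebraMap k K c) < 1 := by
  obtain ⟨a, ha⟩ := w.exists_valuation_sub_lt_of_integer hy 1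
  rw [res, Ideal.inertiaDeg_eq_of_isMaximal (under k w).asIdeal] at h
  let _ : Field (𝓞 k ⧸ (under k w).asIdeal) := Ideal.Quotient.field _
  have hs := (Module.Free.bijective_algebraMap_of_finrank_eq_one h).2
  obtain ⟨c, hc⟩ := hs (Ideal.Quotient.mk _ a)
  obtain ⟨c, rfl⟩ := Ideal.Quotient.mk_surjective c
  refine ⟨c, ?_⟩
  have h3 : a - algebraMap (𝓞 k) (𝓞 K) c ∈ w.asIdeal := by
    rw [← Ideal.Quotient.eq]
    exact hc.symm
  have h4 := (w.valuation_lt_one_iff_mem (K := K) _).mpr h3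
  have h5 : y - algebraMap k K c = -(algebraMap (𝓞 K) K a - y) +
      algebraMap (𝓞 K) K (a - algebraMap (𝓞 k) (𝓞 K) c) := by
    rw [map_sub, ← IsScalarTower.algebraMap_apply (𝓞 k) (𝓞 K) K,
      IsScalarTower.algebraMap_apply (𝓞 k) k K]
    ring
  rw [h5]
  refine Valuation.map_add_lt _ ?_ h4
  rw [Valuation.map_neg]
  exact ha

end PlaceTheory

namespace PlaceTheory

open NumberField IsDedekindDomain

variable {k : Type*} [Field k] [NumberField k] {K : Type*} [Field K] [NumberField K] [Algebra k K]

/-- At least two places lie above the given one. -/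
def IsSplit (K : Type*) [Field K] [NumberField K] [Algebra k K]
    (v : HeightOneSpectrum (𝓞 k)) : Prop :=
  ∃ w w' : HeightOneSpectrum (𝓞 K), w ≠ w' ∧ under k w = v ∧ under k w' = v

section Quadratic

variable (h2 : Module.finrank k K = 2) (σ : K ≃ₐ[k] K) (hσ : σ ≠ 1)

include h2

theorem card_le_two_of_under_eq {v : HeightOneSpectrum (𝓞 k)}
    (s : Finset (HeightOneSpectrum (𝓞 K))) (hs : ∀ w ∈ s, under k w = v) : s.card ≤ 2 := by
  rw [← h2, Finset.card_eq_sum_ones]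
  exact (Finset.sum_le_sum fun w _ => Nat.mul_pos (ram_pos w) (res_pos w)).trans
    (sum_ram_mul_res v s hs)

theorem ram_mul_res_le (w : HeightOneSpectrum (𝓞 K)) : ram k w * res k w ≤ 2 := by
  have := sum_ram_mul_res (under k w) {w} (by simp)
  rwa [h2, Finset.sum_singleton] at this

theorem ram_eq_one_or_two (w : HeightOneSpectrum (𝓞 K)) : ram k w = 1 ∨ ram k w = 2 := by
  have h1 := ram_mul_res_le h2 w
  have h3 := ram_pos (k := k) w
  have h4 := Nat.le_mul_of_pos_right (ram k w) (res_pos (k := k) w)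
  omega

theorem ram_res_eq_one_of_ne {w w' : HeightOneSpectrum (𝓞 K)} (hw : w ≠ w')
    (h : under k w = under k w') : ram k w = 1 ∧ res k w = 1 := by
  classical
  have := sum_ram_mul_res (under k w) {w, w'} (by simp [h])
  rw [h2, Finset.sum_pair hw] at this
  have h1 := Nat.mul_pos (ram_pos (k := k) w) (res_pos (k := k) w)
  have h3 := Nat.mul_pos (ram_pos (k := k) w') (res_pos (k := k) w')
  exact mul_eq_one.mp (show ram k w * res k w = 1 by omega)

theorem res_eq_one_of_ram {w : HeightOneSpectrum (𝓞 K)} (h : ram k w = 2) : res k w = 1 := by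
  have h1 := ram_mul_res_le h2 w
  have h3 := res_pos (k := k) w
  rw [h] at h1
  omega

theorem not_isSplit_of_ram {w : HeightOneSpectrum (𝓞 K)} (h : ram k w = 2) :
    ¬ IsSplit K (under k w) := by
  rintro ⟨w1, w2, hne, h1, h3⟩
  by_cases hw : w1 = w
  · have := (ram_res_eq_one_of_ne h2 (hw ▸ hne : w ≠ w2) h3.symm).1
    omega
  · have := (ram_res_eq_one_of_ne h2 (Ne.symm hw : w ≠ w1) h1.symm).1
    omega

theorem isGalois_of_finrank_two : IsGalois k K := by
  have : Algebra.IsQuadraticExtension k K := { finrank_eq_two' := h2 }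
  infer_instance

theorem exists_ne_one_of_finrank_two : ∃ σ : K ≃ₐ[k] K, σ ≠ 1 := by
  have := isGalois_of_finrank_two h2
  have h1 := IsGalois.card_aut_eq_finrank k K
  rw [h2] at h1
  have : Nontrivial (K ≃ₐ[k] K) := Finite.one_lt_card_iff_nontrivial.mp (by omega)
  exact exists_ne 1

include hσ

theorem eq_one_or_eq (τ : K ≃ₐ[k] K) : τ = 1 ∨ τ = σ := by
  have := isGalois_of_finrank_two h2
  have h1 := IsGalois.card_aut_eq_finrank k K
  rw [h2, Nat.card_eq_two_iff' 1] at h1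
  by_cases h : τ = 1
  · exact Or.inl h
  · exact Or.inr (h1.unique h hσ)

theorem involution_apply_apply (x : K) : σ (σ x) = x := by
  have h3 : σ * σ = 1 := by
    rcases eq_one_or_eq h2 σ hσ (σ * σ) with h | h
    · exact h
    · exact absurd (mul_eq_left.mp h) hσ
  exact congrArg (fun τ : K ≃ₐ[k] K => τ x) h3

theorem mem_range_of_fixed {x : K} (hx : σ x = x) : ∃ c : k, algebraMap k K c = x := by
  have := isGalois_of_finrank_two h2
  refine (IsGalois.mem_range_algebraMap_iff_fixed x).mpr fun τ => ?_
  rcases eq_one_or_eq h2 σ hσ τ with h | h <;> rw [h]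
  · rfl
  · exact hx

theorem algebraMap_norm (y : K) : algebraMap k K (Algebra.norm k y) = y * σ y := by
  classical
  have := isGalois_of_finrank_two h2
  rw [Algebra.norm_eq_prod_automorphisms]
  have : (Finset.univ : Finset (K ≃ₐ[k] K)) = {1, σ} := by
    ext τ
    simpa using eq_one_or_eq h2 σ hσ τ
  rw [this, Finset.prod_pair (Ne.symm hσ)]
  rfl

theorem exists_anti_invariant : ∃ r : K, r ≠ 0 ∧ σ r = -r ∧ ∃ a : k, algebraMap k K a = r ^ 2 := by
  obtain ⟨θ, hθ⟩ : ∃ θ, σ θ ≠ θ := by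
    by_contra! h
    exact hσ (AlgEquiv.ext h)
  have h1 : σ (θ - σ θ) = -(θ - σ θ) := by
    rw [map_sub, involution_apply_apply h2 σ hσ]; ring
  exact ⟨θ - σ θ, sub_ne_zero.mpr hθ.symm, h1,
    mem_range_of_fixed h2 σ hσ (by rw [map_pow, h1, neg_sq])⟩

theorem exists_eq_div_of_mul_eq_one {x : K} (hx : x * σ x = 1) :
    ∃ y : K, y ≠ 0 ∧ x = y / σ y := by
  by_cases h : x = -1
  · obtain ⟨r, hr, hr1, -⟩ := exists_anti_invariant h2 σ hσ
    refine ⟨r, hr, ?_⟩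
    rw [hr1, h]
    field_simp
  · have h1 : 1 + x ≠ 0 := fun h3 => h (by linear_combination h3)
    refine ⟨1 + x, h1, ?_⟩
    rw [eq_div_iff ((map_ne_zero σ).mpr h1), map_add, map_one, mul_add, hx]
    ring

theorem eq_or_eq_conj {w w' : HeightOneSpectrum (𝓞 K)} (h : under k w' = under k w) :
    w' = w ∨ w' = conj (σ : K ≃+* K) w := by
  classical
  by_contra! hc
  have hcard := fun s hs => card_le_two_of_under_eq (v := under k w) h2 s hs
  have hw : conj (σ : K ≃+* K) w = w := by
    by_contra h3
    have := hcard {w, w', conj (σ : K ≃+* K) w} (by simp [h, under_conj])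
    rw [Finset.card_eq_three.mpr ⟨_, _, _, hc.1.symm, Ne.symm h3, hc.2, rfl⟩] at this
    omega
  have hw' : conj (σ : K ≃+* K) w' = w' := by
    by_contra h3
    by_cases h4 : w = conj (σ : K ≃+* K) w'
    · refine hc.2 ?_
      refine eq_of_valuation_eq fun x => ?_
      have e1 := valuation_conj w (σ : K ≃+* K) (σ x)
      have e2 := valuation_conj w' (σ : K ≃+* K) x
      rw [← h4] at e2
      rw [AlgEquiv.coe_ringEquiv, involution_apply_apply h2 σ hσ] at e1
      rw [AlgEquiv.coe_ringEquiv] at e2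
      rw [e1, e2]
    · have := hcard {w, w', conj (σ : K ≃+* K) w'} (by simp [h, under_conj])
      rw [Finset.card_eq_three.mpr ⟨_, _, _, hc.1.symm, h4, Ne.symm h3, rfl⟩] at this
      omega
  obtain ⟨x, hx, hx'⟩ : ∃ x : K, w'.valuation K x < 1 ∧ ¬ w.valuation K x < 1 := by
    by_contra! h3
    exact hc.1 (eq_of_valuation_lt_one h3)
  have e1 := valuation_conj w (σ : K ≃+* K) x
  have e2 := valuation_conj w' (σ : K ≃+* K) x
  rw [hw, AlgEquiv.coe_ringEquiv] at e1
  rw [hw', AlgEquiv.coe_ringEquiv] at e2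
  have f1 := valuation_algebraMap_lt (k := k) w (Algebra.norm k x) 1
  have f2 := valuation_algebraMap_lt (k := k) w' (Algebra.norm k x) 1
  rw [algebraMap_norm h2 σ hσ, map_one, map_one, map_mul, e1] at f1
  rw [algebraMap_norm h2 σ hσ, map_one, map_one, map_mul, e2, h, ← f1] at f2
  have := f2.mp (mul_lt_one_of_nonneg_of_lt_one_left zero_le hx hx.le)
  exact not_lt.mpr (one_le_mul_of_one_le_of_one_le (not_lt.mp hx') (not_lt.mp hx')) this

theorem isSplit_iff (w : HeightOneSpectrum (𝓞 K)) :
    IsSplit K (under k w) ↔ conj (σ : K ≃+* K) w ≠ w := by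
  constructor
  · rintro ⟨w1, w2, hne, h1, h3⟩ hw
    have e1 := eq_or_eq_conj h2 σ hσ h1
    have e2 := eq_or_eq_conj h2 σ hσ h3
    rw [hw, or_self] at e1 e2
    exact hne (e1.trans e2.symm)
  · intro h
    exact ⟨_, _, h, under_conj σ w, rfl⟩

theorem ord_apply_of_not_isSplit {w : HeightOneSpectrum (𝓞 K)} (h : ¬ IsSplit K (under k w))
    (y : K) : ord w (σ y) = ord w y := by
  rw [isSplit_iff h2 σ hσ, not_not] at h
  conv_lhs => rw [← h]
  exact ord_conj w (σ : K ≃+* K) y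

theorem valuation_apply_of_not_isSplit {w : HeightOneSpectrum (𝓞 K)}
    (h : ¬ IsSplit K (under k w)) (y : K) : w.valuation K (σ y) = w.valuation K y := by
  rw [isSplit_iff h2 σ hσ, not_not] at h
  conv_lhs => rw [← h]
  exact valuation_conj w (σ : K ≃+* K) y

omit h2 hσ
end Quadratic

end PlaceTheory

namespace PlaceTheory

open NumberField IsDedekindDomain

theorem exists_quadratic.{u} {k : Type u} [Field k] [NumberField k] {x : k} (hx : ¬ IsSquare x) :
    ∃ (M : Type u) (_ : Field M) (_ : NumberField M) (_ : Algebra k M) (r : M),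
      Module.finrank k M = 2 ∧ r ^ 2 = algebraMap k M x := by
  have hirr : Irreducible (Polynomial.X ^ 2 - Polynomial.C x : Polynomial k) := by
    refine X_pow_sub_C_irreducible_of_prime Nat.prime_two fun b hb => hx ⟨b, ?_⟩
    rw [← hb, sq]
  have := Fact.mk hirr
  have hf := (hirr.ne_zero)
  have hfin : Module.Finite k (AdjoinRoot (Polynomial.X ^ 2 - Polynomial.C x : Polynomial k)) :=
    (AdjoinRoot.powerBasis hf).finite
  refine ⟨AdjoinRoot (Polynomial.X ^ 2 - Polynomial.C x), inferInstance,
    NumberField.of_module_finite k _, inferInstance, AdjoinRoot.root _, ?_, ?_⟩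
  · rw [(AdjoinRoot.powerBasis hf).finrank, AdjoinRoot.powerBasis_dim,
      Polynomial.natDegree_X_pow_sub_C]
  · have := AdjoinRoot.eval₂_root (Polynomial.X ^ 2 - Polynomial.C x : Polynomial k)
    rw [Polynomial.eval₂_sub, Polynomial.eval₂_pow, Polynomial.eval₂_X, Polynomial.eval₂_C,
      sub_eq_zero] at this
    exact this

variable {k : Type*} [Field k] [NumberField k]

theorem le_ord_iff_mem (v : HeightOneSpectrum (𝓞 k)) {a : 𝓞 k} (ha : a ≠ 0) (n : ℕ) :
    (n : ℤ) ≤ ord v (algebraMap (𝓞 k) k a) ↔ a ∈ v.asIdeal ^ n := by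
  rw [← v.intValuation_le_pow_iff_mem, ← v.valuation_of_algebraMap (K := k), ord]
  have h0 : v.valuation k (algebraMap (𝓞 k) k a) ≠ 0 := valuation_ne_zero v (by simpa using ha)
  rw [← WithZero.log_le_iff_le_exp h0]
  omega

/-- The units away from a finite set of primes. -/
def sUnits (S : Finset (HeightOneSpectrum (𝓞 k))) : Subgroup kˣ where
  carrier := {x | ∀ v ∉ S, ord v (x : k) = 0}
  one_mem' := fun v _ => by simp
  mul_mem' := fun {a b} ha hb v hv => by
    rw [Units.val_mul, ord_mul v a.ne_zero b.ne_zero, ha v hv, hb v hv, add_zero]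
  inv_mem' := fun {a} ha v hv => by
    rw [Units.val_inv_eq_inv_val, ord_inv, ha v hv, neg_zero]

/-- Every divisor away from `S` is principal. -/
def PrincipalOutside (S : Finset (HeightOneSpectrum (𝓞 k))) : Prop :=
  ∀ v ∉ S, ∃ c : k, c ≠ 0 ∧ ord v c = 1 ∧ ∀ w ∉ S, w ≠ v → ord w c = 0

theorem PrincipalOutside.mono {S T : Finset (HeightOneSpectrum (𝓞 k))} (h : PrincipalOutside S)
    (hST : S ⊆ T) : PrincipalOutside T := fun v hv => by
  obtain ⟨c, hc, h1, h2⟩ := h v fun h => hv (hST h)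
  exact ⟨c, hc, h1, fun w hw => h2 w fun h => hw (hST h)⟩

theorem PrincipalOutside.exists_ord_eq {S : Finset (HeightOneSpectrum (𝓞 k))}
    (h : PrincipalOutside S) (m : HeightOneSpectrum (𝓞 k) → ℤ)
    (hm : {v | m v ≠ 0}.Finite) : ∃ c : k, c ≠ 0 ∧ ∀ v ∉ S, ord v c = m v := by
  classical
  have hind : ∀ F : Finset (HeightOneSpectrum (𝓞 k)),
      ∃ c : k, c ≠ 0 ∧ ∀ v ∉ S, ord v c = if v ∈ F then m v else 0 := by
    intro F
    induction F using Finset.induction_on with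
    | empty => exact ⟨1, one_ne_zero, fun v _ => by simp⟩
    | insert v F hv ih =>
      obtain ⟨c, hc, h1⟩ := ih
      by_cases hvS : v ∈ S
      · refine ⟨c, hc, fun w hw => ?_⟩
        have : w ≠ v := by rintro rfl; exact hw hvS
        simp [h1 w hw, this]
      · obtain ⟨e, he, h2, h3⟩ := h v hvS
        refine ⟨c * e ^ m v, mul_ne_zero hc (zpow_ne_zero _ he), fun w hw => ?_⟩
        rw [ord_mul w hc (zpow_ne_zero _ he), ord_zpow, h1 w hw]
        by_cases hwv : w = v
        · subst hwv
          simp [hv, h2]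
        · simp [hwv, h3 w hw hwv]
  obtain ⟨c, hc, h1⟩ := hind hm.toFinset
  refine ⟨c, hc, fun v hv => ?_⟩
  rw [h1 v hv]
  by_cases h4 : m v = 0 <;> simp [h4]

theorem exists_principalOutside (S : Finset (HeightOneSpectrum (𝓞 k))) :
    ∃ T, S ⊆ T ∧ PrincipalOutside T := by
  classical
  choose J hJ using ClassGroup.mk0_surjective (R := 𝓞 k)
  have hfin : (⋃ C, {v : HeightOneSpectrum (𝓞 k) | v.asIdeal ∣ (J C : Ideal (𝓞 k))}).Finite :=
    Set.finite_iUnion fun C => Ideal.finite_factors (nonZeroDivisors.ne_zero (J C).2)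
  refine ⟨S ∪ hfin.toFinset, Finset.subset_union_left, fun v hv => ?_⟩
  have hout : ∀ w ∉ S ∪ hfin.toFinset, ∀ C, ¬ (w.asIdeal ∣ (J C : Ideal (𝓞 k))) := by
    intro w hw C h
    refine hw (Finset.mem_union_right _ (hfin.mem_toFinset.mpr ?_))
    exact Set.mem_iUnion.mpr ⟨C, h⟩
  have hv0 := mem_nonZeroDivisors_of_ne_zero v.ne_bot
  let C := (ClassGroup.mk0 ⟨v.asIdeal, hv0⟩)⁻¹
  have hprin : (v.asIdeal * (J C : Ideal (𝓞 k))).IsPrincipal := by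
    rw [← ClassGroup.mk0_eq_one_iff (mul_mem hv0 (J C).2)]
    have : (⟨v.asIdeal * (J C : Ideal (𝓞 k)), mul_mem hv0 (J C).2⟩ : nonZeroDivisors _) =
      ⟨v.asIdeal, hv0⟩ * J C := rfl
    rw [this, map_mul, hJ, mul_inv_cancel]
  obtain ⟨c, hc⟩ := hprin
  rw [Ideal.submodule_span_eq] at hc
  have hJ0 : (J C : Ideal (𝓞 k)) ≠ 0 := nonZeroDivisors.ne_zero (J C).2
  have hc0 : c ≠ 0 := by
    rintro rfl
    rw [Ideal.span_singleton_zero] at hc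
    exact mul_ne_zero v.ne_bot hJ0 hc
  have hmem : ∀ I : Ideal (𝓞 k), c ∈ I ↔ I ∣ v.asIdeal * J C := fun I => by
    rw [hc, Ideal.dvd_span_singleton]
  refine ⟨algebraMap (𝓞 k) k c, by simpa using hc0, le_antisymm ?_ ?_, fun w hw hwv => ?_⟩
  · by_contra! h
    have := (le_ord_iff_mem v hc0 2).mp (by push_cast; omega)
    rw [hmem, pow_two] at this
    exact hout v hv C ((mul_dvd_mul_iff_left v.ne_bot).mp this)
  · refine (le_ord_iff_mem v hc0 1).mpr ?_
    rw [hmem, pow_one]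
    exact dvd_mul_right _ _
  · refine le_antisymm ?_ (ord_algebraMap_nonneg w c)
    by_contra! h
    have := (le_ord_iff_mem w hc0 1).mp (by push_cast; omega)
    rw [hmem, pow_one] at this
    rcases w.prime.dvd_mul.mp this with h1 | h1
    · refine hwv (HeightOneSpectrum.ext ?_)
      exact ((v.isMaximal.eq_of_le w.isPrime.ne_top (Ideal.dvd_iff_le.mp h1))).symm
    · exact hout w hw C h1

theorem exists_pow_ord (v : HeightOneSpectrum (𝓞 k)) :
    ∃ c : k, c ≠ 0 ∧ ord v c = Nat.card (ClassGroup (𝓞 k)) ∧ ∀ w, w ≠ v → ord w c = 0 := by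
  have hv0 := mem_nonZeroDivisors_of_ne_zero v.ne_bot
  set h := Nat.card (ClassGroup (𝓞 k))
  have hprin : (v.asIdeal ^ h).IsPrincipal := by
    rw [← ClassGroup.mk0_eq_one_iff (pow_mem hv0 h)]
    have : (⟨v.asIdeal ^ h, pow_mem hv0 h⟩ : nonZeroDivisors _) = ⟨v.asIdeal, hv0⟩ ^ h := rfl
    rw [this, map_pow, pow_card_eq_one']
  obtain ⟨c, hc⟩ := hprin
  rw [Ideal.submodule_span_eq] at hc
  have hc0 : c ≠ 0 := by
    rintro rfl
    rw [Ideal.span_singleton_zero] at hc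
    exact pow_ne_zero _ v.ne_bot hc
  have hmem : ∀ I : Ideal (𝓞 k), c ∈ I ↔ I ∣ v.asIdeal ^ h := fun I => by
    rw [hc, Ideal.dvd_span_singleton]
  refine ⟨algebraMap (𝓞 k) k c, by simpa using hc0, le_antisymm ?_ ?_, fun w hwv => ?_⟩
  · by_contra! h3
    have := (le_ord_iff_mem v hc0 (h + 1)).mp (by push_cast; omega)
    rw [hmem, pow_dvd_pow_iff v.ne_bot (Ideal.isUnit_iff.not.mpr v.isPrime.ne_top)] at this
    omega
  · refine (le_ord_iff_mem v hc0 h).mpr ?_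
    rw [hmem]
  · refine le_antisymm ?_ (ord_algebraMap_nonneg w c)
    by_contra! h
    have := (le_ord_iff_mem w hc0 1).mp (by push_cast; omega)
    rw [hmem, pow_one] at this
    refine hwv (HeightOneSpectrum.ext ?_)
    exact ((v.isMaximal.eq_of_le w.isPrime.ne_top
      (Ideal.dvd_iff_le.mp (w.prime.dvd_of_dvd_pow this)))).symm

theorem finrank_sUnits [IsTotallyReal k] (S : Finset (HeightOneSpectrum (𝓞 k))) :
    Module.Finite ℤ (Additive (sUnits S)) ∧
    Module.finrank ℤ (Additive (sUnits S)) + 1 = Module.finrank ℚ k + S.card := by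
  classical
  let f : Additive (sUnits S) →+ (S → ℤ) :=
    { toFun := fun x v => ord v.1 ((x.toMul : kˣ) : k)
      map_zero' := by ext v; simp
      map_add' := fun x y => by
        ext v
        simp [ord_mul v.1 (x.toMul : kˣ).ne_zero (y.toMul : kˣ).ne_zero] }
  let ι : Additive (𝓞 k)ˣ →+ Additive (sUnits S) := MonoidHom.toAdditive
    { toFun := fun u => ⟨Units.map (algebraMap (𝓞 k) k).toMonoidHom u, fun v _ => ord_unit v u⟩
      map_one' := by ext; simp
      map_mul' := fun x y => by ext; simp }
  have hι : Function.Injective ι := by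
    intro x y h
    have h1 := congrArg (fun z : Additive (sUnits S) => ((z.toMul : kˣ) : k)) h
    exact Additive.toMul.injective (Units.ext (IsFractionRing.injective (𝓞 k) k h1))
  have hker : LinearMap.ker f.toIntLinearMap = LinearMap.range ι.toIntLinearMap := by
    ext x
    rw [LinearMap.mem_ker, LinearMap.mem_range]
    constructor
    · intro h
      obtain ⟨u, hu⟩ := exists_unit_of_ord_eq_zero (x := ((x.toMul : kˣ) : k)) (Units.ne_zero _)
        (fun v => by
          by_cases hv : v ∈ S
          · exact congrFun h ⟨v, hv⟩
          · exact x.toMul.2 v hv)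
      refine ⟨Additive.ofMul u, Additive.toMul.injective (Subtype.ext (Units.ext hu))⟩
    · rintro ⟨u, rfl⟩
      ext v
      exact ord_unit v.1 u.toMul
  have hfinker : Module.Finite ℤ (LinearMap.ker f.toIntLinearMap) := by
    rw [hker]
    infer_instance
  have hfin : Module.Finite ℤ (Additive (sUnits S)) := by
    have := Module.Finite.equiv f.toIntLinearMap.quotKerEquivRange.symm
    exact Module.Finite.of_submodule_quotient (LinearMap.ker f.toIntLinearMap)
  refine ⟨hfin, ?_⟩
  have hrange : Module.finrank ℤ (LinearMap.range f.toIntLinearMap) = S.card := by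
    apply le_antisymm
    · refine (Submodule.finrank_le _).trans ?_
      simp
    · choose c hc h1 h3 using exists_pow_ord (k := k)
      have hh : (Nat.card (ClassGroup (𝓞 k)) : ℤ) ≠ 0 := by exact_mod_cast Nat.card_pos.ne'
      have hmem : ∀ m : S → ℤ, (Nat.card (ClassGroup (𝓞 k)) : ℤ) • m ∈
          LinearMap.range f.toIntLinearMap := by
        intro m
        let y : Additive (sUnits S) := ∑ v : S, m v • Additive.ofMul (⟨Units.mk0 (c v) (hc v),
          fun w hw => h3 v w fun h => hw (h ▸ v.2)⟩ : sUnits S)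
        refine ⟨y, ?_⟩
        rw [AddMonoidHom.coe_toIntLinearMap, map_sum]
        ext w
        rw [Finset.sum_apply, Finset.sum_eq_single w]
        · rw [map_zsmul, Pi.smul_apply, Pi.smul_apply]
          change m w • ord w.1 (c w) = _
          rw [h1, smul_eq_mul, smul_eq_mul, mul_comm]
        · intro v _ hvw
          rw [map_zsmul, Pi.smul_apply]
          change m v • ord w.1 (c v) = _
          rw [h3 v w (fun h => hvw (Subtype.ext h.symm)), smul_zero]
        · simp
      let g : (S → ℤ) →ₗ[ℤ] LinearMap.range f.toIntLinearMap :=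
        LinearMap.codRestrict _ ((Nat.card (ClassGroup (𝓞 k)) : ℤ) • LinearMap.id) hmem
      have := LinearMap.finrank_le_finrank_of_injective (f := g) (fun m m' h => by
        have := congrArg Subtype.val h
        exact smul_right_injective _ hh this)
      simpa using this
  have hrank := HerbrandQuotient.finrank_eq_range_add_ker f.toIntLinearMap
  rw [hrange, hker, LinearMap.finrank_range_of_inj (f := ι.toIntLinearMap) hι,
    NumberField.Units.finrank_eq, NumberField.Units.rank] at hrank
  have h1 : Fintype.card (InfinitePlace k) = Module.finrank ℚ k := by
    rw [InfinitePlace.card_eq_nrRealPlaces_add_nrComplexPlaces,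
      IsTotallyReal.nrComplexPlaces_eq_zero, IsTotallyReal.finrank, add_zero]
  rw [h1] at hrank
  have := Module.finrank_pos (R := ℚ) (M := k)
  omega

end PlaceTheory

namespace PlaceTheory

open NumberField IsDedekindDomain

variable {k : Type*} [Field k] [NumberField k] {K : Type*} [Field K] [NumberField K] [Algebra k K]

/-- The finite places of `K` above a finite set of finite places of `k`. -/
noncomputable def placesAbove (K : Type*) [Field K] [NumberField K] [Algebra k K]
    (S : Finset (HeightOneSpectrum (𝓞 k))) : Finset (HeightOneSpectrum (𝓞 K)) :=
  Set.Finite.toFinset (s := {w | under k w ∈ S}) <| by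
    refine (Set.Finite.biUnion S.finite_toSet
      fun v _ => finite_under_eq (k := k) (K := K) v).subset fun w hw => ?_
    exact Set.mem_biUnion (x := under k w) hw rfl

theorem mem_placesAbove {S : Finset (HeightOneSpectrum (𝓞 k))} {w : HeightOneSpectrum (𝓞 K)} :
    w ∈ placesAbove K S ↔ under k w ∈ S := by
  simp [placesAbove]

open Classical in
theorem card_placesAbove (h2 : Module.finrank k K = 2) (S : Finset (HeightOneSpectrum (𝓞 k))) :
    (placesAbove K S).card + (S.filter fun v => ¬ IsSplit K v).card = 2 * S.card := by
  rw [Finset.card_eq_sum_card_fiberwise (f := under k) (t := S)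
    fun w hw => mem_placesAbove.mp hw, Finset.card_filter, ← Finset.sum_add_distrib,
    mul_comm, ← smul_eq_mul, ← Finset.sum_const]
  refine Finset.sum_congr rfl fun v hv => ?_
  have hmem : ∀ w, w ∈ (placesAbove K S).filter (fun w => under k w = v) ↔ under k w = v := by
    intro w
    rw [Finset.mem_filter, mem_placesAbove]
    exact ⟨fun h => h.2, fun h => ⟨h ▸ hv, h⟩⟩
  have hle := card_le_two_of_under_eq h2 _ fun w hw => (hmem w).mp hw
  obtain ⟨w, hw⟩ := exists_under_eq (K := K) v
  split_ifs with h
  · obtain ⟨w1, w2, hne, h1, h3⟩ := h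
    have := Finset.one_lt_card.mpr ⟨w1, (hmem w1).mpr h1, w2, (hmem w2).mpr h3, hne⟩
    omega
  · rw [Finset.card_eq_one.mpr ⟨w, Finset.eq_singleton_iff_unique_mem.mpr
      ⟨(hmem w).mpr hw, fun w' hw' => ?_⟩⟩]
    by_contra hne
    exact h ⟨w', w, hne, (hmem w').mp hw', hw⟩

theorem ord_eq_zero_of_algebraMap (w : HeightOneSpectrum (𝓞 K)) {x : k}
    (h : ord w (algebraMap k K x) = 0) : ord (under k w) x = 0 := by
  rw [ord_algebraMap] at h
  exact (mul_eq_zero.mp h).resolve_left (by exact_mod_cast (ram_pos w).ne')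

open Classical in
/-- The index of the norms among the units away from `S`, for a quadratic extension of totally
real fields unramified away from `S`. -/
theorem relIndex_norm_mul_two [IsTotallyReal k] [IsTotallyReal K] (h2 : Module.finrank k K = 2)
    {S : Finset (HeightOneSpectrum (𝓞 k))} (hS : PrincipalOutside S)
    (hram : ∀ w : HeightOneSpectrum (𝓞 K), under k w ∉ S → ram k w = 1) :
    ((sUnits (placesAbove K S)).map (Units.map (Algebra.norm k))).relIndex (sUnits S) * 2 =
      2 ^ (S.filter fun v => ¬ IsSplit K v).card := by
  obtain ⟨σ, hσ⟩ := exists_ne_one_of_finrank_two h2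
  have hin : ∀ w : HeightOneSpectrum (𝓞 K), w ∉ placesAbove K S → under k w ∉ S := fun w h h' =>
    h (mem_placesAbove.mpr h')
  have hin' : ∀ w : HeightOneSpectrum (𝓞 K), w ∉ placesAbove K S →
      conj (σ : K ≃+* K) w ∉ placesAbove K S := fun w h => by
    rwa [mem_placesAbove, under_conj, ← mem_placesAbove]
  have hinvol := involution_apply_apply h2 σ hσ
  have hconj : ∀ w : HeightOneSpectrum (𝓞 K), ∀ x, ord w (σ x) = ord (conj (σ : K ≃+* K) w) x := by
    intro w x
    rw [← ord_conj w (σ : K ≃+* K) (σ x), AlgEquiv.coe_ringEquiv, hinvol]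
  let σu : sUnits (placesAbove K S) →* sUnits (placesAbove K S) :=
    { toFun := fun x => ⟨Units.map (σ : K →* K) x, fun w hw =>
        (hconj w (x : Kˣ)).trans (x.2 _ (hin' w hw))⟩
      map_one' := by ext; simp
      map_mul' := fun x y => by ext; simp }
  let ju : sUnits S →* sUnits (placesAbove K S) :=
    { toFun := fun x => ⟨Units.map (algebraMap k K : k →* K) x, fun w hw => by
        change ord w (algebraMap k K (x : kˣ)) = 0
        rw [ord_algebraMap, x.2 _ (hin w hw), mul_zero]⟩
      map_one' := by ext; simp
      map_mul' := fun x y => by ext; simp }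
  have hnorm : ∀ x ∈ sUnits (placesAbove K S), Units.map (Algebra.norm k) x ∈ sUnits S := by
    intro x hx v hv
    obtain ⟨w, rfl⟩ := exists_under_eq (K := K) v
    apply ord_eq_zero_of_algebraMap
    have hw : w ∉ placesAbove K S := fun h => hv (mem_placesAbove.mp h)
    change ord w (algebraMap k K (Algebra.norm k (x : K))) = 0
    rw [algebraMap_norm h2 σ hσ, ord_mul w x.ne_zero ((map_ne_zero σ).mpr x.ne_zero), hconj,
      hx w hw, hx _ (hin' w hw), add_zero]
  let nu : sUnits (placesAbove K S) →* sUnits S :=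
    ((Units.map (Algebra.norm k)).comp (sUnits (placesAbove K S)).subtype).codRestrict _
      fun x => hnorm x x.2
  obtain ⟨hfA, hrA⟩ := finrank_sUnits (placesAbove K S)
  obtain ⟨hfB, hrB⟩ := finrank_sUnits S
  have key := HerbrandQuotient.index_norm_mul (A := Additive (sUnits (placesAbove K S)))
    (B := Additive (sUnits S)) (MonoidHom.toAdditive ju) ?_ (MonoidHom.toAdditive σu) ?_
    (MonoidHom.toAdditive nu) ?_ ?_ ?_ ?_ (Additive.ofMul ⟨-1, fun v _ => by simp⟩) ?_ ?_ ?_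
  · have h3 : (MonoidHom.toAdditive nu).range.index =
        ((sUnits (placesAbove K S)).map (Units.map (Algebra.norm k))).relIndex (sUnits S) := by
      rw [Subgroup.relIndex, ← Subgroup.index_toAddSubgroup]
      congr 1
      ext x
      constructor
      · rintro ⟨y, rfl⟩
        exact ⟨_, y.toMul.2, rfl⟩
      · rintro ⟨y, hy, h⟩
        exact ⟨Additive.ofMul ⟨y, hy⟩, Additive.toMul.injective (Subtype.ext h)⟩
    rw [h3] at key
    have h4 := card_placesAbove (K := K) h2 S
    have h5 := Module.finrank_mul_finrank ℚ k K
    rw [h2] at h5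
    have h6 := Module.finrank_pos (R := ℚ) (M := k)
    have h7 : 2 ^ (2 * Module.finrank ℤ (Additive (sUnits S))) * 2 =
        2 ^ (S.filter fun v => ¬ IsSplit K v).card *
          2 ^ Module.finrank ℤ (Additive (sUnits (placesAbove K S))) := by
      rw [← pow_succ, ← pow_add]
      congr 1
      omega
    rw [← key] at h7
    refine Nat.eq_of_mul_eq_mul_right
      (pow_pos two_pos (Module.finrank ℤ (Additive (sUnits (placesAbove K S))))) ?_
    rw [← h7]; ring
  · intro x y h
    have h1 := congrArg (fun z : Additive (sUnits (placesAbove K S)) => ((z.toMul : Kˣ) : K)) h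
    exact Additive.toMul.injective (Subtype.ext (Units.ext ((algebraMap k K).injective h1)))
  · intro x
    exact Additive.toMul.injective (Subtype.ext (Units.ext (hinvol _)))
  · intro x
    exact Additive.toMul.injective (Subtype.ext (Units.ext (algebraMap_norm h2 σ hσ _)))
  · intro x h
    have h1 := congrArg (fun z : Additive (sUnits (placesAbove K S)) => ((z.toMul : Kˣ) : K)) h
    obtain ⟨b, hb⟩ := mem_range_of_fixed h2 σ hσ h1
    have hb0 : b ≠ 0 := by
      rintro rfl
      rw [map_zero] at hb
      exact (x.toMul : Kˣ).ne_zero hb.symm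
    refine ⟨Additive.ofMul ⟨Units.mk0 b hb0, fun v hv => ?_⟩,
      Additive.toMul.injective (Subtype.ext (Units.ext hb))⟩
    obtain ⟨w, rfl⟩ := exists_under_eq (K := K) v
    apply ord_eq_zero_of_algebraMap
    have hw : w ∉ placesAbove K S := fun h => hv (mem_placesAbove.mp h)
    rw [Units.val_mk0, hb]
    exact x.toMul.2 w hw
  · intro b
    exact Additive.toMul.injective (Subtype.ext (Units.ext (σ.commutes _)))
  · intro x h
    have h1 : ((x.toMul : Kˣ) : K) * σ ((x.toMul : Kˣ) : K) = 1 :=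
      congrArg (fun z : Additive (sUnits (placesAbove K S)) => ((z.toMul : Kˣ) : K)) h
    obtain ⟨y, hy0, hy⟩ := exists_eq_div_of_mul_eq_one h2 σ hσ h1
    have hσy : σ y ≠ 0 := (map_ne_zero σ).mpr hy0
    have hinv : ∀ w ∉ placesAbove K S, ord (conj (σ : K ≃+* K) w) y = ord w y := by
      intro w hw
      have h3 := x.toMul.2 w hw
      rw [hy, ord_div w hy0 hσy, hconj] at h3
      omega
    choose τ hτ using exists_under_eq (k := k) (K := K)
    have hinv' : ∀ w ∉ placesAbove K S, ord (τ (under k w)) y = ord w y := by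
      intro w hw
      rcases eq_or_eq_conj h2 σ hσ (hτ (under k w)) with h | h
      · rw [h]
      · rw [h, hinv w hw]
    obtain ⟨c, hc0, hc⟩ := hS.exists_ord_eq (fun v => ord (τ v) y) (by
      refine ((finite_ord_ne_zero hy0).image (under k)).subset fun v hv => ?_
      exact ⟨τ v, hv, hτ v⟩)
    have hc0' : algebraMap k K c ≠ 0 := by simpa using hc0
    refine ⟨Additive.ofMul ⟨Units.mk0 (y / algebraMap k K c) (div_ne_zero hy0 hc0'),
      fun w hw => ?_⟩, Additive.toMul.injective (Subtype.ext (Units.ext ?_))⟩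
    · rw [Units.val_mk0, ord_div w hy0 hc0', ord_algebraMap, hram w (hin w hw), hc _ (hin w hw),
        hinv' w hw]
      simp
    · change _ = ((Units.mk0 (y / algebraMap k K c) (div_ne_zero hy0 hc0') / Units.map (σ : K →* K)
        (Units.mk0 (y / algebraMap k K c) (div_ne_zero hy0 hc0')) : Kˣ) : K)
      rw [Units.val_div_eq_div_val]
      change ((x.toMul : Kˣ) : K) = (y / algebraMap k K c) / σ (y / algebraMap k K c)
      rw [hy, map_div₀, σ.commutes]
      field_simp
  · intro h
    have h1 : (-1 : k) = 1 :=
      congrArg (fun z : Additive (sUnits S) => ((z.toMul : kˣ) : k)) h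
    norm_num at h1
  · refine Additive.toMul.injective (Subtype.ext (Units.ext ?_))
    change (-1 : k) * -1 = 1
    norm_num
  · intro x h
    have h1 : ((x.toMul : Kˣ) : K) * ((x.toMul : Kˣ) : K) = 1 :=
      congrArg (fun z : Additive (sUnits (placesAbove K S)) => ((z.toMul : Kˣ) : K)) h
    rcases mul_self_eq_one_iff.mp h1 with h | h
    · exact Or.inl (Additive.toMul.injective (Subtype.ext (Units.ext h)))
    · refine Or.inr (Additive.toMul.injective (Subtype.ext (Units.ext ?_)))
      rw [h]
      change (-1 : K) = algebraMap k K (-1)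
      simp

end PlaceTheory

namespace SignCharacters

variable {A : Type*} [CommGroup A]

/-- An element outside a subgroup containing all squares is detected by a sign character. -/
theorem exists_sign_character {H : Subgroup A} (hsq : ∀ x : A, x ^ 2 ∈ H) {u : A} (hu : u ∉ H) :
    ∃ θ : A →* ℤˣ, (∀ x ∈ H, θ x = 1) ∧ θ u = -1 := by
  classical
  let V := Additive (A ⧸ H)
  let _ : Module (ZMod 2) V := AddCommGroup.zmodModule (n := 2) fun x => by
    refine QuotientGroup.induction_on x.toMul (C := fun y => 2 • Additive.ofMul y = 0) fun a => ?_
    rw [← ofMul_pow, ← QuotientGroup.mk_pow, (QuotientGroup.eq_one_iff _).mpr (hsq a)]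
    rfl
  have h0 : Additive.ofMul (QuotientGroup.mk u : A ⧸ H) ≠ (0 : V) := fun h =>
    hu ((QuotientGroup.eq_one_iff _).mp (Additive.ofMul.injective h))
  have h1 := (Module.forall_dual_apply_eq_zero_iff (ZMod 2) (V := V) _).not.mpr h0
  push Not at h1
  obtain ⟨f, hf⟩ := h1
  let g : A → ZMod 2 := fun x => f (Additive.ofMul (QuotientGroup.mk x : A ⧸ H))
  have hg : ∀ x y, g (x * y) = g x + g y := fun x y =>
    map_add f (Additive.ofMul (QuotientGroup.mk x : A ⧸ H)) (Additive.ofMul (QuotientGroup.mk y))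
  have h2 : ∀ a b : ZMod 2, (if a + b = 0 then (1 : ℤˣ) else -1) =
    (if a = 0 then 1 else -1) * (if b = 0 then 1 else -1) := by decide
  refine ⟨MonoidHom.mk' (fun x => if g x = 0 then 1 else -1) fun x y => ?_, fun x hx => ?_, ?_⟩
  · rw [hg, h2]
  · have : (QuotientGroup.mk x : A ⧸ H) = 1 := (QuotientGroup.eq_one_iff _).mpr hx
    have : g x = 0 := by
      change f (Additive.ofMul (QuotientGroup.mk x : A ⧸ H)) = 0
      rw [this]
      exact map_zero f
    simp [this]
  · have : g u ≠ 0 := hf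
    simp [this]

theorem index_le_card {H : Subgroup A} (s : Finset A) (hs : ∀ x, ∃ r ∈ s, r⁻¹ * x ∈ H) :
    H.index ≠ 0 ∧ H.index ≤ s.card := by
  have hsurj : Function.Surjective fun r : s => (QuotientGroup.mk r.1 : A ⧸ H) := by
    intro q
    obtain ⟨x, rfl⟩ := QuotientGroup.mk_surjective q
    obtain ⟨r, hr, h⟩ := hs x
    exact ⟨⟨r, hr⟩, QuotientGroup.eq.mpr h⟩
  have hfin : Finite (A ⧸ H) := Finite.of_surjective _ hsurj
  refine ⟨Subgroup.index_ne_zero_of_finite, ?_⟩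
  have := Nat.card_le_card_of_surjective _ hsurj
  rwa [Nat.card_eq_fintype_card (α := s), Fintype.card_coe] at this

/-- Jointly surjective sign characters trivial on a subgroup bound its index from below. -/
theorem two_pow_card_le_relIndex {N B : Subgroup A} {ι : Type*} [Finite ι] (θ : ι → A →* ℤˣ)
    (hN : ∀ i, ∀ x ∈ N, θ i x = 1) (h0 : N.relIndex B ≠ 0)
    (hsurj : ∀ ε : ι → ℤˣ, ∃ x ∈ B, ∀ i, θ i x = ε i) : 2 ^ Nat.card ι ≤ N.relIndex B := by
  let Θ : B →* (ι → ℤˣ) := (MonoidHom.mk' (fun x i => θ i x) fun x y => by ext i; simp).comp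
    B.subtype
  have h1 : Function.Surjective Θ := fun ε => by
    obtain ⟨x, hx, h⟩ := hsurj ε
    exact ⟨⟨x, hx⟩, funext h⟩
  have h2 : N.subgroupOf B ≤ Θ.ker := fun x hx => funext fun i => hN i _ hx
  have h3 : Θ.ker.index = 2 ^ Nat.card ι := by
    rw [Subgroup.index_ker, MonoidHom.range_eq_top.mpr h1, Subgroup.card_top]
    simp [Nat.card_fun]
  rw [← h3]
  exact Nat.le_of_dvd (Nat.pos_of_ne_zero h0) (Subgroup.index_dvd_of_le h2)

/-- Selecting finitely many subgroups of index at most two with prescribed intersection. -/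
theorem exists_finset_iInf_eq {B : Subgroup A} {m : ℕ} (hB : B.index = 2 ^ m) {ι : Type*}
    (N : ι → Subgroup A) (hN : ∀ i, B ≤ N i) (hN2 : ∀ i, (N i).index ≤ 2 ∧ (N i).index ≠ 0)
    (hsep : ∀ x ∉ B, ∃ i, x ∉ N i) : ∃ T : Finset ι, T.card = m ∧ ⨅ i ∈ T, N i = B := by
  classical
  have key : ∀ j ≤ m, ∃ T : Finset ι, T.card = j ∧ (⨅ i ∈ T, N i).index = 2 ^ j := by
    intro j
    induction j with
    | zero => exact fun _ => ⟨∅, by simp⟩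
    | succ j ih =>
      intro hj
      obtain ⟨T, hT, hi⟩ := ih (by omega)
      have hle : B ≤ ⨅ i ∈ T, N i := le_iInf₂ fun i _ => hN i
      have hne : ¬ (⨅ i ∈ T, N i) ≤ B := fun h => by
        rw [le_antisymm h hle, hB] at hi
        have := Nat.pow_right_injective le_rfl hi
        omega
      obtain ⟨x, hx, hxB⟩ := SetLike.not_le_iff_exists.mp hne
      obtain ⟨i, hix⟩ := hsep x hxB
      have hiT : i ∉ T := fun h => hix ((iInf₂_le i h : (⨅ i ∈ T, N i) ≤ N i) hx)
      refine ⟨insert i T, by rw [Finset.card_insert_of_notMem hiT, hT], ?_⟩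
      rw [Finset.iInf_insert]
      have h1 := Subgroup.relIndex_mul_index (inf_le_right : N i ⊓ (⨅ i ∈ T, N i) ≤ _)
      rw [Subgroup.inf_relIndex_right, hi] at h1
      have h2 : (N i).relIndex (⨅ i ∈ T, N i) = 2 := by
        have h3 : (N i).relIndex (⨅ i ∈ T, N i) ∣ (N i).index :=
          Subgroup.relIndex_dvd_index_of_normal _ _
        have h4 := Nat.le_of_dvd (Nat.pos_of_ne_zero (hN2 i).2) h3
        have h5 : (N i).relIndex (⨅ i ∈ T, N i) ≠ 1 := fun h =>
          hix (Subgroup.relIndex_eq_one.mp h hx)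
        have h6 := ne_zero_of_dvd_ne_zero (hN2 i).2 h3
        have := (hN2 i).1
        omega
      rw [← h1, h2, pow_succ, mul_comm]
  obtain ⟨T, hT, hi⟩ := key m le_rfl
  refine ⟨T, hT, ?_⟩
  have hle : B ≤ ⨅ i ∈ T, N i := le_iInf₂ fun i _ => hN i
  have h1 := Subgroup.relIndex_mul_index hle
  rw [hi, hB] at h1
  exact le_antisymm (Subgroup.relIndex_eq_one.mp
    (Nat.eq_of_mul_eq_mul_right (pow_pos two_pos m) (h1.trans (one_mul _).symm))) hle

/-- Subgroups of index at most two containing `N` with intersection of index `2 ^ |T|` separate all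
sign patterns. -/
theorem exists_mem_iff {ι : Type*} (T : Finset ι) (N : ι → Subgroup A)
    (hN2 : ∀ i ∈ T, (N i).index ≤ 2 ∧ (N i).index ≠ 0)
    (hT : (⨅ i ∈ T, N i).index = 2 ^ T.card) (P : ι → Prop) :
    ∃ x : A, ∀ i ∈ T, x ∈ N i ↔ P i := by
  classical
  let Φ : A →* (∀ i : T, A ⧸ N i.1) := MonoidHom.mk' (fun x i => QuotientGroup.mk x) fun x y => rfl
  have hker : Φ.ker = ⨅ i ∈ T, N i := by
    ext x
    rw [MonoidHom.mem_ker, Subgroup.mem_iInf]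
    constructor
    · intro h i
      rw [Subgroup.mem_iInf]
      exact fun hi => (QuotientGroup.eq_one_iff _).mp (congrFun h ⟨i, hi⟩)
    · intro h
      ext i
      exact (QuotientGroup.eq_one_iff _).mpr (Subgroup.mem_iInf.mp (h i.1) i.2)
  have hfin : ∀ i : T, Finite (A ⧸ N i.1) := fun i => by
    have : (N i.1).FiniteIndex := ⟨(hN2 i.1 i.2).2⟩
    infer_instance
  have hcard : Nat.card (∀ i : T, A ⧸ N i.1) = ∏ i : T, (N i.1).index := by
    rw [Nat.card_pi]; rfl
  have hle : ∏ i : T, (N i.1).index ≤ 2 ^ T.card := by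
    refine (Finset.prod_le_pow_card _ _ 2 fun i _ => (hN2 i.1 i.2).1).trans_eq ?_
    simp
  have hrange : Nat.card Φ.range = 2 ^ T.card := by
    rw [← Subgroup.index_ker, hker, hT]
  have h4 : Nat.card Φ.range ≤ Nat.card (∀ i : T, A ⧸ N i.1) :=
    Nat.card_le_card_of_injective _ Subtype.val_injective
  have htop : Φ.range = ⊤ := Subgroup.eq_top_of_le_card _ (by omega)
  have heq : ∏ i : T, (N i.1).index = 2 ^ T.card := by omega
  have hind : ∀ i : T, (N i.1).index = 2 := by
    intro i
    by_contra hne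
    have h5 : (N i.1).index < 2 := lt_of_le_of_ne (hN2 i.1 i.2).1 hne
    have h6 := Finset.prod_lt_prod (s := Finset.univ) (f := fun i : T => (N i.1).index)
      (g := fun _ => 2) (fun i _ => Nat.pos_of_ne_zero (hN2 i.1 i.2).2)
      (fun i _ => (hN2 i.1 i.2).1) ⟨i, Finset.mem_univ _, h5⟩
    rw [heq] at h6
    simp at h6
  have hex : ∀ i : T, ∃ u : A, u ∉ N i.1 := by
    intro i
    by_contra! h
    have h7 := hind i
    rw [(Subgroup.eq_top_iff' _).mpr h, Subgroup.index_top] at h7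
    omega
  choose u hu using hex
  obtain ⟨x, hx⟩ := MonoidHom.range_eq_top.mp htop fun i =>
    if P i.1 then 1 else QuotientGroup.mk (u i)
  refine ⟨x, fun i hi => ?_⟩
  have h8 : (QuotientGroup.mk x : A ⧸ N i) = if P i then 1 else QuotientGroup.mk (u ⟨i, hi⟩) :=
    congrFun hx ⟨i, hi⟩
  rw [← QuotientGroup.eq_one_iff, h8]
  by_cases hP : P i
  · simp [hP]
  · simp only [hP, if_false, iff_false]
    exact fun h => hu ⟨i, hi⟩ ((QuotientGroup.eq_one_iff _).mp h)

end SignCharacters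

namespace PlaceTheory

open NumberField IsDedekindDomain SignCharacters

variable {k : Type*} [Field k] [NumberField k]

theorem valuation_two_le (v : HeightOneSpectrum (𝓞 k)) : v.valuation k 2 ≤ 1 := by
  have h : (((2 : 𝓞 k) : 𝓞 k) : k) = 2 := map_ofNat (algebraMap (𝓞 k) k) 2
  rw [← h]
  exact v.valuation_le_one 2

theorem valuation_four_le (v : HeightOneSpectrum (𝓞 k)) : v.valuation k 4 ≤ 1 := by
  have h : (((4 : 𝓞 k) : 𝓞 k) : k) = 4 := map_ofNat (algebraMap (𝓞 k) k) 4
  rw [← h]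
  exact v.valuation_le_one 4

theorem valuation_eq_one_of_sub_lt {v : HeightOneSpectrum (𝓞 k)} {x y : k}
    (hy : v.valuation k y = 1) (h : v.valuation k (x - y) < 1) : v.valuation k x = 1 := by
  have := Valuation.map_add_eq_of_lt_right (v.valuation k) (x := x - y) (y := y) (by rwa [hy])
  rwa [sub_add_cancel, hy] at this

/-- The principal units at `v` of level `4`. -/
def levelFour (v : HeightOneSpectrum (𝓞 k)) : Subgroup kˣ where
  carrier := {u | v.valuation k ((u : k) - 1) < v.valuation k 4}
  one_mem' := by
    simp only [Set.mem_ofPred_eq, Units.val_one, sub_self, map_zero]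
    exact zero_lt_iff.mpr (valuation_ne_zero v (by norm_num))
  mul_mem' := fun {a b} ha hb => by
    simp only [Set.mem_ofPred_eq] at ha hb ⊢
    have h1 := valuation_eq_one_of_sub_lt (v := v) (map_one _) (ha.trans_le (valuation_four_le v))
    have h3 : ((a * b : kˣ) : k) - 1 = a * ((b : k) - 1) + ((a : k) - 1) := by
      rw [Units.val_mul]; ring
    rw [h3]
    refine Valuation.map_add_lt _ ?_ ha
    rwa [map_mul, h1, one_mul]
  inv_mem' := fun {a} ha => by
    simp only [Set.mem_ofPred_eq] at ha ⊢
    have h1 := valuation_eq_one_of_sub_lt (v := v) (map_one _) (ha.trans_le (valuation_four_le v))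
    have h3 : ((a⁻¹ : kˣ) : k) - 1 = -((a : k)⁻¹ * ((a : k) - 1)) := by
      rw [Units.val_inv_eq_inv_val, mul_sub, inv_mul_cancel₀ a.ne_zero]; ring
    rwa [h3, Valuation.map_neg, map_mul, map_inv₀, h1, inv_one, one_mul]

theorem mem_levelFour {v : HeightOneSpectrum (𝓞 k)} {u : kˣ} :
    u ∈ levelFour v ↔ v.valuation k ((u : k) - 1) < v.valuation k 4 := Iff.rfl

/-- Squares times principal units of level `4`; its elements are local squares. -/
def sqClass (v : HeightOneSpectrum (𝓞 k)) : Subgroup kˣ :=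
  (powMonoidHom 2).range ⊔ levelFour v

theorem sq_mem_sqClass (v : HeightOneSpectrum (𝓞 k)) (u : kˣ) : u ^ 2 ∈ sqClass v :=
  (le_sup_left : _ ≤ sqClass v) ⟨u, rfl⟩

theorem levelFour_le_sqClass (v : HeightOneSpectrum (𝓞 k)) : levelFour v ≤ sqClass v :=
  le_sup_right

theorem mem_sqClass {v : HeightOneSpectrum (𝓞 k)} {u : kˣ} :
    u ∈ sqClass v ↔ ∃ y : kˣ, ∃ z ∈ levelFour v, y ^ 2 * z = u := by
  rw [sqClass, Subgroup.mem_sup]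
  constructor
  · rintro ⟨_, ⟨y, rfl⟩, z, hz, h⟩
    exact ⟨y, z, hz, h⟩
  · rintro ⟨y, z, hz, h⟩
    exact ⟨_, ⟨y, rfl⟩, z, hz, h⟩

theorem mul_sq_mem_sqClass_iff {v : HeightOneSpectrum (𝓞 k)} (u y : kˣ) :
    u * y ^ 2 ∈ sqClass v ↔ u ∈ sqClass v :=
  Subgroup.mul_mem_cancel_right _ (sq_mem_sqClass v y)

theorem valuation_eq_one_of_mem_levelFour {v : HeightOneSpectrum (𝓞 k)} {u : kˣ}
    (h : u ∈ levelFour v) : v.valuation k (u : k) = 1 :=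
  valuation_eq_one_of_sub_lt (map_one _) (h.trans_le (valuation_four_le v))

theorem mem_sqClass_of_sub_sq_lt {v : HeightOneSpectrum (𝓞 k)} {u : kˣ} {c : k}
    (hu : v.valuation k (u : k) = 1) (h : v.valuation k ((u : k) - c ^ 2) < v.valuation k 4) :
    u ∈ sqClass v := by
  have hc1 : v.valuation k (c ^ 2) = 1 :=
    valuation_eq_one_of_sub_lt hu (by rw [Valuation.map_sub_swap]; exact h.trans_le (valuation_four_le v))
  have hc : c ≠ 0 := by
    rintro rfl
    rw [zero_pow two_ne_zero, map_zero] at hc1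
    exact zero_ne_one hc1
  refine mem_sqClass.mpr ⟨Units.mk0 c hc, u * (Units.mk0 c hc ^ 2)⁻¹, ?_, by rw [mul_comm, inv_mul_cancel_right]⟩
  rw [mem_levelFour]
  have h3 : ((u * (Units.mk0 c hc ^ 2)⁻¹ : kˣ) : k) - 1 = ((u : k) - c ^ 2) * (c ^ 2)⁻¹ := by
    push_cast
    rw [Units.val_mk0]
    field_simp
  rw [h3, map_mul, map_inv₀, hc1, inv_one, mul_one]
  exact h

/-- Every class modulo squares of even order is represented by a unit. -/
theorem exists_mul_sq_ord_eq_zero {v : HeightOneSpectrum (𝓞 k)} {x : kˣ}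
    (hx : Even (ord v (x : k))) : ∃ y : kˣ, ord v ((x * y ^ 2 : kˣ) : k) = 0 := by
  obtain ⟨m, hm⟩ := hx
  obtain ⟨π, hπ, h1⟩ := exists_ord_eq v (-m)
  refine ⟨Units.mk0 π hπ, ?_⟩
  rw [Units.val_mul, ord_mul v (Units.ne_zero _) (Units.ne_zero _), Units.val_pow_eq_pow_val,
    ord_pow, Units.val_mk0, h1, hm]
  push_cast
  ring

theorem exists_integer_sub_lt {v : HeightOneSpectrum (𝓞 k)} {x : k} (hx : v.valuation k x ≤ 1) :
    ∃ c : 𝓞 k, v.valuation k (x - algebraMap (𝓞 k) k c) < 1 := by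
  obtain ⟨a, ha⟩ := v.exists_valuation_sub_lt_of_integer hx 1
  exact ⟨a, by rw [Valuation.map_sub_swap]; exact ha⟩

/-- Away from `2`, the product of two nonsquares of even order is a local square. -/
theorem mul_mem_sqClass {v : HeightOneSpectrum (𝓞 k)} (h2 : v.valuation k 2 = 1) {x y : kˣ}
    (hx : Even (ord v (x : k))) (hy : Even (ord v (y : k))) (hx' : x ∉ sqClass v)
    (hy' : y ∉ sqClass v) : x * y ∈ sqClass v := by
  classical
  have h4 : v.valuation k 4 = 1 := by
    rw [show (4 : k) = 2 * 2 by norm_num, map_mul, h2, one_mul]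
  wlog hx0 : ord v (x : k) = 0 generalizing x
  · obtain ⟨z, hz⟩ := exists_mul_sq_ord_eq_zero hx
    have := this (x := x * z ^ 2) (by rw [hz]; exact Even.zero)
      (by rwa [mul_sq_mem_sqClass_iff]) hz
    rwa [mul_right_comm, mul_sq_mem_sqClass_iff] at this
  wlog hy0 : ord v (y : k) = 0 generalizing y
  · obtain ⟨z, hz⟩ := exists_mul_sq_ord_eq_zero hy
    have := this (y := y * z ^ 2) (by rw [hz]; exact Even.zero)
      (by rwa [mul_sq_mem_sqClass_iff]) hz
    rwa [← mul_assoc, mul_sq_mem_sqClass_iff] at this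
  have hx1 := (valuation_eq_one_iff v x.ne_zero).mpr hx0
  have hy1 := (valuation_eq_one_iff v y.ne_zero).mpr hy0
  obtain ⟨a, ha⟩ := exists_integer_sub_lt hx1.le
  obtain ⟨b, hb⟩ := exists_integer_sub_lt hy1.le
  let _ : Field (𝓞 k ⧸ v.asIdeal) := Ideal.Quotient.field _
  have : Finite (𝓞 k ⧸ v.asIdeal) := Ideal.finiteQuotientOfFreeOfNeBot _ v.ne_bot
  let _ := Fintype.ofFinite (𝓞 k ⧸ v.asIdeal)
  have key : ∀ {u : kˣ} {a : 𝓞 k}, v.valuation k (u : k) = 1 →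
      v.valuation k ((u : k) - algebraMap (𝓞 k) k a) < 1 →
      IsSquare (Ideal.Quotient.mk v.asIdeal a) → u ∈ sqClass v := by
    rintro u a hu ha ⟨s, hs⟩
    obtain ⟨s, rfl⟩ := Ideal.Quotient.mk_surjective s
    rw [← map_mul, Ideal.Quotient.eq, ← v.valuation_lt_one_iff_mem (K := k)] at hs
    replace hs : v.valuation k (algebraMap (𝓞 k) k (a - s * s)) < 1 := hs
    rw [map_sub, map_mul] at hs
    refine mem_sqClass_of_sub_sq_lt (c := algebraMap (𝓞 k) k s) hu ?_
    rw [h4]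
    have h5 := Valuation.map_add_lt _ ha hs
    rwa [show (u : k) - algebraMap (𝓞 k) k a + (algebraMap (𝓞 k) k a -
      algebraMap (𝓞 k) k s * algebraMap (𝓞 k) k s) = (u : k) - algebraMap (𝓞 k) k s ^ 2 by ring]
      at h5
  have ha' : quadraticChar (𝓞 k ⧸ v.asIdeal) (Ideal.Quotient.mk v.asIdeal a) = -1 :=
    quadraticChar_neg_one_iff_not_isSquare.mpr fun h => hx' (key hx1 ha h)
  have hb' : quadraticChar (𝓞 k ⧸ v.asIdeal) (Ideal.Quotient.mk v.asIdeal b) = -1 :=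
    quadraticChar_neg_one_iff_not_isSquare.mpr fun h => hy' (key hy1 hb h)
  have hab : quadraticChar (𝓞 k ⧸ v.asIdeal) (Ideal.Quotient.mk v.asIdeal (a * b)) = 1 := by
    rw [map_mul, map_mul, ha', hb']; rfl
  refine key (a := a * b) (by rw [Units.val_mul, map_mul, hx1, hy1, one_mul]) ?_ ?_
  · have h6 : ((x * y : kˣ) : k) - algebraMap (𝓞 k) k (a * b) =
      x * ((y : k) - algebraMap (𝓞 k) k b) + ((x : k) - algebraMap (𝓞 k) k a) *
        algebraMap (𝓞 k) k b := by
      rw [Units.val_mul, map_mul]; ring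
    rw [h6]
    refine Valuation.map_add_lt _ ?_ ?_
    · rwa [map_mul, hx1, one_mul]
    · rw [map_mul]
      exact mul_lt_one_of_nonneg_of_lt_one_left zero_le ha (v.valuation_le_one b)
  · refine (quadraticChar_one_iff_isSquare fun h => ?_).mp hab
    rw [h, quadraticChar_zero] at hab
    exact zero_ne_one hab

theorem index_sqClass_le_four {v : HeightOneSpectrum (𝓞 k)} (h2 : v.valuation k 2 = 1) :
    (sqClass v).index ≠ 0 ∧ (sqClass v).index ≤ 4 := by
  classical
  obtain ⟨π, hπ, h1⟩ := exists_ord_eq v 1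
  obtain ⟨j, hj0, hj⟩ : ∃ j : kˣ, Even (ord v (j : k)) ∧
      ∀ x : kˣ, Even (ord v (x : k)) → x ∈ sqClass v ∨ j * x ∈ sqClass v := by
    by_cases h : ∀ x : kˣ, Even (ord v (x : k)) → x ∈ sqClass v
    · exact ⟨1, by simp, fun x hx => Or.inl (h x hx)⟩
    · push Not at h
      obtain ⟨j, hj, hj'⟩ := h
      refine ⟨j, hj, fun x hx => ?_⟩
      by_cases hx' : x ∈ sqClass v
      · exact Or.inl hx'
      · exact Or.inr (mul_mem_sqClass h2 hj hx hj' hx')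
  let p := Units.mk0 π hπ
  have hp : ord v (p : k) = 1 := h1
  obtain ⟨h3, h4⟩ := index_le_card (H := sqClass v) ({1, j⁻¹, p, p * j⁻¹} : Finset kˣ) (by
    intro x
    rcases Int.even_or_odd (ord v (x : k)) with he | ho
    · rcases hj x he with h | h
      · exact ⟨1, by simp, by simpa using h⟩
      · exact ⟨j⁻¹, by simp, by simpa using h⟩
    · have : Even (ord v ((p⁻¹ * x : kˣ) : k)) := by
        rw [Units.val_mul, ord_mul v (Units.ne_zero _) (Units.ne_zero _),
          Units.val_inv_eq_inv_val, ord_inv, hp]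
        rw [add_comm]
        exact ho.sub_odd odd_one
      rcases hj _ this with h | h
      · exact ⟨p, by simp, h⟩
      · exact ⟨p * j⁻¹, by simp, by simpa [mul_assoc] using h⟩)
  exact ⟨h3, h4.trans Finset.card_le_four⟩

/-- The completion at `v` is an unramified extension of `ℚ₂` of degree one. -/
def DyadicSplit (v : HeightOneSpectrum (𝓞 k)) : Prop :=
  ∀ y : k, v.valuation k y ≤ 1 →
    v.valuation k y ≤ v.valuation k 2 ∨ v.valuation k (y - 1) ≤ v.valuation k 2

theorem DyadicSplit.ord_two {v : HeightOneSpectrum (𝓞 k)} (hd : DyadicSplit v)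
    (h2 : v.valuation k 2 < 1) : ord v (2 : k) = 1 := by
  have h0 := (valuation_lt_one_iff v (two_ne_zero (α := k))).mp h2
  obtain ⟨π, hπ, h1⟩ := exists_ord_eq v 1
  have h3 : v.valuation k π < 1 := (valuation_lt_one_iff v hπ).mpr (by omega)
  rcases hd π h3.le with h | h
  · rw [valuation_le_iff v hπ two_ne_zero] at h
    omega
  · have := valuation_eq_one_of_sub_lt (v := v) (map_one _) (h.trans_lt h2)
    exact absurd this h3.ne

theorem index_sqClass_le_eight {v : HeightOneSpectrum (𝓞 k)} (hd : DyadicSplit v)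
    (h2 : v.valuation k 2 < 1) : (sqClass v).index ≠ 0 ∧ (sqClass v).index ≤ 8 := by
  classical
  have ho := hd.ord_two h2
  have h20 : (2 : k) ≠ 0 := two_ne_zero
  have hv2 : v.valuation k (2 : k) ≠ 0 := valuation_ne_zero v h20
  have hstep : ∀ (n : ℕ) (x : k), v.valuation k x ≤ v.valuation k 2 ^ n →
      v.valuation k x ≤ v.valuation k 2 ^ (n + 1) ∨
      v.valuation k (x - 2 ^ n) ≤ v.valuation k 2 ^ (n + 1) := by
    intro n x hx
    have hn : v.valuation k (2 ^ n) ≠ 0 := valuation_ne_zero v (pow_ne_zero _ h20)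
    have e1 : x = x / 2 ^ n * 2 ^ n := by field_simp
    have e2 : x - 2 ^ n = (x / 2 ^ n - 1) * 2 ^ n := by field_simp
    have hle : v.valuation k (x / 2 ^ n) ≤ 1 := by
      rw [map_div₀, map_pow]
      exact div_le_one_of_le₀ hx zero_le
    rw [e2]
    conv_lhs => rw [e1]
    rw [map_mul, map_mul, map_pow, pow_succ']
    rcases hd _ hle with h | h
    · exact Or.inl (mul_le_mul_left h _)
    · exact Or.inr (mul_le_mul_left h _)
  have h1u : v.valuation k (1 : k) = 1 := map_one _
  have hunit : ∀ x : k, v.valuation k x = 1 → ∃ r ∈ ({1, 3, 5, 7} : Finset ℕ),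
      v.valuation k (x - r) ≤ v.valuation k 2 ^ 3 := by
    intro x hx
    have s0 : v.valuation k (x - 1) ≤ v.valuation k 2 ^ 1 := by
      rw [pow_one]
      rcases hd x hx.le with h | h
      · exact absurd hx (h.trans_lt h2).ne
      · exact h
    rcases hstep 1 _ s0 with s1 | s1 <;> rcases hstep 2 _ s1 with s2 | s2
    · exact ⟨1, by simp, by simpa using s2⟩
    · exact ⟨5, by simp, by convert s2 using 2; push_cast; ring⟩
    · exact ⟨3, by simp, by convert s2 using 2; push_cast; ring⟩
    · exact ⟨7, by simp, by convert s2 using 2; push_cast; ring⟩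
  have hr0 : ∀ r : ℕ, (r : k) ≠ 0 ↔ r ≠ 0 := fun r => Nat.cast_ne_zero
  let g : ℕ × ℕ → kˣ := fun p => Units.mk0 2 h20 ^ p.1 *
    if h : (p.2 : k) ≠ 0 then Units.mk0 (p.2 : k) h else 1
  obtain ⟨h3, h4⟩ := index_le_card (H := sqClass v)
    ((({0, 1} : Finset ℕ) ×ˢ ({1, 3, 5, 7} : Finset ℕ)).image g) (by
    intro x
    obtain ⟨i, hi, m, hm⟩ : ∃ i ∈ ({0, 1} : Finset ℕ), ∃ m : ℤ, ord v (x : k) = i + (m + m) := by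
      rcases Int.even_or_odd' (ord v (x : k)) with ⟨m, hm | hm⟩
      · exact ⟨0, by simp, m, by push_cast; omega⟩
      · exact ⟨1, by simp, m, by push_cast; omega⟩
    let t := Units.mk0 (2 : k) h20
    have ht : ord v (t : k) = 1 := ho
    have hy : ord v (((t ^ i)⁻¹ * x : kˣ) : k) = m + m := by
      rw [Units.val_mul, ord_mul v (Units.ne_zero _) (Units.ne_zero _),
        Units.val_inv_eq_inv_val, ord_inv, Units.val_pow_eq_pow_val, ord_pow, ht, hm]
      ring
    obtain ⟨z, hz⟩ := exists_mul_sq_ord_eq_zero ⟨m, hy⟩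
    obtain ⟨r, hr, hrx⟩ := hunit _ ((valuation_eq_one_iff v (Units.ne_zero _)).mpr hz)
    have hrne : (r : k) ≠ 0 := by
      rw [hr0]
      rintro rfl
      simp at hr
    refine ⟨g (i, r), Finset.mem_image_of_mem _ (Finset.mem_product.mpr ⟨hi, hr⟩), ?_⟩
    have hg : g (i, r) = t ^ i * Units.mk0 (r : k) hrne := by
      simp only [g]
      rw [dif_pos hrne]
    rw [hg, ← mul_sq_mem_sqClass_iff _ z]
    apply levelFour_le_sqClass
    have h8 : v.valuation k 2 ^ 3 < v.valuation k 4 := by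
      rw [show (4 : k) = 2 ^ 2 by norm_num, map_pow, ← map_pow, ← map_pow,
        valuation_lt_iff v (pow_ne_zero _ h20) (pow_ne_zero _ h20), ord_pow, ord_pow, ho]
      norm_num
    have hrv : v.valuation k (r : k) = 1 := by
      refine valuation_eq_one_of_sub_lt ((valuation_eq_one_iff v (Units.ne_zero _)).mpr hz) ?_
      rw [Valuation.map_sub_swap]
      exact hrx.trans_lt (h8.trans_le (valuation_four_le v))
    rw [mem_levelFour]
    have h9 : (((t ^ i * Units.mk0 (r : k) hrne)⁻¹ * x * z ^ 2 : kˣ) : k) - 1 =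
        (r : k)⁻¹ * (((t ^ i)⁻¹ * x * z ^ 2 : kˣ) - (r : k)) := by
      rw [mul_sub, inv_mul_cancel₀ hrne]
      simp only [mul_inv, Units.val_mul, Units.val_inv_eq_inv_val, Units.val_mk0]
      ring
    rw [h9, map_mul, map_inv₀, hrv, inv_one, one_mul]
    exact hrx.trans_lt h8)
  exact ⟨h3, h4.trans (Finset.card_image_le.trans (by simp))⟩

end PlaceTheory

namespace PlaceTheory

open NumberField IsDedekindDomain

variable {k : Type*} [Field k] [NumberField k] {K : Type*} [Field K] [NumberField K] [Algebra k K]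

theorem valuation_algebraMap_eq_one_iff (w : HeightOneSpectrum (𝓞 K)) (x : k) :
    w.valuation K (algebraMap k K x) = 1 ↔ (under k w).valuation k x = 1 := by
  rw [← valuation_pow_ram]
  exact pow_eq_one_iff_of_nonneg zero_le (ram_pos w).ne'

theorem valuation_algebraMap_lt_one_iff (w : HeightOneSpectrum (𝓞 K)) (x : k) :
    w.valuation K (algebraMap k K x) < 1 ↔ (under k w).valuation k x < 1 := by
  rw [← valuation_pow_ram]
  exact pow_lt_one_iff_of_nonneg zero_le (ram_pos w).ne'

theorem valuation_four_eq_one {v : HeightOneSpectrum (𝓞 k)} (h2 : v.valuation k 2 = 1) :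
    v.valuation k 4 = 1 := by
  rw [show (4 : k) = 2 * 2 by norm_num, map_mul, h2, one_mul]

theorem apply_sqrt_eq_neg (h2 : Module.finrank k K = 2) (σ : K ≃ₐ[k] K) (hσ : σ ≠ 1) {x : k}
    (hx : ¬ IsSquare x) {r : K} (hr : r ^ 2 = algebraMap k K x) : σ r = -r := by
  have h : σ r ^ 2 = r ^ 2 := by rw [← map_pow, hr, AlgEquiv.commutes]
  rcases sq_eq_sq_iff_eq_or_eq_neg.mp h with h | h
  · obtain ⟨c, rfl⟩ := mem_range_of_fixed h2 σ hσ h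
    rw [← map_pow] at hr
    exact absurd ⟨c, by rw [← (algebraMap k K).injective hr, sq]⟩ hx
  · exact h

theorem isSplit_of_mem_sqClass (h2 : Module.finrank k K = 2) (σ : K ≃ₐ[k] K) (hσ : σ ≠ 1) {x : kˣ}
    {r : K} (hr : r ^ 2 = algebraMap k K x) (hσr : σ r = -r) {v : HeightOneSpectrum (𝓞 k)}
    (hx : x ∈ sqClass v) : IsSplit K v := by
  obtain ⟨w, rfl⟩ := exists_under_eq (K := K) v
  by_contra hs
  obtain ⟨y, z, hz, rfl⟩ := mem_sqClass.mp hx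
  have hy : algebraMap k K (y : k) ≠ 0 := by simp
  let r' := r / algebraMap k K y
  have hr' : r' ^ 2 = algebraMap k K z := by
    simp only [r']
    rw [div_pow, hr, Units.val_mul, map_mul, Units.val_pow_eq_pow_val, map_pow,
      mul_div_cancel_left₀ _ (pow_ne_zero _ hy)]
  have hσr' : σ r' = -r' := by
    simp only [r']
    rw [map_div₀, hσr, AlgEquiv.commutes, neg_div]
  let β := (1 + r') / 2
  have hβ : σ β = (1 - r') / 2 := by
    simp only [β]
    rw [map_div₀, map_add, hσr', map_one, map_ofNat, sub_eq_add_neg]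
  have hz1 : (under k w).valuation k ((1 - z) / 4) < 1 := by
    rw [map_div₀, Valuation.map_sub_swap]
    exact (div_lt_one₀ (zero_lt_iff.mpr (valuation_ne_zero _ (by norm_num)))).mpr
      (mem_levelFour.mp hz)
  rw [← valuation_algebraMap_lt_one_iff] at hz1
  have h1 : algebraMap k K ((1 - z) / 4) = β * σ β := by
    rw [hβ, map_div₀, map_sub, ← hr', map_one, map_ofNat]
    simp only [β]
    ring
  rw [h1, map_mul, valuation_apply_of_not_isSplit h2 σ hσ hs, ← sq] at hz1
  have hlt := (pow_lt_one_iff_of_nonneg zero_le two_ne_zero).mp hz1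
  have := Valuation.map_add_lt _ hlt ((valuation_apply_of_not_isSplit h2 σ hσ hs β).trans_lt hlt)
  rw [hβ, show β + (1 - r') / 2 = 1 by simp only [β]; ring, map_one] at this
  exact lt_irrefl _ this

theorem ram_eq_one_of_even (h2 : Module.finrank k K = 2) (σ : K ≃ₐ[k] K) (hσ : σ ≠ 1) {x : kˣ}
    {r : K} (hr : r ^ 2 = algebraMap k K x) (hσr : σ r = -r) {w : HeightOneSpectrum (𝓞 K)}
    (hw : (under k w).valuation k 2 = 1) (hx : Even (ord (under k w) (x : k))) :
    ram k w = 1 := by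
  refine (ram_eq_one_or_two h2 w).resolve_right fun hram => ?_
  have hs := not_isSplit_of_ram h2 hram
  obtain ⟨y, hy⟩ := exists_mul_sq_ord_eq_zero hx
  rw [← valuation_eq_one_iff _ (Units.ne_zero _), ← valuation_algebraMap_eq_one_iff, Units.val_mul,
    map_mul, ← hr, Units.val_pow_eq_pow_val, map_pow, ← mul_pow, map_pow,
    pow_eq_one_iff_of_nonneg zero_le two_ne_zero] at hy
  obtain ⟨c, hc⟩ := exists_sub_lt_of_res_eq_one (res_eq_one_of_ram h2 hram) hy.le
  have hc' := valuation_apply_of_not_isSplit h2 σ hσ hs (r * algebraMap k K y - algebraMap k K c)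
  rw [map_sub, AlgEquiv.commutes, map_mul, AlgEquiv.commutes, hσr] at hc'
  have h := Valuation.map_sub_lt _ hc (hc'.trans_lt hc)
  rw [show r * algebraMap k K y - algebraMap k K c - (-r * algebraMap k K y - algebraMap k K c) =
    algebraMap k K 2 * (r * algebraMap k K y) by rw [map_ofNat]; ring, map_mul, hy, mul_one,
    (valuation_algebraMap_eq_one_iff w 2).mpr hw] at h
  exact lt_irrefl _ h

theorem ram_eq_two_of_odd (h2 : Module.finrank k K = 2) {x : k}
    {r : K} (hr : r ^ 2 = algebraMap k K x) {w : HeightOneSpectrum (𝓞 K)}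
    (hx : Odd (ord (under k w) x)) : ram k w = 2 := by
  refine (ram_eq_one_or_two h2 w).resolve_left fun hram => ?_
  have h := ord_algebraMap w x
  rw [← hr, ord_pow, hram, Nat.cast_one, one_mul] at h
  rw [← h] at hx
  exact Int.not_even_iff_odd.mpr hx (even_two_mul _)

theorem even_ord_norm (h2 : Module.finrank k K = 2) (σ : K ≃ₐ[k] K) (hσ : σ ≠ 1)
    {w : HeightOneSpectrum (𝓞 K)} (hs : ¬ IsSplit K (under k w)) (hram : ram k w = 1) (y : Kˣ) :
    Even (ord (under k w) (Algebra.norm k (y : K))) := by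
  have h := ord_algebraMap w (Algebra.norm k (y : K))
  rw [algebraMap_norm h2 σ hσ, ord_mul _ y.ne_zero (by simp), ord_apply_of_not_isSplit h2 σ hσ hs,
    hram, Nat.cast_one, one_mul] at h
  exact ⟨_, h.symm⟩

theorem mem_sqClass_of_mem_norm (h2 : Module.finrank k K = 2) (σ : K ≃ₐ[k] K) (hσ : σ ≠ 1)
    {w : HeightOneSpectrum (𝓞 K)} (hram : ram k w = 2) (hw : (under k w).valuation k 2 = 1)
    {u : kˣ} (hu : ord (under k w) (u : k) = 0)
    (hN : u ∈ (Units.map (Algebra.norm k : K →* k)).range ⊔ levelFour (under k w)) :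
    u ∈ sqClass (under k w) := by
  have h4 := valuation_four_eq_one hw
  have hs := not_isSplit_of_ram h2 hram
  obtain ⟨_, ⟨y, rfl⟩, z, hz, rfl⟩ := Subgroup.mem_sup.mp hN
  have hz1 := valuation_eq_one_of_mem_levelFour hz
  rw [← valuation_eq_one_iff _ (Units.ne_zero _), Units.val_mul, map_mul, hz1, mul_one,
    Units.coe_map] at hu
  refine Subgroup.mul_mem _ ?_ (levelFour_le_sqClass _ hz)
  have hy : w.valuation K (y : K) = 1 := by
    rw [← valuation_algebraMap_eq_one_iff, algebraMap_norm h2 σ hσ, map_mul,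
      valuation_apply_of_not_isSplit h2 σ hσ hs, ← sq,
      pow_eq_one_iff_of_nonneg zero_le two_ne_zero] at hu
    exact hu
  obtain ⟨c, hc⟩ := exists_sub_lt_of_res_eq_one (res_eq_one_of_ram h2 hram) hy.le
  refine mem_sqClass_of_sub_sq_lt (c := c) hu ?_
  rw [h4, ← valuation_algebraMap_lt_one_iff, Units.coe_map, map_sub,
    algebraMap_norm h2 σ hσ, map_pow]
  have hc' := valuation_apply_of_not_isSplit h2 σ hσ hs ((y : K) - algebraMap k K c)
  rw [map_sub, AlgEquiv.commutes] at hc'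
  have hc'' := hc'.trans_lt hc
  have hcv : w.valuation K (algebraMap k K c) ≤ 1 :=
    (valuation_eq_one_of_sub_lt hy (by rwa [Valuation.map_sub_swap])).le
  rw [show (y : K) * σ y - algebraMap k K c ^ 2 = y * (σ y - algebraMap k K c) +
    (y - algebraMap k K c) * algebraMap k K c by ring]
  refine Valuation.map_add_lt _ ?_ ?_
  · rwa [map_mul, hy, one_mul]
  · rw [map_mul]
    exact mul_lt_one_of_nonneg_of_lt_one_left zero_le hc hcv

theorem sqClass_le_sup_norm (h2 : Module.finrank k K = 2) (v : HeightOneSpectrum (𝓞 k)) :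
    sqClass v ≤ (Units.map (Algebra.norm k : K →* k)).range ⊔ levelFour v := by
  refine sup_le_sup_right ?_ _
  rintro _ ⟨y, rfl⟩
  refine ⟨Units.map (algebraMap k K) y, Units.ext ?_⟩
  simp [Algebra.norm_algebraMap, h2]

end PlaceTheory

namespace PlaceTheory

open NumberField IsDedekindDomain Filter Topology

variable {k : Type*} [Field k] [NumberField k]

/-- The norm of an effective divisor. -/
noncomputable def divNorm (e : HeightOneSpectrum (𝓞 k) →₀ ℕ) : ℕ :=
  e.prod fun v n => Ideal.absNorm v.asIdeal ^ n

/-- The ideal of an effective divisor. -/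
noncomputable def divIdeal (e : HeightOneSpectrum (𝓞 k) →₀ ℕ) : Ideal (𝓞 k) :=
  e.prod fun v n => v.asIdeal ^ n

theorem absNorm_divIdeal (e : HeightOneSpectrum (𝓞 k) →₀ ℕ) :
    Ideal.absNorm (divIdeal e) = divNorm e := by
  rw [divIdeal, divNorm, map_finsuppProd]
  simp only [map_pow]

theorem divNorm_add (e f : HeightOneSpectrum (𝓞 k) →₀ ℕ) :
    divNorm (e + f) = divNorm e * divNorm f :=
  Finsupp.prod_add_index' (fun _ => pow_zero _) fun _ _ _ => pow_add _ _ _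

theorem divNorm_single (v : HeightOneSpectrum (𝓞 k)) (n : ℕ) :
    divNorm (Finsupp.single v n) = Ideal.absNorm v.asIdeal ^ n :=
  Finsupp.prod_single_index (pow_zero _)

theorem divIdeal_injective : Function.Injective (divIdeal (k := k)) := by
  intro e f h
  have key : ∀ e : HeightOneSpectrum (𝓞 k) →₀ ℕ,
      ((divIdeal e : Ideal (𝓞 k)) : FractionalIdeal (nonZeroDivisors (𝓞 k)) k) =
        (e.mapRange (fun n : ℕ => (n : ℤ)) rfl).prod fun v n =>
          (v.asIdeal : FractionalIdeal (nonZeroDivisors (𝓞 k)) k) ^ n := by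
    intro e
    rw [Finsupp.prod_mapRange_index (fun _ => zpow_zero _), divIdeal, Finsupp.prod, Finsupp.prod]
    have := map_prod (FractionalIdeal.coeIdealHom (nonZeroDivisors (𝓞 k)) k)
      (fun v => v.asIdeal ^ e v) e.support
    exact this.trans (Finset.prod_congr rfl fun v _ => by
      rw [map_pow, zpow_natCast]; rfl)
  ext v
  have h1 := FractionalIdeal.count_finsuppProd k v (e.mapRange (fun n : ℕ => (n : ℤ)) rfl)
  have h2 := FractionalIdeal.count_finsuppProd k v (f.mapRange (fun n : ℕ => (n : ℤ)) rfl)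
  rw [← key, h, key, h2] at h1
  simpa using h1.symm

theorem exists_divIdeal_eq {I : Ideal (𝓞 k)} (hI : I ≠ ⊥) : ∃ e, divIdeal e = I := by
  induction I using UniqueFactorizationMonoid.induction_on_prime with
  | h₁ => exact absurd rfl hI
  | h₂ I hu =>
    exact ⟨0, by rw [divIdeal, Finsupp.prod_zero_index, Ideal.isUnit_iff.mp hu, Ideal.one_eq_top]⟩
  | h₃ I p hI0 hp ih =>
    obtain ⟨e, rfl⟩ := ih hI0
    let v : HeightOneSpectrum (𝓞 k) := ⟨p, Ideal.isPrime_of_prime hp, hp.ne_zero⟩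
    refine ⟨Finsupp.single v 1 + e, ?_⟩
    rw [divIdeal, Finsupp.prod_add_index' (fun _ => pow_zero _) fun _ _ _ => pow_add _ _ _,
      Finsupp.prod_single_index (h := fun (v : HeightOneSpectrum (𝓞 k)) n => v.asIdeal ^ n) (pow_zero _), pow_one]
    rfl

theorem divNorm_pos (e : HeightOneSpectrum (𝓞 k) →₀ ℕ) : 0 < divNorm e :=
  Finset.prod_pos fun v _ => pow_pos (Nat.pos_of_ne_zero fun h =>
    v.ne_bot (Ideal.absNorm_eq_zero_iff.mp h)) _

theorem two_le_absNorm (v : HeightOneSpectrum (𝓞 k)) : 2 ≤ Ideal.absNorm v.asIdeal := by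
  have h0 : Ideal.absNorm v.asIdeal ≠ 0 := fun h => v.ne_bot (Ideal.absNorm_eq_zero_iff.mp h)
  have h1 : Ideal.absNorm v.asIdeal ≠ 1 := fun h => v.isPrime.ne_top (Ideal.absNorm_eq_one_iff.mp h)
  omega

/-- The weight `N(e) ^ (-s)` of an effective divisor. -/
noncomputable def divWeight (s : ℝ) (e : HeightOneSpectrum (𝓞 k) →₀ ℕ) : ENNReal :=
  ENNReal.ofReal ((divNorm e : ℝ) ^ (-s))

theorem divWeight_add (s : ℝ) (e f : HeightOneSpectrum (𝓞 k) →₀ ℕ) :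
    divWeight s (e + f) = divWeight s e * divWeight s f := by
  rw [divWeight, divNorm_add, Nat.cast_mul, Real.mul_rpow (Nat.cast_nonneg _) (Nat.cast_nonneg _),
    ENNReal.ofReal_mul (by positivity)]
  rfl

theorem divWeight_single_le {s : ℝ} (hs : 1 ≤ s) (v : HeightOneSpectrum (𝓞 k)) :
    divWeight s (Finsupp.single v 1) ≤ 2⁻¹ := by
  rw [divWeight, divNorm_single, pow_one, show (2⁻¹ : ENNReal) = ENNReal.ofReal 2⁻¹ by
    rw [ENNReal.ofReal_inv_of_pos two_pos, ENNReal.ofReal_ofNat]]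
  refine ENNReal.ofReal_le_ofReal ?_
  have h : (2 : ℝ) ≤ Ideal.absNorm v.asIdeal := by exact_mod_cast two_le_absNorm v
  rw [Real.rpow_neg (by positivity)]
  refine inv_anti₀ two_pos (h.trans ?_)
  exact Real.self_le_rpow_of_one_le (by linarith) hs

variable (k) in
/-- The zeta function of `k` without the Euler factors at `S`, for real exponents. -/
noncomputable def zetaAway (S : Finset (HeightOneSpectrum (𝓞 k))) (s : ℝ) : ENNReal :=
  ∑' e : {e : HeightOneSpectrum (𝓞 k) →₀ ℕ // ∀ v ∈ S, e v = 0}, divWeight s e.1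

theorem zetaAway_le_zetaAway_empty (S : Finset (HeightOneSpectrum (𝓞 k))) (s : ℝ) :
    zetaAway k S s ≤ zetaAway k ∅ s :=
  ENNReal.tsum_comp_le_tsum_of_injective
    (f := fun e : {e : HeightOneSpectrum (𝓞 k) →₀ ℕ // ∀ v ∈ S, e v = 0} =>
      (⟨e.1, by simp⟩ : {e : HeightOneSpectrum (𝓞 k) →₀ ℕ // ∀ v ∈ (∅ : Finset _), e v = 0}))
    (fun a b h => Subtype.ext (congrArg Subtype.val h :)) (fun e => divWeight s e.1)

theorem zetaAway_le [DecidableEq (HeightOneSpectrum (𝓞 k))]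
    (S : Finset (HeightOneSpectrum (𝓞 k))) {s : ℝ} (hs : 1 ≤ s)
    (v : HeightOneSpectrum (𝓞 k)) (hv : v ∉ S) (hfin : zetaAway k S s ≠ ⊤) :
    zetaAway k S s ≤ 2 * zetaAway k (insert v S) s := by
  let D := {e : HeightOneSpectrum (𝓞 k) →₀ ℕ // ∀ v ∈ S, e v = 0}
  let E := {e : HeightOneSpectrum (𝓞 k) →₀ ℕ // ∀ w ∈ insert v S, e w = 0}
  have hsplit : zetaAway k S s ≤ zetaAway k (insert v S) s + 2⁻¹ * zetaAway k S s := by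
    let g : E ⊕ D → D := Sum.elim (fun e => ⟨e.1, fun w hw => e.2 w (Finset.mem_insert_of_mem hw)⟩)
      fun e => ⟨e.1 + Finsupp.single v 1, fun w hw => by
        have : w ≠ v := fun h => hv (h ▸ hw)
        rw [Finsupp.add_apply, e.2 w hw, Finsupp.single_eq_of_ne this, add_zero]⟩
    have hg : Function.Surjective g := by
      rintro ⟨e, he⟩
      by_cases h : e v = 0
      · refine ⟨Sum.inl ⟨e, fun w hw => ?_⟩, rfl⟩
        rcases Finset.mem_insert.mp hw with rfl | hw
        · exact h
        · exact he w hw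
      · refine ⟨Sum.inr ⟨e - Finsupp.single v 1, fun w hw => ?_⟩, Subtype.ext ?_⟩
        · rw [Finsupp.tsub_apply, he w hw, Nat.zero_sub]
        · exact tsub_add_cancel_of_le (Finsupp.single_le_iff.mpr (by omega))
    have h1 : zetaAway k S s ≤ ∑' x : E ⊕ D, divWeight s (g x).1 :=
      ENNReal.tsum_le_tsum_comp_of_surjective hg fun e : D => divWeight s e.1
    refine h1.trans ?_
    rw [ENNReal.summable.tsum_sum ENNReal.summable]
    refine add_le_add le_rfl ?_
    rw [zetaAway, ← ENNReal.tsum_mul_left]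
    refine ENNReal.tsum_le_tsum fun e => ?_
    change divWeight s (e.1 + Finsupp.single v 1) ≤ _
    rw [divWeight_add, mul_comm]
    exact mul_le_mul_left (divWeight_single_le hs v) _
  generalize zetaAway k S s = a at *
  generalize zetaAway k (insert v S) s = b at *
  by_cases hb : b = ⊤
  · rw [hb, ENNReal.mul_top two_ne_zero]; exact le_top
  lift a to NNReal using hfin
  lift b to NNReal using hb
  have h2 : (2⁻¹ : ENNReal) = ((2⁻¹ : NNReal) : ENNReal) := by simp
  rw [h2] at hsplit
  norm_cast at hsplit ⊢
  have : (a : ℝ) ≤ b + 2⁻¹ * a := by exact_mod_cast hsplit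
  have : (a : ℝ) ≤ 2 * b := by linarith
  exact_mod_cast this

theorem zetaAway_empty_le (S : Finset (HeightOneSpectrum (𝓞 k))) {s : ℝ} (hs : 1 ≤ s)
    (hfin : zetaAway k ∅ s ≠ ⊤) : zetaAway k ∅ s ≤ 2 ^ S.card * zetaAway k S s := by
  classical
  induction S using Finset.induction_on with
  | empty => simp
  | insert v S hv ih =>
    refine ih.trans ?_
    rw [Finset.card_insert_of_notMem hv, pow_succ, mul_assoc]
    exact mul_le_mul_right (zetaAway_le S hs v hv
      (ne_top_of_le_ne_top hfin (zetaAway_le_zetaAway_empty S s))) _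

variable (k) in
/-- The Dirichlet series of ideal norms at a real exponent. -/
noncomputable def zetaReal (s : ℝ) : ℝ :=
  ∑' n : ℕ, (Nat.card {I : Ideal (𝓞 k) // Ideal.absNorm I = n} : ℝ) * (n : ℝ) ^ (-s)

theorem dedekindZeta_eq_zetaReal {s : ℝ} (hs : 1 < s) : dedekindZeta k s = zetaReal k s := by
  rw [dedekindZeta, LSeries, zetaReal, Complex.ofReal_tsum]
  refine tsum_congr fun n => ?_
  rcases eq_or_ne n 0 with rfl | hn
  · rw [LSeries.term_zero, Nat.cast_zero, Real.zero_rpow (by linarith), mul_zero, Complex.ofReal_zero]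
  · rw [LSeries.term_of_ne_zero hn, Complex.ofReal_mul, Complex.ofReal_natCast,
      Complex.ofReal_cpow (Nat.cast_nonneg _), Complex.ofReal_natCast, Complex.ofReal_neg,
      Complex.cpow_neg, div_eq_mul_inv]

theorem tendsto_zetaReal :
    Tendsto (fun s : ℝ => (s - 1) * zetaReal k s) (𝓝[>] 1) (𝓝 (dedekindZeta_residue k)) := by
  have h := tendsto_sub_one_mul_dedekindZeta_nhdsGT k
  have h2 := (Complex.continuous_re.tendsto _).comp h
  refine h2.congr' ?_
  filter_upwards [self_mem_nhdsWithin] with s hs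
  rw [Function.comp_apply, dedekindZeta_eq_zetaReal hs, ← Complex.ofReal_one, ← Complex.ofReal_sub,
    ← Complex.ofReal_mul, Complex.ofReal_re]

theorem eventually_zetaReal_pos : ∀ᶠ s in 𝓝[>] (1 : ℝ), 0 < zetaReal k s := by
  filter_upwards [tendsto_zetaReal.eventually (lt_mem_nhds (dedekindZeta_residue_pos k)),
    self_mem_nhdsWithin] with s hs h1
  exact pos_of_mul_pos_right hs (sub_nonneg.mpr (le_of_lt h1))

theorem zetaAway_empty_eq {s : ℝ} (hs : 1 < s) (hpos : 0 < zetaReal k s) :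
    zetaAway k ∅ s = ENNReal.ofReal (zetaReal k s) := by
  have hsum : Summable fun n : ℕ =>
      (Nat.card {I : Ideal (𝓞 k) // Ideal.absNorm I = n} : ℝ) * (n : ℝ) ^ (-s) := by
    by_contra h
    exact hpos.ne' (tsum_eq_zero_of_not_summable h)
  rw [zetaReal, ENNReal.ofReal_tsum_of_nonneg (fun n => by positivity) hsum]
  have h1 : zetaAway k ∅ s = ∑' e : HeightOneSpectrum (𝓞 k) →₀ ℕ, divWeight s e :=
    (Equiv.subtypeUnivEquiv (by simp)).tsum_eq (divWeight s)
  rw [h1, ← (Equiv.sigmaFiberEquiv (divNorm (k := k))).tsum_eq, ENNReal.tsum_sigma']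
  refine tsum_congr fun n => ?_
  rcases eq_or_ne n 0 with rfl | hn
  · have : IsEmpty {e : HeightOneSpectrum (𝓞 k) →₀ ℕ // divNorm e = 0} :=
      ⟨fun e => (divNorm_pos e.1).ne' e.2⟩
    rw [tsum_empty, Nat.cast_zero, Real.zero_rpow (by linarith), mul_zero, ENNReal.ofReal_zero]
  · have e1 : {e : HeightOneSpectrum (𝓞 k) →₀ ℕ // divNorm e = n} ≃
        {I : Ideal (𝓞 k) // Ideal.absNorm I = n} :=
      Equiv.ofBijective (fun e => ⟨divIdeal e.1, by rw [absNorm_divIdeal, e.2]⟩)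
        ⟨fun a b h => Subtype.ext (divIdeal_injective (congrArg Subtype.val h :)), fun I => by
          have hI : I.1 ≠ ⊥ := fun h => hn (by rw [← I.2, h, Ideal.absNorm_bot])
          obtain ⟨e, he⟩ := exists_divIdeal_eq hI
          exact ⟨⟨e, by rw [← absNorm_divIdeal, he, I.2]⟩, Subtype.ext he⟩⟩
    have : Finite {I : Ideal (𝓞 k) // Ideal.absNorm I = n} := Ideal.finite_setOfPred_absNorm_eq n
    have : Finite {e : HeightOneSpectrum (𝓞 k) →₀ ℕ // divNorm e = n} := Finite.of_equiv _ e1.symm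
    have h2 : ∀ c : {e : HeightOneSpectrum (𝓞 k) →₀ ℕ // divNorm e = n},
        divWeight s (Equiv.sigmaFiberEquiv (divNorm (k := k)) ⟨n, c⟩) =
          ENNReal.ofReal ((n : ℝ) ^ (-s)) := by
      intro c
      change divWeight s c.1 = _
      rw [divWeight, c.2]
    rw [tsum_congr h2, ENNReal.tsum_const, ← Nat.card_congr e1,
      ENNReal.ofReal_mul (Nat.cast_nonneg _), ENNReal.ofReal_natCast, ENat.card_eq_coe_natCard]
    rfl

end PlaceTheory

namespace PlaceTheory

open NumberField IsDedekindDomain Filter Topology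

variable {k : Type*} [Field k] [NumberField k] {K : Type*} [Field K] [NumberField K] [Algebra k K]

theorem absNorm_eq_of_res_eq_one {w : HeightOneSpectrum (𝓞 K)} (h : res k w = 1) :
    Ideal.absNorm w.asIdeal = Ideal.absNorm (under k w).asIdeal := by
  rw [res, Ideal.inertiaDeg_eq_of_isMaximal (under k w).asIdeal] at h
  let _ : Field (𝓞 k ⧸ (under k w).asIdeal) := Ideal.Quotient.field _
  have hs := Module.Free.bijective_algebraMap_of_finrank_eq_one h
  rw [Ideal.absNorm_apply, Ideal.absNorm_apply, Submodule.cardQuot_apply, Submodule.cardQuot_apply]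
  exact (Nat.card_congr (Equiv.ofBijective _ hs)).symm

theorem zetaAway_sq_le (h2 : Module.finrank k K = 2) {S : Finset (HeightOneSpectrum (𝓞 k))}
    (hS : ∀ v ∉ S, IsSplit K v) (s : ℝ) :
    zetaAway k S s ^ 2 ≤ zetaAway K ∅ s := by
  classical
  have hex : ∀ v : HeightOneSpectrum (𝓞 k), ∃ w w' : HeightOneSpectrum (𝓞 K),
      under k w = v ∧ under k w' = v ∧ (v ∉ S → w ≠ w') := by
    intro v
    by_cases hv : v ∈ S
    · obtain ⟨w, hw⟩ := exists_under_eq (K := K) v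
      exact ⟨w, w, hw, hw, fun h => absurd hv h⟩
    · obtain ⟨w, w', h, hw, hw'⟩ := hS v hv
      exact ⟨w, w', hw, hw', fun _ => h⟩
  choose f g hf hg hfg using hex
  have hfi : Function.Injective f := fun a b h => by rw [← hf a, h, hf b]
  have hgi : Function.Injective g := fun a b h => by rw [← hg a, h, hg b]
  let D := {e : HeightOneSpectrum (𝓞 k) →₀ ℕ // ∀ v ∈ S, e v = 0}
  have hnorm : ∀ (h : HeightOneSpectrum (𝓞 k) → HeightOneSpectrum (𝓞 K)) (e : D),
      (∀ v ∉ S, Ideal.absNorm (h v).asIdeal = Ideal.absNorm v.asIdeal) →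
      divNorm (e.1.mapDomain h) = divNorm e.1 := by
    intro h e hh
    rw [divNorm, Finsupp.prod_mapDomain_index (fun _ => pow_zero _) fun _ _ _ => pow_add _ _ _,
      divNorm]
    refine Finsupp.prod_congr fun v hv => ?_
    rw [hh v fun hvS => Finsupp.mem_support_iff.mp hv (e.2 v hvS)]
  have hres : ∀ v ∉ S, res k (f v) = 1 ∧ res k (g v) = 1 := fun v hv =>
    ⟨(ram_res_eq_one_of_ne h2 (hfg v hv) ((hf v).trans (hg v).symm)).2,
      (ram_res_eq_one_of_ne h2 (hfg v hv).symm ((hg v).trans (hf v).symm)).2⟩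
  have hfn : ∀ v ∉ S, Ideal.absNorm (f v).asIdeal = Ideal.absNorm v.asIdeal := fun v hv => by
    rw [absNorm_eq_of_res_eq_one (k := k) (hres v hv).1, hf]
  have hgn : ∀ v ∉ S, Ideal.absNorm (g v).asIdeal = Ideal.absNorm v.asIdeal := fun v hv => by
    rw [absNorm_eq_of_res_eq_one (k := k) (hres v hv).2, hg]
  let F : D × D → {e : HeightOneSpectrum (𝓞 K) →₀ ℕ // ∀ v ∈ (∅ : Finset _), e v = 0} :=
    fun p => ⟨p.1.1.mapDomain f + p.2.1.mapDomain g, by simp⟩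
  have hval : ∀ (a b : D) (v), v ∉ S → (a.1.mapDomain f + b.1.mapDomain g) (f v) = a.1 v ∧
      (a.1.mapDomain f + b.1.mapDomain g) (g v) = b.1 v := by
    intro a b v hv
    rw [Finsupp.add_apply, Finsupp.add_apply, Finsupp.mapDomain_apply hfi,
      Finsupp.mapDomain_apply hgi, Finsupp.mapDomain_of_notMem_range,
      Finsupp.mapDomain_of_notMem_range, add_zero, zero_add]
    · exact ⟨rfl, rfl⟩
    · rintro ⟨u, hu⟩
      have : u = v := by rw [← hf u, hu, hg]
      exact hfg v hv (this ▸ hu)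
    · rintro ⟨u, hu⟩
      have : u = v := by rw [← hg u, hu, hf]
      exact hfg v hv (this ▸ hu).symm
  have hF : Function.Injective F := by
    rintro ⟨a, b⟩ ⟨a', b'⟩ h
    have h' := congrArg Subtype.val h
    change a.1.mapDomain f + b.1.mapDomain g = a'.1.mapDomain f + b'.1.mapDomain g at h'
    refine Prod.ext (Subtype.ext (Finsupp.ext fun v => ?_))
      (Subtype.ext (Finsupp.ext fun v => ?_))
    · by_cases hv : v ∈ S
      · exact (a.2 v hv).trans (a'.2 v hv).symm
      · change a.1 v = a'.1 v
        rw [← (hval a b v hv).1, h', (hval a' b' v hv).1]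
    · by_cases hv : v ∈ S
      · exact (b.2 v hv).trans (b'.2 v hv).symm
      · change b.1 v = b'.1 v
        rw [← (hval a b v hv).2, h', (hval a' b' v hv).2]
  have h1 := ENNReal.tsum_comp_le_tsum_of_injective hF fun e => divWeight s e.1
  refine le_trans (le_of_eq ?_) h1
  rw [ENNReal.tsum_prod', sq, zetaAway, ← ENNReal.tsum_mul_right]
  refine tsum_congr fun a => ?_
  rw [← ENNReal.tsum_mul_left]
  refine tsum_congr fun b => ?_
  change _ = divWeight s (a.1.mapDomain f + b.1.mapDomain g)
  rw [divWeight_add, divWeight, divWeight, divWeight, divWeight, hnorm f a hfn, hnorm g b hgn]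

/-- Infinitely many places do not split in a quadratic extension. -/
theorem exists_not_isSplit (h2 : Module.finrank k K = 2) (S : Finset (HeightOneSpectrum (𝓞 k))) :
    ∃ v ∉ S, ¬ IsSplit K v := by
  by_contra! hS
  have hle : ∀ᶠ s in 𝓝[>] (1 : ℝ), zetaReal k s ^ 2 ≤ (2 ^ S.card) ^ 2 * zetaReal K s := by
    filter_upwards [eventually_zetaReal_pos (k := k), eventually_zetaReal_pos (k := K),
      self_mem_nhdsWithin] with s hk hK hs
    have hs' : (1 : ℝ) < s := hs
    have e1 := zetaAway_empty_eq hs' hk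
    have e2 := zetaAway_empty_eq hs' hK
    have h3 := zetaAway_empty_le S hs'.le (by rw [e1]; exact ENNReal.ofReal_ne_top)
    have h4 := zetaAway_sq_le h2 hS s
    have h5 : ENNReal.ofReal (zetaReal k s ^ 2) ≤
        ENNReal.ofReal ((2 ^ S.card) ^ 2 * zetaReal K s) := by
      rw [ENNReal.ofReal_pow hk.le, ← e1, ENNReal.ofReal_mul (by positivity), ← e2,
        ENNReal.ofReal_pow (by positivity), ENNReal.ofReal_pow two_pos.le, ENNReal.ofReal_ofNat]
      calc zetaAway k ∅ s ^ 2 ≤ (2 ^ S.card * zetaAway k S s) ^ 2 := by gcongr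
        _ = (2 ^ S.card) ^ 2 * zetaAway k S s ^ 2 := mul_pow _ _ _
        _ ≤ _ := by gcongr
    exact (ENNReal.ofReal_le_ofReal_iff (by positivity)).mp h5
  have hk := (tendsto_zetaReal (k := k)).pow 2
  have hs0 : Tendsto (fun s : ℝ => s - 1) (𝓝[>] 1) (𝓝 0) := by
    have : Tendsto (fun s : ℝ => s - 1) (𝓝 1) (𝓝 (1 - 1)) :=
      (continuous_id.sub continuous_const).tendsto 1
    rw [sub_self] at this
    exact this.mono_left nhdsWithin_le_nhds
  have hK := ((hs0.mul (tendsto_zetaReal (k := K))).const_mul (((2 : ℝ) ^ S.card) ^ 2))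
  rw [zero_mul, mul_zero] at hK
  have := le_of_tendsto_of_tendsto hk hK (by
    filter_upwards [hle] with s hs
    rw [mul_pow]
    calc (s - 1) ^ 2 * zetaReal k s ^ 2 ≤ (s - 1) ^ 2 * ((2 ^ S.card) ^ 2 * zetaReal K s) := by
          gcongr
      _ = _ := by ring)
  exact absurd (pow_pos (dedekindZeta_residue_pos k) 2) (not_lt.mpr this)

theorem finite_valuation_ne_one {x : k} (hx : x ≠ 0) :
    {v : HeightOneSpectrum (𝓞 k) | v.valuation k x ≠ 1}.Finite := by
  refine (finite_ord_ne_zero hx).subset fun v hv h => hv ?_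
  exact (valuation_eq_one_iff v hx).mpr h

/-- A nonsquare is not a local square at some place away from any finite set. -/
theorem exists_notMem_sqClass {x : kˣ} (hx : ¬ IsSquare (x : k))
    (S : Finset (HeightOneSpectrum (𝓞 k))) :
    ∃ v ∉ S, v.valuation k 2 = 1 ∧ ord v (x : k) = 0 ∧ x ∉ sqClass v := by
  classical
  obtain ⟨M, _, _, _, r, h2, hr⟩ := exists_quadratic hx
  obtain ⟨σ, hσ⟩ := exists_ne_one_of_finrank_two h2
  obtain ⟨v, hv, hsp⟩ := exists_not_isSplit h2 (S ∪ (finite_ord_ne_zero x.ne_zero).toFinset ∪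
    (finite_valuation_ne_one (two_ne_zero (α := k))).toFinset)
  simp only [Finset.mem_union, Set.Finite.mem_toFinset, Set.mem_ofPred_eq, not_or, not_not] at hv
  exact ⟨v, hv.1.1, hv.2, hv.1.2, fun h =>
    hsp (isSplit_of_mem_sqClass h2 σ hσ hr (apply_sqrt_eq_neg h2 σ hσ hx hr) h)⟩

end PlaceTheory

namespace SignCharacters

variable {A : Type*} [CommGroup A]

/-- If the image of `B` in a product of finite quotients has index at most two, then sign
characters of distinct factors generate all sign relations among classes of `B` modulo `N`. -/
theorem mem_of_sign_characters_eq_one {B N : Subgroup A} (hNB : N ≤ B) {J : Type*} [Fintype J]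
    (Q : J → Subgroup A) (hQ0 : ∀ j, (Q j).index ≠ 0) {m : ℕ}
    (hQ : ∏ j, (Q j).index ≤ 2 ^ (m + 1)) (hB : 2 ^ m ≤ (⨅ j, Q j).relIndex B)
    (R : Finset J) (θ : R → A →* ℤˣ) (hθQ : ∀ j : R, ∀ x ∈ Q j, θ j x = 1)
    (hθ : ∀ j, ∃ u, θ j u = -1) (hθN : ∀ j, ∀ x ∈ N, θ j x = 1)
    (hN : N.relIndex B * 2 = 2 ^ R.card) {b : A} (hb : b ∈ B) (hθb : ∀ j, θ j b = 1) : b ∈ N := by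
  let Φ : A →* ∀ j, A ⧸ Q j := MonoidHom.mk' (fun x j => (x : A ⧸ Q j)) fun x y => rfl
  have hΦ : Φ.ker = ⨅ j, Q j := by
    ext x
    rw [MonoidHom.mem_ker, Subgroup.mem_iInf, funext_iff]
    exact forall_congr' fun j => QuotientGroup.eq_one_iff x
  let Θ : (∀ j, A ⧸ Q j) →* (R → ℤˣ) :=
    MonoidHom.mk' (fun x r => QuotientGroup.lift (Q r) (θ r) (hθQ r) (x r)) fun x y => by
      funext r
      simp only [Pi.mul_apply, map_mul]
  have hfin : ∀ j, Finite (A ⧸ Q j) := fun j =>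
    Nat.finite_of_card_ne_zero (hQ0 j)
  have hΘ : Function.Surjective Θ := by
    classical
    intro ε
    have : ∀ r : R, ∃ x, θ r x = ε r := by
      intro r
      rcases Int.units_eq_one_or (ε r) with h | h
      · exact ⟨1, by rw [map_one, h]⟩
      · obtain ⟨u, hu⟩ := hθ r
        exact ⟨u, by rw [hu, h]⟩
    choose x hx using this
    refine ⟨fun j => if h : j ∈ R then (x ⟨j, h⟩ : A ⧸ Q j) else 1, ?_⟩
    funext r
    change QuotientGroup.lift (Q r) (θ r) (hθQ r) (if h : (r : J) ∈ R then _ else _) = _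
    rw [dif_pos r.2]
    exact hx r
  have hcardP : Nat.card (∀ j, A ⧸ Q j) = ∏ j, (Q j).index := Nat.card_pi
  have h1 : Nat.card (B.map Φ) * (B.map Φ).index = ∏ j, (Q j).index := by
    rw [Subgroup.card_mul_index, hcardP]
  have h2 : Nat.card (B.map Φ) = (⨅ j, Q j).relIndex B := by
    rw [← hΦ, Subgroup.relIndex_ker]
  have hi0 : (B.map Φ).index ≠ 0 := Subgroup.index_ne_zero_of_finite
  have hi2 : (B.map Φ).index ≤ 2 := by
    have : 2 ^ m * (B.map Φ).index ≤ 2 ^ m * 2 := by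
      calc 2 ^ m * (B.map Φ).index ≤ Nat.card (B.map Φ) * (B.map Φ).index :=
            Nat.mul_le_mul_right _ (h2 ▸ hB)
        _ ≤ 2 ^ (m + 1) := h1 ▸ hQ
        _ = _ := pow_succ _ _
    exact Nat.le_of_mul_le_mul_left this (by positivity)
  have h3 : ((B.map Φ).map Θ).index ≤ 2 :=
    (Nat.le_of_dvd (Nat.pos_of_ne_zero hi0) (Subgroup.index_map_dvd _ hΘ)).trans hi2
  have h4 : Nat.card ((B.map Φ).map Θ) * ((B.map Φ).map Θ).index = 2 ^ R.card := by
    rw [Subgroup.card_mul_index, Nat.card_fun, Nat.card_eq_fintype_card (α := ℤˣ),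
      Nat.card_eq_fintype_card]
    simp
  have h4' : Nat.card ((B.map Φ).map Θ) = (Θ.comp Φ).ker.relIndex B := by
    rw [Subgroup.map_map, ← Subgroup.relIndex_ker]
  rw [h4'] at h4
  have hker : ∀ x, x ∈ (Θ.comp Φ).ker ↔ ∀ j, θ j x = 1 := by
    intro x
    rw [MonoidHom.mem_ker, funext_iff]
    rfl
  have h5 : N ≤ (Θ.comp Φ).ker ⊓ B := le_inf (fun x hx => (hker x).mpr fun j => hθN j x hx) hNB
  have h6 := Subgroup.relIndex_mul_relIndex N ((Θ.comp Φ).ker ⊓ B) B h5 inf_le_right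
  rw [Subgroup.inf_relIndex_right] at h6
  have h7 : N.relIndex ((Θ.comp Φ).ker ⊓ B) = 1 := by
    have hpos : 0 < 2 ^ R.card := by positivity
    rw [← hN, ← h6] at h4
    rw [← hN, ← h6] at hpos
    have hc0 : 0 < (Θ.comp Φ).ker.relIndex B := by
      by_contra h
      simp [Nat.eq_zero_of_not_pos h] at hpos
    have hd0 : 0 < N.relIndex ((Θ.comp Φ).ker ⊓ B) := by
      by_contra h
      simp [Nat.eq_zero_of_not_pos h] at hpos
    have h8 : (Θ.comp Φ).ker.relIndex B * (N.relIndex ((Θ.comp Φ).ker ⊓ B) * 2) ≤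
        (Θ.comp Φ).ker.relIndex B * 2 := by
      calc _ = N.relIndex ((Θ.comp Φ).ker ⊓ B) * (Θ.comp Φ).ker.relIndex B * 2 := by ring
        _ = _ := h4.symm
        _ ≤ _ := Nat.mul_le_mul_left _ h3
    have := Nat.le_of_mul_le_mul_left h8 hc0
    omega
  exact Subgroup.relIndex_eq_one.mp h7 ⟨(hker b).mpr hθb, hb⟩

end SignCharacters

namespace PlaceTheory

open NumberField IsDedekindDomain

theorem eq_of_valuation_prime_lt_one {v v' : HeightOneSpectrum (𝓞 ℚ)} {p : ℕ} (hp : p.Prime)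
    (h : v.valuation ℚ (p : ℚ) < 1) (h' : v'.valuation ℚ (p : ℚ) < 1) : v = v' := by
  have key : ∀ v : HeightOneSpectrum (𝓞 ℚ), v.valuation ℚ (p : ℚ) < 1 →
      Rat.HeightOneSpectrum.natGenerator v = p := by
    intro v hv
    have h1 : v.valuation ℚ (algebraMap (𝓞 ℚ) ℚ (p : 𝓞 ℚ)) < 1 := by rwa [map_natCast]
    have h2 := (v.valuation_lt_one_iff_mem _).mp h1
    exact (Nat.prime_dvd_prime_iff_eq (Rat.HeightOneSpectrum.prime_natGenerator v) hp).mp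
      ((Rat.HeightOneSpectrum.natGenerator_dvd_iff v).mpr (by
        have h3 := Ideal.mem_map_of_mem (Rat.IsIntegralClosure.intEquiv (𝓞 ℚ)) h2
        rwa [map_natCast] at h3))
  refine (Rat.HeightOneSpectrum.primesEquiv (R := 𝓞 ℚ)).injective (Subtype.ext ?_)
  exact (key v h).trans (key v' h').symm

variable {k : Type*} [Field k]

theorem under_rat_eq [NumberField k] {w w' : HeightOneSpectrum (𝓞 k)} {p : ℕ} (hp : p.Prime)
    (h : w.valuation k (p : k) < 1) (h' : w'.valuation k (p : k) < 1) :
    under ℚ w = under ℚ w' := by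
  refine eq_of_valuation_prime_lt_one hp ?_ ?_
  · rw [← valuation_algebraMap_lt_one_iff, map_natCast]; exact h
  · rw [← valuation_algebraMap_lt_one_iff, map_natCast]; exact h'

theorem card_le_finrank_of_valuation_lt_one [NumberField k] {p : ℕ} (hp : p.Prime)
    (s : Finset (HeightOneSpectrum (𝓞 k))) (hs : ∀ w ∈ s, w.valuation k (p : k) < 1) :
    s.card ≤ Module.finrank ℚ k := by
  rcases s.eq_empty_or_nonempty with rfl | ⟨w, hw⟩
  · simp
  · refine le_trans ?_ (sum_ram_mul_res (under ℚ w) s fun w' hw' =>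
      under_rat_eq hp (hs w' hw') (hs w hw))
    rw [Finset.card_eq_sum_ones]
    exact Finset.sum_le_sum fun w _ => Nat.mul_pos (ram_pos w) (res_pos w)

/-- The elements positive at a real embedding. -/
def positiveAt (φ : k →+* ℝ) : Subgroup kˣ where
  carrier := {x | 0 < φ x}
  one_mem' := by simp
  mul_mem' := fun {a b} ha hb => by
    simp only [Set.mem_ofPred_eq, Units.val_mul, map_mul] at *
    exact mul_pos ha hb
  inv_mem' := fun {a} ha => by
    simp only [Set.mem_ofPred_eq, Units.val_inv_eq_inv_val, map_inv₀] at *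
    exact inv_pos.mpr ha

theorem mem_positiveAt {φ : k →+* ℝ} {x : kˣ} : x ∈ positiveAt φ ↔ 0 < φ x := Iff.rfl

theorem index_positiveAt (φ : k →+* ℝ) :
    (positiveAt φ).index ≠ 0 ∧ (positiveAt φ).index ≤ 2 := by
  classical
  obtain ⟨h0, h1⟩ := SignCharacters.index_le_card (H := positiveAt φ) {1, -1} (by
    intro x
    rcases lt_or_gt_of_ne (show φ (x : k) ≠ 0 by simp) with h | h
    · exact ⟨-1, by simp, by rw [mem_positiveAt]; simpa using h⟩
    · exact ⟨1, by simp, by rw [mem_positiveAt]; simpa using h⟩)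
  exact ⟨h0, h1.trans Finset.card_le_two⟩

theorem finite_realEmbeddings [NumberField k] : Finite (k →+* ℝ) :=
  Finite.of_injective (fun φ : k →+* ℝ => Complex.ofRealHom.comp φ) fun φ ψ h => by
    ext x
    exact Complex.ofReal_injective (RingHom.congr_fun h x)

theorem card_realEmbeddings_le [NumberField k] : Nat.card (k →+* ℝ) ≤ Module.finrank ℚ k := by
  have h := Nat.card_le_card_of_injective (fun φ : k →+* ℝ => Complex.ofRealHom.comp φ)
    fun φ ψ h => by
      ext x
      exact Complex.ofReal_injective (RingHom.congr_fun h x)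
  rwa [Nat.card_eq_fintype_card (α := k →+* ℂ), Embeddings.card] at h

theorem isTotallyReal_of_sqrt {K : Type*} [Field K] [NumberField K] [Algebra k K]
    [NumberField k] [IsTotallyReal k] (h2 : Module.finrank k K = 2) (σ : K ≃ₐ[k] K) (hσ : σ ≠ 1) {x : k}
    (hx0 : x ≠ 0) {r : K} (hr : r ^ 2 = algebraMap k K x) (hσr : σ r = -r)
    (hx : ∀ φ : k →+* ℝ, 0 < φ x) : IsTotallyReal K := by
  have hr0 : r ≠ 0 := by
    rintro rfl
    rw [zero_pow two_ne_zero, eq_comm, map_eq_zero] at hr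
    exact hx0 hr
  refine ⟨fun w => ?_⟩
  rw [InfinitePlace.isReal_iff]
  set ψ := w.embedding
  have hψk : ∀ c : k, starRingEnd ℂ (ψ (algebraMap k K c)) = ψ (algebraMap k K c) := fun c =>
    RingHom.congr_fun (IsTotallyReal.complexEmbedding_isReal (ψ.comp (algebraMap k K))) c
  have hψr : starRingEnd ℂ (ψ r) = ψ r := by
    let φ := (IsTotallyReal.complexEmbedding_isReal (ψ.comp (algebraMap k K))).embedding
    have h1 : ψ r ^ 2 = ((√(φ x) : ℝ) : ℂ) ^ 2 := by
      rw [← map_pow, hr, ← Complex.ofReal_pow, Real.sq_sqrt (hx φ).le]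
      exact (ComplexEmbedding.IsReal.coe_embedding_apply
        (IsTotallyReal.complexEmbedding_isReal (ψ.comp (algebraMap k K))) x).symm
    rcases sq_eq_sq_iff_eq_or_eq_neg.mp h1 with h | h
    · rw [h, Complex.conj_ofReal]
    · rw [h, map_neg, Complex.conj_ofReal]
  rw [ComplexEmbedding.isReal_iff]
  ext y
  rw [ComplexEmbedding.conjugate_coe_eq]
  obtain ⟨a, ha⟩ := mem_range_of_fixed h2 σ hσ (x := y + σ y) (by
    rw [map_add, involution_apply_apply h2 σ hσ, add_comm])
  obtain ⟨b, hb⟩ := mem_range_of_fixed h2 σ hσ (x := (y - σ y) / r) (by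
    rw [map_div₀, map_sub, involution_apply_apply h2 σ hσ, hσr, div_neg, ← neg_div, neg_sub])
  have hy : y = (algebraMap k K a + algebraMap k K b * r) / 2 := by
    rw [ha, hb, div_mul_cancel₀ _ hr0]
    ring
  rw [hy]
  simp only [map_div₀, map_add, map_mul, hψk, hψr, map_ofNat]

end PlaceTheory

namespace PlaceTheory

open NumberField IsDedekindDomain

section

variable {k : Type*} [Field k] [NumberField k]

theorem index_range_sq_sUnits [IsTotallyReal k] (S : Finset (HeightOneSpectrum (𝓞 k))) :
    (powMonoidHom 2 : sUnits S →* sUnits S).range.index = 2 ^ (Module.finrank ℚ k + S.card) := by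
  obtain ⟨hf, hr⟩ := finrank_sUnits S
  have h := HerbrandQuotient.index_range_two (Additive (sUnits S))
  rw [HerbrandQuotient.card_ker_two_of_unique (A := Additive (sUnits S))
    (Additive.ofMul ⟨-1, fun v _ => by simp⟩) ?_ ?_ ?_, ← pow_succ, hr] at h
  · rw [← h, ← Subgroup.index_toAddSubgroup]
    rfl
  · intro h0
    have h1 := congrArg (fun x : Additive (sUnits S) => ((x.toMul : kˣ) : k)) h0
    have h3 : (-1 : k) = 1 := h1
    have h4 : (2 : k) = 0 := by linear_combination -h3
    exact two_ne_zero h4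
  · apply Additive.toMul.injective
    apply Subtype.ext
    apply Units.ext
    change (-1 : k) * (-1) = 1
    ring
  · intro x hx
    have h1 := congrArg (fun x : Additive (sUnits S) => ((x.toMul : kˣ) : k)) hx
    have h3 : (((x.toMul : sUnits S) : kˣ) : k) * ((x.toMul : sUnits S) : kˣ) = 1 := h1
    rcases mul_self_eq_one_iff.mp h3 with h | h
    · exact Or.inl (Additive.toMul.injective (Subtype.ext (Units.ext h)))
    · exact Or.inr (Additive.toMul.injective (Subtype.ext (Units.ext h)))

/-- The elements of even order at a place. -/
def evenOrd (v : HeightOneSpectrum (𝓞 k)) : Subgroup kˣ where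
  carrier := {x | Even (ord v (x : k))}
  one_mem' := by simp
  mul_mem' := fun {a b} ha hb => by
    simp only [Set.mem_ofPred_eq, Units.val_mul] at *
    rw [ord_mul v a.ne_zero b.ne_zero]
    exact ha.add hb
  inv_mem' := fun {a} ha => by
    simp only [Set.mem_ofPred_eq, Units.val_inv_eq_inv_val, ord_inv] at *
    exact ha.neg

theorem mem_evenOrd {v : HeightOneSpectrum (𝓞 k)} {x : kˣ} :
    x ∈ evenOrd v ↔ Even (ord v (x : k)) := Iff.rfl

end

variable {k : Type*} [Field k] [NumberField k] {K : Type*} [Field K] [NumberField K] [Algebra k K]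

theorem map_mem_sqClass {w : HeightOneSpectrum (𝓞 K)} {x : kˣ} (hx : x ∈ sqClass (under k w)) :
    Units.map (algebraMap k K : k →* K) x ∈ sqClass w := by
  obtain ⟨y, z, hz, rfl⟩ := mem_sqClass.mp hx
  refine mem_sqClass.mpr ⟨Units.map (algebraMap k K : k →* K) y,
    Units.map (algebraMap k K : k →* K) z, ?_, by simp⟩
  rw [mem_levelFour] at hz ⊢
  have := (valuation_algebraMap_lt (k := k) w ((z : k) - 1) 4).mpr hz
  rw [map_ofNat] at this
  simpa using this

/-- A sign character trivial on norms which computes the parity of the order, or the quadratic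
residue symbol of local units. -/
theorem exists_norm_character (h2 : Module.finrank k K = 2) {v : HeightOneSpectrum (𝓞 k)}
    (hv2 : v.valuation k 2 = 1) (hs : ¬ IsSplit K v) {u : kˣ} (hu : ord v (u : k) = 0)
    (hu' : u ∉ sqClass v) :
    ∃ ψ : kˣ →* ℤˣ, (∀ x ∈ (Units.map (Algebra.norm k : K →* k)).range, ψ x = 1) ∧
      ((∀ c : kˣ, ψ c = 1 ↔ Even (ord v (c : k))) ∨
        ∀ y : kˣ, ord v (y : k) = 0 → (ψ y = 1 ↔ y ∈ sqClass v)) := by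
  obtain ⟨σ, hσ⟩ := exists_ne_one_of_finrank_two h2
  obtain ⟨w, rfl⟩ := exists_under_eq (K := K) v
  rcases ram_eq_one_or_two h2 w with hr | hr
  · obtain ⟨x₁, hx0, hx₁⟩ := exists_ord_eq (under k w) 1
    obtain ⟨ψ, h1, h3⟩ := SignCharacters.exists_sign_character (H := evenOrd (under k w))
      (u := Units.mk0 x₁ hx0) (fun x => by
        rw [mem_evenOrd, Units.val_pow_eq_pow_val, ord_pow]
        exact ⟨ord (under k w) (x : k), by push_cast; ring⟩) (by
        rw [mem_evenOrd, Units.val_mk0, hx₁]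
        decide)
    refine ⟨ψ, ?_, Or.inl fun c => ⟨fun hc => ?_, fun hc => h1 c hc⟩⟩
    · rintro _ ⟨y, rfl⟩
      exact h1 _ (even_ord_norm h2 σ hσ hs hr y)
    · by_contra hodd
      rw [Int.not_even_iff_odd] at hodd
      have h4 : c * Units.mk0 x₁ hx0 ∈ evenOrd (under k w) := by
        rw [mem_evenOrd, Units.val_mul, Units.val_mk0, ord_mul _ c.ne_zero hx0, hx₁]
        exact hodd.add_one
      have h5 := h1 _ h4
      rw [map_mul, hc, h3] at h5
      exact absurd h5 (by decide)
  · obtain ⟨ψ, h1, h3⟩ := SignCharacters.exists_sign_character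
      (H := (Units.map (Algebra.norm k : K →* k)).range ⊔ levelFour (under k w))
      (u := u) (fun x => sqClass_le_sup_norm h2 _ (sq_mem_sqClass _ x))
      fun h => hu' (mem_sqClass_of_mem_norm h2 σ hσ hr hv2 hu h)
    refine ⟨ψ, fun x hx => h1 x (Subgroup.mem_sup_left hx), Or.inr fun y hy => ⟨fun hc => ?_,
      fun hc => h1 y (sqClass_le_sup_norm h2 _ hc)⟩⟩
    by_contra hn
    have h4 := mul_mem_sqClass hv2 (by rw [hy]; exact Even.zero) (by rw [hu]; exact Even.zero)
      hn hu'
    have h5 := h1 _ (sqClass_le_sup_norm h2 _ h4)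
    rw [map_mul, hc, h3] at h5
    exact absurd h5 (by decide)

theorem two_pow_card_le_relIndex_norm (h2 : Module.finrank k K = 2)
    {S T : Finset (HeightOneSpectrum (𝓞 k))} (hST : Disjoint S T) (hS : PrincipalOutside S)
    (hT2 : ∀ v ∈ T, v.valuation k 2 = 1)
    (hT : ∀ P : HeightOneSpectrum (𝓞 k) → Prop, ∃ y ∈ sUnits S, ∀ v ∈ T, y ∈ sqClass v ↔ P v)
    (R : Finset (HeightOneSpectrum (𝓞 k))) (hRT : R ⊆ T) (hR : ∀ v ∈ R, ¬ IsSplit K v)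
    {N B : Subgroup kˣ} (hN : N ≤ (Units.map (Algebra.norm k : K →* k)).range)
    (hB : ∀ x : kˣ, (∀ v, v ∉ S → v ∉ T → ord v (x : k) = 0) → x ∈ B)
    (h0 : N.relIndex B ≠ 0) : 2 ^ R.card ≤ N.relIndex B := by
  classical
  have hTS : ∀ v ∈ T, v ∉ S := fun v hv hv' => Finset.disjoint_left.mp hST hv' hv
  obtain ⟨u, huS, hu⟩ := hT fun _ => False
  have := fun v : R => exists_norm_character h2 (hT2 v (hRT v.2)) (hR v v.2)
    (huS v (hTS v (hRT v.2))) fun h => (hu v (hRT v.2)).mp h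
  choose ψ hψ hψ' using this
  have hkey := SignCharacters.two_pow_card_le_relIndex (N := N) (B := B) ψ
    (fun v x hx => hψ v x (hN hx)) h0 ?_
  · simpa using hkey
  intro ε
  let m : HeightOneSpectrum (𝓞 k) → ℤ := fun v => if h : v ∈ R then
    if ε ⟨v, h⟩ = 1 then 0 else if (∀ c : kˣ, ψ ⟨v, h⟩ c = 1 ↔ Even (ord v (c : k))) then 1 else 0
    else 0
  obtain ⟨c, hc0, hc⟩ := hS.exists_ord_eq m ((R.finite_toSet).subset fun v hv => by
    by_contra h
    exact hv (dif_neg h))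
  obtain ⟨y, hyS, hy⟩ := hT fun v => ∀ h : v ∈ R, ψ ⟨v, h⟩ (Units.mk0 c hc0) = ε ⟨v, h⟩
  refine ⟨Units.mk0 c hc0 * y, hB _ fun v hv hv' => ?_, fun v => ?_⟩
  · rw [Units.val_mul, ord_mul v (Units.ne_zero _) y.ne_zero, hyS v hv, Units.val_mk0, hc v hv,
      add_zero]
    exact dif_neg fun h => hv' (hRT h)
  · have hvS := hTS v (hRT v.2)
    by_cases hE : ∀ c : kˣ, ψ v c = 1 ↔ Even (ord (v : HeightOneSpectrum (𝓞 k)) (c : k))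
    · have h1 := hE (Units.mk0 c hc0 * y)
      rw [Units.val_mul, ord_mul _ (Units.ne_zero _) y.ne_zero, hyS v hvS, Units.val_mk0, hc v hvS,
        add_zero] at h1
      have hm : m v = if ε v = 1 then 0 else 1 := by
        change dite _ _ _ = _
        rw [dif_pos v.2]
        simp only [Subtype.coe_eta]
        rw [if_pos hE]
      rw [hm] at h1
      rcases Int.units_eq_one_or (ε v) with h | h
      · rw [h] at h1 ⊢
        rw [h1]
        simp
      · rw [h] at h1 ⊢
        refine (Int.units_eq_one_or _).resolve_left fun h3 => ?_
        have := h1.mp h3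
        simp at this
    · have h3 := ((hψ' v).resolve_left hE) y (hyS v hvS)
      rw [hy v (hRT v.2)] at h3
      have h4 : ψ v y = 1 ↔ ψ v (Units.mk0 c hc0) = ε v :=
        h3.trans ⟨fun h => h v.2, fun h _ => h⟩
      rw [map_mul]
      rcases Int.units_eq_one_or (ψ v y) with h | h
      · rw [h, mul_one]
        exact h4.mp h
      · have h5 : ψ v (Units.mk0 c hc0) ≠ ε v := fun h' => by
          rw [h4.mpr h'] at h
          exact absurd h (by decide)
        rw [h]
        exact (show ∀ a b : ℤˣ, a ≠ b → a * -1 = b by decide) _ _ h5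

theorem map_norm_sUnits_le (S : Finset (HeightOneSpectrum (𝓞 k))) :
    (sUnits (placesAbove K S)).map (Units.map (Algebra.norm k)) ≤
      (Units.map (Algebra.norm k : K →* k)).range := by
  rintro _ ⟨y, _, rfl⟩
  exact ⟨y, rfl⟩

omit K in
theorem isSquare_of_mem_sqClass.{u} {k : Type u} [Field k] [NumberField k] [IsTotallyReal k]
    {S T : Finset (HeightOneSpectrum (𝓞 k))} (hST : Disjoint S T) (hS : PrincipalOutside S)
    (hS2 : ∀ v ∉ S, v.valuation k 2 = 1)
    (hT : ∀ P : HeightOneSpectrum (𝓞 k) → Prop, ∃ y ∈ sUnits S, ∀ v ∈ T, y ∈ sqClass v ↔ P v)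
    {x : kˣ} (hx : ∀ v, v ∉ S → v ∉ T → ord v (x : k) = 0) (hxS : ∀ v ∈ S, x ∈ sqClass v)
    (hpos : ∀ φ : k →+* ℝ, 0 < φ x) : IsSquare (x : k) := by
  classical
  by_contra hsq
  obtain ⟨M, _, _, _, r, h2, hr⟩ := exists_quadratic hsq
  obtain ⟨σ, hσ⟩ := exists_ne_one_of_finrank_two h2
  have hσr := apply_sqrt_eq_neg h2 σ hσ hsq hr
  have htr : IsTotallyReal M := isTotallyReal_of_sqrt h2 σ hσ x.ne_zero hr hσr hpos
  have hram : ∀ w : HeightOneSpectrum (𝓞 M), under k w ∉ S ∪ T → ram k w = 1 := by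
    intro w hw
    rw [Finset.mem_union, not_or] at hw
    exact ram_eq_one_of_even h2 σ hσ hr hσr (hS2 _ hw.1) (by rw [hx _ hw.1 hw.2]; exact Even.zero)
  have h1 := relIndex_norm_mul_two (K := M) h2 (hS.mono (Finset.subset_union_left (s₂ := T))) hram
  have hRT : (S ∪ T).filter (fun v => ¬ IsSplit M v) ⊆ T := by
    intro v hv
    rw [Finset.mem_filter, Finset.mem_union] at hv
    refine hv.1.resolve_left fun h => hv.2 ?_
    exact isSplit_of_mem_sqClass h2 σ hσ hr hσr (hxS v h)
  have h3 := two_pow_card_le_relIndex_norm (K := M) h2 hST hS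
    (fun v hv => hS2 v fun h => Finset.disjoint_left.mp hST h hv) hT _ hRT
    (fun v hv => (Finset.mem_filter.mp hv).2) (map_norm_sUnits_le (K := M) (S ∪ T))
    (B := sUnits (S ∪ T)) (fun y hy v hv => by
      rw [Finset.mem_union, not_or] at hv
      exact hy v hv.1 hv.2) (by
      intro h
      rw [h, zero_mul] at h1
      exact absurd h1.symm (by positivity))
  have h4 : 0 < 2 ^ ((S ∪ T).filter (fun v => ¬ IsSplit M v)).card := by positivity
  rw [← h1] at h3 h4
  omega

end PlaceTheory

namespace PlaceTheory

open NumberField IsDedekindDomain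

variable {k : Type*} [Field k] [NumberField k] {K : Type*} [Field K] [NumberField K] [Algebra k K]

/-- The `S`-units of `k` which are squares in `K`. -/
def becomeSquares (K : Type*) [Field K] [NumberField K] [Algebra k K]
    (S : Finset (HeightOneSpectrum (𝓞 k))) : Subgroup (sUnits S) :=
  (powMonoidHom 2 : Kˣ →* Kˣ).range.comap
    ((Units.map (algebraMap k K : k →* K)).comp (sUnits S).subtype)

theorem mem_becomeSquares {S : Finset (HeightOneSpectrum (𝓞 k))} {x : sUnits S} :
    x ∈ becomeSquares K S ↔ IsSquare (algebraMap k K ((x : kˣ) : k)) := by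
  constructor
  · rintro ⟨c, hc⟩
    refine ⟨c, ?_⟩
    have := congrArg Units.val hc
    rw [← sq]
    exact this.symm
  · rintro ⟨c, hc⟩
    have hc0 : c ≠ 0 := by
      rintro rfl
      rw [mul_zero, map_eq_zero] at hc
      exact (x : kˣ).ne_zero hc
    refine ⟨Units.mk0 c hc0, Units.ext ?_⟩
    change c ^ 2 = _
    rw [sq, ← hc]
    rfl

/-- A square of `K` in `k` is a square in `k`, up to the discriminant. -/
theorem exists_sq_of_isSquare (h2 : Module.finrank k K = 2) (σ : K ≃ₐ[k] K) (hσ : σ ≠ 1) {a : kˣ}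
    {r : K} (hr : r ^ 2 = algebraMap k K a) (hσr : σ r = -r) {x : kˣ}
    (hx : IsSquare (algebraMap k K (x : k))) : ∃ e : kˣ, x = e ^ 2 ∨ x = a * e ^ 2 := by
  obtain ⟨c, hc⟩ := hx
  have hr0 : r ≠ 0 := by
    rintro rfl
    rw [zero_pow two_ne_zero, eq_comm, map_eq_zero] at hr
    exact a.ne_zero hr
  have hc0 : c ≠ 0 := by
    rintro rfl
    rw [mul_zero, map_eq_zero] at hc
    exact x.ne_zero hc
  have h1 : σ c * σ c = c * c := by rw [← map_mul, ← hc, AlgEquiv.commutes]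
  rcases mul_self_eq_mul_self_iff.mp h1 with h | h
  · obtain ⟨e, rfl⟩ := mem_range_of_fixed h2 σ hσ h
    have he0 : e ≠ 0 := by
      rintro rfl
      simp at hc0
    refine ⟨Units.mk0 e he0, Or.inl (Units.ext ?_)⟩
    apply (algebraMap k K).injective
    rw [hc, Units.val_pow_eq_pow_val, Units.val_mk0, map_pow, sq]
  · obtain ⟨e, he⟩ := mem_range_of_fixed h2 σ hσ (x := c / r) (by
      rw [map_div₀, h, hσr, neg_div_neg_eq])
    have he0 : e ≠ 0 := by
      rintro rfl
      rw [map_zero, eq_comm] at he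
      exact div_ne_zero hc0 hr0 he
    refine ⟨Units.mk0 e he0, Or.inr (Units.ext ?_)⟩
    apply (algebraMap k K).injective
    rw [hc, Units.val_mul, Units.val_pow_eq_pow_val, Units.val_mk0, map_mul, map_pow, he, ← hr]
    field_simp

/-- There are enough places outside `S`, where `a` is a local square, to separate the `S`-units
up to squares. -/
theorem exists_separating_places [IsTotallyReal k] (h2 : Module.finrank k K = 2) (σ : K ≃ₐ[k] K)
    (hσ : σ ≠ 1) {a : kˣ} {r : K} (hr : r ^ 2 = algebraMap k K a) (hσr : σ r = -r)
    {S : Finset (HeightOneSpectrum (𝓞 k))} (hS2 : ∀ v ∉ S, v.valuation k 2 = 1)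
    (ha : a ∈ sUnits S) :
    ∃ T : Finset (HeightOneSpectrum (𝓞 k)), Disjoint S T ∧
      Module.finrank ℚ k + S.card ≤ T.card + 1 ∧ (∀ v ∈ T, a ∈ sqClass v) ∧
      ∀ P : HeightOneSpectrum (𝓞 k) → Prop, ∃ y ∈ sUnits S, ∀ v ∈ T, y ∈ sqClass v ↔ P v := by
  classical
  have hsq := index_range_sq_sUnits S
  have hle : (powMonoidHom 2 : sUnits S →* sUnits S).range ≤ becomeSquares K S := by
    rintro _ ⟨x, rfl⟩
    exact mem_becomeSquares.mpr ⟨algebraMap k K ((x : kˣ) : k), by simp [sq]⟩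
  have hexp : ∀ {x : kˣ}, IsSquare (algebraMap k K (x : k)) →
      ∃ e : kˣ, x = e ^ 2 ∨ x = a * e ^ 2 := fun hx => exists_sq_of_isSquare h2 σ hσ hr hσr hx
  have hsU : ∀ e : kˣ, e ^ 2 ∈ sUnits S → e ∈ sUnits S := by
    intro e he v hv
    have := he v hv
    rw [Units.val_pow_eq_pow_val, ord_pow] at this
    push_cast at this
    omega
  have haB : (⟨a, ha⟩ : sUnits S) ∈ becomeSquares K S :=
    mem_becomeSquares.mpr ⟨r, by rw [← hr, sq]⟩
  have hrel : (powMonoidHom 2 : sUnits S →* sUnits S).range.relIndex (becomeSquares K S) ≤ 2 := by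
    refine (SignCharacters.index_le_card {1, ⟨⟨a, ha⟩, haB⟩} ?_).2.trans Finset.card_le_two
    intro x
    obtain ⟨e, he | he⟩ := hexp (mem_becomeSquares.mp x.2)
    · refine ⟨1, by simp, ?_⟩
      rw [Subgroup.mem_subgroupOf, inv_one, one_mul]
      exact ⟨⟨e, hsU e (he ▸ x.1.2)⟩, Subtype.ext he.symm⟩
    · refine ⟨⟨⟨a, ha⟩, haB⟩, by simp, ?_⟩
      rw [Subgroup.mem_subgroupOf]
      have h1 : a⁻¹ * ((x : sUnits S) : kˣ) = e ^ 2 := by rw [he, inv_mul_cancel_left]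
      refine ⟨⟨e, hsU e ?_⟩, Subtype.ext h1.symm⟩
      rw [← h1]
      exact mul_mem (inv_mem ha) x.1.2
  have hmul := Subgroup.relIndex_mul_index hle
  rw [hsq] at hmul
  obtain ⟨m, -, hm⟩ := (Nat.dvd_prime_pow Nat.prime_two).mp (Dvd.intro_left _ hmul)
  have hm1 : Module.finrank ℚ k + S.card ≤ m + 1 := by
    refine (Nat.pow_le_pow_iff_right (a := 2) (by norm_num)).mp ?_
    rw [← hmul, hm, pow_succ, mul_comm]
    exact Nat.mul_le_mul_left _ hrel
  let ι := {w : HeightOneSpectrum (𝓞 k) // w ∉ S ∧ a ∈ sqClass w}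
  let N : ι → Subgroup (sUnits S) := fun w => (sqClass w.1).subgroupOf (sUnits S)
  have heven : ∀ w ∉ S, ∀ x ∈ sUnits S, Even (ord w ((x : kˣ) : k)) := fun w hw x hx => by
    rw [hx w hw]; exact Even.zero
  have hN2 : ∀ i, (N i).index ≤ 2 ∧ (N i).index ≠ 0 := by
    intro i
    by_cases h : ∃ u : sUnits S, (u : kˣ) ∉ sqClass i.1
    · obtain ⟨u, hu⟩ := h
      have := SignCharacters.index_le_card (H := N i) {1, u⁻¹} (fun x => by
        by_cases hx : x ∈ N i
        · exact ⟨1, by simp, by simpa using hx⟩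
        · refine ⟨u⁻¹, by simp, ?_⟩
          rw [inv_inv]
          exact mul_mem_sqClass (hS2 _ i.2.1) (heven _ i.2.1 _ u.2) (heven _ i.2.1 _ x.2) hu hx)
      exact ⟨this.2.trans Finset.card_le_two, this.1⟩
    · push Not at h
      have : N i = ⊤ := by
        rw [eq_top_iff]
        exact fun x _ => h x
      rw [this, Subgroup.index_top]
      omega
  obtain ⟨T, hTm, hT⟩ := SignCharacters.exists_finset_iInf_eq hm N (fun i x hx => by
    obtain ⟨e, he | he⟩ := hexp (mem_becomeSquares.mp hx)
    · change (x : kˣ) ∈ sqClass i.1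
      rw [he]
      exact sq_mem_sqClass _ e
    · change (x : kˣ) ∈ sqClass i.1
      rw [he, mul_sq_mem_sqClass_iff]
      exact i.2.2) hN2 (fun x hx => by
    rw [mem_becomeSquares] at hx
    obtain ⟨W, hW, hW2, hW0, hWx⟩ := exists_notMem_sqClass
      (x := Units.map (algebraMap k K : k →* K) (x : kˣ)) hx (placesAbove K S)
    have hw : under k W ∉ S := fun h => hW (mem_placesAbove.mpr h)
    have hxw : (x : kˣ) ∉ sqClass (under k W) := fun h => hWx (map_mem_sqClass h)
    refine ⟨⟨under k W, hw, ?_⟩, hxw⟩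
    by_contra haw
    have h1 := map_mem_sqClass (mul_mem_sqClass (hS2 _ hw) (heven _ hw _ x.2) (heven _ hw _ ha)
      hxw haw)
    have hr0 : r ≠ 0 := by
      rintro rfl
      rw [zero_pow two_ne_zero, eq_comm, map_eq_zero] at hr
      exact a.ne_zero hr
    have h3 : Units.map (algebraMap k K : k →* K) a = Units.mk0 r hr0 ^ 2 :=
      Units.ext hr.symm
    rw [map_mul, h3, mul_sq_mem_sqClass_iff] at h1
    exact hWx h1)
  refine ⟨T.map (Function.Embedding.subtype _), ?_, by rwa [Finset.card_map, hTm], ?_, ?_⟩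
  · rw [Finset.disjoint_left]
    intro v hv hv'
    obtain ⟨i, -, rfl⟩ := Finset.mem_map.mp hv'
    exact i.2.1 hv
  · intro v hv
    obtain ⟨i, -, rfl⟩ := Finset.mem_map.mp hv
    exact i.2.2
  · intro P
    obtain ⟨y, hy⟩ := SignCharacters.exists_mem_iff T N (fun i _ => hN2 i) (by rw [hT, hm, hTm])
      fun i => P i.1
    refine ⟨y, y.2, fun v hv => ?_⟩
    obtain ⟨i, hi, rfl⟩ := Finset.mem_map.mp hv
    exact hy i hi

end PlaceTheory

namespace PlaceTheory

open NumberField IsDedekindDomain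

section

variable {k : Type*} [Field k] [NumberField k]

theorem prod_index_sqClass_le (S : Finset (HeightOneSpectrum (𝓞 k)))
    (hdy : ∀ v : HeightOneSpectrum (𝓞 k), v.valuation k 2 < 1 → DyadicSplit v) :
    ∏ v ∈ S, (sqClass v).index ≤ 2 ^ (2 * S.card + Module.finrank ℚ k) := by
  classical
  have h1 : ∀ v ∈ S, (sqClass v).index ≤ 4 * if v.valuation k 2 < 1 then 2 else 1 := by
    intro v _
    split_ifs with h
    · exact (index_sqClass_le_eight (hdy v h) h).2
    · exact (index_sqClass_le_four ((valuation_two_le v).antisymm (not_lt.mp h))).2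
  refine (Finset.prod_le_prod' h1).trans ?_
  rw [Finset.prod_mul_distrib, Finset.prod_const, ← Finset.prod_filter, Finset.prod_const,
    pow_add, pow_mul]
  refine Nat.mul_le_mul_left _ (Nat.pow_le_pow_right (by norm_num) ?_)
  exact card_le_finrank_of_valuation_lt_one Nat.prime_two _ fun w hw => by
    simpa using (Finset.mem_filter.mp hw).2

theorem index_sqClass_ne_zero (v : HeightOneSpectrum (𝓞 k))
    (hdy : v.valuation k 2 < 1 → DyadicSplit v) : (sqClass v).index ≠ 0 := by
  by_cases h : v.valuation k 2 < 1
  · exact (index_sqClass_le_eight (hdy h) h).1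
  · exact (index_sqClass_le_four ((valuation_two_le v).antisymm (not_lt.mp h))).1

end

variable {k : Type*} [Field k] [NumberField k] {K : Type*} [Field K] [NumberField K] [Algebra k K]

/-- A form of the Hasse norm theorem for quadratic extensions of totally real fields. -/
theorem mem_range_norm_of_local [IsTotallyReal k] [IsTotallyReal K]
    (h2 : Module.finrank k K = 2)
    (hdy : ∀ v : HeightOneSpectrum (𝓞 k), v.valuation k 2 < 1 → DyadicSplit v) (b : kˣ)
    (hloc : ∀ v : HeightOneSpectrum (𝓞 k), IsSplit K v ∨ ∃ H : Subgroup kˣ, H ≠ ⊤ ∧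
      (Units.map (Algebra.norm k : K →* k)).range ≤ H ∧ levelFour v ≤ H ∧ b ∈ H) :
    b ∈ (Units.map (Algebra.norm k : K →* k)).range := by
  classical
  obtain ⟨σ, hσ⟩ := exists_ne_one_of_finrank_two h2
  obtain ⟨r, hr0, hσr, a, ha⟩ := exists_anti_invariant h2 σ hσ
  have ha0 : a ≠ 0 := by
    rintro rfl
    rw [map_zero, eq_comm] at ha
    exact hr0 (pow_eq_zero_iff two_ne_zero |>.mp ha)
  obtain ⟨S, hS0, hS⟩ := exists_principalOutside
    ((finite_valuation_ne_one (k := k) two_ne_zero).toFinset ∪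
      ((finite_ord_ne_zero ha0).toFinset ∪ (finite_ord_ne_zero b.ne_zero).toFinset))
  have hS2 : ∀ v ∉ S, v.valuation k 2 = 1 := fun v hv => by
    by_contra h
    exact hv (hS0 (by simp [h]))
  have haS : Units.mk0 a ha0 ∈ sUnits S := fun v hv => by
    by_contra h
    exact hv (hS0 (by simp_all))
  have hbS : b ∈ sUnits S := fun v hv => by
    by_contra h
    exact hv (hS0 (by simp_all))
  obtain ⟨T, hST, hTcard, haT, hT⟩ := exists_separating_places h2 σ hσ (a := Units.mk0 a ha0)
    ha.symm hσr hS2 haS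
  have hram : ∀ w : HeightOneSpectrum (𝓞 K), under k w ∉ S ∪ T → ram k w = 1 := by
    intro w hw
    rw [Finset.mem_union, not_or] at hw
    exact ram_eq_one_of_even h2 σ hσ (x := Units.mk0 a ha0) ha.symm hσr (hS2 _ hw.1)
      (by rw [haS _ hw.1]; exact Even.zero)
  have hrel := relIndex_norm_mul_two (K := K) h2 (hS.mono (Finset.subset_union_left (s₂ := T)))
    hram
  have hfil : (S ∪ T).filter (fun v => ¬ IsSplit K v) = S.filter fun v => ¬ IsSplit K v := by
    rw [Finset.filter_union, Finset.filter_false_of_mem (s := T), Finset.union_empty]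
    intro v hv h
    exact h (isSplit_of_mem_sqClass h2 σ hσ (x := Units.mk0 a ha0) ha.symm hσr (haT v hv))
  rw [hfil] at hrel
  have hfinE : Finite (k →+* ℝ) := finite_realEmbeddings
  have hFE : Fintype (k →+* ℝ) := Fintype.ofFinite _
  let Q : S ⊕ (k →+* ℝ) → Subgroup kˣ := Sum.elim (fun v => sqClass v.1) positiveAt
  have hQ0 : ∀ j, (Q j).index ≠ 0 := by
    rintro (v | φ)
    · exact index_sqClass_ne_zero v.1 (hdy v.1)
    · exact (index_positiveAt φ).1
  have hQ : ∏ j, (Q j).index ≤ 2 ^ (Module.finrank ℚ k + (S ∪ T).card + 1) := by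
    rw [Fintype.prod_sum_type]
    have h3 : ∏ v : S, (Q (Sum.inl v)).index ≤ 2 ^ (2 * S.card + Module.finrank ℚ k) := by
      change ∏ v : S, (sqClass v.1).index ≤ _
      rw [Finset.prod_coe_sort S fun v => (sqClass v).index]
      exact prod_index_sqClass_le S hdy
    have h4 : ∏ φ : k →+* ℝ, (Q (Sum.inr φ)).index ≤ 2 ^ Module.finrank ℚ k := by
      refine (Finset.prod_le_pow_card _ _ 2 fun φ _ => (index_positiveAt φ).2).trans ?_
      refine Nat.pow_le_pow_right (by norm_num) ?_
      rw [Finset.card_univ, ← Nat.card_eq_fintype_card]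
      exact card_realEmbeddings_le
    refine (Nat.mul_le_mul h3 h4).trans ?_
    rw [← pow_add]
    refine Nat.pow_le_pow_right (by norm_num) ?_
    rw [Finset.card_union_of_disjoint hST]
    omega
  have hQB : 2 ^ (Module.finrank ℚ k + (S ∪ T).card) ≤ (⨅ j, Q j).relIndex (sUnits (S ∪ T)) := by
    rw [← index_range_sq_sUnits (S ∪ T)]
    have hdvd := Subgroup.index_dvd_of_le (H := (⨅ j, Q j).subgroupOf (sUnits (S ∪ T)))
      (K := (powMonoidHom 2 : sUnits (S ∪ T) →* sUnits (S ∪ T)).range) (by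
      intro x hx
      rw [Subgroup.mem_subgroupOf, Subgroup.mem_iInf] at hx
      obtain ⟨e, he⟩ := isSquare_of_mem_sqClass hST hS hS2 hT (x := x)
        (fun v hv hv' => x.2 v (by rw [Finset.mem_union, not_or]; exact ⟨hv, hv'⟩))
        (fun v hv => hx (Sum.inl ⟨v, hv⟩)) fun φ => hx (Sum.inr φ)
      have he0 : e ≠ 0 := by
        rintro rfl
        rw [mul_zero] at he
        exact (x : kˣ).ne_zero he
      refine ⟨⟨Units.mk0 e he0, fun v hv => ?_⟩, Subtype.ext (Units.ext ?_)⟩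
      · have := x.2 v hv
        rw [he, ord_mul v he0 he0] at this
        rw [Units.val_mk0]
        omega
      · change e ^ 2 = _
        rw [he, sq])
    refine Nat.le_of_dvd (Nat.pos_of_ne_zero ?_) hdvd
    have h5 : (⨅ j, Q j).index ≠ 0 := Subgroup.index_iInf_ne_zero hQ0
    exact fun h => h5 (Nat.eq_zero_of_zero_dvd (h ▸ Subgroup.relIndex_dvd_index_of_normal _ _))
  let R : Finset (S ⊕ (k →+* ℝ)) :=
    (Finset.univ.filter fun v : S => ¬ IsSplit K v.1).map Function.Embedding.inl
  have hRcard : R.card = (S.filter fun v => ¬ IsSplit K v).card := by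
    rw [Finset.card_map, ← Finset.card_map (Function.Embedding.subtype _)]
    congr 1
    ext v
    simp [and_comm]
  have hθ : ∀ j : R, ∃ θ : kˣ →* ℤˣ, (∀ x ∈ Q j, θ x = 1) ∧ (∃ u, θ u = -1) ∧
      (∀ x ∈ (Units.map (Algebra.norm k : K →* k)).range, θ x = 1) ∧ θ b = 1 := by
    rintro ⟨j, hj⟩
    obtain ⟨v, hv, rfl⟩ := Finset.mem_map.mp hj
    obtain ⟨H, hH, hH1, hH2, hH3⟩ := (hloc v.1).resolve_left (Finset.mem_filter.mp hv).2
    have hsq := (sqClass_le_sup_norm (K := K) h2 v.1).trans (sup_le hH1 hH2)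
    obtain ⟨u, -, hu⟩ := SetLike.exists_of_lt hH.lt_top
    obtain ⟨θ, h1, h3⟩ := SignCharacters.exists_sign_character
      (fun x => hsq (sq_mem_sqClass v.1 x)) hu
    exact ⟨θ, fun x hx => h1 x (hsq hx), ⟨u, h3⟩, fun x hx => h1 x (hH1 hx), h1 b hH3⟩
  choose θ hθ1 hθ2 hθ3 hθ4 using hθ
  have hNB : (sUnits (placesAbove K (S ∪ T))).map (Units.map (Algebra.norm k)) ≤
      sUnits (S ∪ T) := by
    rintro _ ⟨y, hy, rfl⟩ v hv
    obtain ⟨w, rfl⟩ := exists_under_eq (K := K) v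
    apply ord_eq_zero_of_algebraMap
    change ord w (algebraMap k K (Algebra.norm k (y : K))) = 0
    have hin : ∀ w : HeightOneSpectrum (𝓞 K), under k w ∉ S ∪ T → ord w (y : K) = 0 :=
      fun w hw => hy w fun h => hw (mem_placesAbove.mp h)
    have h5 : ord w (σ (y : K)) = ord (conj (σ : K ≃+* K) w) (y : K) := by
      rw [← ord_conj w (σ : K ≃+* K) (σ y), AlgEquiv.coe_ringEquiv, involution_apply_apply h2 σ hσ]
    rw [algebraMap_norm h2 σ hσ, ord_mul w y.ne_zero ((map_ne_zero σ).mpr y.ne_zero), hin w hv, h5,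
      hin _ (by rwa [under_conj]), add_zero]
  exact map_norm_sUnits_le (K := K) (S ∪ T) (SignCharacters.mem_of_sign_characters_eq_one hNB Q hQ0
    hQ hQB R θ hθ1 hθ2 (fun j x hx => hθ3 j x (map_norm_sUnits_le (K := K) (S ∪ T) hx))
    (by rw [hRcard]; exact hrel)
    (fun v hv => hbS v fun h => hv (Finset.mem_union_left _ h)) hθ4)

end PlaceTheory

namespace PlaceTheory

open NumberField IsDedekindDomain

variable {k : Type*} [Field k] [NumberField k] {K : Type*} [Field K] [NumberField K] [Algebra k K]

omit [NumberField k] [NumberField K] in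
theorem smul_asIdeal (σ : K ≃ₐ[k] K) (w : HeightOneSpectrum (𝓞 K)) :
    σ • w.asIdeal = (conj (σ : K ≃+* K) w).asIdeal := by
  have hmap : (conj (σ : K ≃+* K) w).asIdeal =
      w.asIdeal.map (RingOfIntegers.mapRingEquiv (σ : K ≃+* K)) := Ideal.comap_symm _
  rw [hmap, Ideal.pointwise_smul_def]
  rfl

theorem exists_conj_eq [IsGalois k K] {w w' : HeightOneSpectrum (𝓞 K)}
    (h : under k w = under k w') : ∃ σ : K ≃ₐ[k] K, conj (σ : K ≃+* K) w = w' := by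
  have hl : w'.asIdeal.LiesOver (under k w).asIdeal := h ▸ inferInstance
  obtain ⟨σ, hσ⟩ := Ideal.exists_smul_eq_of_isGaloisGroup (under k w).asIdeal w.asIdeal w'.asIdeal
    (K ≃ₐ[k] K)
  exact ⟨σ, HeightOneSpectrum.ext (by rw [← smul_asIdeal, hσ])⟩

theorem card_stabilizer_eq_ram_mul_res [IsGalois k K] (w : HeightOneSpectrum (𝓞 K)) :
    Nat.card {σ : K ≃ₐ[k] K // conj (σ : K ≃+* K) w = w} = ram k w * res k w := by
  let p := (under k w).asIdeal
  have hpm : p.IsMaximal := (under k w).isMaximal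
  have hfin : Finite (𝓞 k ⧸ p) := Ideal.finiteQuotientOfFreeOfNeBot p (under k w).ne_bot
  have hres : Finite p.ResidueField :=
    Finite.of_surjective (algebraMap (𝓞 k ⧸ p) p.ResidueField)
      (Ideal.bijective_algebraMap_quotient_residueField p).2
  have h1 := Ideal.card_stabilizer_eq (G := K ≃ₐ[k] K) p w.asIdeal
  rw [Ideal.ramificationIdxIn_eq_ramificationIdx p w.asIdeal (K ≃ₐ[k] K),
    Ideal.inertiaDegIn_eq_inertiaDeg p w.asIdeal (K ≃ₐ[k] K),
    ← Ideal.ramificationIdx'_eq_ramificationIdx _ _ (under k w).ne_bot] at h1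
  rw [ram, res, ← h1]
  refine Nat.card_congr (Equiv.subtypeEquivRight fun σ => ?_)
  rw [MulAction.mem_stabilizer_iff, smul_asIdeal, HeightOneSpectrum.ext_iff]

end PlaceTheory

namespace TwistedProduct

variable {G A : Type*} [Group G] [CommGroup A] [MulDistribMulAction G A]

/-- A normalised 2-cocycle of `G` with values in `A`. -/
structure NormalizedCocycle (G A : Type*) [Group G] [CommGroup A] [MulDistribMulAction G A] where
  val : G → G → A
  cocycle : ∀ g h l, val g h * val (g * h) l = g • val h l * val g (h * l)
  one_left : ∀ g, val 1 g = 1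
  one_right : ∀ g, val g 1 = 1

/-- The extension of `G` by `A` defined by a normalised 2-cocycle. -/
@[ext]
structure Extension (c : NormalizedCocycle G A) where
  coeff : A
  proj : G

namespace Extension

variable {c : NormalizedCocycle G A}

instance : Mul (Extension c) :=
  ⟨fun x y => ⟨x.coeff * x.proj • y.coeff * c.val x.proj y.proj, x.proj * y.proj⟩⟩

instance : One (Extension c) := ⟨⟨1, 1⟩⟩

instance : Inv (Extension c) :=
  ⟨fun x => ⟨(x.proj⁻¹ • x.coeff * c.val x.proj⁻¹ x.proj)⁻¹, x.proj⁻¹⟩⟩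

theorem coeff_mul (x y : Extension c) :
    (x * y).coeff = x.coeff * x.proj • y.coeff * c.val x.proj y.proj := rfl

theorem proj_mul (x y : Extension c) : (x * y).proj = x.proj * y.proj := rfl

instance : Group (Extension c) :=
  Group.ofLeftAxioms
    (fun x y z => by
      refine Extension.ext ?_ (mul_assoc _ _ _)
      have h := c.cocycle x.proj y.proj z.proj
      simp only [coeff_mul, proj_mul, smul_mul', mul_smul]
      calc _ = x.coeff * x.proj • y.coeff * x.proj • y.proj • z.coeff *
            (c.val x.proj y.proj * c.val (x.proj * y.proj) z.proj) := by
            ac_rfl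
        _ = _ := by rw [h]; ac_rfl)
    (fun x => Extension.ext
      (show (1 : A) * (1 : G) • x.coeff * c.val 1 x.proj = x.coeff by
        rw [one_smul, c.one_left, one_mul, mul_one]) (one_mul _))
    (fun x => Extension.ext
      (show (x.proj⁻¹ • x.coeff * c.val x.proj⁻¹ x.proj)⁻¹ * x.proj⁻¹ • x.coeff *
        c.val x.proj⁻¹ x.proj = 1 by rw [mul_assoc, inv_mul_cancel]) (inv_mul_cancel _))

/-- The projection to `G`. -/
def projHom (c : NormalizedCocycle G A) : Extension c →* G where
  toFun := Extension.proj
  map_one' := rfl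
  map_mul' _ _ := rfl

/-- The inclusion of `A`. -/
def incl (c : NormalizedCocycle G A) : A →* Extension c where
  toFun u := ⟨u, 1⟩
  map_one' := rfl
  map_mul' u v := Extension.ext
    (show u * v = u * (1 : G) • v * c.val 1 1 by rw [one_smul, c.one_left, mul_one])
    (mul_one _).symm

theorem proj_incl (u : A) : (incl c u).proj = 1 := rfl

theorem incl_injective : Function.Injective (incl c) := fun _ _ h => congrArg coeff h

theorem mul_incl (x : Extension c) (u : A) : x * incl c u = incl c (x.proj • u) * x :=
  Extension.ext
    (show x.coeff * x.proj • u * c.val x.proj 1 =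
        x.proj • u * (1 : G) • x.coeff * c.val 1 x.proj by
      rw [one_smul, c.one_left, c.one_right, mul_one, mul_one, mul_comm])
    ((mul_one _).trans (one_mul _).symm)

theorem exists_eq_incl_mul {x y : Extension c} (h : x.proj = y.proj) :
    ∃ u, x = incl c u * y := by
  refine ⟨x.coeff / y.coeff, Extension.ext ?_ (h.trans (one_mul _).symm)⟩
  change x.coeff = x.coeff / y.coeff * (1 : G) • y.coeff * c.val 1 y.proj
  rw [one_smul, c.one_left, mul_one, div_mul_cancel]

theorem proj_inv (x : Extension c) : x⁻¹.proj = x.proj⁻¹ := rfl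

/-- `C` maps isomorphically onto `H`. -/
def IsLift (C : Subgroup (Extension c)) (H : Subgroup G) : Prop :=
  C.map (projHom c) = H ∧ ∀ x ∈ C, x.proj = 1 → x = 1

namespace IsLift

variable {C : Subgroup (Extension c)} {H : Subgroup G}

theorem proj_mem (h : IsLift C H) {x : Extension c} (hx : x ∈ C) : x.proj ∈ H :=
  h.1 ▸ Subgroup.mem_map_of_mem (projHom c) hx

theorem exists_lift (h : IsLift C H) {g : G} (hg : g ∈ H) : ∃ x ∈ C, x.proj = g := by
  rw [← h.1] at hg
  exact hg

theorem eq_of_proj_eq (h : IsLift C H) {x y : Extension c} (hx : x ∈ C) (hy : y ∈ C)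
    (hxy : x.proj = y.proj) : x = y := by
  have h1 := h.2 (x * y⁻¹) (C.mul_mem hx (C.inv_mem hy))
    (by rw [proj_mul, proj_inv, hxy, mul_inv_cancel])
  exact mul_inv_eq_one.mp h1

theorem eq_of_incl_mul_mem (h : IsLift C H) {u v : A} {x y : Extension c}
    (hx : x ∈ C) (hy : y ∈ C) (he : incl c u * x = incl c v * y) : u = v ∧ x = y := by
  have hp : x.proj = y.proj := by
    have := congrArg proj he
    rwa [proj_mul, proj_mul, proj_incl, proj_incl, one_mul, one_mul] at this
  have hxy := h.eq_of_proj_eq hx hy hp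
  subst hxy
  exact ⟨incl_injective (mul_right_cancel he), rfl⟩

end IsLift

/-- Hilbert 90 lets one choose a lift of an element normalising `N` which normalises a given
lift of `N`. -/
theorem IsLift.exists_normalizing {C : Subgroup (Extension c)} {N : Subgroup G} (hC : IsLift C N)
    (h90 : ∀ β : N → A, (∀ m n, β (m * n) = β m * m • β n) → ∃ γ : A, ∀ n, β n = n • γ / γ)
    {g : G} (hg : ∀ n ∈ N, g * n * g⁻¹ ∈ N) (hg' : ∀ n ∈ N, g⁻¹ * n * g ∈ N) :
    ∃ t : Extension c, t.proj = g ∧ ∀ x ∈ C, t * x * t⁻¹ ∈ C := by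
  let t₀ : Extension c := ⟨1, g⟩
  have hs (n : N) : ∃ x ∈ C, x.proj = n := hC.exists_lift n.2
  choose s hs hsp using hs
  have hs' (n : N) : ∃ x : Extension c, x ∈ C ∧ (t₀ * x * t₀⁻¹).proj = n := by
    obtain ⟨x, hx, hxp⟩ := hC.exists_lift (hg' n n.2)
    refine ⟨x, hx, ?_⟩
    rw [proj_mul, proj_mul, proj_inv, hxp]
    change g * (g⁻¹ * n * g) * g⁻¹ = n
    group
  choose r hr hrp using hs'
  have hβ (n : N) : ∃ u, t₀ * r n * t₀⁻¹ = incl c u * s n :=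
    exists_eq_incl_mul ((hrp n).trans (hsp n).symm)
  choose β hβ using hβ
  have hsmul (m n : N) : s (m * n) = s m * s n :=
    hC.eq_of_proj_eq (hs _) (C.mul_mem (hs _) (hs _)) (by
      rw [proj_mul, hsp, hsp, hsp, Subgroup.coe_mul])
  have hrmul (m n : N) : r (m * n) = r m * r n := by
    refine hC.eq_of_proj_eq (hr _) (C.mul_mem (hr _) (hr _)) ?_
    have h1 := hrp (m * n)
    have h2 := hrp m
    have h3 := hrp n
    rw [proj_mul, proj_mul, proj_inv] at h1 h2 h3
    rw [Subgroup.coe_mul, ← h2, ← h3] at h1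
    rw [proj_mul]
    refine mul_left_cancel (a := t₀.proj) (mul_right_cancel (b := t₀.proj⁻¹) (h1.trans ?_))
    group
  obtain ⟨γ, hγ⟩ := h90 β (fun m n => by
    have h1 : incl c (β (m * n)) * s (m * n) = incl c (β m * m • β n) * s (m * n) := by
      rw [← hβ, hrmul]
      calc t₀ * (r m * r n) * t₀⁻¹ = (t₀ * r m * t₀⁻¹) * (t₀ * r n * t₀⁻¹) := by group
        _ = incl c (β m) * (s m * incl c (β n)) * s n := by rw [hβ, hβ]; group
        _ = incl c (β m) * (incl c (m • β n) * s m) * s n := by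
            rw [mul_incl, hsp]; rfl
        _ = _ := by rw [map_mul, hsmul]; group
    exact (hC.eq_of_incl_mul_mem (hs _) (hs _) h1).1)
  refine ⟨incl c γ * t₀, by rw [proj_mul, proj_incl, one_mul], fun x hx => ?_⟩
  have hn : g * x.proj * g⁻¹ ∈ N := hg _ (hC.proj_mem hx)
  have hxr : x = r ⟨_, hn⟩ := by
    refine hC.eq_of_proj_eq hx (hr _) ?_
    have h1 := hrp ⟨_, hn⟩
    rw [proj_mul, proj_mul, proj_inv] at h1
    exact (mul_left_cancel (a := g) (mul_right_cancel (b := g⁻¹) h1)).symm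
  have h2 := hβ ⟨_, hn⟩
  have h3 : incl c γ * t₀ * x * (incl c γ * t₀)⁻¹ = s ⟨_, hn⟩ := by
    calc incl c γ * t₀ * x * (incl c γ * t₀)⁻¹
        = incl c γ * (t₀ * x * t₀⁻¹) * incl c γ⁻¹ := by rw [map_inv]; group
      _ = incl c γ * incl c (β ⟨_, hn⟩) * (s ⟨_, hn⟩ * incl c γ⁻¹) := by
          rw [← hxr] at h2
          rw [h2]; group
      _ = incl c (γ * β ⟨_, hn⟩ * ((⟨_, hn⟩ : N) • γ⁻¹)) * s ⟨_, hn⟩ := by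
          rw [mul_incl (s _), hsp, map_mul, map_mul]
          simp only [mul_assoc]
          rfl
      _ = _ := by
          rw [hγ, smul_inv', mul_div_cancel, mul_inv_cancel, map_one, one_mul]
  rw [h3]
  exact hs _

theorem IsLift.smul_eq_of_sq {C : Subgroup (Extension c)} {N : Subgroup G} (hC : IsLift C N)
    {t : Extension c} (ht : ∀ x ∈ C, t * x * t⁻¹ ∈ C) {b : A} {y : Extension c} (hy : y ∈ C)
    (hsq : t * t = incl c b * y) : t.proj • b = b ∧ ∀ n ∈ N, n • b = b := by
  constructor
  · have h1 : incl c (t.proj • b) * (t * y * t⁻¹) = incl c b * y := by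
      rw [← hsq]
      calc incl c (t.proj • b) * (t * y * t⁻¹) = (incl c (t.proj • b) * t) * y * t⁻¹ := by group
        _ = t * (incl c b * y) * t⁻¹ := by rw [← mul_incl]; group
        _ = t * t := by rw [← hsq]; group
    exact (hC.eq_of_incl_mul_mem (ht y hy) hy h1).1
  · intro n hn
    obtain ⟨x, hx, rfl⟩ := hC.exists_lift hn
    have hx' : y⁻¹ * x * y ∈ C := C.mul_mem (C.mul_mem (C.inv_mem hy) hx) hy
    have hz := ht _ (ht _ hx')
    have h1 : incl c ((t * (t * (y⁻¹ * x * y) * t⁻¹) * t⁻¹).proj • b) *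
        (t * (t * (y⁻¹ * x * y) * t⁻¹) * t⁻¹ * y) = incl c b * (y * (y⁻¹ * x * y)) := by
      rw [← mul_assoc, ← mul_incl, mul_assoc, ← hsq, ← mul_assoc (incl c b), ← hsq]
      group
    obtain ⟨h2, h3⟩ := hC.eq_of_incl_mul_mem (C.mul_mem hz hy) (C.mul_mem hy hx') h1
    have h4 : t * (t * (y⁻¹ * x * y) * t⁻¹) * t⁻¹ = x := by
      refine mul_right_cancel (h3.trans ?_)
      group
    rwa [h4] at h2

theorem IsLift.exists_of_normalizing {C : Subgroup (Extension c)} {N H : Subgroup G}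
    (hC : IsLift C N) (hNH : N ≤ H) {t : Extension c} (htH : t.proj ∈ H) (htN : t.proj ∉ N)
    (hcov : ∀ h ∈ H, h ∈ N ∨ h * t.proj⁻¹ ∈ N) (ht : ∀ x ∈ C, t * x * t⁻¹ ∈ C)
    (hsq : t * t ∈ C) : ∃ D : Subgroup (Extension c), IsLift D H := by
  have ht' {x} (hx : x ∈ C) : t⁻¹ * x * t ∈ C := by
    have h1 := C.mul_mem (C.mul_mem (C.inv_mem hsq) (ht x hx)) hsq
    have h2 : (t * t)⁻¹ * (t * x * t⁻¹) * (t * t) = t⁻¹ * x * t := by group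
    rwa [h2] at h1
  let D : Subgroup (Extension c) :=
    { carrier := {x | x ∈ C ∨ x * t⁻¹ ∈ C}
      one_mem' := Or.inl C.one_mem
      mul_mem' := by
        rintro x y (hx | hx) (hy | hy)
        · exact Or.inl (C.mul_mem hx hy)
        · exact Or.inr (by rw [mul_assoc]; exact C.mul_mem hx hy)
        · refine Or.inr ?_
          have : x * y * t⁻¹ = x * t⁻¹ * (t * y * t⁻¹) := by group
          rw [this]
          exact C.mul_mem hx (ht y hy)
        · refine Or.inl ?_
          have : x * y = x * t⁻¹ * (t * (y * t⁻¹) * t⁻¹) * (t * t) := by group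
          rw [this]
          exact C.mul_mem (C.mul_mem hx (ht _ hy)) hsq
      inv_mem' := by
        rintro x (hx | hx)
        · exact Or.inl (C.inv_mem hx)
        · refine Or.inr ?_
          have : x⁻¹ * t⁻¹ = (t * t)⁻¹ * (t * (x * t⁻¹)⁻¹ * t⁻¹) := by group
          rw [this]
          exact C.mul_mem (C.inv_mem hsq) (ht _ (C.inv_mem hx)) }
  refine ⟨D, ?_, ?_⟩
  · ext h
    constructor
    · rintro ⟨x, hx | hx, rfl⟩
      · exact hNH (hC.proj_mem hx)
      · have h1 := H.mul_mem (hNH (hC.proj_mem hx)) htH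
        rwa [← proj_mul, inv_mul_cancel_right] at h1
    · intro hh
      rcases hcov h hh with h1 | h1
      · obtain ⟨x, hx, hxp⟩ := hC.exists_lift h1
        exact ⟨x, Or.inl hx, hxp⟩
      · obtain ⟨x, hx, hxp⟩ := hC.exists_lift h1
        refine ⟨x * t, Or.inr (by rwa [mul_inv_cancel_right]), ?_⟩
        change x.proj * t.proj = h
        rw [hxp, inv_mul_cancel_right]
  · rintro x (hx | hx) hx1
    · exact hC.2 x hx hx1
    · have h1 := hC.proj_mem hx
      rw [proj_mul, hx1, one_mul, proj_inv] at h1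
      exact absurd (N.inv_mem_iff.mp h1) htN

theorem isLift_bot : IsLift (⊥ : Subgroup (Extension c)) ⊥ :=
  ⟨Subgroup.map_bot _, fun _ hx _ => Subgroup.mem_bot.mp hx⟩

/-- Dévissage: if every obstruction in a step of index two is a norm, the extension splits. -/
theorem exists_isLift_of_card_eq [Finite G]
    (h90 : ∀ (N : Subgroup G) (β : N → A), (∀ m n, β (m * n) = β m * m • β n) →
      ∃ γ : A, ∀ n, β n = n • γ / γ)
    (hstep : ∀ (N H : Subgroup G) (C : Subgroup (Extension c)) (t y : Extension c) (b : A),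
      N ≤ H → N.relIndex H = 2 → IsLift C N → t.proj ∈ H → t.proj ∉ N →
      (∀ x ∈ C, t * x * t⁻¹ ∈ C) → y ∈ C → t * t = incl c b * y → (∀ h ∈ H, h • b = b) →
      ∃ z : A, (∀ n ∈ N, n • z = z) ∧ z * t.proj • z = b) (n : ℕ) (H : Subgroup G)
    (hH : Nat.card H = 2 ^ n) : ∃ C : Subgroup (Extension c), IsLift C H := by
  induction n generalizing H with
  | zero =>
    rw [pow_zero, Subgroup.card_eq_one] at hH
    exact ⟨⊥, hH ▸ isLift_bot⟩
  | succ n ih =>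
    have hp : Fact (Nat.Prime 2) := ⟨Nat.prime_two⟩
    obtain ⟨N₀, hN₀⟩ := Sylow.exists_subgroup_card_pow_prime (G := H) 2 (n := n)
      (hH ▸ pow_dvd_pow 2 n.le_succ)
    have hidx : N₀.index = 2 := by
      have h1 := N₀.card_mul_index
      rw [hN₀, hH, pow_succ] at h1
      exact mul_left_cancel₀ (pow_ne_zero n two_ne_zero) h1
    have hnormal : N₀.Normal := Subgroup.normal_of_index_eq_two hidx
    let N : Subgroup G := N₀.map H.subtype
    have hNH : N ≤ H := Subgroup.map_subtype_le N₀
    have hmem {h : H} : (h : G) ∈ N ↔ h ∈ N₀ :=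
      Subgroup.mem_map_iff_mem H.subtype_injective
    have hrel : N.relIndex H = 2 := by
      rw [Subgroup.relIndex, show N.subgroupOf H = N₀ from
        Subgroup.comap_map_eq_self_of_injective H.subtype_injective N₀, hidx]
    obtain ⟨C, hC⟩ := ih N (by
      rw [← hN₀]; exact Nat.card_congr (N₀.equivMapOfInjective _ H.subtype_injective).toEquiv.symm)
    obtain ⟨g, hg⟩ : ∃ g : H, g ∉ N₀ := by
      by_contra! hall
      rw [(Subgroup.eq_top_iff' N₀).mpr hall, Subgroup.index_top] at hidx
      omega
    have hconj (g : H) (n : G) (hn : n ∈ N) : (g : G) * n * (g : G)⁻¹ ∈ N := by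
      have := hnormal.conj_mem ⟨n, hNH hn⟩ (hmem.mp hn) g
      exact hmem.mpr this
    obtain ⟨t, htg, ht⟩ := hC.exists_normalizing (h90 N) (g := g) (hconj g)
      (fun n hn => by simpa using hconj g⁻¹ n hn)
    have hcov (h : G) (hh : h ∈ H) : h ∈ N ∨ h * t.proj⁻¹ ∈ N := by
      by_cases h1 : h ∈ N
      · exact Or.inl h1
      · refine Or.inr ?_
        rw [htg]
        have h2 := (Subgroup.mul_mem_iff_of_index_two hidx (a := ⟨h, hh⟩) (b := g⁻¹)).mpr
          (iff_of_false (fun h3 => h1 (hmem.mpr h3)) (fun h3 => hg (N₀.inv_mem_iff.mp h3)))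
        exact hmem.mpr h2
    have htN : t.proj ∉ N := fun h1 => hg (hmem.mp (htg ▸ h1))
    have htH : t.proj ∈ H := htg ▸ g.2
    have hsqN : (t * t).proj ∈ N := by
      rw [proj_mul, htg]
      exact hmem.mpr (Subgroup.mul_self_mem_of_index_two hidx g)
    obtain ⟨y, hy, hyp⟩ := hC.exists_lift hsqN
    obtain ⟨b, hb⟩ := exists_eq_incl_mul hyp.symm
    obtain ⟨hb1, hb2⟩ := hC.smul_eq_of_sq ht hy hb
    have hbH (h : G) (hh : h ∈ H) : h • b = b := by
      rcases hcov h hh with h1 | h1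
      · exact hb2 h h1
      · have h2 := hb2 _ h1
        conv_lhs at h2 => rw [mul_smul, inv_smul_eq_iff.mpr hb1.symm]
        exact h2
    obtain ⟨z, hz, hzb⟩ := hstep N H C t y b hNH hrel hC htH htN ht hy hb hbH
    have hpz : (incl c z⁻¹ * t).proj = t.proj := by rw [proj_mul, proj_incl, one_mul]
    refine hC.exists_of_normalizing hNH (t := incl c z⁻¹ * t) (hpz ▸ htH) (hpz ▸ htN)
      (by rwa [hpz]) (fun x hx => ?_) ?_
    · have h1 : incl c z⁻¹ * t * x * (incl c z⁻¹ * t)⁻¹ = t * x * t⁻¹ := by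
        have h2 := mul_incl (c := c) (t * x * t⁻¹) z
        rw [hz _ (hC.proj_mem (ht x hx))] at h2
        rw [map_inv]
        calc (incl c z)⁻¹ * t * x * ((incl c z)⁻¹ * t)⁻¹
            = (incl c z)⁻¹ * ((t * x * t⁻¹) * incl c z) := by group
          _ = _ := by rw [h2]; group
      rw [h1]
      exact ht x hx
    · have h1 : incl c z⁻¹ * t * (incl c z⁻¹ * t) = y := by
        calc incl c z⁻¹ * t * (incl c z⁻¹ * t) = incl c z⁻¹ * (t * incl c z⁻¹) * t := by group
          _ = incl c (z⁻¹ * (t.proj • z)⁻¹ * b) * y := by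
            rw [mul_incl, smul_inv', mul_assoc, mul_assoc, hb, map_mul, map_mul]
            group
          _ = y := by rw [← hzb, ← mul_inv, inv_mul_cancel, map_one, one_mul]
      rw [h1]
      exact hy

theorem exists_trivialization [Finite G] (hG : IsPGroup 2 G)
    (h90 : ∀ (N : Subgroup G) (β : N → A), (∀ m n, β (m * n) = β m * m • β n) →
      ∃ γ : A, ∀ n, β n = n • γ / γ)
    (hstep : ∀ (N H : Subgroup G) (C : Subgroup (Extension c)) (t y : Extension c) (b : A),
      N ≤ H → N.relIndex H = 2 → IsLift C N → t.proj ∈ H → t.proj ∉ N →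
      (∀ x ∈ C, t * x * t⁻¹ ∈ C) → y ∈ C → t * t = incl c b * y → (∀ h ∈ H, h • b = b) →
      ∃ z : A, (∀ n ∈ N, n • z = z) ∧ z * t.proj • z = b) :
    ∃ a : G → A, ∀ g h, a (g * h) = a g * g • a h * c.val g h := by
  have hp : Fact (Nat.Prime 2) := ⟨Nat.prime_two⟩
  obtain ⟨n, hn⟩ := IsPGroup.iff_card.mp hG
  obtain ⟨C, hC⟩ := exists_isLift_of_card_eq h90 hstep n ⊤ (by rwa [Subgroup.card_top])
  choose s hs hsp using fun g : G => hC.exists_lift (Subgroup.mem_top g)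
  refine ⟨fun g => (s g).coeff, fun g h => ?_⟩
  have h1 : s (g * h) = s g * s h :=
    hC.eq_of_proj_eq (hs _) (C.mul_mem (hs _) (hs _)) (by rw [proj_mul, hsp, hsp, hsp])
  simp only [h1, coeff_mul, hsp]

end Extension

end TwistedProduct

namespace PlaceTheory

open NumberField IsDedekindDomain

section

variable {k : Type*} [Field k] [NumberField k]

theorem conj_trans {K L : Type*} [Field K] [NumberField K] [Field L] [NumberField L]
    (σ : k ≃+* K) (τ : K ≃+* L) (v : HeightOneSpectrum (𝓞 k)) :
    conj (σ.trans τ) v = conj τ (conj σ v) := by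
  refine eq_of_valuation_eq fun x => ?_
  obtain ⟨y, rfl⟩ := (σ.trans τ).surjective x
  rw [valuation_conj, RingEquiv.trans_apply, valuation_conj, valuation_conj]

theorem valuation_apply_of_conj_eq {σ : k ≃+* k} {v : HeightOneSpectrum (𝓞 k)}
    (h : conj σ v = v) (x : k) : v.valuation k (σ x) = v.valuation k x := by
  conv_lhs => rw [← h]
  exact valuation_conj v σ x

theorem ord_apply_of_conj_eq {σ : k ≃+* k} {v : HeightOneSpectrum (𝓞 k)}
    (h : conj σ v = v) (x : k) : ord v (σ x) = ord v x := by
  conv_lhs => rw [← h]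
  exact ord_conj v σ x

theorem valuation_intCast_le_one (v : HeightOneSpectrum (𝓞 k)) (n : ℤ) :
    v.valuation k (n : k) ≤ 1 := by
  have := v.valuation_le_one (K := k) (n : 𝓞 k)
  simpa using this

theorem valuation_intCast_lt_one_iff {v : HeightOneSpectrum (𝓞 k)} {p : ℕ} (hp : p.Prime)
    (hv : v.valuation k (p : k) < 1) (n : ℤ) : v.valuation k (n : k) < 1 ↔ (p : ℤ) ∣ n := by
  constructor
  · intro h
    by_contra hn
    obtain ⟨a, b, hab⟩ := (Nat.prime_iff_prime_int.mp hp).coprime_iff_not_dvd.mpr hn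
    have h1 : v.valuation k ((a * p + b * n : ℤ) : k) < 1 := by
      push_cast
      refine (v.valuation k).map_add_lt ?_ ?_
      · rw [map_mul]
        exact (mul_le_of_le_one_left' (valuation_intCast_le_one v a)).trans_lt hv
      · rw [map_mul]
        exact (mul_le_of_le_one_left' (valuation_intCast_le_one v b)).trans_lt h
    rw [hab, Int.cast_one, map_one] at h1
    exact lt_irrefl _ h1
  · rintro ⟨m, rfl⟩
    push_cast
    rw [map_mul]
    exact (mul_le_of_le_one_right' (valuation_intCast_le_one v m)).trans_lt hv

theorem valuation_two_eq_one {v : HeightOneSpectrum (𝓞 k)} {p : ℕ} (hp : p.Prime) (hp2 : p ≠ 2)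
    (hv : v.valuation k (p : k) < 1) : v.valuation k 2 = 1 := by
  refine le_antisymm (valuation_two_le v) (not_lt.mp fun h => hp2 ?_)
  have h1 := (valuation_intCast_lt_one_iff hp hv 2).mp (by exact_mod_cast h)
  exact (Nat.prime_dvd_prime_iff_eq hp Nat.prime_two).mp (by exact_mod_cast h1)

end

section tower

variable {k : Type*} [Field k] [NumberField k] {K : Type*} [Field K] [NumberField K] [Algebra k K]
  {L : Type*} [Field L] [NumberField L] [Algebra k L] [Algebra K L] [IsScalarTower k K L]

theorem under_under (w : HeightOneSpectrum (𝓞 L)) : under k (under K w) = under k w := by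
  refine eq_of_valuation_lt_one fun x hx => ?_
  rwa [← valuation_algebraMap_lt_one_iff, ← valuation_algebraMap_lt_one_iff,
    ← IsScalarTower.algebraMap_apply, valuation_algebraMap_lt_one_iff] at hx

omit [NumberField k] in
theorem under_conj_restrictNormal [Normal k K] (φ : L ≃ₐ[k] L) (w : HeightOneSpectrum (𝓞 L)) :
    under K (conj (φ : L ≃+* L) w) =
      conj ((φ.restrictNormal K : K ≃ₐ[k] K) : K ≃+* K) (under K w) := by
  refine eq_of_valuation_lt_one fun x hx => ?_
  obtain ⟨y, rfl⟩ := ((φ.restrictNormal K : K ≃ₐ[k] K) : K ≃+* K).surjective x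
  rw [valuation_conj, ← valuation_algebraMap_lt_one_iff]
  rw [← valuation_algebraMap_lt_one_iff] at hx
  have h1 : algebraMap K L (((φ.restrictNormal K : K ≃ₐ[k] K) : K ≃+* K) y) =
    (φ : L ≃+* L) (algebraMap K L y) := φ.restrictNormal_commutes K y
  rwa [h1, valuation_conj] at hx

theorem exists_conj_eq_self [IsGalois k L] (h2 : Module.finrank k K = 2) {φ : L ≃ₐ[k] L}
    (hφ : ∃ x : K, φ (algebraMap K L x) ≠ algebraMap K L x) {w : HeightOneSpectrum (𝓞 L)}
    (hs : ¬ IsSplit K (under k w)) :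
    ∃ n : L ≃ₐ[K] L, conj ((φ : L ≃+* L).trans (n : L ≃+* L)) w = w := by
  have hgal := isGalois_of_finrank_two h2
  have hKL : IsGalois K L := IsGalois.tower_top_of_isGalois k K L
  have hσ : φ.restrictNormal K ≠ 1 := fun h => by
    obtain ⟨x, hx⟩ := hφ
    refine hx ?_
    rw [← φ.restrictNormal_commutes K x, h, AlgEquiv.one_apply]
  rw [← under_under (K := K), isSplit_iff h2 _ hσ, not_not, ← under_conj_restrictNormal] at hs
  obtain ⟨n, hn⟩ := exists_conj_eq hs
  exact ⟨n, by rw [conj_trans, hn]⟩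

theorem ord_under_natCast {w : HeightOneSpectrum (𝓞 L)} {p : ℕ} (h : ord w (p : L) = 1) :
    ram K w = 1 ∧ ord (under K w) (p : K) = 1 := by
  have h1 := ord_algebraMap w (p : K)
  rw [map_natCast, h] at h1
  have h3 : (ram K w : ℤ) = 1 := Int.eq_one_of_mul_eq_one_right (Int.natCast_nonneg _) h1.symm
  rw [h3, one_mul] at h1
  exact ⟨by exact_mod_cast h3, h1.symm⟩

theorem exists_local_subgroup_of_even (h2 : Module.finrank k K = 2) {w : HeightOneSpectrum (𝓞 L)}
    (hs : ¬ IsSplit K (under k w)) {p : ℕ} (hp : ord w (p : L) = 1) {b : kˣ}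
    (hb : Even (ord w (algebraMap k L b))) :
    ∃ H : Subgroup kˣ, H ≠ ⊤ ∧ (Units.map (Algebra.norm k : K →* k)).range ≤ H ∧
      levelFour (under k w) ≤ H ∧ b ∈ H := by
  obtain ⟨hram, hpk⟩ := ord_under_natCast (K := k) hp
  obtain ⟨-, hpK⟩ := ord_under_natCast (K := K) hp
  obtain ⟨hramk, -⟩ := ord_under_natCast (K := k) hpK
  obtain ⟨σ, hσ⟩ := exists_ne_one_of_finrank_two h2
  refine ⟨evenOrd (under k w), fun htop => ?_, ?_, fun u hu => ?_, ?_⟩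
  · obtain ⟨x, hx, hx1⟩ := exists_ord_eq (under k w) 1
    have h1 : Units.mk0 x hx ∈ evenOrd (under k w) := htop ▸ Subgroup.mem_top _
    rw [mem_evenOrd, Units.val_mk0, hx1] at h1
    exact absurd h1 (by decide)
  · rintro _ ⟨y, rfl⟩
    rw [← under_under (K := K)] at hs ⊢
    exact even_ord_norm h2 σ hσ hs hramk y
  · rw [mem_evenOrd, (valuation_eq_one_iff _ u.ne_zero).mp (valuation_eq_one_of_mem_levelFour hu)]
    exact Even.zero
  · rw [ord_algebraMap, hram, Nat.cast_one, one_mul] at hb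
    exact hb

/-- Units which are congruent to a product `ℓ * φ ℓ`. -/
def twistedNorms (k : Type*) [Field k] {L : Type*} [Field L] [NumberField L] [Algebra k L]
    (φ : L ≃ₐ[k] L) (w : HeightOneSpectrum (𝓞 L)) : Subgroup kˣ where
  carrier := {b | ∃ l : Lˣ, w.valuation L (algebraMap k L b / (l * φ l) - 1) < 1}
  one_mem' := ⟨1, by simp⟩
  mul_mem' := by
    rintro a b ⟨l, hl⟩ ⟨m, hm⟩
    refine ⟨l * m, ?_⟩
    have h1 := valuation_eq_one_of_sub_lt (map_one (w.valuation L)) hl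
    have h3 : algebraMap k L (a * b : kˣ) / ((l * m : Lˣ) * φ (l * m : Lˣ)) - 1 =
        algebraMap k L a / (l * φ l) * (algebraMap k L b / (m * φ m) - 1) +
          (algebraMap k L a / (l * φ l) - 1) := by
      rw [Units.val_mul, Units.val_mul, map_mul, map_mul]
      ring
    rw [h3]
    refine (w.valuation L).map_add_lt ?_ hl
    rwa [map_mul, h1, one_mul]
  inv_mem' := by
    rintro a ⟨l, hl⟩
    refine ⟨l⁻¹, ?_⟩
    have h1 := valuation_eq_one_of_sub_lt (map_one (w.valuation L)) hl
    have h0 : algebraMap k L a ≠ 0 := (map_ne_zero _).mpr a.ne_zero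
    have h2 : φ (l : L) ≠ 0 := (map_ne_zero _).mpr l.ne_zero
    have h3 : algebraMap k L (a⁻¹ : kˣ) / ((l⁻¹ : Lˣ) * φ (l⁻¹ : Lˣ)) - 1 =
        - ((algebraMap k L a / (l * φ l) - 1) * (algebraMap k L a / (l * φ l))⁻¹) := by
      rw [Units.val_inv_eq_inv_val, Units.val_inv_eq_inv_val, map_inv₀, map_inv₀]
      have := l.ne_zero
      field_simp
      ring
    rw [h3, Valuation.map_neg, map_mul, map_inv₀, h1, inv_one, mul_one]
    exact hl

theorem exists_local_subgroup_of_tame (h2 : Module.finrank k K = 2) [IsGalois k L]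
    {φ : L ≃ₐ[k] L} (hφ : ∃ x : K, φ (algebraMap K L x) ≠ algebraMap K L x)
    {w : HeightOneSpectrum (𝓞 L)} (hw : conj (φ : L ≃+* L) w = w) {q : ℕ} (hq : q.Prime)
    (hq2 : q ≠ 2) (hwq : w.valuation L (q : L) < 1)
    (hres : ∀ y : L, w.valuation L y ≤ 1 → ∃ c : ℤ, w.valuation L (y - c) < 1)
    {b : kˣ} {l : Lˣ} (hb : algebraMap k L b = l * φ l) :
    ∃ H : Subgroup kˣ, H ≠ ⊤ ∧ (Units.map (Algebra.norm k : K →* k)).range ≤ H ∧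
      levelFour (under k w) ≤ H ∧ b ∈ H := by
  have hφw (y : L) : w.valuation L (φ y) = w.valuation L y := valuation_apply_of_conj_eq hw y
  refine ⟨twistedNorms k φ w, fun htop => ?_, ?_, fun u hu => ⟨1, ?_⟩, ⟨l, ?_⟩⟩
  · have hqf : Fact q.Prime := ⟨hq⟩
    obtain ⟨a, ha⟩ := FiniteField.exists_nonsquare (F := ZMod q) (by rwa [ZMod.ringChar_zmod_n])
    obtain ⟨u, rfl⟩ := ZMod.intCast_surjective a
    have hwu : w.valuation L (u : L) = 1 := by
      refine le_antisymm (valuation_intCast_le_one w u) (not_lt.mp fun h => ha ?_)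
      rw [valuation_intCast_lt_one_iff hq hwq, ← ZMod.intCast_zmod_eq_zero_iff_dvd] at h
      rw [h]
      exact IsSquare.zero
    have hu0 : (u : k) ≠ 0 := fun h => by
      have h1 : (u : L) = 0 := by rw [← map_intCast (algebraMap k L), h, map_zero]
      rw [h1, map_zero] at hwu
      exact zero_ne_one hwu
    obtain ⟨m, hm⟩ : Units.mk0 (u : k) hu0 ∈ twistedNorms k φ w := htop ▸ Subgroup.mem_top _
    rw [Units.val_mk0, map_intCast] at hm
    have h1 := valuation_eq_one_of_sub_lt (map_one (w.valuation L)) hm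
    rw [map_div₀, map_mul, hφw, hwu, one_div, inv_eq_one, ← pow_two] at h1
    have h3 : w.valuation L (m : L) = 1 := (pow_eq_one_iff_of_nonneg zero_le two_ne_zero).mp h1
    obtain ⟨c, hc⟩ := hres m h3.le
    have hc' : w.valuation L (φ m - c) < 1 := by
      rw [← map_intCast φ c, ← map_sub, hφw]
      exact hc
    have hwm : w.valuation L (m * φ m) = 1 := by rw [map_mul, hφw, h3, one_mul]
    have hmm : (m : L) * φ m ≠ 0 := mul_ne_zero m.ne_zero ((map_ne_zero φ).mpr m.ne_zero)
    have h4 : w.valuation L ((u - c ^ 2 : ℤ) : L) < 1 := by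
      have h5 : ((u - c ^ 2 : ℤ) : L) = (u / (m * φ m) - 1) * (m * φ m) +
          (φ m * (m - c) + c * (φ m - c)) := by
        rw [sub_mul, div_mul_cancel₀ _ hmm]
        push_cast
        ring
      rw [h5]
      refine (w.valuation L).map_add_lt ?_ ((w.valuation L).map_add_lt ?_ ?_)
      · rwa [map_mul, hwm, mul_one]
      · rwa [map_mul, hφw, h3, one_mul]
      · rw [map_mul]
        exact (mul_le_of_le_one_left' (valuation_intCast_le_one w c)).trans_lt hc'
    rw [valuation_intCast_lt_one_iff hq hwq, ← ZMod.intCast_zmod_eq_zero_iff_dvd] at h4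
    refine ha ⟨(c : ZMod q), ?_⟩
    push_cast at h4
    rw [sub_eq_zero.mp h4, pow_two]
  · rintro _ ⟨y, rfl⟩
    have hgal := isGalois_of_finrank_two h2
    have hσ : φ.restrictNormal K ≠ 1 := fun h => by
      obtain ⟨x, hx⟩ := hφ
      refine hx ?_
      rw [← φ.restrictNormal_commutes K x, h, AlgEquiv.one_apply]
    refine ⟨Units.map (algebraMap K L : K →* L) y, ?_⟩
    have h0 : algebraMap K L (y : K) ≠ 0 := (map_ne_zero _).mpr y.ne_zero
    have h3 : algebraMap k L (Algebra.norm k (y : K)) =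
        algebraMap K L y * φ (algebraMap K L y) := by
      rw [IsScalarTower.algebraMap_apply k K L, algebraMap_norm h2 _ hσ, map_mul,
        φ.restrictNormal_commutes K]
    change w.valuation L (algebraMap k L (Algebra.norm k (y : K)) /
      (algebraMap K L y * φ (algebraMap K L y)) - 1) < 1
    rw [h3, div_self (mul_ne_zero h0 ((map_ne_zero φ).mpr h0)), sub_self, map_zero]
    exact zero_lt_one
  · have h3 : w.valuation L (algebraMap k L ((u : k) - 1)) < 1 := by
      rw [valuation_algebraMap_lt_one_iff]
      exact lt_of_lt_of_le (mem_levelFour.mp hu) (valuation_four_le _)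
    simpa using h3
  · rw [hb, div_self (mul_ne_zero l.ne_zero ((map_ne_zero φ).mpr l.ne_zero)), sub_self, map_zero]
    exact zero_lt_one

end tower

end PlaceTheory

namespace PlaceTheory

open NumberField IsDedekindDomain TwistedProduct

theorem DyadicSplit.of_under {k : Type*} [Field k] [NumberField k] {K : Type*} [Field K]
    [NumberField K] [Algebra k K] {w : HeightOneSpectrum (𝓞 K)} (h : DyadicSplit w) :
    DyadicSplit (under k w) := fun y hy => by
  have h1 (x : k) := valuation_algebraMap_le w x 1
  simp only [map_one] at h1
  have h2 (x : k) := valuation_algebraMap_le w x 2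
  simp only [map_ofNat] at h2
  rcases h _ ((h1 y).mpr hy) with h3 | h3
  · exact Or.inl ((h2 y).mp h3)
  · exact Or.inr ((h2 _).mp (by rwa [map_sub, map_one]))

section

variable {L : Type*} [Field L] [NumberField L] {c : NormalizedCocycle (L ≃ₐ[ℚ] L) Lˣ}

/-- The local hypothesis at `w` for the extension defined by `c` to be trivial. -/
def IsLocallyTrivial (c : NormalizedCocycle (L ≃ₐ[ℚ] L) Lˣ) (w : HeightOneSpectrum (𝓞 L)) : Prop :=
  (∃ p : ℕ, ord w (p : L) = 1) ∨
    ∃ q : ℕ, q.Prime ∧ q ≠ 2 ∧ w.valuation L (q : L) < 1 ∧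
      (∀ y : L, w.valuation L y ≤ 1 → ∃ m : ℤ, w.valuation L (y - m) < 1) ∧
      ∀ φ : L ≃ₐ[ℚ] L, conj (φ : L ≃+* L) w = w → ∃ y : Extension c, y.proj = φ ∧ y * y = 1

theorem ord_coeff_mul (hc : ∀ g h, c.val g h ^ 2 = 1) {w : HeightOneSpectrum (𝓞 L)}
    {x : Extension c} (hx : conj (x.proj : L ≃+* L) w = w) (y : Extension c) :
    ord w ((x * y).coeff : L) = ord w (x.coeff : L) + ord w (y.coeff : L) := by
  have h1 : ord w (c.val x.proj y.proj : L) = 0 := by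
    have h2 : ord w ((c.val x.proj y.proj : L) ^ 2) = 0 := by
      rw [← Units.val_pow_eq_pow_val, hc, Units.val_one, ord_one]
    rw [ord_pow] at h2
    simpa using h2
  have h3 : ord w ((x.proj • y.coeff : Lˣ) : L) = ord w (y.coeff : L) :=
    ord_apply_of_conj_eq hx _
  rw [Extension.coeff_mul, Units.val_mul, Units.val_mul,
    ord_mul w (mul_ne_zero x.coeff.ne_zero (Units.ne_zero _)) (Units.ne_zero _),
    ord_mul w x.coeff.ne_zero (Units.ne_zero _), h1, h3, add_zero]

theorem ord_coeff_of_pow_eq_one (hc : ∀ g h, c.val g h ^ 2 = 1) {w : HeightOneSpectrum (𝓞 L)}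
    {x : Extension c} (hx : conj (x.proj : L ≃+* L) w = w) {n : ℕ} (hn : n ≠ 0)
    (hxn : x ^ n = 1) : ord w (x.coeff : L) = 0 := by
  have h1 (m : ℕ) : ord w ((x ^ m).coeff : L) = m * ord w (x.coeff : L) := by
    induction m with
    | zero =>
      rw [pow_zero, Nat.cast_zero, zero_mul]
      change ord w ((1 : Lˣ) : L) = 0
      rw [Units.val_one, ord_one]
    | succ m ih =>
      rw [pow_succ', ord_coeff_mul hc hx, ih]
      push_cast
      ring
  have h2 := h1 n
  rw [hxn] at h2
  change ord w ((1 : Lˣ) : L) = _ at h2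
  rw [Units.val_one, ord_one] at h2
  rcases mul_eq_zero.mp h2.symm with h3 | h3
  · exact absurd (Nat.cast_eq_zero.mp h3) hn
  · exact h3

theorem pow_card_eq_one_of_isLift {C : Subgroup (Extension c)} {N : Subgroup (L ≃ₐ[ℚ] L)}
    (hC : Extension.IsLift C N) {x : Extension c} (hx : x ∈ C) :
    x ^ Nat.card (L ≃ₐ[ℚ] L) = 1 :=
  hC.2 _ (C.pow_mem hx _) (by
    change Extension.projHom c (x ^ _) = 1
    rw [map_pow, pow_card_eq_one'])

end

section tower

variable {k : Type*} [Field k] [NumberField k] {K : Type*} [Field K] [NumberField K] [Algebra k K]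
  {L : Type*} [Field L] [NumberField L] [Algebra k L] [Algebra K L] [IsScalarTower k K L]

theorem exists_local_subgroup [IsGalois k L] (h2 : Module.finrank k K = 2)
    {c : NormalizedCocycle (L ≃ₐ[ℚ] L) Lˣ} (hc : ∀ g h, c.val g h ^ 2 = 1)
    {N H : Subgroup (L ≃ₐ[ℚ] L)} (hNH : N ≤ H) (hN : ∀ n : L ≃ₐ[ℚ] L,
      (∀ x : K, n (algebraMap K L x) = algebraMap K L x) → n ∈ N)
    (hH : ∀ h ∈ H, ∀ x : k, h (algebraMap k L x) = algebraMap k L x)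
    {C : Subgroup (Extension c)} {t y : Extension c} {b : kˣ}
    (hC : Extension.IsLift C N) (htH : t.proj ∈ H) (htN : t.proj ∉ N)
    (ht : ∀ x ∈ C, t * x * t⁻¹ ∈ C) (hy : y ∈ C)
    (htt : t * t = Extension.incl c (Units.map (algebraMap k L : k →* L) b) * y)
    {w : HeightOneSpectrum (𝓞 L)} (hw : IsLocallyTrivial c w) :
    IsSplit K (under k w) ∨ ∃ H : Subgroup kˣ, H ≠ ⊤ ∧
      (Units.map (Algebra.norm k : K →* k)).range ≤ H ∧ levelFour (under k w) ≤ H ∧ b ∈ H := by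
  refine or_iff_not_imp_left.mpr fun hs => ?_
  let B : Lˣ := Units.map (algebraMap k L : k →* L) b
  let φ₀ : L ≃ₐ[k] L := AlgEquiv.ofRingEquiv (f := (t.proj : L ≃+* L)) (hH _ htH)
  obtain ⟨n, hn⟩ := exists_conj_eq_self h2 (φ := φ₀) (w := w) (by
    by_contra! hall
    exact htN (hN _ hall)) hs
  let nG : L ≃ₐ[ℚ] L := AlgEquiv.ofRingEquiv (f := (n : L ≃+* L)) (fun r => by simp)
  have hnG : nG ∈ N := hN _ n.commutes
  obtain ⟨x, hx, hxp⟩ := hC.exists_lift hnG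
  have hφw : conj ((x * t).proj : L ≃+* L) w = w := by
    rw [Extension.proj_mul, hxp]
    exact hn
  have hsmulB (h : L ≃ₐ[ℚ] L) (hh : h ∈ H) : h • B = B := Units.ext (hH h hh b)
  have hsq : x * t * (x * t) = Extension.incl c B * (x * (t * x * t⁻¹) * y) := by
    have h1 := Extension.mul_incl (c := c) (x * (t * x * t⁻¹)) B
    rw [hsmulB _ (hNH (hC.proj_mem (C.mul_mem hx (ht x hx))))] at h1
    calc x * t * (x * t) = x * (t * x * t⁻¹) * (t * t) := by group
      _ = (x * (t * x * t⁻¹)) * Extension.incl c B * y := by rw [htt]; group; rfl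
      _ = _ := by rw [h1]; group
  have hz : x * (t * x * t⁻¹) * y ∈ C := C.mul_mem (C.mul_mem hx (ht x hx)) hy
  rcases hw with ⟨p, hp⟩ | ⟨q, hq, hq2, hwq, hres, hlift⟩
  · refine exists_local_subgroup_of_even h2 hs hp ?_
    have hBw : conj ((Extension.incl c B).proj : L ≃+* L) w = w := by
      refine eq_of_valuation_eq fun u => ?_
      exact valuation_conj w (1 : L ≃+* L) u
    have hzp : (x * (t * x * t⁻¹) * y).proj = (x * t).proj * (x * t).proj := by
      rw [← Extension.proj_mul, hsq, Extension.proj_mul (Extension.incl c B),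
        Extension.proj_incl, one_mul]
    have hzw : conj ((x * (t * x * t⁻¹) * y).proj : L ≃+* L) w = w := by
      rw [hzp]
      exact (conj_trans ((x * t).proj : L ≃+* L) ((x * t).proj : L ≃+* L) w).trans
        (by rw [hφw, hφw])
    have h1 := congrArg (fun e : Extension c => ord w (e.coeff : L)) hsq
    change ord w ((x * t * (x * t)).coeff : L) = _ at h1
    rw [ord_coeff_mul hc hφw, ord_coeff_mul hc hBw, ord_coeff_of_pow_eq_one hc hzw
      Nat.card_pos.ne' (pow_card_eq_one_of_isLift hC hz), add_zero] at h1
    exact ⟨_, h1.symm⟩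
  · obtain ⟨e, hep, hee⟩ := hlift _ hφw
    obtain ⟨l, hl⟩ := Extension.exists_eq_incl_mul hep.symm
    let φ : L ≃ₐ[k] L := AlgEquiv.ofRingEquiv (f := ((x * t).proj : L ≃+* L)) (hH _ (by
      rw [Extension.proj_mul]
      exact H.mul_mem (hNH (hC.proj_mem hx)) htH))
    refine exists_local_subgroup_of_tame (l := l) h2 (φ := φ) ?_ hφw hq hq2 hwq hres ?_
    · by_contra! hall
      have h1 := hN _ hall
      rw [Extension.proj_mul] at h1
      exact htN ((N.mul_mem_cancel_left (hC.proj_mem hx)).mp h1)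
    · have h1 : x * t * (x * t) = Extension.incl c (l * (x * t).proj • l) := by
        calc x * t * (x * t) = Extension.incl c l * (e * Extension.incl c l) * e := by
              rw [hl]; group
          _ = Extension.incl c l * Extension.incl c ((x * t).proj • l) * (e * e) := by
              rw [Extension.mul_incl, hep]; group
          _ = _ := by rw [hee, mul_one, map_mul]
      rw [hsq] at h1
      have h3 : Extension.incl c B * (x * (t * x * t⁻¹) * y) =
          Extension.incl c (l * (x * t).proj • l) * 1 := h1.trans (mul_one _).symm
      have h4 := (hC.eq_of_incl_mul_mem hz C.one_mem h3).1
      exact congrArg (fun u : Lˣ => (u : L)) h4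

theorem exists_twisted_norm [IsGalois k L] [IsTotallyReal L] (h2 : Module.finrank k K = 2)
    (hdy : ∀ w : HeightOneSpectrum (𝓞 L), w.valuation L 2 < 1 → DyadicSplit w)
    {c : NormalizedCocycle (L ≃ₐ[ℚ] L) Lˣ} (hc : ∀ g h, c.val g h ^ 2 = 1)
    (hloc : ∀ w, IsLocallyTrivial c w)
    {N H : Subgroup (L ≃ₐ[ℚ] L)} (hNH : N ≤ H) (hN : ∀ n : L ≃ₐ[ℚ] L,
      (∀ x : K, n (algebraMap K L x) = algebraMap K L x) → n ∈ N)
    (hH : ∀ h ∈ H, ∀ x : k, h (algebraMap k L x) = algebraMap k L x)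
    (hHk : ∀ x : L, (∀ h ∈ H, h x = x) → ∃ a : k, algebraMap k L a = x)
    (hNK : ∀ n ∈ N, ∀ x : K, n (algebraMap K L x) = algebraMap K L x)
    {C : Subgroup (Extension c)} {t y : Extension c} {b : Lˣ}
    (hC : Extension.IsLift C N) (htH : t.proj ∈ H) (htN : t.proj ∉ N)
    (ht : ∀ x ∈ C, t * x * t⁻¹ ∈ C) (hy : y ∈ C)
    (htt : t * t = Extension.incl c b * y) (hb : ∀ h ∈ H, h • b = b) :
    ∃ z : Lˣ, (∀ n ∈ N, n • z = z) ∧ z * t.proj • z = b := by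
  obtain ⟨a, ha⟩ := hHk b (fun h hh => congrArg Units.val (hb h hh))
  have ha0 : a ≠ 0 := by
    rintro rfl
    rw [map_zero] at ha
    exact b.ne_zero ha.symm
  have hab : Units.map (algebraMap k L : k →* L) (Units.mk0 a ha0) = b := Units.ext ha
  have hk : IsTotallyReal k := IsTotallyReal.of_algebra k L
  have hK : IsTotallyReal K := IsTotallyReal.of_algebra K L
  obtain ⟨z, hz⟩ := mem_range_norm_of_local (K := K) h2 (fun v hv => by
    obtain ⟨w, rfl⟩ := exists_under_eq (K := L) v
    refine (hdy w ?_).of_under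
    rwa [← map_ofNat (algebraMap k L), valuation_algebraMap_lt_one_iff]) (Units.mk0 a ha0)
    (fun v => by
      obtain ⟨w, rfl⟩ := exists_under_eq (K := L) v
      exact exists_local_subgroup h2 hc hNH hN hH hC htH htN ht hy (hab ▸ htt) (hloc w))
  refine ⟨Units.map (algebraMap K L : K →* L) z, fun n hn => Units.ext (hNK n hn z), Units.ext ?_⟩
  have hgal := isGalois_of_finrank_two h2
  let φ : L ≃ₐ[k] L := AlgEquiv.ofRingEquiv (f := (t.proj : L ≃+* L)) (hH _ htH)
  have hσ : φ.restrictNormal K ≠ 1 := fun h => by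
    refine htN (hN _ fun x => ?_)
    have h1 := φ.restrictNormal_commutes K x
    rw [h, AlgEquiv.one_apply] at h1
    exact h1.symm
  change algebraMap K L z * φ (algebraMap K L z) = b
  rw [← φ.restrictNormal_commutes K, ← map_mul, ← algebraMap_norm h2 _ hσ,
    ← IsScalarTower.algebraMap_apply, ← ha]
  exact congrArg (fun u : kˣ => algebraMap k L u) hz

end tower

/-- A sign-valued 2-cocycle which is locally trivial becomes trivial in `Lˣ`. -/
theorem exists_unit_trivialization {L : Type*} [Field L] [NumberField L] [IsGalois ℚ L]
    [IsTotallyReal L] (hG : IsPGroup 2 (L ≃ₐ[ℚ] L))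
    (hdy : ∀ w : HeightOneSpectrum (𝓞 L), w.valuation L 2 < 1 → DyadicSplit w)
    {c : NormalizedCocycle (L ≃ₐ[ℚ] L) Lˣ} (hc : ∀ g h, c.val g h ^ 2 = 1)
    (hloc : ∀ w, IsLocallyTrivial c w) :
    ∃ a : (L ≃ₐ[ℚ] L) → Lˣ, ∀ g h, a (g * h) = a g * g • a h * c.val g h := by
  refine Extension.exists_trivialization hG (fun N β hβ => ?_)
    (fun N H C t y b hNH hrel hC htH htN ht hy htt hb => ?_)
  · let e := IntermediateField.subgroupEquivAlgEquiv N
    obtain ⟨γ, hγ⟩ := groupCohomology.isMulCoboundary₁_of_isMulCocycle₁_of_aut_to_units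
      (fun g => β (e.symm g)) (fun g h => by
        simp only [map_mul, hβ]
        exact mul_comm _ _)
    refine ⟨γ, fun n => ?_⟩
    have h1 := hγ (e n)
    exact (congrArg β (e.symm_apply_apply n)).symm.trans h1.symm
  · let k := IntermediateField.fixedField H
    let K := IntermediateField.fixedField N
    have hle : k ≤ K := IntermediateField.fixedField_antitone hNH
    let _ : Algebra k K := (IntermediateField.inclusion hle).toRingHom.toAlgebra
    have : IsScalarTower k K L := IsScalarTower.of_algebraMap_eq fun _ => rfl
    have h2 : Module.finrank k K = 2 := by
      have h3 := Module.finrank_mul_finrank k K L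
      rw [IntermediateField.finrank_fixedField_eq_card,
        IntermediateField.finrank_fixedField_eq_card, ← (N.subgroupOf H).index_mul_card,
        Nat.card_congr (Subgroup.subgroupOfEquivOfLe hNH).toEquiv] at h3
      exact mul_right_cancel₀ Nat.card_pos.ne' (h3.trans (congrArg (· * _) hrel))
    refine exists_twisted_norm (k := k) (K := K) h2 hdy hc hloc hNH (fun n hn => ?_)
      (fun h hh x => ?_) (fun x hx => ?_) (fun n hn x => ?_) hC htH htN ht hy htt hb
    · rw [← IntermediateField.fixingSubgroup_fixedField N, IntermediateField.mem_fixingSubgroup_iff]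
      exact fun x hx => hn ⟨x, hx⟩
    · exact (IntermediateField.mem_fixedField_iff H _).mp x.2 h hh
    · exact ⟨⟨x, (IntermediateField.mem_fixedField_iff H x).mpr hx⟩, rfl⟩
    · exact (IntermediateField.mem_fixedField_iff N _).mp x.2 n hn

end PlaceTheory

namespace PlaceTheory

open NumberField IsDedekindDomain

section

variable {L : Type*} [Field L] [NumberField L] {M : Type*} [Field M] [NumberField M] [Algebra L M]

theorem exists_eq_add_mul_sqrt (h2 : Module.finrank L M = 2) {α : L} (hα : ¬ IsSquare α) {r : M}
    (hr : r ^ 2 = algebraMap L M α) (y : M) :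
    ∃ a b : L, y = algebraMap L M a + algebraMap L M b * r := by
  obtain ⟨σ, hσ⟩ := exists_ne_one_of_finrank_two h2
  have hσr := apply_sqrt_eq_neg h2 σ hσ hα hr
  have hr0 : r ≠ 0 := by
    rintro rfl
    rw [zero_pow two_ne_zero] at hr
    exact hα ⟨0, by rw [mul_zero]; exact (map_eq_zero (algebraMap L M)).mp hr.symm⟩
  have hinv := involution_apply_apply h2 σ hσ
  obtain ⟨a, ha⟩ := mem_range_of_fixed h2 σ hσ (x := (y + σ y) / 2) (by
    rw [map_div₀, map_add, hinv, map_ofNat, add_comm])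
  obtain ⟨b, hb⟩ := mem_range_of_fixed h2 σ hσ (x := (y - σ y) / (2 * r)) (by
    rw [map_div₀, map_sub, hinv, map_mul, map_ofNat, hσr]
    field_simp
    ring)
  refine ⟨a, b, ?_⟩
  rw [ha, hb]
  field_simp
  ring

theorem isGalois_of_sqrt [IsGalois ℚ L] (h2 : Module.finrank L M = 2) {α : L} (hα : ¬ IsSquare α)
    {r : M} (hr : r ^ 2 = algebraMap L M α)
    (hg : ∀ g : L ≃ₐ[ℚ] L, ∃ a : L, g α = α * a ^ 2) : IsGalois ℚ M := by
  let Ω := AlgebraicClosure M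
  let j : M →ₐ[ℚ] Ω := IsScalarTower.toAlgHom ℚ M Ω
  have halg : Algebra.IsAlgebraic ℚ Ω := Algebra.IsAlgebraic.trans ℚ M Ω
  have hΩ : Normal ℚ Ω := normal_iff.mpr fun x =>
    ⟨(Algebra.IsAlgebraic.isAlgebraic x).isIntegral, IsAlgClosed.splits _⟩
  have hn : Normal ℚ j.fieldRange := by
    refine IntermediateField.normal_iff_forall_fieldRange_le.mpr ?_
    rintro τ' _ ⟨⟨_, ⟨m, rfl⟩⟩, rfl⟩
    let τ : M →ₐ[ℚ] Ω := τ'.comp j.rangeRestrict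
    change τ m ∈ j.fieldRange
    let i : L →ₐ[ℚ] M := IsScalarTower.toAlgHom ℚ L M
    let g₀ : L →ₐ[ℚ] L := (τ.comp i).restrictNormal L
    have hg₀ (x : L) : τ (i x) = j (i (g₀ x)) := ((τ.comp i).restrictNormal_commutes L x).symm
    let g := AlgEquiv.ofBijective g₀ (Algebra.IsAlgebraic.algHom_bijective g₀)
    obtain ⟨a, ha⟩ := hg g
    have hτr : τ r ^ 2 = j (i a * r) ^ 2 := by
      rw [← map_pow, ← map_pow, mul_pow, hr]
      change τ (i α) = j (i a ^ 2 * i α)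
      rw [hg₀, ← map_pow, ← map_mul, mul_comm]
      exact congrArg (fun x => j (i x)) ha
    have hr' : τ r ∈ j.fieldRange := by
      rcases sq_eq_sq_iff_eq_or_eq_neg.mp hτr with h | h
      · exact ⟨_, h.symm⟩
      · exact ⟨-(i a * r), by rw [h]; exact map_neg j _⟩
    obtain ⟨x, z, rfl⟩ := exists_eq_add_mul_sqrt h2 hα hr m
    rw [map_add, map_mul]
    refine add_mem ⟨_, (hg₀ x).symm⟩ (mul_mem ⟨_, (hg₀ z).symm⟩ hr')
  have : Normal ℚ M := by
    let e : j.fieldRange ≃ₐ[ℚ] M := (AlgEquiv.ofInjectiveField j).symm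
    exact @Normal.of_algEquiv _ _ _ _ _ _ _ _ hn e
  exact ⟨⟩

end

/-- Residues modulo `w` are represented by integers. -/
def HasIntegerResidues {L : Type*} [Field L] [NumberField L] (w : HeightOneSpectrum (𝓞 L)) : Prop :=
  ∀ y : L, w.valuation L y ≤ 1 → ∃ m : ℤ, w.valuation L (y - m) < 1

/-- A totally real Galois field of 2-power degree, ramified exactly at `S` with index two, in
which the primes of `T` split completely. -/
structure IsAdmissible (S T : Finset ℕ) (L : Type*) [Field L] [NumberField L] : Prop where
  isGalois : IsGalois ℚ L
  isPGroup : IsPGroup 2 (L ≃ₐ[ℚ] L)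
  isTotallyReal : IsTotallyReal L
  prime : ∀ p ∈ S ∪ T, p.Prime
  two_mem : 2 ∈ T
  split : ∀ p ∈ T, ∀ w : HeightOneSpectrum (𝓞 L), w.valuation L (p : L) < 1 →
    ord w (p : L) = 1 ∧ HasIntegerResidues w
  tame : ∀ q ∈ S, ∀ w : HeightOneSpectrum (𝓞 L), w.valuation L (q : L) < 1 →
    ord w (q : L) = 2 ∧ HasIntegerResidues w
  unram : ∀ p : ℕ, p.Prime → p ∉ S → ∀ w : HeightOneSpectrum (𝓞 L), w.valuation L (p : L) < 1 →
    ord w (p : L) = 1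
  sqrt : ∀ q ∈ S, ∃ r : L, r ^ 2 = q

theorem valuation_natCast_eq_one {L : Type*} [Field L] [NumberField L]
    {w : HeightOneSpectrum (𝓞 L)} {p q : ℕ} (hp : p.Prime) (hq : q.Prime) (hpq : p ≠ q)
    (hw : w.valuation L (p : L) < 1) : w.valuation L (q : L) = 1 := by
  refine le_antisymm (by simpa using valuation_intCast_le_one w (q : ℤ)) (not_lt.mp fun h => ?_)
  have h1 := (valuation_intCast_lt_one_iff hp hw (q : ℤ)).mp (by simpa using h)
  exact hpq ((Nat.prime_dvd_prime_iff_eq hp hq).mp (Int.natCast_dvd_natCast.mp h1))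

theorem exists_prime_valuation_lt_one {L : Type*} [Field L] [NumberField L]
    (w : HeightOneSpectrum (𝓞 L)) : ∃ p : ℕ, p.Prime ∧ w.valuation L (p : L) < 1 := by
  have := w.isMaximal
  obtain ⟨p, -, -, hp, hpp, -⟩ := Ideal.exists_prime_and_absNorm_eq_pow w.asIdeal
  exact ⟨p, hpp, by simpa using (w.valuation_lt_one_iff_mem (K := L) _).mpr hp⟩

section

variable {L : Type*} [Field L] [NumberField L] {M : Type*} [Field M] [NumberField M] [Algebra L M]

theorem HasIntegerResidues.of_under {w : HeightOneSpectrum (𝓞 M)} (h : res L w = 1)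
    (hw : HasIntegerResidues (under L w)) : HasIntegerResidues w := fun y hy => by
  obtain ⟨c, hc⟩ := exists_sub_lt_of_res_eq_one h hy
  obtain ⟨m, hm⟩ := hw (algebraMap (𝓞 L) L c) ((under L w).valuation_le_one c)
  refine ⟨m, ?_⟩
  rw [← valuation_algebraMap_lt_one_iff (K := M), map_sub, map_intCast] at hm
  rw [← sub_add_sub_cancel y (algebraMap L M (algebraMap (𝓞 L) L c))]
  exact Valuation.map_add_lt _ hc hm

theorem ord_natCast (w : HeightOneSpectrum (𝓞 M)) (p : ℕ) :
    ord w (p : M) = ram L w * ord (under L w) (p : L) := by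
  rw [← ord_algebraMap, map_natCast]

theorem valuation_under_natCast_lt_one {w : HeightOneSpectrum (𝓞 M)} {p : ℕ}
    (h : w.valuation M (p : M) < 1) : (under L w).valuation L (p : L) < 1 := by
  rwa [← valuation_algebraMap_lt_one_iff (K := M), map_natCast]

/-- Adjoining the square root of `α` to an admissible field. -/
theorem IsAdmissible.adjoin_sqrt {S T Q : Finset ℕ} (hL : IsAdmissible S T L) (hQ : Q ⊆ T)
    (h2Q : 2 ∉ Q) (h2 : Module.finrank L M = 2) {α : Lˣ} (hα : ¬ IsSquare (α : L)) {r : M}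
    (hr : r ^ 2 = algebraMap L M α) (hg : ∀ g : L ≃ₐ[ℚ] L, ∃ a : L, g α = α * a ^ 2)
    (hpos : ∀ φ : L →+* ℝ, 0 < φ α) (hQα : ∀ q ∈ Q, (q : L) = α)
    (hcls : ∀ p ∈ S ∪ T \ Q, ∀ w : HeightOneSpectrum (𝓞 L), w.valuation L (p : L) < 1 →
      α ∈ sqClass w)
    (heven : ∀ w : HeightOneSpectrum (𝓞 L), (∀ p ∈ S ∪ T, w.valuation L (p : L) = 1) →
      Even (ord w (α : L))) :
    IsAdmissible (S ∪ Q) (T \ Q) M ∧ (Q = ∅ → ∀ w : HeightOneSpectrum (𝓞 M), ram L w = 1) := by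
  have hgal := hL.isGalois
  have hreal := hL.isTotallyReal
  obtain ⟨σ, hσ⟩ := exists_ne_one_of_finrank_two h2
  have hσr := apply_sqrt_eq_neg h2 σ hσ hα hr
  have hgalM := isGalois_of_sqrt h2 hα hr hg
  have hcls' (p : ℕ) (hp : p ∈ S ∪ T \ Q) (w : HeightOneSpectrum (𝓞 M))
      (hw : w.valuation M (p : M) < 1) : ram L w = 1 ∧ res L w = 1 := by
    obtain ⟨w₁, w₂, hne, h1, h2'⟩ := isSplit_of_mem_sqClass h2 σ hσ hr hσr
      (hcls p hp (under L w) (valuation_under_natCast_lt_one hw))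
    by_cases hw1 : w = w₁
    · subst hw1
      exact ram_res_eq_one_of_ne h2 hne (h1.trans h2'.symm)
    · exact ram_res_eq_one_of_ne h2 hw1 h1.symm
  have hQ' (q : ℕ) (hq : q ∈ Q) (w : HeightOneSpectrum (𝓞 M))
      (hw : w.valuation M (q : M) < 1) : ram L w = 2 ∧ ord (under L w) (q : L) = 1 ∧
        HasIntegerResidues (under L w) := by
    have h1 := hL.split q (hQ hq) (under L w) (valuation_under_natCast_lt_one hw)
    refine ⟨ram_eq_two_of_odd h2 hr ?_, h1⟩
    rw [← hQα q hq, h1.1]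
    exact odd_one
  have hunr (p : ℕ) (hp : p.Prime) (hpS : p ∉ S ∪ Q) (w : HeightOneSpectrum (𝓞 M))
      (hw : w.valuation M (p : M) < 1) : ram L w = 1 := by
    by_cases hpT : p ∈ T
    · exact (hcls' p (Finset.mem_union_right _ (Finset.mem_sdiff.mpr
        ⟨hpT, fun h => hpS (Finset.mem_union_right _ h)⟩)) w hw).1
    have hw' := valuation_under_natCast_lt_one (L := L) hw
    refine ram_eq_one_of_even h2 σ hσ hr hσr
      (valuation_two_eq_one hp (fun h => hpT (h ▸ hL.two_mem)) hw') (heven _ fun p' hp' => ?_)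
    refine valuation_natCast_eq_one hp (hL.prime p' hp') ?_ hw'
    rintro rfl
    rcases Finset.mem_union.mp hp' with h | h
    · exact hpS (Finset.mem_union_left _ h)
    · exact hpT h
  refine ⟨⟨hgalM, ?_, ?_, ?_, ?_, ?_, ?_, ?_, ?_⟩, ?_⟩
  · obtain ⟨n, hn⟩ := IsPGroup.iff_card.mp hL.isPGroup
    rw [IsGalois.card_aut_eq_finrank] at hn
    refine IsPGroup.of_card (n := n + 1) ?_
    rw [IsGalois.card_aut_eq_finrank, ← Module.finrank_mul_finrank ℚ L M, h2, hn, pow_succ]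
  · exact isTotallyReal_of_sqrt h2 σ hσ α.ne_zero hr hσr hpos
  · intro p hp
    refine hL.prime p ?_
    rcases Finset.mem_union.mp hp with h | h
    · rcases Finset.mem_union.mp h with h | h
      · exact Finset.mem_union_left _ h
      · exact Finset.mem_union_right _ (hQ h)
    · exact Finset.mem_union_right _ (Finset.mem_sdiff.mp h).1
  · exact Finset.mem_sdiff.mpr ⟨hL.two_mem, h2Q⟩
  · intro p hp w hw
    obtain ⟨h3, h4⟩ := hcls' p (Finset.mem_union_right _ hp) w hw
    obtain ⟨h5, h6⟩ := hL.split p (Finset.mem_sdiff.mp hp).1 _ (valuation_under_natCast_lt_one hw)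
    exact ⟨by rw [ord_natCast (L := L), h3, h5]; rfl, h6.of_under h4⟩
  · intro q hq w hw
    rcases Finset.mem_union.mp hq with h | h
    · obtain ⟨h3, h4⟩ := hcls' q (Finset.mem_union_left _ h) w hw
      obtain ⟨h5, h6⟩ := hL.tame q h _ (valuation_under_natCast_lt_one hw)
      exact ⟨by rw [ord_natCast (L := L), h3, h5]; rfl, h6.of_under h4⟩
    · obtain ⟨h3, h4, h5⟩ := hQ' q h w hw
      exact ⟨by rw [ord_natCast (L := L), h3, h4]; rfl, h5.of_under (res_eq_one_of_ram h2 h3)⟩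
  · intro p hp hpS w hw
    rw [ord_natCast (L := L), hunr p hp hpS w hw, hL.unram p hp
      (fun h => hpS (Finset.mem_union_left _ h)) _ (valuation_under_natCast_lt_one hw)]
    rfl
  · intro q hq
    rcases Finset.mem_union.mp hq with h | h
    · obtain ⟨s, hs⟩ := hL.sqrt q h
      exact ⟨algebraMap L M s, by rw [← map_pow, hs, map_natCast]⟩
    · exact ⟨r, by rw [hr, ← hQα q h, map_natCast]⟩
  · rintro rfl w
    obtain ⟨p, hp, hw⟩ := exists_prime_valuation_lt_one w
    by_cases hpS : p ∈ S
    · exact (hcls' p (Finset.mem_union_left _ hpS) w hw).1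
    · exact hunr p hp (by simpa using hpS) w hw

end

end PlaceTheory

namespace PlaceTheory

open NumberField IsDedekindDomain TwistedProduct

section

variable {L : Type*} [Field L] [NumberField L]

theorem exists_valuation_natCast_lt_one (L : Type*) [Field L] [NumberField L] {p : ℕ}
    (hp : p.Prime) : ∃ w : HeightOneSpectrum (𝓞 L), w.valuation L (p : L) < 1 := by
  let v : HeightOneSpectrum (𝓞 ℚ) :=
    (Rat.HeightOneSpectrum.primesEquiv (R := 𝓞 ℚ)).symm ⟨p, hp⟩
  have hvp : Rat.HeightOneSpectrum.natGenerator v = p :=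
    congrArg Subtype.val ((Rat.HeightOneSpectrum.primesEquiv (R := 𝓞 ℚ)).apply_symm_apply ⟨p, hp⟩)
  obtain ⟨w, hw⟩ := exists_under_eq (K := L) v
  refine ⟨w, ?_⟩
  rw [← map_natCast (algebraMap ℚ L), valuation_algebraMap_lt_one_iff, hw,
    ← map_natCast (algebraMap (𝓞 ℚ) ℚ), v.valuation_lt_one_iff_mem]
  have h1 := (Rat.HeightOneSpectrum.natGenerator_dvd_iff v).mp (dvd_of_eq hvp)
  rw [← map_natCast (Rat.IsIntegralClosure.intEquiv (𝓞 ℚ)),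
    Ideal.mem_map_of_equiv] at h1
  obtain ⟨x, hx, hxp⟩ := h1
  rwa [(Rat.IsIntegralClosure.intEquiv (𝓞 ℚ)).injective hxp] at hx

theorem HasIntegerResidues.res_eq_one {w : HeightOneSpectrum (𝓞 L)} (hw : HasIntegerResidues w) :
    res ℚ w = 1 := by
  refine le_antisymm ?_ (res_pos w)
  rw [res, Ideal.inertiaDeg_eq_of_isMaximal (under ℚ w).asIdeal]
  let _ : Field (𝓞 ℚ ⧸ (under ℚ w).asIdeal) := Ideal.Quotient.field _
  refine finrank_le_one (Ideal.Quotient.mk _ 1) fun y => ?_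
  obtain ⟨y, rfl⟩ := Ideal.Quotient.mk_surjective y
  obtain ⟨m, hm⟩ := hw (algebraMap (𝓞 L) L y) (w.valuation_le_one y)
  rw [← map_intCast (algebraMap (𝓞 L) L), ← map_sub, w.valuation_lt_one_iff_mem,
    ← Ideal.Quotient.eq] at hm
  refine ⟨Ideal.Quotient.mk _ (m : 𝓞 ℚ), ?_⟩
  rw [hm, Algebra.smul_def, map_one, mul_one, map_intCast, map_intCast, map_intCast]

theorem card_stabilizer_le_two [IsGalois ℚ L] {w : HeightOneSpectrum (𝓞 L)}
    (hw : HasIntegerResidues w) {q : ℕ} (hq : ord w (q : L) = 2) :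
    Nat.card {σ : L ≃ₐ[ℚ] L // conj (σ : L ≃+* L) w = w} ≤ 2 := by
  rw [card_stabilizer_eq_ram_mul_res, hw.res_eq_one, mul_one]
  rw [ord_natCast (L := ℚ)] at hq
  exact Int.ofNat_le.mp (Int.le_of_dvd two_pos (Dvd.intro _ hq))

theorem HasIntegerResidues.dyadicSplit {w : HeightOneSpectrum (𝓞 L)} (hw : HasIntegerResidues w)
    (h2 : ord w (2 : L) = 1) : DyadicSplit w := fun y hy => by
  obtain ⟨m, hm⟩ := hw y hy
  have hlt : w.valuation L 2 < 1 :=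
    (valuation_lt_one_iff w two_ne_zero).mpr (h2 ▸ one_pos)
  have heven (n : ℤ) (hn : Even n) : w.valuation L (n : L) < 1 :=
    (valuation_intCast_lt_one_iff Nat.prime_two (by exact_mod_cast hlt) n).mpr hn.two_dvd
  rw [← valuation_lt_one_iff_le w h2, ← valuation_lt_one_iff_le w h2]
  rcases Int.even_or_odd m with h | h
  · exact Or.inl (by simpa using Valuation.map_add_lt _ hm (heven m h))
  · refine Or.inr ?_
    have h3 := Valuation.map_add_lt _ hm (heven (m - 1) (h.sub_odd odd_one))
    rwa [Int.cast_sub, Int.cast_one, sub_add_sub_cancel] at h3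

theorem index_sqClass_le_eight' {w : HeightOneSpectrum (𝓞 L)}
    (hdy : w.valuation L 2 < 1 → DyadicSplit w) :
    (sqClass w).index ≠ 0 ∧ (sqClass w).index ≤ 8 := by
  by_cases h : w.valuation L 2 < 1
  · exact index_sqClass_le_eight (hdy h) h
  · have h1 := index_sqClass_le_four ((valuation_two_le w).antisymm (not_lt.mp h))
    exact ⟨h1.1, h1.2.trans (by norm_num)⟩

theorem map_mem_sqClass_conj (g : L ≃+* L) {w : HeightOneSpectrum (𝓞 L)} {u : Lˣ}
    (hu : u ∈ sqClass w) : Units.map (g : L →* L) u ∈ sqClass (conj g w) := by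
  obtain ⟨y, z, hz, rfl⟩ := mem_sqClass.mp hu
  refine mem_sqClass.mpr ⟨Units.map (g : L →* L) y, Units.map (g : L →* L) z, ?_, by
    rw [map_mul, map_pow]⟩
  rw [mem_levelFour] at hz ⊢
  have h1 := valuation_conj w g ((z : L) - 1)
  have h2 := valuation_conj w g 4
  rw [map_sub, map_one] at h1
  rw [map_ofNat] at h2
  change (conj g w).valuation L (g z - 1) < _
  rwa [h1, h2]

/-- Two real embeddings of a Galois extension of `ℚ` differ by an automorphism. -/
theorem exists_realEmbedding_eq_comp [IsGalois ℚ L] (φ ψ : L →+* ℝ) :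
    ∃ g : L ≃ₐ[ℚ] L, ∀ x, ψ x = φ (g x) := by
  let _ : Algebra L ℝ := φ.toAlgebra
  have : IsScalarTower ℚ L ℝ := IsScalarTower.of_algebraMap_eq fun x =>
    (map_ratCast φ x).symm
  let ψ' : L →ₐ[ℚ] ℝ := { ψ with commutes' := fun x => map_ratCast ψ x }
  let g := ψ'.restrictNormal L
  exact ⟨AlgEquiv.ofBijective g (Algebra.IsAlgebraic.algHom_bijective g),
    fun x => (ψ'.restrictNormal_commutes L x).symm⟩

theorem exists_conj_eq_of_valuation_lt_one [IsGalois ℚ L] {w w' : HeightOneSpectrum (𝓞 L)} {p : ℕ}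
    (hp : p.Prime) (h : w.valuation L (p : L) < 1) (h' : w'.valuation L (p : L) < 1) :
    ∃ g : L ≃ₐ[ℚ] L, conj (g : L ≃+* L) w = w' :=
  exists_conj_eq (under_rat_eq hp h h')

/-- A class whose Galois conjugates agree modulo squares can be changed by a rational number so
that its order is even outside a finite set of rational primes. -/
theorem exists_natCast_mul_even_ord [IsGalois ℚ L] (P : Finset ℕ)
    (hP : ∀ p : ℕ, p.Prime → p ∉ P → ∀ w : HeightOneSpectrum (𝓞 L), w.valuation L (p : L) < 1 →
      ord w (p : L) = 1) (α : Lˣ)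
    (hα : ∀ g : L ≃ₐ[ℚ] L, ∃ a : Lˣ, g α = (α : L) * a ^ 2) :
    ∃ m : ℕ, m ≠ 0 ∧ ∀ w : HeightOneSpectrum (𝓞 L), (∀ p ∈ P, p.Prime → w.valuation L (p : L) = 1) →
      Even (ord w ((m : L) * α)) := by
  classical
  choose f hfp hf using exists_prime_valuation_lt_one (L := L)
  let D := ((finite_ord_ne_zero α.ne_zero).toFinset.filter
    (fun w => Odd (ord w (α : L)))).image f \ P
  have hD (p : ℕ) (hp : p ∈ D) : p.Prime := by
    obtain ⟨w, -, rfl⟩ := Finset.mem_image.mp (Finset.mem_sdiff.mp hp).1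
    exact hfp w
  refine ⟨∏ p ∈ D, p, Finset.prod_ne_zero_iff.mpr fun p hp => (hD p hp).ne_zero, fun w hw => ?_⟩
  have hfw : f w ∉ P := fun h => (hf w).ne (hw _ h (hfp w))
  have h0 : ((∏ p ∈ D, p : ℕ) : L) ≠ 0 :=
    Nat.cast_ne_zero.mpr (Finset.prod_ne_zero_iff.mpr fun p hp => (hD p hp).ne_zero)
  have hprime (p : ℕ) (hp : p.Prime) : ord w (p : L) = if p = f w then 1 else 0 := by
    split_ifs with h
    · subst h
      exact hP _ hp hfw w (hf w)
    · rw [← valuation_eq_one_iff w (Nat.cast_ne_zero.mpr hp.ne_zero)]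
      exact valuation_natCast_eq_one (hfp w) hp (Ne.symm h) (hf w)
  have hprod : ord w ((∏ p ∈ D, p : ℕ) : L) = if f w ∈ D then 1 else 0 := by
    have h1 (E : Finset ℕ) (hE : ∀ p ∈ E, p.Prime) :
        ord w ((∏ p ∈ E, p : ℕ) : L) = if f w ∈ E then 1 else 0 := by
      induction E using Finset.induction_on with
      | empty => simp [ord_one]
      | insert p E hp ih =>
        have hE' : ∀ p ∈ E, p.Prime := fun p hp => hE p (Finset.mem_insert_of_mem hp)
        have hp' := hE p (Finset.mem_insert_self _ _)
        rw [Finset.prod_insert hp, Nat.cast_mul, ord_mul w (Nat.cast_ne_zero.mpr hp'.ne_zero)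
          (Nat.cast_ne_zero.mpr (Finset.prod_ne_zero_iff.mpr fun p hp => (hE' p hp).ne_zero)),
          ih hE', hprime p hp']
        by_cases h : p = f w
        · subst h
          simp [hp]
        · simp [h, Ne.symm h]
    exact h1 D hD
  rw [ord_mul w h0 α.ne_zero, hprod]
  by_cases hodd : Odd (ord w (α : L))
  · have h1 : f w ∈ D := by
      refine Finset.mem_sdiff.mpr ⟨Finset.mem_image_of_mem _ (Finset.mem_filter.mpr
        ⟨?_, hodd⟩), hfw⟩
      rw [Set.Finite.mem_toFinset]
      exact fun h => by simp [h] at hodd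
    rw [if_pos h1]
    exact odd_one.add_odd hodd
  · have h1 : f w ∉ D := by
      intro h
      obtain ⟨w', hw', hww⟩ := Finset.mem_image.mp (Finset.mem_sdiff.mp h).1
      obtain ⟨g, hg⟩ := exists_conj_eq_of_valuation_lt_one (hfp w) (hww ▸ hf w') (hf w)
      obtain ⟨a, ha⟩ := hα g
      have h2 : ord w (g α) = ord w' (α : L) := by
        rw [← hg]
        exact ord_conj w' (g : L ≃+* L) (α : L)
      rw [ha, ord_mul w α.ne_zero (pow_ne_zero _ a.ne_zero), ord_pow] at h2
      refine hodd ?_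
      have h3 := (Finset.mem_filter.mp hw').2
      rw [← h2] at h3
      rcases h3 with ⟨s, hs⟩
      exact ⟨s - ord w (a : L), by push_cast at hs; omega⟩
    rw [if_neg h1, zero_add]
    exact Int.not_odd_iff_even.mp hodd

end

end PlaceTheory

namespace PlaceTheory

open NumberField IsDedekindDomain TwistedProduct

theorem zmod_two_eq : ∀ x : ZMod 2, x = 0 ∨ x = 1 := by decide

section

variable {L : Type*} [Field L]

/-- The sign `(-1)^x` as a unit of `L`. -/
def signUnit (L : Type*) [Field L] (x : ZMod 2) : Lˣ := if x = 0 then 1 else -1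

theorem signUnit_add (x y : ZMod 2) : signUnit L (x + y) = signUnit L x * signUnit L y := by
  have h11 : (1 : ZMod 2) + 1 = 0 := by decide
  rcases zmod_two_eq x with rfl | rfl <;> rcases zmod_two_eq y with rfl | rfl <;>
    simp [signUnit, h11]

theorem signUnit_zero : signUnit L 0 = 1 := if_pos rfl

theorem signUnit_sq (x : ZMod 2) : signUnit L x ^ 2 = 1 := by
  rw [sq, ← signUnit_add, CharTwo.add_self_eq_zero, signUnit_zero]

theorem smul_signUnit (g : L ≃+* L) (x : ZMod 2) : g (signUnit L x : L) = signUnit L x := by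
  unfold signUnit
  split_ifs <;> simp

theorem signUnit_injective [CharZero L] : Function.Injective (signUnit L) := by
  have h1 : (-1 : Lˣ) ≠ 1 := by
    intro h
    have h2 := congrArg Units.val h
    rw [Units.val_neg, Units.val_one] at h2
    exact (by norm_num : (-1 : L) ≠ 1) h2
  intro x y h
  rcases zmod_two_eq x with rfl | rfl <;> rcases zmod_two_eq y with rfl | rfl <;>
    simp_all [signUnit, eq_comm]

theorem signUnit_sum {ι : Type*} (s : Finset ι) (f : ι → ZMod 2) :
    signUnit L (∑ i ∈ s, f i) = ∏ i ∈ s, signUnit L (f i) := by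
  classical
  induction s using Finset.induction_on with
  | empty => simp [signUnit_zero]
  | insert i s hi ih => rw [Finset.sum_insert hi, Finset.prod_insert hi, signUnit_add, ih]

end

variable {L : Type*} [Field L] [NumberField L] {S T : Finset ℕ}

theorem IsAdmissible.exists_characters (hL : IsAdmissible S T L) {n : ℕ} (hn : S.card = n) :
    ∃ χ : Fin n → (L ≃ₐ[ℚ] L) → ZMod 2, (∀ i g h, χ i (g * h) = χ i g + χ i h) ∧
      LinearIndependent (ZMod 2) χ := by
  classical
  have hgal := hL.isGalois
  let e : Fin n ≃ S := (finCongr hn.symm).trans S.equivFin.symm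
  choose r hr using fun i => hL.sqrt (e i) (e i).2
  have hp (i : Fin n) : (e i : ℕ).Prime := hL.prime _ (Finset.mem_union_left _ (e i).2)
  have hr0 (i : Fin n) : r i ≠ 0 := by
    intro h
    have := hr i
    rw [h, zero_pow two_ne_zero] at this
    exact (hp i).ne_zero (Nat.cast_eq_zero.mp this.symm)
  have hex (i : Fin n) (g : L ≃ₐ[ℚ] L) : ∃ x : ZMod 2, g (r i) = signUnit L x * r i := by
    have h1 : g (r i) ^ 2 = r i ^ 2 := by rw [← map_pow, hr, map_natCast]
    rcases sq_eq_sq_iff_eq_or_eq_neg.mp h1 with h | h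
    · exact ⟨0, by rw [h, signUnit_zero, Units.val_one, one_mul]⟩
    · exact ⟨1, by rw [h]; simp [signUnit]⟩
  choose χ hχ using hex
  refine ⟨χ, fun i g h => signUnit_injective (L := L) (Units.ext
    (mul_right_cancel₀ (hr0 i) ?_)), ?_⟩
  · rw [← hχ, AlgEquiv.mul_apply, hχ i h, map_mul, hχ i g, signUnit_add, Units.val_mul]
    have h1 : g (signUnit L (χ i h) : L) = signUnit L (χ i h) := smul_signUnit (g : L ≃+* L) _
    rw [h1]
    ring
  · rw [Fintype.linearIndependent_iff]
    intro a ha i₀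
    by_contra hi₀
    let D := Finset.univ.filter fun i => a i ≠ 0
    have hD (g : L ≃ₐ[ℚ] L) : ∑ i ∈ D, χ i g = 0 := by
      have h1 := congrFun ha g
      rw [Finset.sum_apply] at h1
      rw [Finset.sum_filter]
      refine Eq.trans (Finset.sum_congr rfl fun i _ => ?_) h1
      rcases zmod_two_eq (a i) with h | h <;> simp [h]
    have hfix (g : L ≃ₐ[ℚ] L) : g (∏ i ∈ D, r i) = ∏ i ∈ D, r i := by
      rw [map_prod, Finset.prod_congr rfl fun i _ => hχ i g, Finset.prod_mul_distrib,
        ← Units.coe_prod, ← signUnit_sum, hD, signUnit_zero, Units.val_one, one_mul]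
    obtain ⟨t, ht⟩ := (IsGalois.mem_range_algebraMap_iff_fixed (F := ℚ) _).mpr hfix
    have hsq : IsSquare (∏ i ∈ D, (e i : ℕ)) := by
      rw [← Rat.isSquare_natCast_iff]
      refine ⟨t, (algebraMap ℚ L).injective ?_⟩
      rw [map_mul, ht, ← sq, ← Finset.prod_pow, Finset.prod_congr rfl fun i _ => hr i, map_natCast,
        Nat.cast_prod]
    obtain ⟨m, hm⟩ := hsq
    have hsqf : Squarefree (∏ i ∈ D, (e i : ℕ)) := by
      refine Finset.squarefree_prod_of_pairwise_isCoprime (fun i _ j _ hij => ?_)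
        fun i _ => (hp i).prime.squarefree
      exact Nat.coprime_iff_isRelPrime.mp ((Nat.coprime_primes (hp i) (hp j)).mpr fun h =>
        hij (e.injective (Subtype.ext h)))
    have hdvd : (e i₀ : ℕ) ∣ m * m := hm ▸ Finset.dvd_prod_of_mem _
      (Finset.mem_filter.mpr ⟨Finset.mem_univ _, hi₀⟩)
    have h3 := ((hp i₀).dvd_mul.mp hdvd).elim id id
    exact (hp i₀).one_lt.ne' (Nat.isUnit_iff.mp (hsqf _ (hm ▸ mul_dvd_mul h3 h3)))

theorem IsAdmissible.dyadicSplit (hL : IsAdmissible S T L) {w : HeightOneSpectrum (𝓞 L)}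
    (hw : w.valuation L 2 < 1) : DyadicSplit w := by
  obtain ⟨h1, h2⟩ := hL.split 2 hL.two_mem w (by exact_mod_cast hw)
  exact h2.dyadicSplit (by exact_mod_cast h1)

theorem IsAdmissible.exists_stabilizer (hL : IsAdmissible S T L) {q : ℕ} (hq : q ∈ S) :
    ∃ (w : HeightOneSpectrum (𝓞 L)) (x : L ≃ₐ[ℚ] L), w.valuation L (q : L) < 1 ∧ x * x = 1 ∧
      ∀ φ : L ≃ₐ[ℚ] L, conj (φ : L ≃+* L) w = w → φ = 1 ∨ φ = x := by
  have hgal := hL.isGalois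
  obtain ⟨w, hw⟩ := exists_valuation_natCast_lt_one L
    (hL.prime q (Finset.mem_union_left _ hq))
  obtain ⟨h1, h2⟩ := hL.tame q hq w hw
  have hcard := card_stabilizer_le_two h2 h1
  have := Fintype.ofFinite {σ : L ≃ₐ[ℚ] L // conj (σ : L ≃+* L) w = w}
  rw [Nat.card_eq_fintype_card] at hcard
  have hone : conj ((1 : L ≃ₐ[ℚ] L) : L ≃+* L) w = w :=
    eq_of_valuation_eq fun u => valuation_conj w (1 : L ≃+* L) u
  by_cases hx : ∃ x : L ≃ₐ[ℚ] L, conj (x : L ≃+* L) w = w ∧ x ≠ 1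
  · obtain ⟨x, hxw, hx1⟩ := hx
    have key (φ : L ≃ₐ[ℚ] L) (hφ : conj (φ : L ≃+* L) w = w) : φ = 1 ∨ φ = x := by
      by_contra! h
      refine hcard.not_gt (Fintype.two_lt_card_iff.mpr
        ⟨⟨1, hone⟩, ⟨x, hxw⟩, ⟨φ, hφ⟩, ?_, ?_, ?_⟩)
      · exact fun h' => hx1 (congrArg Subtype.val h').symm
      · exact fun h' => h.1 (congrArg Subtype.val h').symm
      · exact fun h' => h.2 (congrArg Subtype.val h').symm
    refine ⟨w, x, hw, (key (x * x) ?_).resolve_right fun h => hx1 (mul_eq_left.mp h), key⟩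
    exact (conj_trans (x : L ≃+* L) (x : L ≃+* L) w).trans (by rw [hxw, hxw])
  · push Not at hx
    exact ⟨w, 1, hw, one_mul 1, fun φ hφ => Or.inl (hx φ hφ)⟩

/-- The sign cocycle of an additive cocycle with values in `ZMod 2`. -/
def signCocycle (L : Type*) [Field L] [NumberField L] {c : (L ≃ₐ[ℚ] L) → (L ≃ₐ[ℚ] L) → ZMod 2}
    (hc : ∀ g h l, c g h + c (g * h) l = c h l + c g (h * l)) (hc1 : ∀ g, c 1 g = 0 ∧ c g 1 = 0) :
    NormalizedCocycle (L ≃ₐ[ℚ] L) Lˣ where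
  val g h := signUnit L (c g h)
  cocycle g h l := by
    have h1 : g • signUnit L (c h l) = signUnit L (c h l) :=
      Units.ext (smul_signUnit (g : L ≃+* L) _)
    rw [h1, ← signUnit_add, ← signUnit_add, hc]
  one_left g := by rw [(hc1 g).1, signUnit_zero]
  one_right g := by rw [(hc1 g).2, signUnit_zero]

theorem IsAdmissible.exists_trivialization (hL : IsAdmissible S T L)
    {c : (L ≃ₐ[ℚ] L) → (L ≃ₐ[ℚ] L) → ZMod 2}
    (hc : ∀ g h l, c g h + c (g * h) l = c h l + c g (h * l)) (hc1 : ∀ g, c 1 g = 0 ∧ c g 1 = 0)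
    (hx : ∀ q ∈ S, ∃ (w : HeightOneSpectrum (𝓞 L)) (x : L ≃ₐ[ℚ] L), w.valuation L (q : L) < 1 ∧
      x * x = 1 ∧ (∀ φ : L ≃ₐ[ℚ] L, conj (φ : L ≃+* L) w = w → φ = 1 ∨ φ = x) ∧ c x x = 0) :
    ∃ a : (L ≃ₐ[ℚ] L) → Lˣ, (∀ g h, a (g * h) = a g * g • a h * signUnit L (c g h)) ∧
      ∃ α : Lˣ, ∀ g : L ≃ₐ[ℚ] L, g • α = α * a g ^ 2 := by
  have hgal := hL.isGalois
  have hreal := hL.isTotallyReal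
  obtain ⟨a, ha⟩ := exists_unit_trivialization hL.isPGroup (fun w hw => hL.dyadicSplit hw)
    (c := signCocycle L hc hc1) (fun g h => signUnit_sq _) fun w => by
      obtain ⟨p, hp, hw⟩ := exists_prime_valuation_lt_one w
      by_cases hpS : p ∈ S
      · obtain ⟨h1, h2⟩ := hL.tame p hpS w hw
        have hp2 : p ≠ 2 := by
          rintro rfl
          have := (hL.split 2 hL.two_mem w hw).1
          omega
        refine Or.inr ⟨p, hp, hp2, hw, h2, fun φ hφ => ?_⟩
        obtain ⟨w₀, x, hw₀, hxx, hx', hcx⟩ := hx p hpS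
        obtain ⟨g, hg⟩ := exists_conj_eq_of_valuation_lt_one hp hw₀ hw
        have hconj (σ τ : L ≃ₐ[ℚ] L) (v : HeightOneSpectrum (𝓞 L)) :
            conj ((σ * τ : L ≃ₐ[ℚ] L) : L ≃+* L) v =
              conj (σ : L ≃+* L) (conj (τ : L ≃+* L) v) :=
          conj_trans (τ : L ≃+* L) (σ : L ≃+* L) v
        have hgi : conj ((g⁻¹ : L ≃ₐ[ℚ] L) : L ≃+* L) w = w₀ := by
          rw [← hg, ← hconj, inv_mul_cancel]
          exact eq_of_valuation_eq fun u => valuation_conj w₀ (1 : L ≃+* L) u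
        have h3 := hx' (g⁻¹ * φ * g) (by rw [hconj, hconj, hg, hφ, hgi])
        let gl : Extension (signCocycle L hc hc1) := ⟨1, g⟩
        obtain ⟨y, hy, hyy⟩ : ∃ y : Extension (signCocycle L hc hc1),
            y.proj = g⁻¹ * φ * g ∧ y * y = 1 := by
          rcases h3 with h | h
          · exact ⟨1, h.symm, one_mul 1⟩
          · refine ⟨⟨1, x⟩, h.symm, Extension.ext ?_ hxx⟩
            change (1 : Lˣ) * x • 1 * signUnit L (c x x) = 1
            rw [hcx, signUnit_zero, smul_one, one_mul, one_mul]
        refine ⟨gl * y * gl⁻¹, ?_, ?_⟩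
        · rw [Extension.proj_mul, Extension.proj_mul, Extension.proj_inv, hy]
          change g * (g⁻¹ * φ * g) * g⁻¹ = φ
          group
        · rw [show gl * y * gl⁻¹ * (gl * y * gl⁻¹) = gl * (y * y) * gl⁻¹ by group, hyy]
          group
      · exact Or.inl ⟨p, hL.unram p hp hpS w hw⟩
  refine ⟨a, ha, ?_⟩
  obtain ⟨α, hα⟩ := groupCohomology.isMulCoboundary₁_of_isMulCocycle₁_of_aut_to_units
    (fun g : L ≃ₐ[ℚ] L => a g ^ 2) (fun g h => by
      change a (g * h) ^ 2 = g • a h ^ 2 * a g ^ 2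
      have h1 : (signUnit L (c g h)) ^ 2 = 1 := signUnit_sq _
      rw [ha, mul_pow, mul_pow]
      change a g ^ 2 * (g • a h) ^ 2 * (signUnit L (c g h)) ^ 2 = _
      rw [h1, mul_one, mul_comm, smul_pow'])
  exact ⟨α, fun g => by
    rw [show a g ^ 2 = g • α / α from (hα g).symm, mul_div_cancel]⟩

theorem eq_add_of_isSquare {c c' : (L ≃ₐ[ℚ] L) → (L ≃ₐ[ℚ] L) → ZMod 2}
    {a a' : (L ≃ₐ[ℚ] L) → Lˣ} (ha : ∀ g h, a (g * h) = a g * g • a h * signUnit L (c g h))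
    (ha' : ∀ g h, a' (g * h) = a' g * g • a' h * signUnit L (c' g h)) {α α' : Lˣ}
    (hα : ∀ g : L ≃ₐ[ℚ] L, g • α = α * a g ^ 2) (hα' : ∀ g : L ≃ₐ[ℚ] L, g • α' = α' * a' g ^ 2)
    {m : ℕ} (h : IsSquare ((m : L) * (α * α'))) (hm : m ≠ 0) :
    ∃ b : (L ≃ₐ[ℚ] L) → ZMod 2, ∀ g h, c g h + c' g h = b g + b h - b (g * h) := by
  obtain ⟨β, hβ⟩ := h
  have hm' : (m : L) ≠ 0 := Nat.cast_ne_zero.mpr hm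
  have hβ0 : β ≠ 0 := by
    rintro rfl
    rw [mul_zero] at hβ
    exact mul_ne_zero hm' (mul_ne_zero α.ne_zero α'.ne_zero) hβ
  have key (g : L ≃ₐ[ℚ] L) : ∃ x : ZMod 2, g β = signUnit L x * (β * (a g * a' g)) := by
    have h1 : g (α : L) = α * (a g : L) ^ 2 := congrArg Units.val (hα g)
    have h2 : g (α' : L) = α' * (a' g : L) ^ 2 := congrArg Units.val (hα' g)
    have h3 : g β ^ 2 = (β * (a g * a' g)) ^ 2 := by
      rw [sq (g β), ← map_mul, ← hβ, map_mul, map_mul, map_natCast, h1, h2, mul_pow, sq β, ← hβ]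
      ring
    rcases sq_eq_sq_iff_eq_or_eq_neg.mp h3 with h | h
    · exact ⟨0, by rw [h, signUnit_zero, Units.val_one, one_mul]⟩
    · exact ⟨1, by rw [h]; simp [signUnit]⟩
  choose b hb using key
  refine ⟨b, fun g h => ?_⟩
  rw [CharTwo.sub_eq_add]
  refine signUnit_injective (L := L) (Units.ext ?_)
  have h1 (x : ZMod 2) : g (signUnit L x : L) = signUnit L x := smul_signUnit (g : L ≃+* L) _
  have h2 : (a (g * h) : L) = a g * g (a h : L) * signUnit L (c g h) :=
    congrArg Units.val (ha g h)
  have h3 : (a' (g * h) : L) = a' g * g (a' h : L) * signUnit L (c' g h) :=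
    congrArg Units.val (ha' g h)
  have h4 := hb (g * h)
  rw [AlgEquiv.mul_apply, hb h, map_mul, map_mul, map_mul, hb g, h1, h2, h3] at h4
  have hs (x : ZMod 2) : (signUnit L x : L) * signUnit L x = 1 := by
    rw [← sq, ← Units.val_pow_eq_pow_val, signUnit_sq, Units.val_one]
  have h0 : β * (a g * a' g) * (g (a h : L) * g (a' h : L)) ≠ 0 :=
    mul_ne_zero (mul_ne_zero hβ0 (mul_ne_zero (a g).ne_zero (a' g).ne_zero))
      (mul_ne_zero ((map_ne_zero g).mpr (a h).ne_zero) ((map_ne_zero g).mpr (a' h).ne_zero))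
  have h5 : (signUnit L (b g) : L) * signUnit L (b h) =
      signUnit L (b (g * h)) * signUnit L (c g h) * signUnit L (c' g h) := by
    refine mul_right_cancel₀ h0 ?_
    linear_combination h4
  simp only [signUnit_add, Units.val_mul]
  rw [h5]
  linear_combination -(signUnit L (c g h) * signUnit L (c' g h) : L) * hs (b (g * h))

end PlaceTheory

namespace PlaceTheory

open NumberField IsDedekindDomain

variable {L : Type*} [Field L] [NumberField L] {S T : Finset ℕ}

theorem mem_sqClass_of_valuation_lt_one [IsGalois ℚ L] {α : Lˣ}
    (hα : ∀ g : L ≃ₐ[ℚ] L, ∃ a : Lˣ, g • α = α * a ^ 2) {p : ℕ} (hp : p.Prime)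
    {w w' : HeightOneSpectrum (𝓞 L)} (h : w.valuation L (p : L) < 1)
    (h' : w'.valuation L (p : L) < 1) (hw : α ∈ sqClass w) : α ∈ sqClass w' := by
  obtain ⟨g, rfl⟩ := exists_conj_eq_of_valuation_lt_one hp h h'
  obtain ⟨a, ha⟩ := hα g
  have h1 := map_mem_sqClass_conj (g : L ≃+* L) hw
  rw [← mul_sq_mem_sqClass_iff α a, ← ha]
  exact h1

theorem forall_pos_of_pos [IsGalois ℚ L] {α : Lˣ}
    (hα : ∀ g : L ≃ₐ[ℚ] L, ∃ a : Lˣ, g • α = α * a ^ 2) {φ : L →+* ℝ} (hφ : 0 < φ α)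
    (ψ : L →+* ℝ) : 0 < ψ α := by
  obtain ⟨g, hg⟩ := exists_realEmbedding_eq_comp φ ψ
  obtain ⟨a, ha⟩ := hα g
  have h1 : g (α : L) = α * (a : L) ^ 2 := congrArg Units.val ha
  rw [hg, h1, map_mul, map_pow]
  exact mul_pos hφ (by
    have : φ a ≠ 0 := (map_ne_zero φ).mpr a.ne_zero
    positivity)

/-- Among sufficiently many quadratic cocycles, two have generators that agree at all the relevant
places. -/
theorem IsAdmissible.exists_mem_sqClass (hL : IsAdmissible S {2} L) (hS : S.card = 18) :
    ∃ α : Lˣ, ¬IsSquare (α : L) ∧ (∀ g : L ≃ₐ[ℚ] L, ∃ a : Lˣ, g • α = α * a ^ 2) ∧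
      (∀ φ : L →+* ℝ, 0 < φ α) ∧
      (∀ p ∈ S ∪ {2}, ∀ w : HeightOneSpectrum (𝓞 L), w.valuation L (p : L) < 1 → α ∈ sqClass w) ∧
      ∀ w : HeightOneSpectrum (𝓞 L), (∀ p ∈ S ∪ {2}, w.valuation L (p : L) = 1) →
        Even (ord w (α : L)) := by
  classical
  have hgal := hL.isGalois
  have hreal := hL.isTotallyReal
  obtain ⟨χ, hχ, hχli⟩ := hL.exists_characters hS
  obtain ⟨r, hr, c, hc, hc1, hcinj⟩ := GolodShafarevich.exists_cocycles hL.isPGroup χ hχ hχli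
    (a := 9) (by norm_num) (by norm_num)
  choose w₀ x₀ hw₀ hxx hx₀ using fun q : S => hL.exists_stabilizer q.2
  let ev : (Fin r → ZMod 2) →ₗ[ZMod 2] (S → ZMod 2) :=
    { toFun := fun f q => c f (x₀ q) (x₀ q)
      map_add' := fun f f' => by ext q; simp
      map_smul' := fun t f => by ext q; simp }
  have hker (f : LinearMap.ker ev) (q : S) : c f.1 (x₀ q) (x₀ q) = 0 :=
    congrFun (LinearMap.mem_ker.mp f.2) q
  have hcard : 2 ^ 64 ≤ Nat.card (LinearMap.ker ev) := by
    have h1 := ev.finrank_range_add_finrank_ker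
    have h2 := Submodule.finrank_le (LinearMap.range ev)
    rw [Module.finrank_fintype_fun_eq_card] at h1 h2
    rw [Fintype.card_coe, hS] at h2
    rw [Fintype.card_fin] at h1
    rw [Module.natCard_eq_pow_finrank (K := ZMod 2), Nat.card_zmod]
    exact Nat.pow_le_pow_right (by norm_num) (by omega)
  choose a ha α hα using fun f : LinearMap.ker ev =>
    hL.exists_trivialization (hc f.1) (hc1 f.1) fun q hq =>
      ⟨w₀ ⟨q, hq⟩, x₀ ⟨q, hq⟩, hw₀ ⟨q, hq⟩, hxx ⟨q, hq⟩, hx₀ ⟨q, hq⟩, hker f ⟨q, hq⟩⟩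
  have hexm (f : LinearMap.ker ev) := exists_natCast_mul_even_ord (L := L) (S ∪ {2})
    (fun p hp hpS w hw => hL.unram p hp (fun h => hpS (Finset.mem_union_left _ h)) w hw) (α f)
    fun g => ⟨a f g, congrArg Units.val (hα f g)⟩
  choose m hm0 hm using hexm
  let β (f : LinearMap.ker ev) : Lˣ := Units.mk0 (m f : L) (Nat.cast_ne_zero.mpr (hm0 f)) * α f
  have hβ (f : LinearMap.ker ev) (g : L ≃ₐ[ℚ] L) : g • β f = β f * a f g ^ 2 := by
    have h1 : g • Units.mk0 (m f : L) (Nat.cast_ne_zero.mpr (hm0 f)) =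
        Units.mk0 (m f : L) (Nat.cast_ne_zero.mpr (hm0 f)) := Units.ext (map_natCast g _)
    rw [smul_mul', h1, hα, mul_assoc]
  obtain ⟨φ₀⟩ : Nonempty (L →+* ℝ) := by
    obtain ⟨φ⟩ : Nonempty (L →+* ℂ) := inferInstance
    exact ⟨(IsTotallyReal.complexEmbedding_isReal φ).embedding⟩
  choose u hu using fun p : (S ∪ {2} : Finset ℕ) =>
    exists_valuation_natCast_lt_one L (hL.prime p.1 p.2)
  have hidx (p : (S ∪ {2} : Finset ℕ)) : (sqClass (u p)).index ≠ 0 ∧ (sqClass (u p)).index ≤ 8 :=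
    index_sqClass_le_eight' fun h => hL.dyadicSplit h
  let H : Subgroup Lˣ := positiveAt φ₀ ⊓ ⨅ p, sqClass (u p)
  have hcard' : Fintype.card (S ∪ {2} : Finset ℕ) ≤ 19 := by
    rw [Fintype.card_coe]
    exact (Finset.card_union_le _ _).trans (by rw [hS, Finset.card_singleton])
  have hH0 : H.index ≠ 0 :=
    Subgroup.index_inf_ne_zero (index_positiveAt φ₀).1
      (Subgroup.index_iInf_ne_zero fun p => (hidx p).1)
  have hH : H.index < 2 ^ 64 := by
    calc H.index ≤ (positiveAt φ₀).index * (⨅ p, sqClass (u p)).index := Subgroup.index_inf_le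
      _ ≤ 2 * ∏ p : (S ∪ {2} : Finset ℕ), (sqClass (u p)).index :=
        Nat.mul_le_mul (index_positiveAt φ₀).2 (Subgroup.index_iInf_le _)
      _ ≤ 2 * ∏ p : (S ∪ {2} : Finset ℕ), 8 :=
        Nat.mul_le_mul_left _ (Finset.prod_le_prod' fun p _ => (hidx p).2)
      _ ≤ 2 * 8 ^ 19 := by
        rw [Finset.prod_const, Finset.card_univ]
        exact Nat.mul_le_mul_left _ (Nat.pow_le_pow_right (by norm_num) hcard')
      _ < 2 ^ 64 := by norm_num
  have hfin : Finite (Lˣ ⧸ H) := by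
    have : H.FiniteIndex := ⟨hH0⟩
    infer_instance
  obtain ⟨f, f', hff, heq⟩ : ∃ f f' : LinearMap.ker ev, f ≠ f' ∧
      (QuotientGroup.mk (β f) : Lˣ ⧸ H) = QuotientGroup.mk (β f') := by
    by_contra! h
    have h1 := Nat.card_le_card_of_injective (fun f : LinearMap.ker ev =>
      (QuotientGroup.mk (β f) : Lˣ ⧸ H)) fun f f' hf => by_contra fun hne => h f f' hne hf
    rw [← Subgroup.index] at h1
    omega
  have hmem : β f * β f' ∈ H := by
    have h1 := QuotientGroup.eq.mp heq
    have h2 : β f ^ 2 ∈ H := by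
      refine ⟨?_, Subgroup.mem_iInf.mpr fun p => sq_mem_sqClass _ _⟩
      change 0 < φ₀ ((β f ^ 2 : Lˣ) : L)
      rw [Units.val_pow_eq_pow_val, map_pow]
      have : φ₀ (β f) ≠ 0 := (map_ne_zero φ₀).mpr (β f).ne_zero
      positivity
    have h3 := mul_mem h2 h1
    rwa [sq, mul_assoc, mul_inv_cancel_left] at h3
  have hg (g : L ≃ₐ[ℚ] L) : ∃ b : Lˣ, g • (β f * β f') = β f * β f' * b ^ 2 :=
    ⟨a f g * a f' g, by rw [smul_mul', hβ, hβ, mul_pow]; exact mul_mul_mul_comm _ _ _ _⟩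
  refine ⟨β f * β f', fun hsq => hff (Subtype.ext ?_), hg, forall_pos_of_pos hg hmem.1,
    fun p hp w hw => mem_sqClass_of_valuation_lt_one hg (hL.prime p hp) (hu ⟨p, hp⟩) hw
      (Subgroup.mem_iInf.mp hmem.2 ⟨p, hp⟩), fun w hw => ?_⟩
  · obtain ⟨b, hb⟩ := eq_add_of_isSquare (ha f) (ha f') (hα f) (hα f') (m := m f * m f') (by
      convert hsq using 1
      change _ = ((m f : L) * α f) * ((m f' : L) * α f')
      push_cast
      ring) (mul_ne_zero (hm0 f) (hm0 f'))
    have h1 := hcinj (f.1 + f'.1) ⟨b, fun g h => by rw [map_add]; exact hb g h⟩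
    funext i
    have h2 := congrFun h1 i
    rwa [Pi.add_apply, Pi.zero_apply, CharTwo.add_eq_zero] at h2
  · rw [Units.val_mul, ord_mul w (β f).ne_zero (β f').ne_zero]
    exact (hm f w fun p hp _ => hw p hp).add (hm f' w fun p hp _ => hw p hp)

theorem IsAdmissible.exists_unramified_quadratic.{u} {L : Type u} [Field L] [NumberField L]
    (hL : IsAdmissible S {2} L) (hS : S.card = 18) :
    ∃ (M : Type u) (_ : Field M) (_ : NumberField M) (_ : Algebra L M), Module.finrank L M = 2 ∧
      IsAdmissible S {2} M ∧ ∀ w : HeightOneSpectrum (𝓞 M), ram L w = 1 := by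
  obtain ⟨α, hα, hg, hpos, hcls, heven⟩ := hL.exists_mem_sqClass hS
  obtain ⟨M, _, _, _, r, h2, hr⟩ := exists_quadratic hα
  obtain ⟨h3, h4⟩ := hL.adjoin_sqrt (Finset.empty_subset _) (Finset.notMem_empty 2) h2 hα hr
    (fun g => (hg g).elim fun a ha => ⟨a, congrArg Units.val ha⟩) hpos
    (fun q hq => absurd hq (Finset.notMem_empty q))
    (fun p hp => hcls p (by simpa using hp)) heven
  rw [Finset.union_empty, Finset.sdiff_empty] at h3
  exact ⟨M, _, _, _, h2, h3, h4 rfl⟩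

end PlaceTheory

namespace PlaceTheory

open NumberField IsDedekindDomain

theorem natAbs_discr_of_ram_eq_one {k K : Type*} [Field k] [NumberField k] [Field K]
    [NumberField K] [Algebra k K] (h : ∀ w : HeightOneSpectrum (𝓞 K), ram k w = 1) :
    (discr K).natAbs = (discr k).natAbs ^ Module.finrank k K := by
  let _ : Algebra (FractionRing (𝓞 k)) (FractionRing (𝓞 K)) := FractionRing.liftAlgebra (𝓞 k) _
  have hsep : Algebra.IsSeparable (FractionRing (𝓞 k)) (FractionRing (𝓞 K)) := inferInstance
  rw [natAbs_discr_eq_absNorm_differentIdeal_mul_natAbs_discr_pow k (𝓞 k) K (𝓞 K)]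
  have h1 : differentIdeal (𝓞 k) (𝓞 K) = ⊤ := by
    by_contra hne
    obtain ⟨P, hP, hle⟩ := Ideal.exists_le_maximal _ hne
    have hP0 : P ≠ ⊥ := by
      rintro rfl
      exact differentIdeal_ne_bot (le_bot_iff.mp hle)
    let w : HeightOneSpectrum (𝓞 K) := ⟨P, hP.isPrime, hP0⟩
    have hprime := hP.isPrime
    refine dvd_differentIdeal_iff.mp (Ideal.dvd_iff_le.mpr hle)
      (Ideal.ramificationIdx_eq_one_iff.mp ?_)
    have hlies : P.LiesOver (under k w).asIdeal := ⟨rfl⟩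
    rw [← h w]
    exact (Ideal.ramificationIdx'_eq_ramificationIdx _ _ (under k w).ne_bot).symm
  rw [h1, Ideal.absNorm_top, one_mul]

/-- The infinite tower of admissible fields with bounded root discriminant. -/
theorem IsAdmissible.exists_tower.{u} {S : Finset ℕ} {L : Type u} [Field L] [NumberField L]
    (hL : IsAdmissible S {2} L) (hS : S.card = 18) (n : ℕ) :
    ∃ (M : Type u) (_ : Field M) (_ : NumberField M), IsAdmissible S {2} M ∧
      Module.finrank ℚ M = 2 ^ n * Module.finrank ℚ L ∧
      (discr M).natAbs = (discr L).natAbs ^ 2 ^ n := by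
  induction n with
  | zero => exact ⟨L, _, _, hL, by simp, by simp⟩
  | succ n ih =>
    obtain ⟨M, _, _, hM, hd, hdisc⟩ := ih
    obtain ⟨M', _, _, _, h2, hM', hram⟩ := hM.exists_unramified_quadratic hS
    refine ⟨M', _, _, hM', ?_, ?_⟩
    · rw [← Module.finrank_mul_finrank ℚ M M', hd, h2]
      ring
    · rw [natAbs_discr_of_ram_eq_one hram, h2, hdisc, ← pow_mul, pow_succ]

end PlaceTheory

namespace PlaceTheory

open NumberField IsDedekindDomain

theorem hasIntegerResidues_rat (w : HeightOneSpectrum (𝓞 ℚ)) : HasIntegerResidues w := fun y hy => by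
  obtain ⟨c, hc⟩ := exists_integer_sub_lt hy
  refine ⟨Rat.ringOfIntegersEquiv c, ?_⟩
  have h1 : c = ((Rat.ringOfIntegersEquiv c : ℤ) : 𝓞 ℚ) :=
    Rat.ringOfIntegersEquiv.injective (by rw [map_intCast, Int.cast_id])
  have h2 : algebraMap (𝓞 ℚ) ℚ c = ((Rat.ringOfIntegersEquiv c : ℤ) : ℚ) := by
    conv_lhs => rw [h1]
    rw [map_intCast]
  rwa [← h2]

theorem ord_natCast_rat {w : HeightOneSpectrum (𝓞 ℚ)} {p : ℕ} (hp : p.Prime)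
    (hw : w.valuation ℚ (p : ℚ) < 1) : ord w (p : ℚ) = 1 := by
  have hp0 : (p : ℚ) ≠ 0 := Nat.cast_ne_zero.mpr hp.ne_zero
  have hnn (m : ℤ) (hm : m ≠ 0) : 0 ≤ ord w (m : ℚ) := by
    have h1 : (m : ℚ) ≠ 0 := Int.cast_ne_zero.mpr hm
    rcases (valuation_intCast_le_one w m).lt_or_eq with h | h
    · exact ((valuation_lt_one_iff w h1).mp h).le
    · exact ((valuation_eq_one_iff w h1).mp h).ge
  obtain ⟨t, ht0, ht⟩ := exists_ord_eq w 1
  have hden0 : (t.den : ℤ) ≠ 0 := Int.natCast_ne_zero.mpr t.den_ne_zero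
  have hnum0 : t.num ≠ 0 := Rat.num_ne_zero.mpr ht0
  have h1 : ord w (t.num : ℚ) = 1 + ord w ((t.den : ℤ) : ℚ) := by
    rw [← ht, ← ord_mul w ht0 (Int.cast_ne_zero.mpr hden0), Int.cast_natCast, Rat.mul_den_eq_num]
  have h2 : (p : ℤ) ∣ t.num := (valuation_intCast_lt_one_iff hp hw _).mp
    ((valuation_lt_one_iff w (Int.cast_ne_zero.mpr hnum0)).mpr (by have := hnn _ hden0; omega))
  have h3 : ¬(p : ℤ) ∣ (t.den : ℤ) := fun h => by
    have h4 := Int.natAbs_dvd_natAbs.mpr h2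
    rw [Int.natAbs_natCast] at h4
    have h5 := Nat.dvd_gcd h4 (Int.natCast_dvd_natCast.mp h)
    rw [t.reduced.gcd_eq_one] at h5
    exact hp.one_lt.ne' (Nat.dvd_one.mp h5)
  have h5 : ord w ((t.den : ℤ) : ℚ) = 0 := by
    refine (valuation_eq_one_iff w (Int.cast_ne_zero.mpr hden0)).mp
      (le_antisymm (valuation_intCast_le_one w _) (not_lt.mp fun h => h3 ?_))
    exact (valuation_intCast_lt_one_iff hp hw _).mp h
  obtain ⟨m, hm⟩ := h2
  have hm0 : m ≠ 0 := fun h => hnum0 (by rw [hm, h, mul_zero])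
  have h6 : ord w (t.num : ℚ) = ord w (p : ℚ) + ord w (m : ℚ) := by
    rw [hm, Int.cast_mul, Int.cast_natCast, ord_mul w hp0 (Int.cast_ne_zero.mpr hm0)]
  have h7 := (valuation_lt_one_iff w hp0).mp hw
  have h8 := hnn m hm0
  omega

theorem isAdmissible_rat {T : Finset ℕ} (hT : ∀ p ∈ T, p.Prime) (h2 : 2 ∈ T) :
    IsAdmissible ∅ T ℚ where
  isGalois := IsGalois.self ℚ
  isPGroup g := ⟨0, AlgEquiv.ext fun x => by
    rw [pow_zero, pow_one, AlgEquiv.one_apply, eq_ratCast g x]; rfl⟩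
  isTotallyReal := inferInstance
  prime p hp := hT p (by simpa using hp)
  two_mem := h2
  split p hp w hw := ⟨ord_natCast_rat (hT p hp) hw, hasIntegerResidues_rat w⟩
  tame q hq := absurd hq (Finset.notMem_empty q)
  unram p hp _ w hw := ord_natCast_rat hp hw
  sqrt q hq := absurd hq (Finset.notMem_empty q)

theorem exists_primes (n : ℕ) : ∃ Q : Finset ℕ, Q.card = n ∧
    (∀ q ∈ Q, q.Prime ∧ q ≡ 1 [MOD 8]) ∧ ∀ p ∈ Q, ∀ q ∈ Q, p ≠ q → IsSquare (q : ZMod p) := by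
  induction n with
  | zero => exact ⟨∅, rfl, by simp, by simp⟩
  | succ n ih =>
    obtain ⟨Q, hn, hQ, hsq⟩ := ih
    have hk : 8 * ∏ q ∈ Q, q ≠ 0 :=
      mul_ne_zero (by norm_num) (Finset.prod_ne_zero_iff.mpr fun q hq => (hQ q hq).1.ne_zero)
    obtain ⟨q, hq, -, hqm⟩ := Nat.exists_prime_gt_modEq_one 0 hk
    have h8 : q ≡ 1 [MOD 8] := hqm.of_dvd (dvd_mul_right _ _)
    have hqp (p : ℕ) (hp : p ∈ Q) : q ≡ 1 [MOD p] :=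
      hqm.of_dvd ((Finset.dvd_prod_of_mem _ hp).mul_left _)
    have hqQ : q ∉ Q := fun h => by
      have h1 := hqp q h
      rw [Nat.ModEq, Nat.mod_self, Nat.mod_eq_of_lt hq.one_lt] at h1
      exact zero_ne_one h1
    have hsq1 (p : ℕ) (hp : p ∈ Q) : IsSquare (q : ZMod p) := by
      rw [(ZMod.natCast_eq_natCast_iff q 1 p).mpr (hqp p hp), Nat.cast_one]
      exact IsSquare.one
    have hsq2 (p : ℕ) (hp : p ∈ Q) : IsSquare (p : ZMod q) := by
      have := Fact.mk hq
      have := Fact.mk (hQ p hp).1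
      refine (ZMod.exists_sq_eq_prime_iff_of_mod_four_eq_one (p := q) (q := p) ?_ ?_).mpr (hsq1 p hp)
      · have := h8.of_dvd (show 4 ∣ 8 by norm_num)
        exact this
      · rintro rfl
        have := (hQ 2 hp).2
        simp [Nat.ModEq] at this
    refine ⟨insert q Q, by rw [Finset.card_insert_of_notMem hqQ, hn], fun p hp => ?_,
      fun p hp p' hp' hne => ?_⟩
    · rcases Finset.mem_insert.mp hp with rfl | hp
      · exact ⟨hq, h8⟩
      · exact hQ p hp
    · rcases Finset.mem_insert.mp hp with rfl | hpQ
      · exact hsq2 p' ((Finset.mem_insert.mp hp').resolve_left (Ne.symm hne))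
      · rcases Finset.mem_insert.mp hp' with rfl | hpQ'
        · exact hsq1 p hpQ
        · exact hsq p hpQ p' hpQ' hne

theorem natCast_mem_sqClass {L : Type*} [Field L] [NumberField L] {p q : ℕ} (hp : p.Prime)
    (hq : q.Prime) (hpq : p ≠ q) (hp2 : p ≠ 2) (hsq : IsSquare (q : ZMod p))
    {w : HeightOneSpectrum (𝓞 L)} (hw : w.valuation L (p : L) < 1) {α : Lˣ} (hα : (q : L) = α) :
    α ∈ sqClass w := by
  have := Fact.mk hp
  obtain ⟨t, ht⟩ := hsq
  have h2 : w.valuation L 2 = 1 := by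
    exact_mod_cast valuation_natCast_eq_one hp Nat.prime_two hp2 hw
  have h4 : w.valuation L 4 = 1 := by
    rw [show (4 : L) = 2 * 2 by norm_num, map_mul, h2, one_mul]
  refine mem_sqClass_of_sub_sq_lt (c := ((t.val : ℤ) : L)) ?_ ?_
  · rw [← hα]
    exact valuation_natCast_eq_one hp hq hpq hw
  · have h1 : (α : L) - ((t.val : ℤ) : L) ^ 2 = (((q : ℤ) - (t.val : ℤ) ^ 2 : ℤ) : L) := by
      rw [← hα]
      push_cast
      ring
    rw [h4, h1, valuation_intCast_lt_one_iff hp hw, ← ZMod.intCast_zmod_eq_zero_iff_dvd]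
    push_cast
    rw [ZMod.natCast_zmod_val, ht]
    ring

theorem natCast_mem_sqClass_two {L : Type*} [Field L] [NumberField L] {q : ℕ} (hq : q ≡ 1 [MOD 8])
    {w : HeightOneSpectrum (𝓞 L)} (hw : w.valuation L (2 : L) < 1) {α : Lˣ} (hα : (q : L) = α) :
    α ∈ sqClass w := by
  refine levelFour_le_sqClass w (mem_levelFour.mpr ?_)
  obtain ⟨m, hm⟩ := (Nat.modEq_iff_dvd.mp hq.symm)
  have h1 : (α : L) - 1 = 2 * (4 * (m : L)) := by
    have h2 := congrArg (Int.cast (R := L)) hm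
    push_cast at h2
    rw [← hα, h2]
    ring
  have h4 : 0 < w.valuation L 4 := zero_lt_iff.mpr ((Valuation.ne_zero_iff _).mpr (by norm_num))
  rw [h1, map_mul, map_mul]
  calc w.valuation L 2 * (w.valuation L 4 * w.valuation L (m : L))
      ≤ w.valuation L 2 * (w.valuation L 4 * 1) := by
        gcongr
        exact valuation_intCast_le_one w m
    _ < 1 * (w.valuation L 4 * 1) := mul_lt_mul_of_pos_right hw (by rwa [mul_one])
    _ = _ := by rw [one_mul, mul_one]

theorem exists_isAdmissible {Q : Finset ℕ} (hQ : ∀ q ∈ Q, q.Prime ∧ q ≡ 1 [MOD 8])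
    (hsq : ∀ p ∈ Q, ∀ q ∈ Q, p ≠ q → IsSquare (q : ZMod p)) :
    ∃ (L : Type) (_ : Field L) (_ : NumberField L), IsAdmissible Q {2} L := by
  have h2Q : 2 ∉ Q := fun h => by
    have := (hQ 2 h).2
    simp [Nat.ModEq] at this
  suffices h : ∀ S ⊆ Q, ∃ (L : Type) (_ : Field L) (_ : NumberField L),
      IsAdmissible S (insert 2 (Q \ S)) L by
    obtain ⟨L, _, _, hL⟩ := h Q subset_rfl
    exact ⟨L, _, _, by simpa using hL⟩
  intro S hS
  induction S using Finset.induction_on with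
  | empty =>
    refine ⟨ℚ, _, _, isAdmissible_rat (fun p hp => ?_) (Finset.mem_insert_self _ _)⟩
    rcases Finset.mem_insert.mp hp with rfl | hp
    · exact Nat.prime_two
    · exact (hQ p (by simpa using hp)).1
  | insert q S hqS ih =>
    obtain ⟨hqQ, hSQ⟩ := Finset.insert_subset_iff.mp hS
    obtain ⟨L, _, _, hL⟩ := ih hSQ
    have hqp := (hQ q hqQ).1
    have hq2 : q ≠ 2 := fun h => h2Q (h ▸ hqQ)
    have hqT : q ∈ insert 2 (Q \ S) :=
      Finset.mem_insert_of_mem (Finset.mem_sdiff.mpr ⟨hqQ, hqS⟩)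
    have hq0 : (q : L) ≠ 0 := Nat.cast_ne_zero.mpr hqp.ne_zero
    let α : Lˣ := Units.mk0 (q : L) hq0
    have hα : ¬IsSquare (α : L) := by
      rintro ⟨b, hb⟩
      obtain ⟨w, hw⟩ := exists_valuation_natCast_lt_one L hqp
      have h1 := (hL.split q hqT w hw).1
      have hb0 : b ≠ 0 := by
        rintro rfl
        rw [mul_zero] at hb
        exact α.ne_zero hb
      rw [show (q : L) = b * b from hb, ord_mul w hb0 hb0] at h1
      omega
    obtain ⟨M, _, _, _, r, h2, hr⟩ := exists_quadratic hα
    have h3 := (hL.adjoin_sqrt (Q := {q}) (Finset.singleton_subset_iff.mpr hqT)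
      (by simpa using hq2.symm) h2 hα hr (fun g => ⟨1, by simp [α]⟩) (fun φ => by
        simpa [α] using hqp.pos) (fun p hp => by rw [Finset.mem_singleton.mp hp]; rfl)
      (fun p hp w hw => ?_) fun w hw => ?_).1
    · refine ⟨M, inferInstance, inferInstance, ?_⟩
      convert h3 using 1
      · ext p
        simp
      · ext p
        simp only [Finset.mem_insert, Finset.mem_sdiff, Finset.mem_singleton]
        constructor
        · rintro (rfl | ⟨h1, h2⟩)
          · exact ⟨Or.inl rfl, hq2.symm⟩
          · push Not at h2
            exact ⟨Or.inr ⟨h1, h2.2⟩, h2.1⟩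
        · rintro ⟨rfl | ⟨h1, h2⟩, h3⟩
          · exact Or.inl rfl
          · exact Or.inr ⟨h1, fun h => h.elim h3 h2⟩
    · by_cases hp2 : p = 2
      · subst hp2
        exact natCast_mem_sqClass_two (hQ q hqQ).2 (by exact_mod_cast hw) rfl
      · have hpQ : p ∈ Q ∧ p ≠ q := by
          rcases Finset.mem_union.mp hp with hp | hp
          · exact ⟨hSQ hp, fun h => hqS (h ▸ hp)⟩
          · obtain ⟨h1, h2⟩ := Finset.mem_sdiff.mp hp
            exact ⟨(Finset.mem_sdiff.mp ((Finset.mem_insert.mp h1).resolve_left hp2)).1,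
              fun h => h2 (Finset.mem_singleton.mpr h)⟩
        exact natCast_mem_sqClass (hQ p hpQ.1).1 hqp hpQ.2 hp2 (hsq p hpQ.1 q hqQ hpQ.2) hw rfl
    · have h1 := hw q (Finset.mem_union_right _ hqT)
      rw [show ord w (α : L) = 0 from (valuation_eq_one_iff w hq0).mp h1]
      exact Even.zero

/-- There are totally real Galois fields of arbitrarily large degree and bounded root discriminant
in which `2` splits completely. -/
theorem exists_infinite_tower : ∃ (S : Finset ℕ) (ρ : ℝ), 1 ≤ ρ ∧ ∀ n : ℕ, ∃ (M : Type) (_ : Field M)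
    (_ : NumberField M), IsAdmissible S {2} M ∧ n ≤ Module.finrank ℚ M ∧ Even (Module.finrank ℚ M) ∧
      |(discr M : ℝ)| ≤ ρ ^ Module.finrank ℚ M := by
  obtain ⟨Q, hQ, h1, h2⟩ := exists_primes 18
  obtain ⟨L, _, _, hL⟩ := exists_isAdmissible h1 h2
  have hd : (1 : ℝ) ≤ (discr L).natAbs := by
    exact_mod_cast Nat.one_le_iff_ne_zero.mpr (Int.natAbs_ne_zero.mpr (discr_ne_zero L))
  have hpos : 0 < Module.finrank ℚ L := Module.finrank_pos
  refine ⟨Q, (discr L).natAbs, hd, fun n => ?_⟩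
  obtain ⟨M, _, _, hM, hdeg, hdisc⟩ := hL.exists_tower hQ (n + 1)
  refine ⟨M, _, _, hM, ?_, ?_, ?_⟩
  · rw [hdeg]
    calc n ≤ n + 1 := n.le_succ
      _ ≤ 2 ^ (n + 1) := Nat.lt_two_pow_self.le
      _ ≤ _ := Nat.le_mul_of_pos_right _ hpos
  · rw [hdeg, pow_succ]
    exact ((even_two.mul_left _).mul_right _)
  · rw [← Int.cast_abs, Int.abs_eq_natAbs, Int.cast_natCast, hdisc, hdeg, Nat.cast_pow]
    exact pow_le_pow_right₀ hd (Nat.le_mul_of_pos_right _ hpos)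

end PlaceTheory

namespace PlaceTheory

open NumberField IsDedekindDomain MeasureTheory

/-- A Blichfeldt-type bound: if every translate of `s` meets the lattice in at most the set `T`
of differences, then the volume of `s` is at most `|T|` times the covolume. -/
theorem measure_le_encard_mul {G α : Type*} [AddGroup G] [AddAction G α] [MeasurableSpace α]
    {μ : Measure α} [MeasurableConstVAdd G α] [VAddInvariantMeasure G α μ] [Countable G]
    {F : Set α} (hF : IsAddFundamentalDomain G F μ) {s : Set α} (hs : MeasurableSet s) (T : Set G)
    (hT : ∀ x ∈ s, ∀ g : G, g +ᵥ x ∈ s → g ∈ T) : μ s ≤ T.encard * μ F := by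
  rw [← lintegral_indicator_one hs, hF.lintegral_eq_tsum', ← lintegral_tsum]
  · calc ∫⁻ x in F, ∑' g : G, s.indicator 1 (-g +ᵥ x) ∂μ ≤ ∫⁻ _ in F, (T.encard : ENNReal) ∂μ := by
          refine lintegral_mono fun x => ?_
          let U : Set G := {g | -g +ᵥ x ∈ s}
          have h1 : ∑' g : G, s.indicator (1 : α → ENNReal) (-g +ᵥ x) = U.encard := by
            rw [← ENNReal.tsum_set_one, tsum_subtype U (fun _ => (1 : ENNReal))]
            rfl
          rw [h1]
          rcases U.eq_empty_or_nonempty with hU | ⟨g₀, hg₀⟩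
          · simp [hU]
          · refine ENat.toENNReal_le.mpr (Set.encard_le_encard_of_injOn (f := fun g => -g + g₀) ?_ ?_)
            · intro g hg
              refine hT _ hg₀ _ ?_
              rw [vadd_vadd, add_neg_cancel_right]
              exact hg
            · intro g _ g' _ h
              exact neg_injective (add_right_cancel h)
      _ = T.encard * μ F := by rw [lintegral_const, Measure.restrict_apply_univ]
  · intro g
    exact ((measurable_one.indicator hs).comp (measurable_const_vadd (-g))).aemeasurable

variable {K : Type*} [Field K]

/-- The elements of an ideal all of whose archimedean absolute values are at most `Y`. -/
def idealBox (I : Ideal (𝓞 K)) (Y : ℝ) : Set (𝓞 K) :=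
  {x | x ∈ I ∧ ∀ w : InfinitePlace K, w (x : K) ≤ Y}

variable [NumberField K] [IsTotallyReal K]

theorem card_infinitePlace : Fintype.card (InfinitePlace K) = Module.finrank ℚ K := by
  rw [InfinitePlace.card_eq_nrRealPlaces_add_nrComplexPlaces, IsTotallyReal.nrComplexPlaces_eq_zero,
    IsTotallyReal.finrank, add_zero]

theorem prod_eq_abs_norm' (x : 𝓞 K) :
    ∏ w : InfinitePlace K, w (x : K) = |(Algebra.norm ℤ x : ℝ)| := by
  have h1 := InfinitePlace.prod_eq_abs_norm (x : K)
  rw [← Algebra.coe_norm_int] at h1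
  rw [← Int.cast_abs]
  push_cast at h1
  rw [← Int.cast_abs] at h1
  rw [← h1]
  refine Finset.prod_congr rfl fun w _ => ?_
  rw [InfinitePlace.mult, if_pos (IsTotallyReal.isReal w), pow_one]

theorem eq_zero_of_mem_of_lt {I : Ideal (𝓞 K)} {x : 𝓞 K} (hx : x ∈ I) {s : ℝ}
    (hs : s ^ Module.finrank ℚ K ≤ Ideal.absNorm I) (h : ∀ w : InfinitePlace K, w (x : K) < s) :
    x = 0 := by
  by_contra h0
  have h1 : ∏ w : InfinitePlace K, w (x : K) < s ^ Module.finrank ℚ K := by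
    rw [← card_infinitePlace, ← Finset.card_univ, ← Finset.prod_const]
    have hx0 : (x : K) ≠ 0 := RingOfIntegers.coe_ne_zero_iff.mpr h0
    exact Finset.prod_lt_prod_of_nonempty (fun w _ => InfinitePlace.pos_iff.mpr hx0)
      (fun w _ => h w) Finset.univ_nonempty
  rw [prod_eq_abs_norm', ← Int.cast_abs] at h1
  have h2 : (Ideal.absNorm I : ℤ) ≤ |Algebra.norm ℤ x| :=
    Int.le_of_dvd (abs_pos.mpr (Algebra.norm_ne_zero_iff.mpr h0))
      ((dvd_abs _ _).mpr (Ideal.absNorm_dvd_norm_of_mem hx))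
  have h3 : (Ideal.absNorm I : ℝ) ≤ (|Algebra.norm ℤ x| : ℤ) := by exact_mod_cast h2
  linarith

theorem idealBox_ncard_le_of_pow_le {I : Ideal (𝓞 K)} {Y s : ℝ} (hY : 0 ≤ Y) (hs0 : 0 < s)
    (hs : s ^ Module.finrank ℚ K ≤ Ideal.absNorm I) :
    (idealBox I Y).Finite ∧ ((idealBox I Y).ncard : ℝ) ≤ (2 * Y / s + 1) ^ Module.finrank ℚ K := by
  classical
  let e : ∀ w : InfinitePlace K, K →+* ℝ := fun w =>
    InfinitePlace.embedding_of_isReal (IsTotallyReal.isReal w)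
  have he : ∀ (w : InfinitePlace K) (x : K), |e w x| = w x := fun w x =>
    InfinitePlace.norm_embedding_of_isReal (IsTotallyReal.isReal w) x
  let P : Finset (InfinitePlace K → ℤ) := Fintype.piFinset fun _ => Finset.Icc 0 ⌊2 * Y / s⌋
  let f : 𝓞 K → InfinitePlace K → ℤ := fun x w => ⌊(e w x + Y) / s⌋
  have hf : ∀ x ∈ idealBox I Y, f x ∈ (P : Set (InfinitePlace K → ℤ)) := by
    intro x hx
    refine Finset.mem_coe.mpr (Fintype.mem_piFinset.mpr fun w => Finset.mem_Icc.mpr ?_)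
    have h1 := abs_le.mp ((he w x).trans_le (hx.2 w))
    exact ⟨Int.floor_nonneg.mpr (div_nonneg (by linarith) hs0.le),
      Int.floor_le_floor (div_le_div_of_nonneg_right (by linarith) hs0.le)⟩
  have hinj : Set.InjOn f (idealBox I Y) := by
    intro x hx y hy hxy
    refine sub_eq_zero.mp (eq_zero_of_mem_of_lt (I.sub_mem hx.1 hy.1) hs fun w => ?_)
    have h1 := Int.abs_sub_lt_one_of_floor_eq_floor (congrFun hxy w)
    rw [← sub_div, abs_div, abs_of_pos hs0, div_lt_one hs0] at h1
    rw [← he, show ((x - y : 𝓞 K) : K) = x - y from rfl, map_sub]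
    rwa [add_sub_add_right_eq_sub] at h1
  have hfin : (idealBox I Y).Finite := Set.Finite.of_injOn hf hinj P.finite_toSet
  refine ⟨hfin, ?_⟩
  have h1 := Set.ncard_le_ncard_of_injOn f hf hinj P.finite_toSet
  have h2 : (P.card : ℝ) ≤ (2 * Y / s + 1) ^ Module.finrank ℚ K := by
    rw [Fintype.card_piFinset, Finset.prod_const, Finset.card_univ, card_infinitePlace, Nat.cast_pow]
    refine pow_le_pow_left₀ (Nat.cast_nonneg _) ?_ _
    have h3 : (0 : ℤ) ≤ ⌊2 * Y / s⌋ := Int.floor_nonneg.mpr (by positivity)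
    have h4 : (((Finset.Icc 0 ⌊2 * Y / s⌋).card : ℤ) : ℝ) = (⌊2 * Y / s⌋ : ℝ) + 1 := by
      rw [Int.card_Icc, Int.toNat_of_nonneg (by linarith)]
      push_cast
      ring
    rw [Int.cast_natCast] at h4
    rw [h4]
    linarith [Int.floor_le (2 * Y / s)]
  refine le_trans ?_ h2
  rw [Set.ncard_coe_finset] at h1
  exact_mod_cast h1

theorem idealBox_finite (I : Ideal (𝓞 K)) {Y : ℝ} (hY : 0 ≤ Y) : (idealBox I Y).Finite := by
  have h1 : (idealBox (⊤ : Ideal (𝓞 K)) Y).Finite :=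
    (idealBox_ncard_le_of_pow_le hY one_pos (by rw [Ideal.absNorm_top]; simp)).1
  exact h1.subset fun x hx => ⟨Submodule.mem_top, hx.2⟩

theorem idealBox_ncard_mul_absNorm_le {I : Ideal (𝓞 K)} (hI : I ≠ ⊥) {Y : ℝ} (hY : 0 ≤ Y)
    (h : (Ideal.absNorm I : ℝ) ≤ Y ^ Module.finrank ℚ K) :
    ((idealBox I Y).ncard : ℝ) * Ideal.absNorm I ≤ (3 * Y) ^ Module.finrank ℚ K := by
  have hd : Module.finrank ℚ K ≠ 0 := Module.finrank_pos.ne'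
  have hN : (0 : ℝ) < Ideal.absNorm I := by
    exact_mod_cast Nat.pos_of_ne_zero (Ideal.absNorm_eq_zero_iff.not.mpr hI)
  obtain ⟨s, hs0, hs⟩ : ∃ s : ℝ, 0 < s ∧ s ^ Module.finrank ℚ K = Ideal.absNorm I :=
    ⟨(Ideal.absNorm I : ℝ) ^ ((Module.finrank ℚ K : ℝ)⁻¹), Real.rpow_pos_of_pos hN _,
      Real.rpow_inv_natCast_pow hN.le hd⟩
  have hsY : s ≤ Y := le_of_pow_le_pow_left₀ hd hY (hs.trans_le h)
  have h1 := (idealBox_ncard_le_of_pow_le hY hs0 hs.le).2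
  calc ((idealBox I Y).ncard : ℝ) * Ideal.absNorm I
      ≤ (2 * Y / s + 1) ^ Module.finrank ℚ K * s ^ Module.finrank ℚ K := by
        rw [hs]
        exact mul_le_mul_of_nonneg_right h1 hN.le
    _ = (2 * Y + s) ^ Module.finrank ℚ K := by
        rw [← mul_pow, add_mul, div_mul_cancel₀ _ hs0.ne', one_mul]
    _ ≤ _ := pow_le_pow_left₀ (by positivity) (by linarith) _

open mixedEmbedding in
theorem pow_le_idealBox_ncard_mul {I : Ideal (𝓞 K)} (hI : I ≠ ⊥) {X : ℝ} (hX : 0 ≤ X) :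
    X ^ Module.finrank ℚ K ≤
      (idealBox I X).ncard * (Ideal.absNorm I * Real.sqrt |(discr K : ℝ)|) := by
  classical
  let J : (FractionalIdeal (nonZeroDivisors (𝓞 K)) K)ˣ :=
    Units.mk0 (I : FractionalIdeal (nonZeroDivisors (𝓞 K)) K) (FractionalIdeal.coeIdeal_ne_zero.mpr hI)
  have hF := ZSpan.isAddFundamentalDomain' (fractionalIdealLatticeBasis K J) volume
  have : Countable (Submodule.span ℤ (Set.range (fractionalIdealLatticeBasis K J))).toAddSubgroup := by
    change Countable (Submodule.span ℤ (Set.range (fractionalIdealLatticeBasis K J)))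
    infer_instance
  let f : InfinitePlace K → NNReal := fun _ => Real.toNNReal (X / 2)
  let T : Set (Submodule.span ℤ (Set.range (fractionalIdealLatticeBasis K J))).toAddSubgroup :=
    {g | ∃ x ∈ idealBox I X, mixedEmbedding K (x : K) = g}
  have hT : ∀ x ∈ convexBodyLT K f, ∀ g : (Submodule.span ℤ
      (Set.range (fractionalIdealLatticeBasis K J))).toAddSubgroup,
      g +ᵥ x ∈ convexBodyLT K f → g ∈ T := by
    rintro x hx ⟨g, hg⟩ hgx
    rw [Submodule.mem_toAddSubgroup, mem_span_fractionalIdealLatticeBasis] at hg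
    obtain ⟨a, ha, rfl⟩ := hg
    obtain ⟨b, hb, rfl⟩ := (FractionalIdeal.mem_coeIdeal _).mp ha
    refine ⟨b, ⟨hb, ?_⟩, rfl⟩
    have h1 : mixedEmbedding K (b : K) ∈ convexBodyLT K (fun w => f w + f w) := by
      have h2 : mixedEmbedding K (b : K) = (mixedEmbedding K (b : K) + x) + -x := by abel
      rw [h2]
      have h3 := convexBodyLT_neg_mem K f x hx
      have h4 : mixedEmbedding K (b : K) + x ∈ convexBodyLT K f := hgx
      refine ⟨fun w _ => ?_, fun w _ => ?_⟩
      · have h5 := h4.1 w trivial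
        have h6 := h3.1 w trivial
        rw [mem_ball_zero_iff] at h5 h6 ⊢
        exact (norm_add_le _ _).trans_lt (add_lt_add h5 h6)
      · have h5 := h4.2 w trivial
        have h6 := h3.2 w trivial
        rw [mem_ball_zero_iff] at h5 h6 ⊢
        exact (norm_add_le _ _).trans_lt (add_lt_add h5 h6)
    intro w
    have h2 := (convexBodyLT_mem K _).mp h1 w
    have h3 : ((f w + f w : NNReal) : ℝ) = X := by
      rw [NNReal.coe_add, Real.coe_toNNReal _ (by positivity), add_halves]
    exact (h2.trans_eq h3).le
  have hmeas : MeasurableSet (convexBodyLT K f) :=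
    (MeasurableSet.univ_pi fun _ => measurableSet_ball).prod
      (MeasurableSet.univ_pi fun _ => measurableSet_ball)
  have h1 := measure_le_encard_mul hF hmeas T hT
  have hfin := idealBox_finite I hX
  have hTcard : T.encard ≤ (idealBox I X).ncard := by
    rw [hfin.cast_ncard_eq]
    have h2 : (Subtype.val '' T).encard ≤ ((fun x : 𝓞 K => mixedEmbedding K (x : K)) '' idealBox I X).encard := by
      refine Set.encard_le_encard ?_
      rintro _ ⟨g, ⟨x, hx, h⟩, rfl⟩
      exact ⟨x, hx, h⟩
    rw [Subtype.val_injective.encard_image] at h2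
    exact h2.trans (Set.encard_image_le _ _)
  have hvol : volume (convexBodyLT K f) = ENNReal.ofReal (X ^ Module.finrank ℚ K) := by
    have h2 : convexBodyLTFactor K * ∏ w : InfinitePlace K, f w ^ w.mult =
        Real.toNNReal (X ^ Module.finrank ℚ K) := by
      rw [← NNReal.coe_inj, Real.coe_toNNReal _ (by positivity), convexBodyLTFactor,
        IsTotallyReal.nrComplexPlaces_eq_zero, pow_zero, mul_one, ← IsTotallyReal.finrank]
      have h3 : ∏ w : InfinitePlace K, f w ^ w.mult = Real.toNNReal (X / 2) ^ Module.finrank ℚ K := by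
        rw [← card_infinitePlace, ← Finset.card_univ, ← Finset.prod_const]
        refine Finset.prod_congr rfl fun w _ => ?_
        rw [InfinitePlace.mult, if_pos (IsTotallyReal.isReal w), pow_one]
      rw [h3, ← mul_pow, NNReal.coe_pow]
      rw [NNReal.coe_mul, Real.coe_toNNReal _ (by positivity), NNReal.coe_ofNat,
        mul_div_cancel₀ X two_ne_zero]
    rw [convexBodyLT_volume, ENNReal.ofReal, ← h2, ← ENNReal.coe_mul]
  have hcov : volume (ZSpan.fundamentalDomain (fractionalIdealLatticeBasis K J)) =
      ENNReal.ofReal (Ideal.absNorm I * Real.sqrt |(discr K : ℝ)|) := by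
    rw [volume_fundamentalDomain_fractionalIdealLatticeBasis, volume_fundamentalDomain_latticeBasis,
      IsTotallyReal.nrComplexPlaces_eq_zero, pow_zero, one_mul, ENNReal.ofReal_mul (by positivity)]
    congr 1
    · rw [Units.val_mk0, FractionalIdeal.coeIdeal_absNorm, Rat.cast_natCast]
    · rw [ENNReal.ofReal]
      congr 1
      rw [← NNReal.coe_inj, Real.coe_toNNReal _ (Real.sqrt_nonneg _), Real.coe_sqrt, coe_nnnorm,
        Int.norm_eq_abs]
  rw [hvol, hcov] at h1
  have h2 : ENNReal.ofReal (X ^ Module.finrank ℚ K) ≤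
      ENNReal.ofReal ((idealBox I X).ncard * (Ideal.absNorm I * Real.sqrt |(discr K : ℝ)|)) := by
    rw [ENNReal.ofReal_mul (Nat.cast_nonneg _), ENNReal.ofReal_natCast]
    refine h1.trans (mul_le_mul_left ?_ _)
    exact_mod_cast hTcard
  exact (ENNReal.ofReal_le_ofReal_iff (by positivity)).mp h2

end PlaceTheory

namespace PlaceTheory

open NumberField IsDedekindDomain

variable {K : Type*} [Field K] [NumberField K]

theorem valuation_natCast_lt_one_iff {w : HeightOneSpectrum (𝓞 K)} {p : ℕ} :
    w.valuation K (p : K) < 1 ↔ (p : 𝓞 K) ∈ w.asIdeal := by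
  rw [← map_natCast (algebraMap (𝓞 K) K), w.valuation_lt_one_iff_mem]

theorem HasIntegerResidues.absNorm_eq_two {w : HeightOneSpectrum (𝓞 K)}
    (hw : HasIntegerResidues w) (h2 : w.valuation K ((2 : ℕ) : K) < 1) : Ideal.absNorm w.asIdeal = 2 := by
  have h2' : (2 : 𝓞 K) ∈ w.asIdeal := by
    have h3 := valuation_natCast_lt_one_iff.mp h2
    rwa [Nat.cast_ofNat] at h3
  have h0 : Ideal.absNorm w.asIdeal ≠ 0 := Ideal.absNorm_eq_zero_iff.not.mpr w.ne_bot
  have h1 : Ideal.absNorm w.asIdeal ≠ 1 := Ideal.absNorm_eq_one_iff.not.mpr w.isPrime.ne_top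
  have hle : Ideal.absNorm w.asIdeal ≤ 2 := by
    rw [Ideal.absNorm_apply, Submodule.cardQuot_apply, ← Nat.card_eq_two_iff.mpr
      (⟨false, true, by simp, by ext b; cases b <;> simp⟩ : ∃ x y : Bool, x ≠ y ∧ {x, y} = Set.univ)]
    refine Nat.card_le_card_of_surjective
      (fun b : Bool => Ideal.Quotient.mk w.asIdeal (if b then 1 else 0)) fun y => ?_
    obtain ⟨y, rfl⟩ := Ideal.Quotient.mk_surjective y
    obtain ⟨m, hm⟩ := hw (algebraMap (𝓞 K) K y) (w.valuation_le_one y)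
    rw [← map_intCast (algebraMap (𝓞 K) K), ← map_sub, w.valuation_lt_one_iff_mem] at hm
    rcases Int.even_or_odd' m with ⟨n, rfl | rfl⟩
    · refine ⟨false, (Ideal.Quotient.eq.mpr ?_).symm⟩
      have h3 := w.asIdeal.add_mem hm (w.asIdeal.mul_mem_right (n : 𝓞 K) h2')
      push_cast at h3
      simpa using h3
    · refine ⟨true, (Ideal.Quotient.eq.mpr ?_).symm⟩
      have h3 := w.asIdeal.add_mem hm (w.asIdeal.mul_mem_right (n : 𝓞 K) h2')
      push_cast at h3
      rw [if_pos rfl]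
      convert h3 using 1
      ring
  omega

theorem exists_primes_over_two
    (h : ∀ w : HeightOneSpectrum (𝓞 K), w.valuation K ((2 : ℕ) : K) < 1 →
      ord w ((2 : ℕ) : K) = 1 ∧ HasIntegerResidues w) :
    ∃ P : Fin (Module.finrank ℚ K) → Ideal (𝓞 K), Function.Injective P ∧ (∀ i, (P i).IsMaximal) ∧
      ∀ i, Ideal.absNorm (P i) = 2 := by
  obtain ⟨w₀, hw₀⟩ := exists_valuation_natCast_lt_one K Nat.prime_two
  let v := under ℚ w₀
  have hv := valuation_under_natCast_lt_one (L := ℚ) hw₀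
  have h1 := Ideal.sum_ramification_inertia_eq_finrank v.asIdeal (𝓞 K)
  rw [finrank_ringOfIntegers] at h1
  have hne (q : v.asIdeal.primesOver (𝓞 K)) : q.1 ≠ ⊥ := by
    have := q.2.1
    have := q.2.2
    exact Ideal.ne_bot_of_liesOver_of_ne_bot v.ne_bot q.1
  let W : v.asIdeal.primesOver (𝓞 K) → HeightOneSpectrum (𝓞 K) := fun q => ⟨q.1, q.2.1, hne q⟩
  have hunder (q) : under ℚ (W q) = v := HeightOneSpectrum.ext q.2.2.over.symm
  have hW (q) : (W q).valuation K ((2 : ℕ) : K) < 1 := by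
    rw [← map_natCast (algebraMap ℚ K), valuation_algebraMap_lt_one_iff, hunder]
    exact hv
  have h3 (q : v.asIdeal.primesOver (𝓞 K)) :
      q.1.ramificationIdx (𝓞 ℚ) * q.1.inertiaDeg (𝓞 ℚ) = 1 := by
    have h4 := h (W q) (hW q)
    have h5 := h4.1
    rw [ord_natCast (L := ℚ), hunder, ord_natCast_rat Nat.prime_two hv, mul_one] at h5
    have h6 : ram ℚ (W q) = 1 := by exact_mod_cast h5
    have : (W q).asIdeal.LiesOver (under ℚ (W q)).asIdeal := ⟨rfl⟩
    rw [ram, Ideal.ramificationIdx'_eq_ramificationIdx _ _ (under ℚ (W q)).ne_bot] at h6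
    have h7 := h4.2.res_eq_one
    exact mul_eq_one.mpr ⟨h6, h7⟩
  rw [Finset.sum_congr rfl fun q _ => h3 q, Finset.sum_const, smul_eq_mul, mul_one,
    Finset.card_univ] at h1
  let e := Fintype.equivFinOfCardEq h1
  exact ⟨fun i => (e.symm i).1, Subtype.val_injective.comp e.symm.injective,
    fun i => (W (e.symm i)).isMaximal, fun i => (h _ (hW _)).2.absNorm_eq_two (hW _)⟩

end PlaceTheory

namespace PlaceTheory

open NumberField IsDedekindDomain

theorem sq_sum_card_le {ι α : Type*} [Fintype ι] [DecidableEq α] (B : ι → Finset α) :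
    (∑ f, (B f).card) ^ 2 ≤ (Finset.univ.biUnion B).card * ∑ f, ∑ g, (B f ∩ B g).card := by
  let U := Finset.univ.biUnion B
  let χ : ι → α → ℕ := fun f x => if x ∈ B f then 1 else 0
  have hsub (f : ι) : B f ⊆ U := Finset.subset_biUnion_of_mem B (Finset.mem_univ f)
  have h1 (f : ι) : (B f).card = ∑ x ∈ U, χ f x := by
    rw [Finset.sum_boole, Finset.filter_mem_eq_inter, Finset.inter_eq_right.mpr (hsub f), Nat.cast_id]
  have h2 (f g : ι) : (B f ∩ B g).card = ∑ x ∈ U, χ f x * χ g x := by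
    have h3 (x : α) : χ f x * χ g x = if x ∈ B f ∩ B g then 1 else 0 := by
      simp only [χ, Finset.mem_inter, ite_and, mul_ite, mul_one, mul_zero]
      split_ifs <;> rfl
    rw [Finset.sum_congr rfl fun x _ => h3 x, Finset.sum_boole, Finset.filter_mem_eq_inter,
      Finset.inter_eq_right.mpr (Finset.inter_subset_left.trans (hsub f)), Nat.cast_id]
  have h4 : ∑ f, ∑ g, (B f ∩ B g).card = ∑ x ∈ U, (∑ f, χ f x) ^ 2 := by
    rw [Finset.sum_congr rfl fun f _ => Finset.sum_congr rfl fun g _ => h2 f g]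
    rw [Finset.sum_congr rfl fun f _ => Finset.sum_comm, Finset.sum_comm]
    refine Finset.sum_congr rfl fun x _ => ?_
    rw [sq, Finset.sum_mul_sum]
  rw [h4, Finset.sum_congr rfl fun f _ => h1 f, Finset.sum_comm]
  exact sq_sum_le_card_mul_sum_sq

theorem sum_half_pow_le_of_le (a : ℕ) {n : ℕ} (hn : n ≤ a) :
    ∑ b ∈ Finset.range n, (1 / 2 : ℝ) ^ ((a - b) + (b - a)) ≤ (1 / 2 : ℝ) ^ (a - n) := by
  induction n with
  | zero => simp
  | succ n ih =>
    rw [Finset.sum_range_succ]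
    have h1 := ih (by omega)
    rw [show (a - n) + (n - a) = a - n by omega]
    rw [show a - n = (a - (n + 1)) + 1 by omega, pow_succ] at h1 ⊢
    linarith

theorem sum_half_pow_le (a n : ℕ) :
    ∑ b ∈ Finset.range n, (1 / 2 : ℝ) ^ ((a - b) + (b - a)) ≤ 3 := by
  have h1 (k : ℕ) : ∑ b ∈ Finset.range (a + 1 + k), (1 / 2 : ℝ) ^ ((a - b) + (b - a)) ≤
      3 - (1 / 2 : ℝ) ^ k := by
    induction k with
    | zero =>
      have h2 := sum_half_pow_le_of_le a le_rfl
      rw [Nat.sub_self, pow_zero] at h2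
      rw [add_zero, Finset.sum_range_succ, Nat.sub_self, add_zero, pow_zero]
      linarith
    | succ k ih =>
      rw [← add_assoc, Finset.sum_range_succ, show (a - (a + 1 + k)) + (a + 1 + k - a) = k + 1 by omega]
      rw [pow_succ]
      linarith
  have h2 : (0 : ℝ) ≤ (1 / 2 : ℝ) ^ n := by positivity
  refine le_trans ?_ ((h1 n).trans (by linarith))
  exact Finset.sum_le_sum_of_subset_of_nonneg (Finset.range_mono (by omega)) fun _ _ _ => by positivity

theorem sum_prod_half_pow_le (m J : ℕ) :
    ∑ f : Fin m → Fin J, ∑ g : Fin m → Fin J,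
      ∏ i, (1 / 2 : ℝ) ^ (((f i : ℕ) - g i) + ((g i : ℕ) - f i)) ≤ (3 * J : ℝ) ^ m := by
  have h1 : ∀ f : Fin m → Fin J, ∑ g : Fin m → Fin J,
      ∏ i, (1 / 2 : ℝ) ^ (((f i : ℕ) - g i) + ((g i : ℕ) - f i)) ≤ 3 ^ m := by
    intro f
    rw [← Fintype.prod_sum fun i (b : Fin J) => (1 / 2 : ℝ) ^ (((f i : ℕ) - b) + ((b : ℕ) - f i))]
    refine (Finset.prod_le_prod (fun i _ => by positivity) (g := fun _ => (3 : ℝ)) fun i _ => ?_).trans_eq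
      (by simp)
    rw [Fin.sum_univ_eq_sum_range fun b => (1 / 2 : ℝ) ^ (((f i : ℕ) - b) + (b - (f i : ℕ)))]
    exact sum_half_pow_le _ _
  refine (Finset.sum_le_sum fun f _ => h1 f).trans_eq ?_
  simp [mul_pow, mul_comm]

variable {K : Type*} [Field K] [NumberField K] {κ : Type*} [Fintype κ]

/-- The product of the ideals `P k` to the powers `e k`. -/
def prodIdeal (P : κ → Ideal (𝓞 K)) (e : κ → ℕ) : Ideal (𝓞 K) := ∏ k, P k ^ e k

variable {P : κ → Ideal (𝓞 K)}

theorem absNorm_prodIdeal (hP2 : ∀ k, Ideal.absNorm (P k) = 2) (e : κ → ℕ) :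
    Ideal.absNorm (prodIdeal P e) = 2 ^ ∑ k, e k := by
  rw [prodIdeal, map_prod, ← Finset.prod_pow_eq_pow_sum]
  exact Finset.prod_congr rfl fun k _ => by rw [map_pow, hP2]

theorem prodIdeal_ne_bot (hP2 : ∀ k, Ideal.absNorm (P k) = 2) (e : κ → ℕ) : prodIdeal P e ≠ ⊥ := by
  rw [Ne, ← Ideal.absNorm_eq_zero_iff, absNorm_prodIdeal hP2]
  positivity

omit [NumberField K] in
theorem mul_mem_prodIdeal {e e' : κ → ℕ} {x y : 𝓞 K} (hx : x ∈ prodIdeal P e)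
    (hy : y ∈ prodIdeal P e') : x * y ∈ prodIdeal P (fun k => e k + e' k) := by
  have h1 : prodIdeal P (fun k => e k + e' k) = prodIdeal P e * prodIdeal P e' := by
    simp_rw [prodIdeal, pow_add, Finset.prod_mul_distrib]
  rw [h1]
  exact Ideal.mul_mem_mul hx hy

theorem mem_prodIdeal_max (hinj : Function.Injective P) (hmax : ∀ k, (P k).IsMaximal) {e e' : κ → ℕ}
    {x : 𝓞 K} (hx : x ∈ prodIdeal P e) (hx' : x ∈ prodIdeal P e') :
    x ∈ prodIdeal P (fun k => max (e k) (e' k)) := by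
  rw [← Ideal.dvd_span_singleton] at hx hx' ⊢
  have hdvd {n : κ → ℕ} (h : prodIdeal P n ∣ Ideal.span {x}) (k : κ) :
      P k ^ n k ∣ Ideal.span {x} :=
    (Finset.dvd_prod_of_mem (fun k => P k ^ n k) (Finset.mem_univ k)).trans h
  refine Fintype.prod_dvd_of_isRelPrime ?_ fun k => ?_
  · intro k k' hk
    have := hmax k
    have := hmax k'
    exact (IsCoprime.pow (Ideal.isCoprime_of_isMaximal (hinj.ne hk))).isRelPrime
  · change P k ^ max (e k) (e' k) ∣ _
    rcases max_choice (e k) (e' k) with h | h <;> rw [h]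
    · exact hdvd hx k
    · exact hdvd hx' k

end PlaceTheory

namespace PlaceTheory

open NumberField IsDedekindDomain

variable {K : Type*} [Field K]

theorem mem_idealBox_top {I : Ideal (𝓞 K)} {X : ℝ} {x : 𝓞 K} (hx : x ∈ idealBox I X) :
    x ∈ idealBox (⊤ : Ideal (𝓞 K)) X := ⟨Submodule.mem_top, hx.2⟩

variable [NumberField K] [IsTotallyReal K]

theorem idealBox_top_ncard_le {Y : ℝ} (hY : 1 ≤ Y) :
    ((idealBox (⊤ : Ideal (𝓞 K)) Y).ncard : ℝ) ≤ (3 * Y) ^ Module.finrank ℚ K := by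
  have h1 := (idealBox_ncard_le_of_pow_le (K := K) (I := ⊤) (Y := Y) (by linarith) one_pos
    (by rw [Ideal.absNorm_top]; simp)).2
  refine h1.trans (pow_le_pow_left₀ (by positivity) ?_ _)
  linarith

/-- The exponents `f i` at the first half of the primes and `H - f i` at the second half. -/
def balancedExponents {m : ℕ} (H : ℕ) (f : Fin m → Fin (H + 1)) : Fin m ⊕ Fin m → ℕ :=
  Sum.elim (fun i => f i) fun i => H - f i

theorem sum_balancedExponents {m H : ℕ} (f : Fin m → Fin (H + 1)) :
    ∑ k, balancedExponents H f k = H * m := by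
  rw [Fintype.sum_sum_type, ← Finset.sum_add_distrib]
  have h1 (i : Fin m) : balancedExponents H f (Sum.inl i) + balancedExponents H f (Sum.inr i) = H :=
    Nat.add_sub_cancel' (Nat.lt_succ_iff.mp (f i).2)
  rw [Finset.sum_congr rfl fun i _ => h1 i, Finset.sum_const, Finset.card_univ, Fintype.card_fin,
    smul_eq_mul, mul_comm]

theorem sum_max_balancedExponents {m H : ℕ} (f g : Fin m → Fin (H + 1)) :
    ∑ k, max (balancedExponents H f k) (balancedExponents H g k) =
      H * m + ∑ i, (((f i : ℕ) - g i) + ((g i : ℕ) - f i)) := by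
  rw [Fintype.sum_sum_type, ← Finset.sum_add_distrib]
  have h1 (i : Fin m) : max (balancedExponents H f (Sum.inl i)) (balancedExponents H g (Sum.inl i)) +
      max (balancedExponents H f (Sum.inr i)) (balancedExponents H g (Sum.inr i)) =
      H + (((f i : ℕ) - g i) + ((g i : ℕ) - f i)) := by
    have h2 := (f i).2
    have h3 := (g i).2
    simp only [balancedExponents, Sum.elim_inl, Sum.elim_inr]
    omega
  rw [Finset.sum_congr rfl fun i _ => h1 i, Finset.sum_add_distrib, Finset.sum_const, Finset.card_univ,
    Fintype.card_fin, smul_eq_mul, mul_comm m]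

section

variable {m : ℕ} {P : Fin m ⊕ Fin m → Ideal (𝓞 K)} {H : ℕ} {X : ℝ}

/-- The union of the boxes in the ideals with balanced exponents. -/
def balancedSet (P : Fin m ⊕ Fin m → Ideal (𝓞 K)) (H : ℕ) (X : ℝ) : Set (𝓞 K) :=
  ⋃ f : Fin m → Fin (H + 1), idealBox (prodIdeal P (balancedExponents H f)) X

omit [NumberField K] [IsTotallyReal K] in
theorem balancedSet_subset : balancedSet P H X ⊆ idealBox ⊤ X :=
  Set.iUnion_subset fun _ _ hx => mem_idealBox_top hx

theorem balancedSet_finite (hX : 0 ≤ X) : (balancedSet P H X).Finite :=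
  (idealBox_finite ⊤ hX).subset balancedSet_subset

theorem balancedSet_ncard_le (hX : 1 ≤ X) :
    ((balancedSet P H X).ncard : ℝ) ≤ (3 * X) ^ Module.finrank ℚ K := by
  refine le_trans ?_ (idealBox_top_ncard_le hX)
  exact_mod_cast Set.ncard_le_ncard balancedSet_subset (idealBox_finite ⊤ (by linarith))

theorem balancedSet_add_ncard_le (hX : 1 ≤ X) :
    ((balancedSet P H X + balancedSet P H X).ncard : ℝ) ≤ (6 * X) ^ Module.finrank ℚ K := by
  have h1 : balancedSet P H X + balancedSet P H X ⊆ idealBox ⊤ (2 * X) := by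
    rintro _ ⟨x, hx, y, hy, rfl⟩
    refine ⟨Submodule.mem_top, fun w => ?_⟩
    have h2 := (balancedSet_subset hx).2 w
    have h3 := (balancedSet_subset hy).2 w
    have h4 : w ((x + y : 𝓞 K) : K) ≤ w (x : K) + w (y : K) := w.1.add_le _ _
    linarith
  have h2 := idealBox_top_ncard_le (K := K) (Y := 2 * X) (by linarith)
  rw [show 3 * (2 * X) = 6 * X by ring] at h2
  refine le_trans ?_ h2
  exact_mod_cast Set.ncard_le_ncard h1 (idealBox_finite ⊤ (by linarith))

theorem balancedSet_mul_ncard_le (hd : Module.finrank ℚ K = 2 * m)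
    (hP2 : ∀ k, Ideal.absNorm (P k) = 2) (hX : 2 ^ H ≤ X) :
    ((balancedSet P H X * balancedSet P H X).ncard : ℝ) * 4 ^ (H * m) ≤
      (18 * (H + 1) * X ^ 4) ^ m := by
  have hX1 : 1 ≤ X := (one_le_pow₀ one_le_two).trans hX
  let E : (Fin m → Fin (2 * H + 1)) → Fin m ⊕ Fin m → ℕ := fun g =>
    Sum.elim (fun i => g i) fun i => 2 * H - g i
  have hE (g) : ∑ k, E g k = 2 * H * m := sum_balancedExponents g
  let B : (Fin m → Fin (2 * H + 1)) → Set (𝓞 K) := fun g => idealBox (prodIdeal P (E g)) (X * X)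
  have hB (g) : (B g).Finite := idealBox_finite _ (by positivity)
  have hsub : balancedSet P H X * balancedSet P H X ⊆ ⋃ g, B g := by
    rintro _ ⟨x, hx, y, hy, rfl⟩
    obtain ⟨f, hf⟩ := Set.mem_iUnion.mp hx
    obtain ⟨f', hf'⟩ := Set.mem_iUnion.mp hy
    refine Set.mem_iUnion.mpr ⟨fun i => ⟨f i + f' i, by have := (f i).2; have := (f' i).2; omega⟩,
      ?_, fun w => ?_⟩
    · have h1 := mul_mem_prodIdeal hf.1 hf'.1
      convert h1 using 2
      funext k
      rcases k with i | i
      · rfl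
      · have h2 := (f i).2
        have h3 := (f' i).2
        simp only [E, balancedExponents, Sum.elim_inr]
        omega
    · have h1 : w ((x * y : 𝓞 K) : K) = w (x : K) * w (y : K) := map_mul w _ _
      change w ((x * y : 𝓞 K) : K) ≤ _
      rw [h1]
      exact mul_le_mul (hf.2 w) (hf'.2 w) (apply_nonneg w _) (by linarith)
  have hcard (g) : ((B g).ncard : ℝ) * 4 ^ (H * m) ≤ (9 * X ^ 4) ^ m := by
    have h1 : (Ideal.absNorm (prodIdeal P (E g)) : ℝ) = 4 ^ (H * m) := by
      rw [absNorm_prodIdeal hP2, hE, mul_assoc, pow_mul]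
      norm_num
    have h2 := idealBox_ncard_mul_absNorm_le (prodIdeal_ne_bot hP2 (E g)) (Y := X * X) (by positivity) ?_
    · rw [h1, hd, pow_mul (3 * (X * X)), show (3 * (X * X)) ^ 2 = 9 * X ^ 4 by ring] at h2
      exact h2
    · rw [h1, hd, pow_mul, pow_mul]
      refine pow_le_pow_left₀ (by positivity) ?_ m
      calc (4 : ℝ) ^ H = (2 ^ H) * (2 ^ H) := by rw [← mul_pow]; norm_num
        _ ≤ X * X := mul_le_mul hX hX (by positivity) (by positivity)
        _ ≤ (X * X) ^ 2 := le_self_pow₀ (one_le_mul_of_one_le_of_one_le hX1 hX1) two_ne_zero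
  have h1 : (balancedSet P H X * balancedSet P H X).ncard ≤ ∑ g, (B g).ncard :=
    (Set.ncard_le_ncard hsub (Set.finite_iUnion hB)).trans (Set.ncard_iUnion_le_of_fintype B)
  have h2 : ((balancedSet P H X * balancedSet P H X).ncard : ℝ) ≤ ∑ g, ((B g).ncard : ℝ) := by
    exact_mod_cast h1
  calc _ ≤ (∑ g, ((B g).ncard : ℝ)) * 4 ^ (H * m) := by gcongr
    _ ≤ ∑ g : Fin m → Fin (2 * H + 1), (9 * X ^ 4) ^ m := by
      rw [Finset.sum_mul]
      exact Finset.sum_le_sum fun g _ => hcard g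
    _ = ((2 * H + 1) * (9 * X ^ 4)) ^ m := by
      simp [mul_pow]
    _ ≤ _ := by
      refine pow_le_pow_left₀ (by positivity) ?_ m
      nlinarith [show 0 ≤ X ^ 4 by positivity]

theorem le_balancedSet_ncard_mul (hd : Module.finrank ℚ K = 2 * m) (hinj : Function.Injective P)
    (hmax : ∀ k, (P k).IsMaximal) (hP2 : ∀ k, Ideal.absNorm (P k) = 2) (hX : 2 ^ H ≤ X) :
    ((H + 1) * X ^ 2) ^ m ≤
      (balancedSet P H X).ncard * ((27 * 2 ^ H) ^ m * |(discr K : ℝ)|) := by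
  classical
  have hX1 : 1 ≤ X := (one_le_pow₀ one_le_two).trans hX
  have hX0 : 0 < X := by linarith
  have hfin (f : Fin m → Fin (H + 1)) := idealBox_finite (prodIdeal P (balancedExponents H f)) hX0.le
  let B : (Fin m → Fin (H + 1)) → Finset (𝓞 K) := fun f => (hfin f).toFinset
  have hBcard (f) : ((B f).card : ℝ) = (idealBox (prodIdeal P (balancedExponents H f)) X).ncard := by
    rw [Set.ncard_eq_toFinset_card _ (hfin f)]
  have hU : (Finset.univ.biUnion B).card = (balancedSet P H X).ncard := by
    rw [← Set.ncard_coe_finset]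
    congr 1
    ext x
    simp [B, balancedSet]
  let D := Real.sqrt |(discr K : ℝ)|
  have hD : D ^ 2 = |(discr K : ℝ)| := Real.sq_sqrt (abs_nonneg _)
  have hD0 : 0 < D := Real.sqrt_pos.mpr (abs_pos.mpr (Int.cast_ne_zero.mpr (discr_ne_zero K)))
  let V : ℝ := 2 ^ (H * m)
  have hV0 : 0 < V := by positivity
  have hnorm (f : Fin m → Fin (H + 1)) :
      (Ideal.absNorm (prodIdeal P (balancedExponents H f)) : ℝ) = V := by
    rw [absNorm_prodIdeal hP2, sum_balancedExponents]
    push_cast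
    rfl
  have hlow (f) : X ^ (2 * m) ≤ (B f).card * (V * D) := by
    have h1 := pow_le_idealBox_ncard_mul (prodIdeal_ne_bot hP2 (balancedExponents H f)) hX0.le
    rwa [hd, ← hBcard, hnorm] at h1
  have hupp (f g : Fin m → Fin (H + 1)) : ((B f ∩ B g).card : ℝ) * V ≤
      (3 * X) ^ (2 * m) * ∏ i, (1 / 2 : ℝ) ^ (((f i : ℕ) - g i) + ((g i : ℕ) - f i)) := by
    let e : Fin m ⊕ Fin m → ℕ := fun k => max (balancedExponents H f k) (balancedExponents H g k)
    let δ : ℕ := ∑ i, (((f i : ℕ) - g i) + ((g i : ℕ) - f i))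
    have hN : (Ideal.absNorm (prodIdeal P e) : ℝ) = V * 2 ^ δ := by
      rw [absNorm_prodIdeal hP2, sum_max_balancedExponents, pow_add]
      push_cast
      rfl
    have hδ : δ ≤ H * m := by
      have h1 : δ ≤ ∑ _i : Fin m, H := Finset.sum_le_sum fun i _ => by
        have := (f i).2
        have := (g i).2
        omega
      rwa [Finset.sum_const, Finset.card_univ, Fintype.card_fin, smul_eq_mul, mul_comm] at h1
    have h1 := idealBox_ncard_mul_absNorm_le (prodIdeal_ne_bot hP2 e) hX0.le ?_
    · rw [hN, hd] at h1
      have h2 : (B f ∩ B g).card ≤ (idealBox (prodIdeal P e) X).ncard := by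
        rw [← Set.ncard_coe_finset]
        refine Set.ncard_le_ncard (fun x hx => ?_) (idealBox_finite _ hX0.le)
        have h3 := Finset.mem_inter.mp (Finset.mem_coe.mp hx)
        have h4 := (hfin f).mem_toFinset.mp h3.1
        have h5 := (hfin g).mem_toFinset.mp h3.2
        exact ⟨mem_prodIdeal_max hinj hmax h4.1 h5.1, h4.2⟩
      have h3 : ((B f ∩ B g).card : ℝ) ≤ (idealBox (prodIdeal P e) X).ncard := by exact_mod_cast h2
      rw [Finset.prod_pow_eq_pow_sum, one_div, inv_pow, ← div_eq_mul_inv, le_div_iff₀ (by positivity)]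
      refine le_trans ?_ h1
      rw [mul_assoc]
      gcongr
    · rw [hN, hd, pow_mul]
      calc V * 2 ^ δ ≤ V * 2 ^ (H * m) := by gcongr; exact one_le_two
        _ = ((2 ^ H) ^ 2) ^ m := by
          rw [← pow_add, ← pow_mul, ← pow_mul]
          congr 1
          ring
        _ ≤ _ := by gcongr
  let R : ℝ := ((H + 1 : ℕ) : ℝ) ^ m
  have hR0 : 0 < R := by positivity
  have hsum : R * X ^ (2 * m) ≤ (∑ f, ((B f).card : ℝ)) * (V * D) := by
    rw [Finset.sum_mul]
    refine le_trans (le_of_eq ?_) (Finset.sum_le_sum fun f _ => hlow f)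
    simp [R]
  have hsum2 : (∑ f, ∑ g, ((B f ∩ B g).card : ℝ)) * V ≤
      (3 * X) ^ (2 * m) * (3 ^ m * R) := by
    have h1 := sum_prod_half_pow_le m (H + 1)
    rw [mul_pow] at h1
    refine le_trans ?_ (mul_le_mul_of_nonneg_left h1 (by positivity))
    rw [Finset.sum_mul, Finset.mul_sum]
    refine Finset.sum_le_sum fun f _ => ?_
    rw [Finset.sum_mul, Finset.mul_sum]
    exact Finset.sum_le_sum fun g _ => hupp f g
  have hcs : (∑ f, ((B f).card : ℝ)) ^ 2 ≤
      (balancedSet P H X).ncard * ∑ f, ∑ g, ((B f ∩ B g).card : ℝ) := by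
    have h1 := sq_sum_card_le B
    rw [hU] at h1
    exact_mod_cast h1
  let a : ℝ := (balancedSet P H X).ncard
  have ha : 0 ≤ a := Nat.cast_nonneg _
  have hmain : (R * X ^ (2 * m)) ^ 2 ≤ a * (V * D ^ 2) * ((3 * X) ^ (2 * m) * (3 ^ m * R)) := by
    calc (R * X ^ (2 * m)) ^ 2 ≤ ((∑ f, ((B f).card : ℝ)) * (V * D)) ^ 2 := by gcongr
      _ = (∑ f, ((B f).card : ℝ)) ^ 2 * (V * D) ^ 2 := mul_pow _ _ _
      _ ≤ (a * ∑ f, ∑ g, ((B f ∩ B g).card : ℝ)) * (V * D) ^ 2 := by gcongr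
      _ = a * (V * D ^ 2) * ((∑ f, ∑ g, ((B f ∩ B g).card : ℝ)) * V) := by ring
      _ ≤ _ := by gcongr
  have h27 : (3 * X) ^ (2 * m) * (3 ^ m * R) = 27 ^ m * (R * X ^ (2 * m)) := by
    rw [mul_pow, pow_mul 3, ← mul_assoc, mul_right_comm ((3 ^ 2 : ℝ) ^ m), ← mul_pow]
    norm_num
    ring
  have h2 : R * X ^ (2 * m) ≤ a * (V * D ^ 2) * 27 ^ m := by
    refine le_of_mul_le_mul_right (a := R * X ^ (2 * m)) ?_ (by positivity)
    rwa [← sq, mul_assoc (a * (V * D ^ 2)), ← h27]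
  calc ((H + 1) * X ^ 2) ^ m = R * X ^ (2 * m) := by
        rw [mul_pow, ← pow_mul, ← Nat.cast_add_one]
    _ ≤ _ := h2
    _ = _ := by
        rw [hD, mul_pow, ← pow_mul 2 H m]
        ring

end

end PlaceTheory

namespace PlaceTheory

open NumberField IsDedekindDomain

theorem exponent_bounds {a p q σ ε X : ℝ} {m H : ℕ} (hσ : 1 ≤ σ) (hε : 0 < ε) (hε1 : ε < 1)
    (hH : 26244 * σ ^ 2 ≤ (H : ℝ) + 1) (hX : X = (6 * 2 ^ H : ℝ) ^ (ε⁻¹))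
    (ha : a ≤ (9 * X ^ 2) ^ m) (hp : p ≤ (36 * X ^ 2) ^ m)
    (hq : q * 4 ^ (H * m) ≤ (18 * (H + 1) * X ^ 4) ^ m)
    (hlow : ((H + 1) * X ^ 2) ^ m ≤ a * ((27 * 2 ^ H) ^ m * σ ^ m)) :
    2 ^ m ≤ a ∧ p ≤ a ^ (1 + ε) ∧
      q ≤ a ^ (2 - Real.log 2 / Real.log (9 * (6 * 2 ^ H) ^ 2) * ε) := by
  have h2H : (1 : ℝ) ≤ 2 ^ H := one_le_pow₀ one_le_two
  let B : ℝ := 6 * 2 ^ H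
  have hB : (6 : ℝ) ≤ B := by simp only [B]; linarith
  have hBX : B ≤ X := by
    rw [hX]
    exact Real.self_le_rpow_of_one_le (by linarith) (by rw [one_le_inv₀ hε]; exact hε1.le)
  have hXε : X ^ ε = B := by
    rw [hX, Real.rpow_inv_rpow (by linarith) hε.ne']
  have hX0 : 0 < X := by linarith
  let J : ℝ := H + 1
  have hJ : 26244 * σ ^ 2 ≤ J := hH
  have hσ2 : σ ≤ σ ^ 2 := le_self_pow₀ hσ two_ne_zero
  have hJ0 : 0 < J := by linarith
  let Z : ℝ := J * X ^ 2 / (27 * 2 ^ H * σ)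
  have hden : 0 < 27 * 2 ^ H * σ := by positivity
  have hZa : Z ^ m ≤ a := by
    rw [← mul_pow] at hlow
    rw [div_pow, div_le_iff₀ (by positivity)]
    exact hlow
  have hZ : X ^ 2 / 2 ^ H ≤ Z := by
    rw [div_le_div_iff₀ (by positivity) hden]
    have h1 : 27 * σ ≤ J := by linarith
    calc X ^ 2 * (27 * 2 ^ H * σ) = (27 * σ) * (X ^ 2 * 2 ^ H) := by ring
      _ ≤ J * (X ^ 2 * 2 ^ H) := by gcongr
      _ = _ := by ring
  have hZ2 : 2 ≤ X ^ 2 / 2 ^ H := by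
    rw [le_div_iff₀ (by positivity)]
    have h1 : 2 * 2 ^ H ≤ X := le_trans (by simp only [B]; linarith) hBX
    exact h1.trans (le_self_pow₀ (by linarith) two_ne_zero)
  have hZ0 : 0 < Z := by linarith
  have ha0 : 0 < a := (pow_pos hZ0 m).trans_le hZa
  refine ⟨(pow_le_pow_left₀ zero_le_two (hZ2.trans hZ) m).trans hZa, ?_, ?_⟩
  · have h1 : 36 * X ^ 2 ≤ (X ^ 2 / 2 ^ H) ^ (1 + ε) := by
      rw [Real.rpow_one_add' (by positivity) (by positivity), Real.div_rpow (by positivity) (by positivity),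
        ← Real.rpow_natCast X 2, ← Real.rpow_mul hX0.le, mul_comm ((2 : ℕ) : ℝ) ε, Real.rpow_mul hX0.le,
        hXε, Real.rpow_natCast, Real.rpow_natCast, div_mul_div_comm, le_div_iff₀ (by positivity)]
      have h2 : ((2 : ℝ) ^ H) ^ ε ≤ 2 ^ H := by
        conv_rhs => rw [← Real.rpow_one (2 ^ H : ℝ)]
        exact Real.rpow_le_rpow_of_exponent_le h2H hε1.le
      calc 36 * X ^ 2 * (2 ^ H * (2 ^ H) ^ ε) ≤ 36 * X ^ 2 * (2 ^ H * 2 ^ H) := by gcongr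
        _ = X ^ 2 * B ^ 2 := by simp only [B]; ring
    calc p ≤ (36 * X ^ 2) ^ m := hp
      _ ≤ ((X ^ 2 / 2 ^ H) ^ (1 + ε)) ^ m := by gcongr
      _ ≤ (Z ^ (1 + ε)) ^ m := by gcongr
      _ = (Z ^ m) ^ (1 + ε) := (Real.rpow_pow_comm hZ0.le _ _)
      _ ≤ a ^ (1 + ε) := by gcongr
  · let c : ℝ := Real.log 2 / Real.log (9 * (6 * 2 ^ H) ^ 2)
    have hB9 : (1 : ℝ) < 9 * B ^ 2 := by nlinarith
    have hc : 0 < c := div_pos (Real.log_pos one_lt_two) (Real.log_pos hB9)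
    have hcB : (9 * B ^ 2) ^ c = 2 := by
      rw [Real.rpow_def_of_pos (by positivity), mul_div_cancel₀ _ (Real.log_pos hB9).ne',
        Real.exp_log two_pos]
    have h1 : a ^ (c * ε) ≤ 2 ^ m := by
      have h2 : (9 * X ^ 2) ^ ε ≤ 9 * B ^ 2 := by
        rw [Real.mul_rpow (by norm_num) (by positivity), ← Real.rpow_pow_comm hX0.le, hXε]
        have h3 : (9 : ℝ) ^ ε ≤ 9 := by
          conv_rhs => rw [← Real.rpow_one 9]
          exact Real.rpow_le_rpow_of_exponent_le (by norm_num) hε1.le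
        gcongr
      calc a ^ (c * ε) ≤ ((9 * X ^ 2) ^ m) ^ (c * ε) := by gcongr
        _ = (((9 * X ^ 2) ^ ε) ^ c) ^ m := by
          rw [← Real.rpow_mul (by positivity), mul_comm ε, Real.rpow_pow_comm (by positivity)]
        _ ≤ ((9 * B ^ 2) ^ c) ^ m := by gcongr
        _ = 2 ^ m := by rw [hcB]
    have h2 : q * 2 ^ m ≤ a ^ 2 := by
      have h3 : 18 * J * X ^ 4 * 2 ≤ Z ^ 2 * 4 ^ H := by
        have h4 : Z ^ 2 * 4 ^ H = J ^ 2 * X ^ 4 / (729 * σ ^ 2) := by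
          simp only [Z]
          rw [show (4 : ℝ) ^ H = (2 ^ H) ^ 2 by rw [← pow_mul, mul_comm, pow_mul]; norm_num]
          field_simp
          ring
        rw [h4, le_div_iff₀ (by positivity)]
        calc 18 * J * X ^ 4 * 2 * (729 * σ ^ 2) = (26244 * σ ^ 2) * (J * X ^ 4) := by ring
          _ ≤ J * (J * X ^ 4) := by gcongr
          _ = _ := by ring
      refine le_of_mul_le_mul_right (a := (4 : ℝ) ^ (H * m)) ?_ (by positivity)
      calc q * 2 ^ m * 4 ^ (H * m) = q * 4 ^ (H * m) * 2 ^ m := by ring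
        _ ≤ (18 * J * X ^ 4) ^ m * 2 ^ m := by gcongr
        _ = (18 * J * X ^ 4 * 2) ^ m := (mul_pow _ _ _).symm
        _ ≤ (Z ^ 2 * 4 ^ H) ^ m := by gcongr
        _ = (Z ^ m) ^ 2 * 4 ^ (H * m) := by rw [mul_pow, ← pow_mul, ← pow_mul, ← pow_mul, mul_comm 2 m]
        _ ≤ _ := by gcongr
    change q ≤ a ^ (2 - c * ε)
    rw [Real.rpow_sub ha0, le_div_iff₀ (Real.rpow_pos_of_pos ha0 _), Real.rpow_two]
    rcases le_or_gt q 0 with hq0 | hq0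
    · exact (mul_nonpos_of_nonpos_of_nonneg hq0 (Real.rpow_nonneg ha0.le _)).trans (sq_nonneg a)
    · exact (mul_le_mul_of_nonneg_left h1 hq0.le).trans h2

theorem exists_small_sumset_small_productset :
    ∃ c : ℝ, 0 < c ∧
      ∀ ε : ℝ, 0 < ε → ε < 1 →
        ∀ N : ℕ, ∃ A : Set ℝ, A.Finite ∧ N ≤ A.ncard ∧
          ((A + A).ncard : ℝ) ≤ (A.ncard : ℝ) ^ ((1 : ℝ) + ε) ∧
          ((A * A).ncard : ℝ) ≤ (A.ncard : ℝ) ^ ((2 : ℝ) - c * ε) := by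
  obtain ⟨S, ρ, hρ, hT⟩ := exists_infinite_tower
  obtain ⟨H, hH⟩ := exists_nat_ge (26244 * (ρ ^ 2) ^ 2)
  have h2H : (1 : ℝ) ≤ 2 ^ H := one_le_pow₀ one_le_two
  have hlog : 1 < (9 * (6 * 2 ^ H) ^ 2 : ℝ) := by nlinarith
  refine ⟨Real.log 2 / Real.log (9 * (6 * 2 ^ H) ^ 2),
    div_pos (Real.log_pos one_lt_two) (Real.log_pos hlog), fun ε hε hε1 N => ?_⟩
  obtain ⟨M, _, _, hM, hN, ⟨m, hm⟩, hdisc⟩ := hT (2 * N)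
  have := hM.isTotallyReal
  have hd : Module.finrank ℚ M = 2 * m := by rw [hm, two_mul]
  obtain ⟨P', hinj', hmax', hP2'⟩ := exists_primes_over_two (hM.split 2 (Finset.mem_singleton_self 2))
  let e : Fin m ⊕ Fin m ≃ Fin (Module.finrank ℚ M) := finSumFinEquiv.trans (finCongr hm.symm)
  let P : Fin m ⊕ Fin m → Ideal (𝓞 M) := P' ∘ e
  have hP2 (k) : Ideal.absNorm (P k) = 2 := hP2' _
  let X : ℝ := (6 * 2 ^ H : ℝ) ^ (ε⁻¹)
  have hX : 2 ^ H ≤ X := by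
    refine le_trans (by linarith) (Real.self_le_rpow_of_one_le (x := 6 * 2 ^ H) (by linarith) ?_)
    rw [one_le_inv₀ hε]
    exact hε1.le
  have hX1 : 1 ≤ X := h2H.trans hX
  have ha := balancedSet_ncard_le (P := P) (H := H) hX1
  have hp := balancedSet_add_ncard_le (P := P) (H := H) hX1
  have hq := balancedSet_mul_ncard_le hd hP2 hX
  have hlow := le_balancedSet_ncard_mul hd (hinj'.comp e.injective) (fun k => hmax' _) hP2 hX
  rw [hd, pow_mul] at ha hp hdisc
  rw [mul_pow] at ha hp
  have hlow' := hlow.trans (mul_le_mul_of_nonneg_left (mul_le_mul_of_nonneg_left hdisc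
    (by positivity : (0 : ℝ) ≤ (27 * 2 ^ H) ^ m)) (Nat.cast_nonneg _))
  obtain ⟨h1, h2, h3⟩ := exponent_bounds (one_le_pow₀ hρ) hε hε1 (by linarith) rfl
    (by norm_num at ha ⊢; exact ha) (by norm_num at hp ⊢; exact hp) hq hlow'
  let w : InfinitePlace M := Classical.arbitrary _
  let φ : 𝓞 M →+* ℝ :=
    (InfinitePlace.embedding_of_isReal (IsTotallyReal.isReal w)).comp (algebraMap (𝓞 M) M)
  have hφ : Function.Injective φ :=
    (InfinitePlace.embedding_of_isReal (IsTotallyReal.isReal w)).injective.comp (FaithfulSMul.algebraMap_injective (𝓞 M) M)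
  let A := balancedSet P H X
  refine ⟨φ '' A, (balancedSet_finite (by linarith)).image _, ?_, ?_, ?_⟩
  · rw [Set.ncard_image_of_injective _ hφ]
    have h4 : (2 ^ m : ℕ) ≤ A.ncard := by exact_mod_cast h1
    have h5 : N ≤ m := by omega
    exact h5.trans (Nat.lt_two_pow_self.le.trans h4)
  · rw [← Set.image_add φ, Set.ncard_image_of_injective _ hφ, Set.ncard_image_of_injective _ hφ]
    exact h2
  · rw [← Set.image_mul φ, Set.ncard_image_of_injective _ hφ, Set.ncard_image_of_injective _ hφ]
    exact h3

end PlaceTheory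

/-- There exists an absolute constant `c > 0` such that for every `ε ∈ (0,1)` there are
arbitrarily large finite `A ⊆ ℝ` with `|A+A| ≤ |A|^(1+ε)` and `|AA| ≤ |A|^(2-cε)`. -/
theorem statement2 :
    ∃ c : ℝ, 0 < c ∧
      ∀ ε : ℝ, 0 < ε → ε < 1 →
        ∀ N : ℕ, ∃ A : Set ℝ, A.Finite ∧ N ≤ A.ncard ∧
          ((A + A).ncard : ℝ) ≤ (A.ncard : ℝ) ^ ((1 : ℝ) + ε) ∧
          ((A * A).ncard : ℝ) ≤ (A.ncard : ℝ) ^ ((2 : ℝ) - c * ε) := by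
  exact PlaceTheory.exists_small_sumset_small_productset
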